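/- Let D be a finite-dimensional central division algebra over a number field K. The Schur index of D equals the least common multiple over all primes 𝒫 of K (including infinite primes) of the local indices m_𝒫(D), where m_𝒫(D) is the index of D ⊗_K K_𝒫. -/

import Mathlib

open scoped TensorProduct

/-- `A` is the cyclic algebra `(L/K, σ, a)`. -/
def IsCyclicAlgebra (K : Type*) [Field K] (L : Type*) [Field L] [Algebra K L]
    (σ : L ≃ₐ[K] L) (a : L) (A : Type*) [Ring A] [Algebra K A] : Prop :=
  ∃ (ι : L →ₐ[K] A) (u : Aˣ),
    (u : A) ^ Module.finrank K L = ι a ∧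
    (∀ x : L, (u : A) * ι x = ι (σ x) * (u : A)) ∧
    Function.Bijective fun f : Fin (Module.finrank K L) → L =>
      ∑ i, ι (f i) * (u : A) ^ (i : ℕ)

/-- The Schur index of a central simple `K`-algebra. -/
noncomputable def schurIndex (K A : Type*) [Field K] [Ring A] [Algebra K A] : ℕ :=
  sInf {m | ∃ (D : Type) (_ : DivisionRing D) (_ : Algebra K D) (r : ℕ),
      Nonempty (A ≃ₐ[K] Matrix (Fin r) (Fin r) D) ∧ m * m = Module.finrank K D}

/-- Local index at a real embedding. -/
noncomputable def realLocalIndex (K A : Type*) [Field K] [Ring A] [Algebra K A]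
    (φ : K →+* ℝ) : ℕ :=
  letI := φ.toAlgebra
  schurIndex ℝ (ℝ ⊗[K] A)

def IsBrauerEquiv (K A B : Type*) [Field K] [Ring A] [Algebra K A] [Ring B] [Algebra K B] :
    Prop :=
  ∃ r s : ℕ, 0 < r ∧ 0 < s ∧
    Nonempty (Matrix (Fin r) (Fin r) A ≃ₐ[K] Matrix (Fin s) (Fin s) B)

/-- The simple component `Re` of `R`, realized as `R/(1-e)`. -/
abbrev simpleComponent (R : Type*) [Ring R] (e : R) : Type _ :=
  (TwoSidedIdeal.span {1 - e}).ringCon.Quotient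

noncomputable instance (F R : Type*) [CommSemiring F] [Ring R] [Algebra F R] (e : R) :
    Algebra F (simpleComponent R e) :=
  RingHom.toAlgebra' ((TwoSidedIdeal.span {1 - e}).ringCon.mk'.comp (algebraMap F R)) <| by
    intro c x
    induction x using Quotient.inductionOn' with
    | h x =>
        show ((algebraMap F R c : R) : simpleComponent R e) * (x : simpleComponent R e)
          = (x : simpleComponent R e) * ((algebraMap F R c : R) : simpleComponent R e)
        rw [← RingCon.coe_mul, ← RingCon.coe_mul, Algebra.commutes]

/-- `e` is a centrally primitive idempotent. -/
def IsCentrallyPrimitiveIdempotent (R : Type*) [Ring R] (e : R) : Prop :=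
  e ∈ Subring.center R ∧ e * e = e ∧ e ≠ 0 ∧
    ∀ a b : R, a ∈ Subring.center R → b ∈ Subring.center R → a * a = a → b * b = b →
      a * b = 0 → e = a + b → a = 0 ∨ b = 0


/-- Local index at a complex embedding. -/
noncomputable def complexLocalIndex (K A : Type*) [Field K] [Ring A] [Algebra K A]
    (φ : K →+* ℂ) : ℕ :=
  letI := φ.toAlgebra
  schurIndex ℂ (ℂ ⊗[K] A)

noncomputable instance (priority := 1000) adicSMulCommClass {R : Type*} [CommRing R]
    [IsDedekindDomain R] {K : Type*} [Field K] [Algebra R K] [IsFractionRing R K]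
    (v : IsDedekindDomain.HeightOneSpectrum R) :
    SMulCommClass K (v.adicCompletion K) (v.adicCompletion K) :=
  Algebra.to_smulCommClass

/-- The ring `D` has an `N`-dimensional representation over `E`, compatible with the
homomorphism `i` from the base field `K` to `E`. -/
def HasRep {K E : Type*} [Field K] [Field E] (i : K →+* E) (D : Type*) [Ring D] [Algebra K D]
    (N : ℕ) : Prop :=
  ∃ f : D →+* Matrix (Fin N) (Fin N) E, ∀ a, f (algebraMap K D a) = Matrix.scalar (Fin N) (i a)

namespace HasRep

variable {K E : Type*} [Field K] [Field E] {i : K →+* E} {D : Type*} [Ring D] [Algebra K D]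

theorem of_end {V : Type*} [AddCommGroup V] [Module E V] [FiniteDimensional E V] {N : ℕ}
    (hN : Module.finrank E V = N) (f : D →+* Module.End E V)
    (hf : ∀ a v, f (algebraMap K D a) v = i a • v) : HasRep i D N := by
  subst hN
  refine ⟨(LinearMap.toMatrixAlgEquiv (Module.finBasis E V) : _ →+* _).comp f, fun a => ?_⟩
  have : f (algebraMap K D a) = algebraMap E (Module.End E V) (i a) := by
    ext v; rw [hf]; rfl
  rw [RingHom.comp_apply, this]
  exact AlgEquiv.commutes (LinearMap.toMatrixAlgEquiv (Module.finBasis E V)) (i a)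

theorem exists_end {N : ℕ} (h : HasRep i D N) :
    ∃ f : D →+* Module.End E (Fin N → E), ∀ a v, f (algebraMap K D a) v = i a • v := by
  obtain ⟨f, hf⟩ := h
  refine ⟨(Matrix.toLinAlgEquiv' : Matrix (Fin N) (Fin N) E ≃ₐ[E] _).toRingEquiv.toRingHom.comp f,
    fun a v => ?_⟩
  change Matrix.toLin' (f (algebraMap K D a)) v = _
  rw [hf, Matrix.toLin'_apply]
  simp

theorem map {E' : Type*} [Field E'] (j : E →+* E') {N : ℕ} (h : HasRep i D N) :
    HasRep (j.comp i) D N := by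
  obtain ⟨f, hf⟩ := h
  refine ⟨j.mapMatrix.comp f, fun a => ?_⟩
  rw [RingHom.comp_apply, hf]
  ext s t
  simp [Matrix.diagonal_apply, apply_ite j]

theorem map_eq {E' : Type*} [Field E'] (j : E →+* E') {i' : K →+* E'} (hj : j.comp i = i') {N : ℕ}
    (h : HasRep i D N) : HasRep i' D N := hj ▸ h.map j

theorem restrict {E₀ : Type*} [Field E₀] [Algebra E₀ E] [FiniteDimensional E₀ E] {i₀ : K →+* E₀}
    (hi : (algebraMap E₀ E).comp i₀ = i) {N : ℕ} (h : HasRep i D N) :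
    HasRep i₀ D (Module.finrank E₀ E * N) := by
  obtain ⟨f, hf⟩ := h.exists_end
  refine of_end (V := Fin N → E) ?_
    ({ toFun := fun d => (f d).restrictScalars E₀, map_one' := by rw [map_one]; rfl
       map_mul' := fun a b => by rw [map_mul]; rfl
       map_zero' := by rw [map_zero]; rfl
       map_add' := fun a b => by rw [map_add]; rfl } : D →+* Module.End E₀ (Fin N → E)) ?_
  · rw [Module.finrank_pi_fintype]; simp [mul_comm]
  · intro a v
    change f (algebraMap K D a) v = _
    rw [hf, ← hi, RingHom.comp_apply, algebraMap_smul]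

theorem mul_right {N : ℕ} (h : HasRep i D N) (k : ℕ) : HasRep i D (N * k) := by
  obtain ⟨f, hf⟩ := h.exists_end
  refine of_end (V := Fin k → Fin N → E) ?_
    ({ toFun := fun d => LinearMap.pi fun s => (f d).comp (LinearMap.proj s)
       map_one' := by ext; simp
       map_mul' := fun a b => by ext; simp
       map_zero' := by ext; simp
       map_add' := fun a b => by ext; simp } : D →+* Module.End E (Fin k → Fin N → E)) ?_
  · rw [Module.finrank_pi_fintype]; simp [mul_comm]
  · intro a v
    ext s t
    simp [hf]

theorem of_dvd {N M : ℕ} (h : HasRep i D N) (hd : N ∣ M) : HasRep i D M := by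
  obtain ⟨k, rfl⟩ := hd; exact h.mul_right k

theorem comp_algHom {D' : Type*} [Ring D'] [Algebra K D'] {N : ℕ} (h : HasRep i D N) (g : D' →ₐ[K] D) :
    HasRep i D' N := by
  obtain ⟨f, hf⟩ := h
  exact ⟨f.comp g, fun a => by rw [RingHom.comp_apply, ← hf]; congr 1; exact g.commutes a⟩

/-- A representation of an algebra over `L` restricts to one of an algebra over a smaller field. -/
theorem comp_ringHom {K' : Type*} [Field K'] {D' : Type*} [Ring D'] [Algebra K' D'] {N : ℕ}
    (h : HasRep i D N) (g : D' →+* D) (j : K' →+* K)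
    (hg : ∀ a, g (algebraMap K' D' a) = algebraMap K D (j a)) : HasRep (i.comp j) D' N := by
  obtain ⟨f, hf⟩ := h
  exact ⟨f.comp g, fun a => by rw [RingHom.comp_apply, hg, hf]; rfl⟩

theorem matrix {N : ℕ} (h : HasRep i D N) (r : ℕ) : HasRep i (Matrix (Fin r) (Fin r) D) (N * r) := by
  obtain ⟨f, hf⟩ := h
  refine ⟨((Matrix.reindexAlgEquiv E E (finProdFinEquiv.trans (finCongr (mul_comm r N))) :
    Matrix (Fin r × Fin N) (Fin r × Fin N) E →+* _).comp
      (Matrix.compRingEquiv (Fin r) (Fin N) E).toRingHom).comp f.mapMatrix, fun a => ?_⟩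
  have : (Matrix.compRingEquiv (Fin r) (Fin N) E).toRingHom (f.mapMatrix
      (algebraMap K (Matrix (Fin r) (Fin r) D) a)) = algebraMap E _ (i a) := by
    ext ⟨s, t⟩ ⟨s', t'⟩
    have h1 : f.mapMatrix (algebraMap K (Matrix (Fin r) (Fin r) D) a) s s' =
        if s = s' then Matrix.scalar (Fin N) (i a) else 0 := by
      rw [← hf, Matrix.algebraMap_eq_diagonal]
      simp [Matrix.diagonal_apply, apply_ite f]
    have h2 : (Matrix.compRingEquiv (Fin r) (Fin N) E).toRingHom (f.mapMatrix
      (algebraMap K (Matrix (Fin r) (Fin r) D) a)) (s, t) (s', t') =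
        f.mapMatrix (algebraMap K (Matrix (Fin r) (Fin r) D) a) s s' t t' := rfl
    rw [h2, h1, Matrix.algebraMap_eq_diagonal]
    by_cases hs : s = s' <;> simp [hs, Matrix.diagonal_apply]
  rw [RingHom.comp_apply, RingHom.comp_apply, this]
  exact AlgEquiv.commutes (Matrix.reindexAlgEquiv E E (finProdFinEquiv.trans (finCongr (mul_comm r N)))) (i a)

end HasRep
namespace HasRep

variable {K E : Type*} [Field K] [Field E] {i : K →+* E} {D : Type*} [Ring D] [Algebra K D]

theorem corner {r M : ℕ} (hr : 0 < r) (h : HasRep i (Matrix (Fin r) (Fin r) D) M) :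
    ∃ N, M = N * r ∧ HasRep i D N := by
  obtain ⟨f, hf⟩ := h.exists_end
  let e : Fin r → Fin r → D → Matrix (Fin r) (Fin r) D := fun s t d => Matrix.single s t d
  have hee : ∀ s t u d d', f (e s t d) * f (e t u d') = f (e s u (d * d')) := fun s t u d d' => by
    rw [← map_mul, Matrix.single_mul_single_same]
  have hee0 : ∀ s t t' u d d', t ≠ t' → f (e s t d) * f (e t' u d') = 0 := fun s t t' u d d' h => by
    rw [← map_mul, Matrix.single_mul_single_of_ne _ _ _ _ h, map_zero]
  have hee' : ∀ s t u d d' v, f (e s t d) (f (e t u d') v) = f (e s u (d * d')) v :=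
    fun s t u d d' v => by rw [← hee s t u]; rfl
  have hee0' : ∀ s t t' u d d' v, t ≠ t' → f (e s t d) (f (e t' u d') v) = 0 :=
    fun s t t' u d d' v h => by rw [← Module.End.mul_apply, hee0 _ _ _ _ _ _ h]; rfl
  have hsum : ∀ v, ∑ s, f (e s s 1) v = v := by
    intro v
    have h1 : ∑ s, e s s 1 = 1 := by
      exact Matrix.sum_single_one
    have := congrArg (fun m => f m v) h1
    simpa [map_sum] using this
  let o : Fin r := ⟨0, hr⟩
  let W : Submodule E (Fin M → E) := LinearMap.range (f (e o o 1))
  have hmem : ∀ t d v, f (e o t d) v ∈ W := fun t d v =>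
    ⟨f (e o t d) v, by rw [hee', one_mul]⟩
  have hid : ∀ w ∈ W, f (e o o 1) w = w := by
    rintro _ ⟨v, rfl⟩; rw [hee', one_mul]
  refine ⟨Module.finrank E W, ?_, of_end (V := W) rfl
    ({ toFun := fun d => (f (e o o d)).restrict fun w _ => hmem o d w
       map_one' := by ext w : 1; exact Subtype.ext (hid w w.2)
       map_mul' := fun a b => by ext w : 1; exact Subtype.ext (hee' _ _ _ _ _ _).symm
       map_zero' := by ext w : 1; apply Subtype.ext; simp [e]
       map_add' := fun a b => by ext w : 1; apply Subtype.ext; simp [e, Matrix.single_add] } : D →+* Module.End E W) ?_⟩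
  · let φ : (Fin M → E) ≃ₗ[E] (Fin r → W) := LinearEquiv.ofLinearMap
      (LinearMap.pi fun s => (f (e o s 1)).codRestrict W fun v => hmem s 1 v)
      (∑ s, (f (e s o 1)).comp (W.subtype.comp (LinearMap.proj s)))
      (by
        refine LinearMap.ext fun w => funext fun s => Subtype.ext ?_
        simp only [LinearMap.comp_apply, LinearMap.pi_apply, LinearMap.codRestrict_apply, LinearMap.sum_apply,
          map_sum, LinearMap.proj_apply, Submodule.subtype_apply, LinearMap.id_apply]
        rw [Finset.sum_eq_single s, LinearMap.codRestrict_apply, hee', one_mul, hid _ (w s).2]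
        · intro t _ ht; exact Subtype.ext (hee0' _ _ _ _ _ _ _ ht.symm)
        · simp)
      (by
        refine LinearMap.ext fun v => ?_
        simp only [LinearMap.comp_apply, LinearMap.pi_apply, LinearMap.sum_apply,
          LinearMap.proj_apply, Submodule.subtype_apply, LinearMap.id_apply, LinearMap.codRestrict_apply, hee', one_mul, hsum])
    have := φ.finrank_eq
    rw [Module.finrank_pi_fintype, Module.finrank_pi_fintype] at this
    simpa [mul_comm] using this
  · intro a w
    apply Subtype.ext
    change f (e o o (algebraMap K D a)) w = i a • (w : Fin M → E)
    have h1 : e o o (algebraMap K D a) = algebraMap K _ a * e o o 1 := by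
      rw [← Algebra.smul_def, Matrix.smul_single, Algebra.algebraMap_eq_smul_one]
    rw [h1, map_mul, Module.End.mul_apply, hid _ w.2, hf]

end HasRep

section Division

variable {K : Type*} [Field K] {D : Type*} [DivisionRing D] [Algebra K D]

theorem HasRep.finrank_dvd {E : Type*} [Field E] [Algebra K E] [FiniteDimensional K E]  {N : ℕ}
    (h : HasRep (algebraMap K E) D N) : Module.finrank K D ∣ Module.finrank K E * N := by
  obtain ⟨f, hf⟩ := (h.restrict (i₀ := RingHom.id K) rfl).exists_end
  letI : Module D (Fin (Module.finrank K E * N) → K) := Module.compHom _ f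
  haveI : IsScalarTower K D (Fin (Module.finrank K E * N) → K) := ⟨fun a d v => by
    change f (a • d) v = a • f d v
    rw [Algebra.smul_def, map_mul, Module.End.mul_apply, hf]; rfl⟩
  refine ⟨Module.finrank D (Fin (Module.finrank K E * N) → K), ?_⟩
  rw [Module.finrank_mul_finrank]; simp

theorem hasRep_regular (K : Type*) [Field K] (D : Type*) [Ring D] [Algebra K D] [FiniteDimensional K D] :
    HasRep (RingHom.id K) D (Module.finrank K D) :=
  HasRep.of_end (V := D) rfl (Algebra.lmul K D : D →+* Module.End K D) fun a v => by
    simp [Algebra.smul_def]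

end Division

section Tensor

variable {K : Type*} [Field K] {D : Type*} [Ring D] [Algebra K D] {E : Type*} [Field E]
  [Algebra K E]

theorem hasRep_tensor_iff {F : Type*} [Field F] (j : E →+* F) {N : ℕ} :
    HasRep j (E ⊗[K] D) N ↔ HasRep (j.comp (algebraMap K E)) D N := by
  constructor
  · intro h
    exact h.comp_ringHom (Algebra.TensorProduct.includeRight : D →ₐ[K] E ⊗[K] D) (algebraMap K E)
      fun a => by
        rw [Algebra.TensorProduct.algebraMap_apply]; exact (Algebra.TensorProduct.includeRight.commutes a)
  · rintro ⟨f, hf⟩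
    letI := j.toAlgebra
    letI := (j.comp (algebraMap K E)).toAlgebra
    haveI : IsScalarTower K E F := IsScalarTower.of_algebraMap_eq fun _ => rfl
    let g : D →ₐ[K] Matrix (Fin N) (Fin N) F := { f with commutes' := hf }
    refine ⟨(Algebra.TensorProduct.lift (Algebra.ofId E (Matrix (Fin N) (Fin N) F)) g
      fun a b => Algebra.commutes _ _ : E ⊗[K] D →ₐ[E] _), fun a => ?_⟩
    exact AlgHom.commutes (Algebra.TensorProduct.lift (Algebra.ofId E (Matrix (Fin N) (Fin N) F)) g
      fun a b => Algebra.commutes _ _) a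

end Tensor

section Simple

variable {K : Type*} [Field K] {D : Type*} [DivisionRing D] [Algebra K D] [Algebra.IsCentral K D]
  {E : Type*} [Field E] [Algebra K E]

theorem exists_tensor_coeff.{u} (K D : Type*) (E : Type u) [Field K] [DivisionRing D] [Algebra K D] [Field E] [Algebra K E] :
    ∃ (ι : Type u) (b : ι → E) (φ : E ⊗[K] D ≃ₗ[K] (ι →₀ D)), (∀ x, x = (φ x).sum fun j d => b j ⊗ₜ d) ∧
      (∀ (y : E ⊗[K] D) (d : D) j, φ (y * (1 ⊗ₜ d)) j = φ y j * d) ∧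
      (∀ (y : E ⊗[K] D) (d : D) j, φ ((1 ⊗ₜ d) * y) j = d * φ y j) := by
  classical
  obtain ⟨ι, ⟨b⟩⟩ : ∃ ι : Type u, Nonempty (Module.Basis ι K E) :=
    ⟨_, ⟨Module.Free.chooseBasis K E⟩⟩
  refine ⟨ι, b, TensorProduct.equivFinsuppOfBasisLeft (N := D) b, fun x => ?_, fun y d j => ?_, fun y d j => ?_⟩
  · rw [← TensorProduct.equivFinsuppOfBasisLeft_symm_apply, LinearEquiv.symm_apply_apply]
  · induction y with
    | zero => simp
    | tmul e d' => simp [TensorProduct.equivFinsuppOfBasisLeft_apply_tmul]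
    | add y z hy hz => simp [add_mul, hy, hz]
  · induction y with
    | zero => simp
    | tmul e d' => simp [TensorProduct.equivFinsuppOfBasisLeft_apply_tmul]
    | add y z hy hz => simp [mul_add, hy, hz]

theorem mem_range_includeLeft_of_commute {x : E ⊗[K] D} (hx : ∀ d : D, Commute x (1 ⊗ₜ d)) :
    ∃ e : E, x = e ⊗ₜ 1 := by
  obtain ⟨ι, b, φ, h4, h1, h2⟩ := exists_tensor_coeff K D E
  have h3 : ∀ j, ∃ a : K, algebraMap K D a = φ x j := by
    intro j
    have : φ x j ∈ Subalgebra.center K D := by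
      rw [Subalgebra.mem_center_iff]
      intro d
      rw [← h1, ← h2, (hx d).eq]
    exact Algebra.IsCentral.out this
  choose a ha using h3
  refine ⟨(φ x).sum fun j d => a j • b j, ?_⟩
  conv_lhs => rw [h4 x]
  simp only [Finsupp.sum]
  rw [TensorProduct.sum_tmul]
  refine Finset.sum_congr rfl fun j _ => ?_
  rw [← ha j, TensorProduct.smul_tmul, Algebra.algebraMap_eq_smul_one]

instance isSimpleRing_tensor : IsSimpleRing (E ⊗[K] D) := by
  have : Nontrivial (TwoSidedIdeal (E ⊗[K] D)) := inferInstance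
  refine ⟨⟨fun I => ?_⟩⟩
  by_contra! hI
  obtain ⟨hI0, hI1⟩ := hI
  classical
  obtain ⟨ι, b, φ, -, h1, h2⟩ := exists_tensor_coeff K D E
  have hex : ∃ n, ∃ x ∈ I, x ≠ 0 ∧ (φ x).support.card = n := by
    obtain ⟨x, hx, hx0⟩ : ∃ x ∈ I, x ≠ 0 := by
      by_contra! h
      exact hI0 (le_bot_iff.1 fun x hx => (TwoSidedIdeal.mem_bot _).2 (h x hx))
    exact ⟨_, x, hx, hx0, rfl⟩
  obtain ⟨x, hxI, hx0, hxc⟩ := Nat.find_spec hex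
  have hmin : ∀ y ∈ I, (φ y).support.card < (φ x).support.card → y = 0 := by
    intro y hy hlt
    by_contra h
    exact Nat.find_min hex (hxc ▸ hlt) ⟨y, hy, h, rfl⟩
  obtain ⟨j, hj⟩ : ∃ j, φ x j ≠ 0 := by
    by_contra! h
    exact hx0 (φ.injective (by rw [map_zero]; exact Finsupp.ext h))
  obtain ⟨e, he⟩ := mem_range_includeLeft_of_commute (x := x * (1 ⊗ₜ (φ x j)⁻¹)) (K := K) (D := D) (E := E) (by
    intro d
    rw [commute_iff_eq, ← sub_eq_zero]
    apply hmin _ (I.sub_mem (I.mul_mem_right _ _ (I.mul_mem_right _ _ hxI))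
      (I.mul_mem_left _ _ (I.mul_mem_right _ _ hxI)))
    apply Finset.card_lt_card
    rw [Finset.ssubset_iff_of_subset]
    · refine ⟨j, Finsupp.mem_support_iff.2 hj, ?_⟩
      rw [Finsupp.notMem_support_iff, map_sub, Finsupp.sub_apply, h1, h2, h1, mul_inv_cancel₀ hj]
      simp
    · intro t ht
      rw [Finsupp.mem_support_iff, map_sub, Finsupp.sub_apply, h1, h2, h1] at ht
      rw [Finsupp.mem_support_iff]
      rintro h0
      apply ht
      simp [h0])
  have hmem : e ⊗ₜ[K] (1 : D) ∈ I := he ▸ I.mul_mem_right _ _ hxI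
  have he0 : e ≠ 0 := by
    rintro rfl
    have := congrArg (fun y => φ y j) he
    simp [h1, hj] at this
  apply hI1
  rw [← TwoSidedIdeal.one_mem_iff]
  have := I.mul_mem_left (e⁻¹ ⊗ₜ[K] (1 : D)) _ hmem
  rwa [Algebra.TensorProduct.tmul_mul_tmul, inv_mul_cancel₀ he0, one_mul] at this

end Simple

section Degree

variable {K : Type*} [Field K] {D : Type*} [DivisionRing D] [Algebra K D] [Algebra.IsCentral K D]
  [FiniteDimensional K D]

theorem exists_matrix_over_algebraicClosure : ∃ n, 0 < n ∧ Module.finrank K D = n * n ∧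
    HasRep (algebraMap K (AlgebraicClosure K)) D n := by
  obtain ⟨n, hn, ⟨e⟩⟩ := IsSimpleRing.exists_algEquiv_matrix_of_isAlgClosed (AlgebraicClosure K)
    (AlgebraicClosure K ⊗[K] D)
  refine ⟨n, NeZero.pos n, ?_, ?_⟩
  · have := e.toLinearEquiv.finrank_eq
    rwa [Module.finrank_baseChange, Module.finrank_matrix, Module.finrank_self, mul_one,
      Fintype.card_fin] at this
  · exact (hasRep_tensor_iff (RingHom.id _)).1 ⟨e, fun a => e.commutes a⟩

end Degree

section Structure

theorem exists_wedderburn.{u, v, w} {K : Type u} [Field K] {D : Type v} [DivisionRing D] [Algebra K D]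
    [Algebra.IsCentral K D] [FiniteDimensional K D] (E : Type w) [Field E] [Algebra K E]
    {n : ℕ} (hn : Module.finrank K D = n * n) :
    ∃ (r m : ℕ) (B : Type (max w v)) (_ : DivisionRing B) (_ : Algebra E B),
      0 < r ∧ 0 < m ∧ n = r * m ∧ Module.Finite E B ∧ Module.finrank E B = m * m ∧
      Algebra.IsCentral E B ∧ Nonempty (E ⊗[K] D ≃ₐ[E] Matrix (Fin r) (Fin r) B) := by
  have := IsArtinianRing.of_finite E (E ⊗[K] D)
  obtain ⟨r, hr, B, _, _, hB, ⟨e⟩⟩ :=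
    IsSimpleRing.exists_algEquiv_matrix_divisionRing_finite E (E ⊗[K] D)
  have h1 := e.toLinearEquiv.finrank_eq
  rw [Module.finrank_baseChange, Module.finrank_matrix, Fintype.card_fin, hn] at h1
  have hr0 := NeZero.pos r
  have hrn : r ∣ n := by
    rw [← Nat.pow_dvd_pow_iff two_ne_zero, pow_two, pow_two, h1]; exact dvd_mul_right _ _
  obtain ⟨m, rfl⟩ := hrn
  have h2 : Module.finrank E B = m * m := by
    have : r * m * (r * m) = r * r * (m * m) := by ring
    rw [this] at h1
    exact (Nat.eq_of_mul_eq_mul_left (by positivity) h1).symm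
  refine ⟨r, m, B, inferInstance, inferInstance, hr0, ?_, rfl, hB, h2, ⟨?_⟩, ⟨e⟩⟩
  · have := Module.finrank_pos (R := E) (M := B)
    rw [h2] at this
    exact Nat.pos_of_ne_zero fun h => by simp [h] at this
  · intro b hb
    rw [Subalgebra.mem_center_iff] at hb
    obtain ⟨c, hc⟩ := mem_range_includeLeft_of_commute (x := e.symm (Matrix.scalar (Fin r) b)) fun d => by
      apply e.injective
      rw [map_mul, map_mul, AlgEquiv.apply_symm_apply]
      exact Matrix.scalar_commute b (fun b' => (hb b').symm) _
    refine ⟨c, ?_⟩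
    have h3 := congrArg e hc
    rw [AlgEquiv.apply_symm_apply] at h3
    have h4 : e (c ⊗ₜ 1) = algebraMap E _ c := e.commutes c
    rw [h4] at h3
    have := congrFun (congrFun h3 ⟨0, hr0⟩) ⟨0, hr0⟩
    simpa [Matrix.algebraMap_matrix_apply] using this.symm

theorem hasRep_iff_of_algEquiv {E A B F : Type*} [Field E] [Ring A] [Algebra E A] [Ring B] [Algebra E B] [Field F]
    {r : ℕ} (hr : 0 < r) (e : A ≃ₐ[E] Matrix (Fin r) (Fin r) B) (j : E →+* F) (N : ℕ) :
    HasRep j A N ↔ ∃ N', N = N' * r ∧ HasRep j B N' := by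
  constructor
  · intro h
    exact (h.comp_algHom e.symm.toAlgHom).corner hr
  · rintro ⟨N', rfl, h⟩
    exact (h.matrix r).comp_algHom e.toAlgHom

theorem dvd_of_hasRep {K : Type*} [Field K] {D : Type*} [DivisionRing D] [Algebra K D]
    [Algebra.IsCentral K D] [FiniteDimensional K D] {E : Type*} [Field E] {i : K →+* E}
    {n N : ℕ} (hn : Module.finrank K D = n * n) (h : HasRep i D N) : n ∣ N := by
  let _ := i.toAlgebra
  obtain ⟨r, m, B, _, _, hr, hm, rfl, hB, hBm, -, ⟨e⟩⟩ := exists_wedderburn E hn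
  obtain ⟨N', rfl, h'⟩ := (hasRep_iff_of_algEquiv hr e (RingHom.id E) N).1 (hasRep_tensor_iff _ |>.2 h)
  have := HasRep.finrank_dvd (E := E) h'
  rw [Module.finrank_self, one_mul, hBm] at this
  rw [mul_comm]
  exact mul_dvd_mul_right ((dvd_mul_right m m).trans this) r

/-- Over a division algebra `B` of degree `m`, representations have dimension divisible by `m ^ 2`. -/
theorem hasRep_self_iff {E : Type*} [Field E] {B : Type*} [DivisionRing B] [Algebra E B] [FiniteDimensional E B]
    (N : ℕ) : HasRep (RingHom.id E) B N ↔ Module.finrank E B ∣ N := by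
  refine ⟨fun h => ?_, fun h => (hasRep_regular E B).of_dvd h⟩
  have := HasRep.finrank_dvd (E := E) h
  rwa [Module.finrank_self, one_mul] at this

theorem schurIndex_dvd_iff' {E A : Type} [Field E] [Ring A] [Nontrivial A] [Algebra E A] [FiniteDimensional E A]
    {n : ℕ} (hn : 0 < n) (hA : Module.finrank E A = n * n)
    (hne : ∃ m, ∃ (D : Type) (_ : DivisionRing D) (_ : Algebra E D) (r : ℕ),
      Nonempty (A ≃ₐ[E] Matrix (Fin r) (Fin r) D) ∧ m * m = Module.finrank E D) (k : ℕ) :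
    schurIndex E A ∣ k ↔ HasRep (RingHom.id E) A (n * k) := by
  obtain ⟨B, _, _, r, ⟨e⟩, hm⟩ := Nat.sInf_mem hne
  change schurIndex E A * schurIndex E A = _ at hm
  generalize schurIndex E A = m at *
  have hr : 0 < r := by
    rcases Nat.eq_zero_or_pos r with rfl | h
    · exact absurd e.toEquiv.symm.nontrivial (not_nontrivial_iff_subsingleton.2 inferInstance)
    · exact h
  have h1 := e.toLinearEquiv.finrank_eq
  rw [Module.finrank_matrix, Fintype.card_fin, hA, ← hm] at h1
  have h2 : n = r * m := by
    have : n * n = (r * m) * (r * m) := by rw [h1]; ring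
    exact Nat.mul_self_inj.1 this
  subst h2
  have hm0 : 0 < m := Nat.pos_of_mul_pos_left hn
  have : FiniteDimensional E B := Module.finite_of_finrank_pos (by rw [← hm]; positivity)
  rw [hasRep_iff_of_algEquiv hr e]
  simp_rw [hasRep_self_iff, ← hm]
  constructor
  · rintro ⟨c, rfl⟩
    exact ⟨m * m * c, by ring, dvd_mul_right _ _⟩
  · rintro ⟨N', h, ⟨c, rfl⟩⟩
    refine ⟨c, ?_⟩
    have : (r * m) * k = (r * m) * (m * c) := by rw [h]; ring
    exact Nat.eq_of_mul_eq_mul_left hn this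

theorem schurIndex_tensor_dvd_iff {K D E : Type} [Field K] [DivisionRing D] [Algebra K D]
    [Algebra.IsCentral K D] [FiniteDimensional K D] [Field E] [Algebra K E] {n : ℕ} (hn : 0 < n)
    (hD : Module.finrank K D = n * n) (k : ℕ) :
    schurIndex E (E ⊗[K] D) ∣ k ↔ HasRep (algebraMap K E) D (n * k) := by
  rw [schurIndex_dvd_iff' hn (by rw [Module.finrank_baseChange, hD]), hasRep_tensor_iff]
  · rfl
  · obtain ⟨r, m, B, _, _, hr, hm, -, hB, hBm, -, he⟩ := exists_wedderburn E hD
    exact ⟨m, B, _, _, r, he, hBm.symm⟩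

theorem schurIndex_division {K D : Type} [Field K] [DivisionRing D] [Algebra K D]
    [FiniteDimensional K D] {n : ℕ} (hn : 0 < n)
    (hD : Module.finrank K D = n * n) : schurIndex K D = n := by
  have h := schurIndex_dvd_iff' hn hD ⟨n, D, _, _, 1,
    ⟨AlgEquiv.ofBijective (Matrix.scalarAlgHom (Fin 1) K) ⟨fun a b hab => by
      simpa using congrFun (congrFun hab 0) 0, fun M => ⟨M 0 0, by
        ext s t; fin_cases s; fin_cases t; simp⟩⟩⟩, hD.symm⟩
  simp_rw [hasRep_self_iff, hD, Nat.mul_dvd_mul_iff_left hn] at h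
  exact Nat.dvd_antisymm ((h n).2 dvd_rfl) ((h _).1 dvd_rfl)

end Structure

section MaximalSubfield

open Polynomial

variable {E : Type*} [Field E] {B : Type*} [DivisionRing B] [Algebra E B]
  [Algebra.IsCentral E B] [FiniteDimensional E B]

theorem exists_le_natDegree_minpoly [Infinite E] {m : ℕ} (hm : Module.finrank E B = m * m) :
    ∃ d : B, m ≤ (minpoly E d).natDegree := by
  obtain ⟨n, hn, ⟨e⟩⟩ := IsSimpleRing.exists_algEquiv_matrix_of_isAlgClosed (AlgebraicClosure E)
    (AlgebraicClosure E ⊗[E] B)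
  have hnm : n = m := by
    have := e.toLinearEquiv.finrank_eq
    rw [Module.finrank_baseChange, Module.finrank_matrix, Module.finrank_self, mul_one,
      Fintype.card_fin, hm] at this
    exact (Nat.mul_self_inj.1 this).symm
  subst hnm
  let Ω := AlgebraicClosure E
  let b := Module.finBasis E B
  let bΩ := b.baseChange Ω
  let T : Matrix (Fin n) (Fin n) (MvPolynomial (Fin (Module.finrank E B)) Ω) :=
    ∑ i, (MvPolynomial.X i : MvPolynomial _ Ω) • (e (1 ⊗ₜ b i)).map MvPolynomial.C
  let P : MvPolynomial (Fin (Module.finrank E B)) Ω :=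
    (Matrix.of fun i j : Fin n => ((T ^ (j : ℕ)).mulVec fun _ => 1) i).det
  have hT : ∀ c : Fin (Module.finrank E B) → Ω,
      (MvPolynomial.eval c).mapMatrix T = e (∑ i, c i • (1 ⊗ₜ b i)) := by
    intro c
    rw [map_sum, map_sum]
    refine Finset.sum_congr rfl fun i _ => ?_
    ext s t
    simp
  have hP : ∀ c : Fin (Module.finrank E B) → Ω, MvPolynomial.eval c P =
      (Matrix.of fun i j : Fin n =>
        ((e (∑ i, c i • (1 ⊗ₜ b i)) ^ (j : ℕ)).mulVec fun _ => 1) i).det := by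
    intro c
    rw [RingHom.map_det]
    congr 1
    ext i j
    change MvPolynomial.eval c (((T ^ (j : ℕ)).mulVec fun _ => 1) i) = _
    rw [Matrix.of_apply, ← hT, ← map_pow (MvPolynomial.eval c).mapMatrix T j]
    simp [Matrix.mulVec, dotProduct]
  have hP0 : P ≠ 0 := by
    intro h
    let α : Fin n ↪ E := (Fin.valEmbedding.trans (Infinite.natEmbedding E))
    have h1 := hP (fun i => bΩ.repr (e.symm (Matrix.diagonal fun i => algebraMap E Ω (α i))) i)
    have h2 : ∑ i, bΩ.repr (e.symm (Matrix.diagonal fun i => algebraMap E Ω (α i))) i •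
      ((1 : Ω) ⊗ₜ[E] b i) = e.symm (Matrix.diagonal fun i => algebraMap E Ω (α i)) := by
      conv_rhs => rw [← bΩ.sum_repr (e.symm (Matrix.diagonal fun i => algebraMap E Ω (α i)))]
      simp [bΩ]
    rw [h2, AlgEquiv.apply_symm_apply, h, map_zero] at h1
    have h3 : (Matrix.of fun i j : Fin n =>
        (((Matrix.diagonal fun i => algebraMap E Ω (α i)) ^ (j : ℕ)).mulVec fun _ => 1) i)
        = Matrix.vandermonde fun i => algebraMap E Ω (α i) := by
      ext i j
      simp [Matrix.diagonal_pow, Matrix.mulVec_diagonal, Matrix.vandermonde]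
    rw [h3] at h1
    exact Matrix.det_vandermonde_ne_zero_iff.2
      ((algebraMap E Ω).injective.comp α.injective) h1.symm
  obtain ⟨c, hc⟩ : ∃ c : Fin (Module.finrank E B) → E,
      MvPolynomial.eval (fun i => algebraMap E Ω (c i)) P ≠ 0 := by
    by_contra! h
    apply hP0
    refine MvPolynomial.funext_set (fun _ => Set.range (algebraMap E Ω)) ?_ ?_
    · exact fun _ => Set.infinite_range_of_injective (algebraMap E Ω).injective
    · intro x hx
      choose c hc using fun i => hx i trivial
      rw [show x = fun i => algebraMap E Ω (c i) from funext fun i => (hc i).symm, h, map_zero]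
  refine ⟨∑ i, c i • b i, ?_⟩
  by_contra! hlt
  rw [hP] at hc
  have h4 : ∑ i, algebraMap E Ω (c i) • ((1 : Ω) ⊗ₜ[E] b i) =
      Algebra.TensorProduct.includeRight (∑ i, c i • b i) := by
    simp [map_sum]
  rw [h4] at hc
  have h5 := Polynomial.aeval_eq_sum_range' hlt (∑ i, c i • b i)
  set d := ∑ i, c i • b i with hd
  rw [minpoly.aeval] at h5
  have h6 := congrArg (fun x => (e (Algebra.TensorProduct.includeRight x)).mulVec fun _ => (1:Ω)) h5
  simp only [map_zero, Matrix.zero_mulVec, map_sum] at h6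
  have h7 := Matrix.eq_zero_of_mulVec_eq_zero hc
    (v := fun j => algebraMap E Ω ((minpoly E d).coeff j)) (by
    rw [h6, Finset.sum_range]
    ext i
    rw [Matrix.sum_mulVec, Finset.sum_apply]
    simp only [Matrix.mulVec, dotProduct, Matrix.of_apply]
    refine Finset.sum_congr rfl fun j _ => ?_
    rw [map_smul, ← algebraMap_smul Ω ((minpoly E d).coeff j), map_smul, map_pow, map_pow]
    simp [Matrix.smul_apply, Finset.mul_sum, Finset.sum_mul, mul_comm])
  apply minpoly.ne_zero (Algebra.IsIntegral.isIntegral (R := E) d)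
  ext k
  by_cases hk : k < n
  · simpa using congrFun h7 ⟨k, hk⟩
  · exact coeff_eq_zero_of_natDegree_lt (by omega)

theorem aeval_mulRight (d x : B) (p : E[X]) :
    aeval (LinearMap.mulRight E d) p x = x * aeval d p := by
  rw [aeval_eq_sum_range, aeval_eq_sum_range, LinearMap.sum_apply, Finset.mul_sum]
  refine Finset.sum_congr rfl fun i _ => ?_
  rw [LinearMap.smul_apply, LinearMap.pow_mulRight, LinearMap.mulRight_apply, mul_smul_comm]

theorem hasRep_adjoinRoot_minpoly (d : B) [Fact (Irreducible (minpoly E d))] :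
    ∃ N, Module.finrank E B = (minpoly E d).natDegree * N ∧
    HasRep (algebraMap E (AdjoinRoot (minpoly E d))) B N := by
  let R : AdjoinRoot (minpoly E d) →+* Module.End E B :=
    Ideal.Quotient.lift _ (aeval (R := E) (LinearMap.mulRight E d)).toRingHom (by
      intro p hp
      obtain ⟨q, rfl⟩ := Ideal.mem_span_singleton.1 hp
      ext x
      change aeval (LinearMap.mulRight E d) _ x = _
      rw [aeval_mulRight, map_mul, minpoly.aeval]
      simp)
  let _ : Module (AdjoinRoot (minpoly E d)) B := Module.compHom B R
  have hR : ∀ (p : E[X]) (x : B), AdjoinRoot.mk (minpoly E d) p • x = x * aeval d p :=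
    fun p x => aeval_mulRight d x p
  have ha : ∀ (a : E) (x : B), algebraMap E (AdjoinRoot (minpoly E d)) a • x = a • x := by
    intro a x
    have := hR (C a) x
    rw [aeval_C, ← Algebra.commutes, ← Algebra.smul_def] at this
    exact this
  have : IsScalarTower E (AdjoinRoot (minpoly E d)) B := ⟨fun a y x => by
    rw [Algebra.smul_def, mul_smul, ha]⟩
  have : Module.Finite (AdjoinRoot (minpoly E d)) B := Module.Finite.right E _ _
  have hfin : Module.finrank E (AdjoinRoot (minpoly E d)) = (minpoly E d).natDegree :=
    (AdjoinRoot.powerBasis (minpoly.ne_zero (Algebra.IsIntegral.isIntegral (R := E) d))).finrank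
  refine ⟨Module.finrank (AdjoinRoot (minpoly E d)) B, ?_, ?_⟩
  · rw [← hfin, Module.finrank_mul_finrank]
  · refine HasRep.of_end (V := B) rfl
      ({ toFun := fun b =>
          { toFun := fun x => b * x
            map_add' := mul_add b
            map_smul' := fun c x => by
              obtain ⟨p, rfl⟩ := AdjoinRoot.mk_surjective c
              rw [RingHom.id_apply, hR, hR, mul_assoc] }
         map_one' := by ext; simp
         map_mul' := fun a b => by ext; simp [mul_assoc]
         map_zero' := by ext; simp
         map_add' := fun a b => by ext; simp [add_mul] } :
        B →+* Module.End (AdjoinRoot (minpoly E d)) B) ?_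
    intro a x
    rw [ha, Algebra.smul_def]
    rfl

theorem exists_hasRep_adjoinRoot [Infinite E] {m : ℕ} (hm : Module.finrank E B = m * m) :
    ∃ f : E[X], ∃ _ : Fact (Irreducible f), f.Monic ∧ f.natDegree = m ∧
      HasRep (algebraMap E (AdjoinRoot f)) B m := by
  obtain ⟨d, hd⟩ := exists_le_natDegree_minpoly hm
  have hint := Algebra.IsIntegral.isIntegral (R := E) d
  have hfact : Fact (Irreducible (minpoly E d)) := ⟨minpoly.irreducible hint⟩
  obtain ⟨N, hN, h⟩ := hasRep_adjoinRoot_minpoly (E := E) d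
  have h0 : 0 < m * m := hm ▸ Module.finrank_pos
  have hmN : m ∣ N := dvd_of_hasRep hm h
  have hN0 : 0 < N := Nat.pos_of_ne_zero fun h0N => h0.ne' (by rw [← hm, hN, h0N, mul_zero])
  have h1 := Nat.le_of_dvd hN0 hmN
  have h2 : (minpoly E d).natDegree = m ∧ N = m := by
    rw [hm] at hN
    have hm0 : 0 < m := Nat.pos_of_mul_pos_left h0
    constructor
    · nlinarith
    · by_contra hne
      have : m < N := lt_of_le_of_ne h1 (Ne.symm hne)
      nlinarith
  exact ⟨_, hfact, minpoly.monic hint, h2.1, h2.2 ▸ h⟩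

end MaximalSubfield

section LocalSubfield

open Polynomial

/-- A central division algebra over `K` has over each infinite extension `E` a splitting polynomial
whose degree is the index over `E`. -/
theorem exists_splitting_polynomial {K : Type*} [Field K] {D : Type*} [DivisionRing D] [Algebra K D]
    [Algebra.IsCentral K D] [FiniteDimensional K D] {E : Type*} [Field E] [Infinite E] (i : K →+* E)
    {n k : ℕ} (hn : Module.finrank K D = n * n) (hk : HasRep i D (n * k)) :
    ∃ f : E[X], f.Monic ∧ Irreducible f ∧ f.natDegree ∣ k ∧ ∃ _ : Fact (Irreducible f),
      HasRep ((algebraMap E (AdjoinRoot f)).comp i) D n := by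
  let _ := i.toAlgebra
  obtain ⟨r, m, B, _, _, hr, hm, hrm, _, hBm, _, ⟨e⟩⟩ := exists_wedderburn E hn
  obtain ⟨f, hf, hfm, hdeg, hB⟩ := exists_hasRep_adjoinRoot hBm
  refine ⟨f, hfm, hf.out, ?_, hf, ?_⟩
  · rw [hdeg]
    obtain ⟨N', hN', h'⟩ := (hasRep_iff_of_algEquiv hr e (RingHom.id E) _).1 (hasRep_tensor_iff _ |>.2 hk)
    rw [hasRep_self_iff, hBm] at h'
    rw [hrm] at hN'
    have : m * k = N' := Nat.eq_of_mul_eq_mul_left hr (by rw [← mul_assoc, hN', mul_comm])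
    rw [← this] at h'
    exact Nat.dvd_of_mul_dvd_mul_left hm h'
  · have := (hasRep_iff_of_algEquiv hr e _ n).2 ⟨m, by rw [hrm, mul_comm], hB⟩
    exact hasRep_tensor_iff _ |>.1 this

theorem HasRep.of_root {K : Type*} [Field K] {D : Type*} [Ring D] [Algebra K D]
    {E : Type*} [Field E] {i : K →+* E} {n : ℕ} {f : E[X]} [Fact (Irreducible f)]
    (h : HasRep ((algebraMap E (AdjoinRoot f)).comp i) D n) {F : Type*} [Field F] (j : E →+* F)
    {x : F} (hx : f.eval₂ j x = 0) : HasRep (j.comp i) D n := by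
  refine h.map_eq (AdjoinRoot.lift j x hx) ?_
  ext a
  simp

end LocalSubfield

section FiniteSplittingField

theorem HasRep.of_subfield {K D A : Type*} [Field K] [Ring D] [Algebra K D] [Field A] {i : K →+* A}
    {N : ℕ} (f : D →+* Matrix (Fin N) (Fin N) A) (hf : ∀ a, f (algebraMap K D a) = Matrix.scalar (Fin N) (i a))
    {Ω : Type*} [Field Ω] (j : Ω →+* A) (i' : K →+* Ω) (hi : j.comp i' = i)
    (hΩ : ∀ d s t, f d s t ∈ j.range) : HasRep i' D N := by
  have hinj : Function.Injective (j.mapMatrix (m := Fin N)) := Matrix.map_injective j.injective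
  have hf' : ∀ d, ∃ M : Matrix (Fin N) (Fin N) Ω, j.mapMatrix M = f d := fun d => by
    choose M hM using hΩ d
    exact ⟨Matrix.of M, by ext s t; exact hM s t⟩
  choose g hg using hf'
  refine ⟨{ toFun := g, map_one' := hinj (by rw [hg, map_one, map_one]),
            map_mul' := fun a b => hinj (by rw [hg, map_mul, map_mul, hg, hg]),
            map_zero' := hinj (by rw [hg, map_zero, map_zero]),
            map_add' := fun a b => hinj (by rw [hg, map_add, map_add, hg, hg]) }, fun a => hinj ?_⟩
  change j.mapMatrix (g _) = _
  rw [hg, hf, ← hi]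
  ext s t
  simp [Matrix.diagonal_apply, apply_ite j]

theorem exists_galois_hasRep {K : Type*} [Field K] {D : Type*} [DivisionRing D] [Algebra K D]
    [Algebra.IsCentral K D] [FiniteDimensional K D] {F : Type*} [Field F] [CharZero F] (i : K →+* F)
    {n : ℕ} (hn : Module.finrank K D = n * n) (z : AlgebraicClosure F) :
    ∃ Ω : IntermediateField F (AlgebraicClosure F), FiniteDimensional F Ω ∧ IsGalois F Ω ∧
      z ∈ Ω ∧ HasRep ((algebraMap F Ω).comp i) D n := by
  classical
  let A := AlgebraicClosure F
  let _ : Algebra K A := ((algebraMap F A).comp i).toAlgebra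
  obtain ⟨n', hn0, hnn, h⟩ := exists_matrix_over_algebraicClosure (K := K) (D := D)
  obtain rfl : n' = n := Nat.mul_self_inj.1 (hnn.symm.trans hn)
  obtain ⟨f, hf⟩ := h.map_eq (i' := (algebraMap F A).comp i)
    (IsAlgClosed.lift (R := K) (M := A) (S := AlgebraicClosure K)).toRingHom (by
      ext a
      exact (IsAlgClosed.lift (R := K) (M := A) (S := AlgebraicClosure K)).commutes a)
  let b := Module.finBasis K D
  let S : Set A := insert z (Set.range fun x : Fin (Module.finrank K D) × Fin n' × Fin n' =>
    f (b x.1) x.2.1 x.2.2)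
  have hS : S.Finite := (Set.finite_range _).insert z
  let Ω₀ := IntermediateField.adjoin F S
  have : FiniteDimensional F Ω₀ :=
    IntermediateField.finiteDimensional_adjoin (K := F) (S := S) (fun x _ => Algebra.IsIntegral.isIntegral x)
  let Ω := IntermediateField.normalClosure F Ω₀ A
  have hle : Ω₀ ≤ Ω := IntermediateField.le_normalClosure Ω₀
  refine ⟨Ω, inferInstance, ?_, hle (IntermediateField.subset_adjoin F S (Set.mem_insert _ _)), ?_⟩
  · exact ⟨⟩
  · refine HasRep.of_subfield f hf (algebraMap Ω A) _ rfl ?_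
    intro d s t
    suffices f d s t ∈ Ω from ⟨⟨_, this⟩, rfl⟩
    rw [← b.sum_repr d, map_sum, Matrix.sum_apply]
    refine sum_mem fun k _ => ?_
    rw [Algebra.smul_def, map_mul, hf]
    simp only [Matrix.scalar_apply, Matrix.diagonal_mul]
    exact mul_mem (IntermediateField.algebraMap_mem Ω _)
      (hle (IntermediateField.subset_adjoin F S (Set.mem_insert_of_mem _ ⟨(k, s, t), rfl⟩)))

end FiniteSplittingField

section Symbol

open Polynomial

theorem Module.End.eq_zero_of_sum_eigenvectors {R M ι : Type*} [Field R] [AddCommGroup M] [Module R M]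
    [Fintype ι] (T : Module.End R M) {μ : ι → R} (hμ : Function.Injective μ) {w : ι → M}
    (hw : ∀ i, T (w i) = μ i • w i) (hsum : ∑ i, w i = 0) (i : ι) : w i = 0 := by
  classical
  by_contra h
  let s : Finset ι := Finset.univ.filter fun i => w i ≠ 0
  have hLI : LinearIndependent R (fun i : s => w i) := by
    refine Module.End.eigenvectors_linearIndependent' T (fun i : s => μ i)
      (hμ.comp Subtype.val_injective) _ fun i => ?_
    exact ⟨Module.End.mem_eigenspace_iff.2 (hw i), (Finset.mem_filter.1 i.2).2⟩
  have h1 : ∑ i : s, (1 : R) • w i = 0 := by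
    simp_rw [one_smul]
    rw [Finset.sum_coe_sort s w, Finset.sum_filter_ne_zero, hsum]
  exact one_ne_zero (Fintype.linearIndependent_iff.1 hLI _ h1 ⟨i, by simp [s, h]⟩)

/-- `a` is a norm from `E[X]/(X ^ p - b)`. -/
def NormP {E : Type*} [Field E] (p : ℕ) (ζ b a : E) : Prop :=
  ∃ f : E[X], (X ^ p - C b) ∣ (∏ i ∈ Finset.range p, f.comp (C (ζ ^ i) * X)) - C a

theorem eq_pow_of_pow_eq_one {L : Type*} [Field L] {B : Type*} [Ring B] [IsDomain B] [Algebra L B] {p : ℕ}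
    (hp : 0 < p) {ζ : L} (hζ : IsPrimitiveRoot ζ p) {z : B} (hz : z ^ p = 1) :
    ∃ i, z = algebraMap L B (ζ ^ i) := by
  classical
  have h := congrArg (aeval z) (X_pow_sub_one_eq_prod hp hζ)
  rw [map_sub, map_pow, aeval_X, hz, map_one, sub_self] at h
  by_contra! hne
  have h2 : ∀ s ⊆ nthRootsFinset p (1 : L), aeval z (∏ c ∈ s, (X - C c)) ≠ 0 := by
    intro s
    induction s using Finset.induction_on with
    | empty => simp
    | insert c s hc ih =>
      intro hs
      rw [Finset.prod_insert hc, map_mul]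
      refine mul_ne_zero ?_ (ih fun x hx => hs (Finset.mem_insert_of_mem hx))
      have := NeZero.of_pos hp
      obtain ⟨i, -, rfl⟩ := hζ.eq_pow_of_pow_eq_one
        ((mem_nthRootsFinset hp _).1 (hs (Finset.mem_insert_self _ _)))
      simpa [sub_eq_zero] using hne i
  exact h2 _ subset_rfl h.symm

/-- Moving a polynomial in `x` past `y`. -/
theorem mul_aeval_eq_aeval_mul {L B : Type*} [Field L] [Ring B] [Algebra L B] {ζ : L} {x y : B}
    (h : y * x = ζ • (x * y)) (f : L[X]) (c : L) :
    y * aeval (c • x) f = aeval ((ζ * c) • x) f * y := by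
  have h1 : ∀ k : ℕ, y * (c • x) ^ k = ((ζ * c) • x) ^ k * y := by
    intro k
    induction k with
    | zero => simp
    | succ k ih =>
      rw [pow_succ, ← mul_assoc, ih, mul_assoc, mul_smul_comm, h, pow_succ, mul_assoc, smul_mul_assoc,
        smul_smul, mul_comm c]
  rw [aeval_eq_sum_range, aeval_eq_sum_range, Finset.mul_sum, Finset.sum_mul]
  refine Finset.sum_congr rfl fun i _ => ?_
  rw [mul_smul_comm, h1, smul_mul_assoc]

theorem aeval_prod_comp {L B : Type*} [Field L] [Ring B] [Algebra L B] (ζ : L) (x : B) (f : L[X]) (k : ℕ) :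
    aeval x (∏ i ∈ Finset.range (k + 1), f.comp (C (ζ ^ i) * X)) =
      aeval x f * aeval (ζ • x) (∏ i ∈ Finset.range k, f.comp (C (ζ ^ i) * X)) := by
  rw [Finset.prod_range_succ', mul_comm, map_mul]
  congr 1
  · simp
  · rw [show aeval (ζ • x) = (aeval x).comp (aeval (R := L) (C ζ * X)) by
      ext; simp [Algebra.smul_def], AlgHom.comp_apply]
    congr 1
    rw [map_prod]
    refine Finset.prod_congr rfl fun i _ => ?_
    rw [← comp_eq_aeval, comp_assoc]
    congr 1
    simp [pow_succ, mul_assoc]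


theorem pow_eq_aeval_prod_mul {L B : Type*} [Field L] [Ring B] [Algebra L B] {ζ : L} {x y z : B}
    (h : y * x = ζ • (x * y)) (f : L[X]) (hz : y = aeval x f * z)
    (h' : z * x = ζ • (x * z)) (k : ℕ) :
    y ^ k = aeval x (∏ i ∈ Finset.range k, f.comp (C (ζ ^ i) * X)) * z ^ k := by
  induction k with
  | zero => simp
  | succ k ih =>
    rw [pow_succ', ih, hz, aeval_prod_comp, pow_succ' z, mul_assoc, mul_assoc, ← mul_assoc z]
    have := mul_aeval_eq_aeval_mul h' (∏ i ∈ Finset.range k, f.comp (C (ζ ^ i) * X)) 1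
    rw [one_smul, mul_one] at this
    rw [this, mul_assoc]

theorem not_normP {L B : Type*} [Field L] [DivisionRing B] [Algebra L B] {p : ℕ} (hp : 1 < p) {ζ a b : L} {x y : B}
    (hζ : IsPrimitiveRoot ζ p)
    (h : y * x = ζ • (x * y)) (hx : x ^ p = algebraMap L B b) (hy : y ^ p = algebraMap L B a)
    (hx0 : x ≠ 0) (hy0 : y ≠ 0) : ¬ NormP p ζ b a := by
  rintro ⟨f, q, hq⟩
  have h1 : aeval x (∏ i ∈ Finset.range p, f.comp (C (ζ ^ i) * X)) = algebraMap L B a := by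
    have := congrArg (aeval x) hq
    rw [map_mul, map_sub, map_sub, map_pow, aeval_X, aeval_C, aeval_C, hx, sub_self, zero_mul, sub_eq_zero] at this
    exact this
  have ha : algebraMap L B a ≠ 0 := hy ▸ pow_ne_zero _ hy0
  have hf : aeval x f ≠ 0 := by
    intro h0
    obtain ⟨k, rfl⟩ : ∃ k, p = k + 1 := ⟨p - 1, by omega⟩
    rw [aeval_prod_comp, h0, zero_mul] at h1
    exact ha h1.symm
  have hcomm : Commute x (aeval x f) := by
    have := (Commute.all X f).map (aeval (R := L) x)
    rwa [aeval_X] at this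
  have hyz : y = aeval x f * ((aeval x f)⁻¹ * y) := by rw [mul_inv_cancel_left₀ hf]
  have h2 := pow_eq_aeval_prod_mul h f hyz (by
    rw [mul_assoc, h, mul_smul_comm, ← mul_assoc, ← mul_assoc, (hcomm.symm.inv_left₀).eq]) p
  rw [h1, hy] at h2
  obtain ⟨i, hi⟩ := eq_pow_of_pow_eq_one (by omega) hζ (mul_left_cancel₀ ha (h2.symm.trans (mul_one _).symm))
  rw [hi] at hyz
  have h3 : y * x = x * y := by
    rw [hyz, mul_assoc, Algebra.commutes, ← mul_assoc, ← mul_assoc, hcomm.eq]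
  rw [h3] at h
  have h4 : (ζ - 1) • (x * y) = 0 := by rw [sub_smul, one_smul, ← h, sub_self]
  rcases smul_eq_zero.1 h4 with h4 | h4
  · exact hζ.ne_one hp (sub_eq_zero.1 h4)
  · exact mul_ne_zero hx0 hy0 h4

theorem normP_of_pow {E : Type*} [Field E] {p : ℕ} (hp : 0 < p) {ζ c a : E} (hζ : IsPrimitiveRoot ζ p) (hc : c ≠ 0) :
    NormP p ζ (c ^ p) a := by
  classical
  let r : ℕ → E := fun k => if k = 0 then a else 1
  let v : ℕ → E := fun k => ζ ^ k * c
  have hv : Set.InjOn v (Finset.range p) := by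
    intro i hi j hj hij
    exact hζ.pow_inj (by simpa using hi) (by simpa using hj) (mul_right_cancel₀ hc hij)
  refine ⟨Lagrange.interpolate (Finset.range p) v r, ?_⟩
  have h1 : (X ^ p - C (c ^ p) : E[X]) = ∏ k ∈ Finset.range p, (X - C (v k)) := by
    rw [X_pow_sub_C_eq_prod hζ hp rfl]
  rw [h1]
  refine Finset.prod_dvd_of_coprime ?_ fun k hk => ?_
  · intro i hi j hj hij
    exact isCoprime_X_sub_C_of_isUnit_sub (sub_ne_zero.2 fun h => hij (hv hi hj h)).isUnit
  · rw [dvd_iff_isRoot, IsRoot.def, eval_sub, eval_prod, eval_C, sub_eq_zero]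
    have h2 : ∀ i, (Lagrange.interpolate (Finset.range p) v r).eval (v i) = r (i % p) := by
      intro i
      have : v i = v (i % p) := by
        simp only [v]; rw [← pow_mod_orderOf, ← hζ.eq_orderOf]
      rw [this]
      exact Lagrange.eval_interpolate_at_node r hv (Finset.mem_range.2 (Nat.mod_lt _ hp))
    have h3 : ∀ i ∈ Finset.range p, eval (v k) ((Lagrange.interpolate (Finset.range p) v r).comp (C (ζ ^ i) * X))
      = r ((i + k) % p) := by
      intro i _
      rw [← h2, eval_comp, eval_mul, eval_C, eval_X]
      congr 1
      simp only [v]; ring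
    rw [Finset.prod_congr rfl h3]
    have hk' := Finset.mem_range.1 hk
    rw [Finset.prod_eq_single ((p - k) % p)]
    · have : ((p - k) % p + k) % p = 0 := by
        rw [Nat.mod_add_mod, Nat.sub_add_cancel hk'.le, Nat.mod_self]
      simp [r, this]
    · intro i hi hne
      have : (i + k) % p ≠ 0 := by
        intro h0
        apply hne
        obtain ⟨t, ht⟩ := Nat.dvd_of_mod_eq_zero h0
        have hi' := Finset.mem_range.1 hi
        have : t < 2 := by nlinarith
        interval_cases t
        · obtain ⟨rfl, rfl⟩ : i = 0 ∧ k = 0 := by omega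
          simp
        · rw [Nat.mod_eq_of_lt (by omega)]; omega
      simp [r, this]
    · intro h
      exact absurd (Finset.mem_range.2 (Nat.mod_lt _ hp)) h

/-- If `v` is killed by `q`, and `f` is irreducible with `f(x) = 0`, then `f` divides `q`. -/
theorem dvd_of_aeval_apply_eq_zero {E V : Type*} [Field E] [AddCommGroup V] [Module E V] {f q : E[X]}
    (hf : Irreducible f) {x : Module.End E V} (hx : aeval x f = 0) {v : V} (hv : v ≠ 0) (hq : aeval x q v = 0) : f ∣ q := by
  by_contra h
  obtain ⟨a, b, hab⟩ := (hf.coprime_iff_not_dvd.2 h)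
  have := congrArg (fun g => aeval x g v) hab
  simp only [map_add, map_mul, hx, mul_zero, zero_add, map_one, Module.End.mul_apply, hq, map_zero,
    LinearMap.add_apply, LinearMap.zero_apply, Module.End.one_apply] at this
  exact hv this.symm

theorem normP_of_matrices {E : Type*} [Field E] {p : ℕ} (hp : p.Prime) {ζ a b : E} (hζ : IsPrimitiveRoot ζ p)
    (hb : b ≠ 0) {V : Type*} [AddCommGroup V] [Module E V] (hV : Module.finrank E V = p)
    {x y : Module.End E V} (h : y * x = ζ • (x * y)) (hx : x ^ p = algebraMap E _ b)
    (hy : y ^ p = algebraMap E _ a) : NormP p ζ b a := by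
  by_cases hbp : ∃ c, c ^ p = b
  · obtain ⟨c, rfl⟩ := hbp
    exact normP_of_pow hp.pos hζ (by rintro rfl; simp [hp.ne_zero] at hb)
  have hirr : Irreducible (X ^ p - C b) := X_pow_sub_C_irreducible_of_prime hp (by simpa using hbp)
  have hx' : aeval x (X ^ p - C b) = 0 := by simp [hx]
  have : Module.Finite E V := Module.finite_of_finrank_pos (hV ▸ hp.pos)
  have : Nontrivial V := Module.nontrivial_of_finrank_pos (R := E) (hV ▸ hp.pos)
  obtain ⟨v, hv⟩ := exists_ne (0 : V)
  have hLI : LinearIndependent E fun i : Fin p => (x ^ (i : ℕ)) v := by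
    rw [Fintype.linearIndependent_iff]
    intro g hg i
    let q : E[X] := ∑ i : Fin p, C (g i) * X ^ (i : ℕ)
    have hq : q = 0 := by
      by_contra h0
      have := natDegree_le_of_dvd (dvd_of_aeval_apply_eq_zero hirr hx' hv (q := q) (by
        rw [← hg]; simp [q, LinearMap.sum_apply, ← Algebra.smul_def])) h0
      rw [natDegree_X_pow_sub_C] at this
      have h4 : q.natDegree < p := by
        rw [natDegree_lt_iff_degree_lt h0]
        exact degree_sum_fin_lt g
      omega
    have := congrArg (fun q => coeff q i) hq
    simpa [q, finset_sum_coeff, coeff_C_mul, coeff_X_pow, Fin.val_inj] using this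
  obtain ⟨f, hf⟩ : ∃ f : E[X], y v = aeval x f v := by
    have hspan := hLI.span_eq_top_of_card_eq_finrank' (by simp [hV])
    have hmem : y v ∈ Submodule.span E (Set.range fun i : Fin p => (x ^ (i : ℕ)) v) := hspan ▸ trivial
    obtain ⟨c, hc⟩ := (Submodule.mem_span_range_iff_exists_fun E).1 hmem
    exact ⟨∑ i : Fin p, C (c i) * X ^ (i : ℕ), by rw [← hc]; simp [LinearMap.sum_apply, ← Algebra.smul_def]⟩
  have hk : ∀ k, (y ^ k) v = aeval x (∏ i ∈ Finset.range k, f.comp (C (ζ ^ i) * X)) v := by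
    intro k
    induction k with
    | zero => simp
    | succ k ih =>
      have := mul_aeval_eq_aeval_mul h (∏ i ∈ Finset.range k, f.comp (C (ζ ^ i) * X)) 1
      rw [one_smul, mul_one] at this
      rw [pow_succ', Module.End.mul_apply, ih, ← Module.End.mul_apply, this, Module.End.mul_apply, hf,
        ← Module.End.mul_apply, aeval_prod_comp]
      congr 1
      have hc : aeval (ζ • x) = (aeval x).comp (aeval (R := E) (C ζ * X)) := by
        ext; simp [Algebra.smul_def]
      rw [hc, AlgHom.comp_apply]
      exact (Commute.all _ f).map (aeval (R := E) x)
  refine ⟨f, dvd_of_aeval_apply_eq_zero hirr hx' hv ?_⟩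
  rw [map_sub, LinearMap.sub_apply, ← hk, hy, aeval_C, sub_self]

end Symbol

section SymbolPresentation

open Polynomial

variable {L : Type*} [Field L] {B : Type*} [DivisionRing B] [Algebra L B]
  [FiniteDimensional L B] {p : ℕ}

theorem exists_pth_root {L₁ : Type*} [Field L₁] [Algebra L L₁]
    (hp : p.Prime) (hB : Module.finrank L B = p * p) (hL : Module.finrank L L₁ = p)
    (h : HasRep (algebraMap L L₁) B p) {ξ : L₁} {b : L} (hξ : ξ ^ p = algebraMap L L₁ b)
    (hξ' : ∀ c, ξ ≠ algebraMap L L₁ c) :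
    ∃ x : B, x ^ p = algebraMap L B b ∧ ∀ c, x ≠ algebraMap L B c := by
  obtain ⟨f, hf⟩ := h.exists_end
  have : FiniteDimensional L L₁ := Module.finite_of_finrank_pos (hL ▸ hp.pos)
  have := NeZero.of_pos hp.pos
  let v : Fin p → L₁ := fun _ => 1
  have hv : v ≠ 0 := fun h => one_ne_zero (congrFun h 0)
  let g : B →ₗ[L] (Fin p → L₁) :=
    { toFun := fun d => f d v
      map_add' := fun a b => by rw [map_add, LinearMap.add_apply]
      map_smul' := fun c d => by
        rw [Algebra.smul_def, map_mul, Module.End.mul_apply, hf, RingHom.id_apply, algebraMap_smul] }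
  have hg : Function.Injective g := by
    rw [injective_iff_map_eq_zero]
    intro d hd
    by_contra h0
    apply hv
    have : f (d⁻¹ * d) v = f d⁻¹ (g d) := by rw [map_mul]; rfl
    rwa [inv_mul_cancel₀ h0, map_one, hd, map_zero] at this
  have hg' : Function.Surjective g := by
    rw [← LinearMap.injective_iff_surjective_of_finrank_eq_finrank]
    · exact hg
    · rw [hB, Module.finrank_pi_fintype]; simp [hL]
  obtain ⟨x, hx⟩ := hg' (ξ • v)
  change f x v = ξ • v at hx
  have hxk : ∀ k : ℕ, f (x ^ k) v = ξ ^ k • v := by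
    intro k
    induction k with
    | zero => simp
    | succ k ih => rw [pow_succ, map_mul, Module.End.mul_apply, hx, map_smul, ih, smul_smul, pow_succ']
  refine ⟨x, hg ?_, ?_⟩
  · change f _ v = f _ v
    rw [hxk, hf, hξ]
  · rintro c rfl
    rw [hf] at hx
    exact hξ' c (by simpa [v] using (congrFun hx 0).symm)

theorem exists_eigenvector (hp : p.Prime) {ζ : L} (hζ : IsPrimitiveRoot ζ p) {x : B} {b : L}
    (hx : x ^ p = algebraMap L B b) {y₀ : B} (hy₀ : y₀ * x ≠ x * y₀) :
    ∃ (ζ' : L) (y : B), IsPrimitiveRoot ζ' p ∧ y ≠ 0 ∧ y * x = ζ' • (x * y) := by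
  classical
  have hx0 : x ≠ 0 := by rintro rfl; simp at hy₀
  let T : Module.End L B := (LinearMap.mulRight L x).comp (LinearMap.mulLeft L x⁻¹)
  have hT : ∀ y, T y = x⁻¹ * y * x := fun y => rfl
  have hTk : ∀ (k : ℕ) (y : B), (T ^ k) y = (x⁻¹) ^ k * y * x ^ k := by
    intro k y
    induction k with
    | zero => simp
    | succ k ih =>
      rw [pow_succ', Module.End.mul_apply, ih, hT, pow_succ', pow_succ x]
      simp only [mul_assoc]
  have hTp : T ^ p = 1 := by
    ext y
    rw [hTk, inv_pow, hx, mul_assoc, ← Algebra.commutes, ← hx, ← mul_assoc, inv_mul_cancel₀ (pow_ne_zero _ hx0)]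
    simp
  by_contra! hne
  have h1 : ∀ c ∈ nthRootsFinset p (1 : L), c ≠ 1 → Function.Injective (aeval T (X - C c)) := by
    intro c hc hc1
    rw [injective_iff_map_eq_zero]
    intro y hy
    by_contra hy0
    have hc' : IsPrimitiveRoot c p := by
      have h2 : c ^ p = 1 := (mem_nthRootsFinset hp.pos _).1 hc
      have h3 := orderOf_eq_prime h2 hc1 (hp := ⟨hp⟩)
      exact h3 ▸ IsPrimitiveRoot.orderOf c
    refine hne c y hc' hy0 ?_
    rw [map_sub, aeval_X, aeval_C, LinearMap.sub_apply, Module.algebraMap_end_apply, hT, sub_eq_zero] at hy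
    rw [← mul_smul_comm, ← hy, ← mul_assoc, ← mul_assoc, mul_inv_cancel₀ hx0, one_mul]
  have h2 : ∀ s ⊆ (nthRootsFinset p (1 : L)).erase 1, Function.Injective (aeval T (∏ c ∈ s, (X - C c))) := by
    intro s
    induction s using Finset.induction_on with
    | empty => intro _; simp; exact fun _ _ h => h
    | insert c s hc ih =>
      intro hs
      rw [Finset.prod_insert hc, map_mul]
      have h3 := Finset.mem_erase.1 (hs (Finset.mem_insert_self c s))
      exact (h1 c h3.2 h3.1).comp (ih fun x hx => hs (Finset.mem_insert_of_mem hx))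
  have h3 := congrArg (aeval T) (X_pow_sub_one_eq_prod hp.pos hζ)
  rw [map_sub, map_pow, aeval_X, hTp, map_one, sub_self,
    ← Finset.prod_erase_mul _ _ ((mem_nthRootsFinset hp.pos _).2 (one_pow p)), map_mul] at h3
  apply hy₀
  have h4 : aeval T (X - C (1 : L)) y₀ = 0 := by
    apply h2 _ subset_rfl
    rw [map_zero, ← Module.End.mul_apply, ← h3]
    rfl
  rw [map_sub, aeval_X, aeval_C, LinearMap.sub_apply, Module.algebraMap_end_apply, hT, sub_eq_zero, one_smul] at h4
  conv_rhs => rw [← h4, ← mul_assoc, ← mul_assoc, mul_inv_cancel₀ hx0, one_mul]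

theorem exists_algebraMap_eq_pow (hp : p.Prime) (hB : Module.finrank L B = p * p) {ζ : L} (hζ : IsPrimitiveRoot ζ p) {x y : B} {b : L}
    (hx : x ^ p = algebraMap L B b) (hx0 : x ≠ 0) (hy0 : y ≠ 0) (h : y * x = ζ • (x * y)) :
    ∃ a, y ^ p = algebraMap L B a := by
  have hinj : Function.Injective fun i : Fin p => ζ ^ (i : ℕ) := fun i j hij =>
    Fin.ext (hζ.pow_inj i.2 j.2 hij)
  have hyx : ∀ k : ℕ, y * x ^ k = ζ ^ k • (x ^ k * y) := by
    intro k
    have := mul_aeval_eq_aeval_mul h (X ^ k) 1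
    simpa [_root_.smul_pow, smul_mul_assoc] using this
  have hxy : ∀ k : ℕ, y ^ k * x = ζ ^ k • (x * y ^ k) := by
    intro k
    induction k with
    | zero => simp
    | succ k ih => rw [pow_succ', mul_assoc, ih, mul_smul_comm, ← mul_assoc, h, smul_mul_assoc, smul_smul,
                    ← pow_succ, mul_assoc]
  let C := Subalgebra.toSubmodule (Subalgebra.centralizer L {x})
  have hC : ∀ c, c ∈ C ↔ x * c = c * x := fun c => by
    change c ∈ Subalgebra.centralizer L {x} ↔ _
    rw [Subalgebra.mem_centralizer_iff]; simp
  have hdim : Module.finrank L C ≤ p := by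
    let T : Module.End L B := (LinearMap.mulRight L x).comp (LinearMap.mulLeft L x⁻¹)
    have hT : ∀ y, T y = x⁻¹ * y * x := fun y => rfl
    let g : (Fin p → C) →ₗ[L] B := ∑ i : Fin p,
      (LinearMap.mulRight L (y ^ (i : ℕ))).comp (C.subtype.comp (LinearMap.proj i))
    have hg : ∀ c, g c = ∑ i : Fin p, (c i : B) * y ^ (i : ℕ) := fun c => by
      simp [g, LinearMap.sum_apply]
    have hgi : Function.Injective g := by
      rw [injective_iff_map_eq_zero]
      intro c hc
      rw [hg] at hc
      ext i
      have := Module.End.eq_zero_of_sum_eigenvectors T hinj (w := fun i => (c i : B) * y ^ (i : ℕ)) (fun i => by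
        rw [hT, mul_assoc, mul_assoc, hxy, mul_smul_comm, ← mul_assoc _ x, ← (hC _).1 (c i).2, mul_smul_comm,
          mul_assoc, inv_mul_cancel_left₀ hx0]) hc i
      exact (mul_eq_zero.1 this).resolve_right (pow_ne_zero _ hy0)
    have := LinearMap.finrank_le_finrank_of_injective hgi
    rw [hB, Module.finrank_pi_fintype] at this
    simp only [Finset.sum_const, Finset.card_univ, Fintype.card_fin, smul_eq_mul] at this
    exact Nat.le_of_mul_le_mul_left this hp.pos
  let u : Fin p → C := fun i => ⟨x ^ (i : ℕ), (hC _).2 (by rw [← pow_succ, ← pow_succ'])⟩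
  let S : Module.End L B := (LinearMap.mulRight L y⁻¹).comp (LinearMap.mulLeft L y)
  have hSu : ∀ i : Fin p, S (u i) = ζ ^ (i : ℕ) • (u i : B) := fun i => by
    change y * x ^ (i : ℕ) * y⁻¹ = ζ ^ (i : ℕ) • (x ^ (i : ℕ))
    rw [hyx, smul_mul_assoc, mul_assoc, mul_inv_cancel₀ hy0, mul_one]
  have huLI : LinearIndependent L u := by
    refine LinearIndependent.of_comp C.subtype ?_
    refine Module.End.eigenvectors_linearIndependent' S _ hinj _ fun i => ?_
    exact ⟨Module.End.mem_eigenspace_iff.2 (hSu i), pow_ne_zero _ hx0⟩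
  have := NeZero.of_pos hp.pos
  have hspan := huLI.span_eq_top_of_card_eq_finrank'
    (le_antisymm huLI.fintype_card_le_finrank (by simpa using hdim))
  have hmem : (⟨y ^ p, (hC _).2 (by rw [hxy, hζ.pow_eq_one, one_smul])⟩ : C) ∈ Submodule.span L (Set.range u) :=
    hspan ▸ trivial
  obtain ⟨c, hc⟩ := (Submodule.mem_span_range_iff_exists_fun L).1 hmem
  have hc := congrArg C.subtype hc
  simp only [map_sum, map_smul, Submodule.subtype_apply] at hc
  have h1 : ∀ i : Fin p, i ≠ 0 → c i = 0 := by
    intro i hi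
    have h2 : ∑ i : Fin p, ((ζ ^ (i : ℕ) - 1) * c i) • (u i : B) = 0 := by
      have : S (y ^ p) = y ^ p := by
        change y * y ^ p * y⁻¹ = _
        rw [← pow_succ', pow_succ, mul_assoc, mul_inv_cancel₀ hy0, mul_one]
      rw [← hc, map_sum, ← sub_eq_zero, ← Finset.sum_sub_distrib] at this
      rw [← this]
      refine Finset.sum_congr rfl fun i _ => ?_
      rw [map_smul, hSu, smul_smul, sub_mul, sub_smul, one_mul, mul_comm]
    have h3 := Fintype.linearIndependent_iff.1 (huLI.map' C.subtype (Submodule.ker_subtype _)) _ h2 i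
    refine (mul_eq_zero.1 h3).resolve_left (sub_ne_zero.2 fun h4 => hi ?_)
    exact hinj (by simpa using h4)
  refine ⟨c 0, hc.symm.trans ?_⟩
  rw [Finset.sum_eq_single 0 (fun i _ hi => by rw [h1 i hi, zero_smul]) (by simp)]
  simp [u, Algebra.smul_def]


theorem hasRep_or_not_normP.{u} {K : Type*} [Field K] {D : Type*} [DivisionRing D] [Algebra K D]
    [Algebra.IsCentral K D] [FiniteDimensional K D] {L L₁ : Type*} [Field L] (i : K →+* L) [Field L₁]
    [Algebra L L₁] {n p : ℕ} (hn : Module.finrank K D = n * n)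
    (hp : p.Prime) {ζ : L} (hζ : IsPrimitiveRoot ζ p) (hL : Module.finrank L L₁ = p)
    {ξ : L₁} {b : L} (hξ : ξ ^ p = algebraMap L L₁ b) (hξ' : ∀ c, ξ ≠ algebraMap L L₁ c)
    (h : HasRep ((algebraMap L L₁).comp i) D n) :
    HasRep i D n ∨ ∃ ζ' a : L, IsPrimitiveRoot ζ' p ∧ a ≠ 0 ∧ ¬ NormP p ζ' b a ∧
      ∀ (E : Type u) [Field E] (j : L →+* E), HasRep (j.comp i) D n → NormP p (j ζ') (j b) (j a) := by
  let _ := i.toAlgebra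
  have : FiniteDimensional L L₁ := Module.finite_of_finrank_pos (hL ▸ hp.pos)
  obtain ⟨r, m, B, _, _, hr, hm, rfl, hB, hBm, hcen, ⟨e⟩⟩ := exists_wedderburn L hn
  have key : ∀ {E : Type u} [Field E] (j : L →+* E), HasRep (j.comp i) D (r * m) → HasRep j B m := by
    intro E _ j hE
    obtain ⟨N', hN', h'⟩ := (hasRep_iff_of_algEquiv hr e j _).1 (hasRep_tensor_iff _ |>.2 hE)
    rwa [Nat.eq_of_mul_eq_mul_right hr ((mul_comm m r).trans hN')]
  have hBL : HasRep (algebraMap L L₁) B m := by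
    obtain ⟨N', hN', h'⟩ := (hasRep_iff_of_algEquiv hr e (algebraMap L L₁) _).1 (hasRep_tensor_iff _ |>.2 h)
    rwa [Nat.eq_of_mul_eq_mul_right hr ((mul_comm m r).trans hN')]
  have hmp : m ∣ p := by
    have := hBL.restrict (E₀ := L) (i₀ := RingHom.id L) rfl
    rw [hasRep_self_iff, hBm, hL] at this
    exact Nat.dvd_of_mul_dvd_mul_right hm this
  rcases (Nat.dvd_prime hp).1 hmp with rfl | rfl
  · left
    exact (hasRep_tensor_iff (RingHom.id L)).1 ((hasRep_iff_of_algEquiv hr e _ _).2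
      ⟨1, by ring, (hasRep_self_iff 1).2 (by simp [hBm])⟩)
  · right
    obtain ⟨x, hx, hxL⟩ := exists_pth_root hp hBm hL hBL hξ hξ'
    obtain ⟨y₀, hy₀⟩ : ∃ y₀, y₀ * x ≠ x * y₀ := by
      by_contra! hcon
      obtain ⟨c, hc⟩ := Algebra.IsCentral.out (Subalgebra.mem_center_iff (R := L).2 hcon)
      exact hxL c hc.symm
    obtain ⟨ζ', y, hζ', hy0, hyx⟩ := exists_eigenvector hp hζ hx hy₀
    have hx0 : x ≠ 0 := by rintro rfl; simp at hy₀
    obtain ⟨a, ha⟩ := exists_algebraMap_eq_pow hp hBm hζ' hx hx0 hy0 hyx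
    refine ⟨ζ', a, hζ', ?_, not_normP hp.one_lt hζ' hyx hx ha hx0 hy0, ?_⟩
    · rintro rfl
      exact pow_ne_zero _ hy0 (ha.trans (map_zero _))
    · intro E _ j hE
      obtain ⟨f, hf⟩ := (key j hE).exists_end
      have hf' : ∀ c, f (algebraMap L B c) = algebraMap E _ (j c) := fun c => by
        exact LinearMap.ext fun v => hf c v
      have hb : b ≠ 0 := by
        rintro rfl
        exact pow_ne_zero _ hx0 (hx.trans (map_zero _))
      refine normP_of_matrices hp (hζ'.map_of_injective j.injective) (by simpa using hb) (V := Fin m → E) (by simp)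
        (x := f x) (y := f y) ?_ (by rw [← map_pow, hx, hf']) (by rw [← map_pow, ha, hf'])
      rw [← map_mul, hyx, Algebra.smul_def, map_mul, map_mul, hf', Algebra.smul_def]

end SymbolPresentation


section EigenvalueSplit

open Polynomial

theorem natDegree_minpoly_le {K D : Type*} [Field K] [DivisionRing D] [Algebra K D]
    [Algebra.IsCentral K D] [FiniteDimensional K D] {n : ℕ} (hn : Module.finrank K D = n * n) (d : D) :
    (minpoly K d).natDegree ≤ n := by
  have hint := Algebra.IsIntegral.isIntegral (R := K) d
  have hfact : Fact (Irreducible (minpoly K d)) := ⟨minpoly.irreducible hint⟩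
  obtain ⟨N, hN, h⟩ := hasRep_adjoinRoot_minpoly (E := K) d
  obtain ⟨c, rfl⟩ : n ∣ N := dvd_of_hasRep hn h
  have h0 : 0 < Module.finrank K D := Module.finrank_pos
  rw [hn] at hN h0
  have hn0 : 0 < n := Nat.pos_of_mul_pos_left h0
  have h1 : n = (minpoly K d).natDegree * c := Nat.eq_of_mul_eq_mul_left hn0 (by rw [hN]; ring)
  have hc : 0 < c := Nat.pos_of_ne_zero fun h => by rw [h, mul_zero] at h1; omega
  calc _ ≤ (minpoly K d).natDegree * c := Nat.le_mul_of_pos_right _ hc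
    _ = n := h1.symm

/-- A central simple algebra of degree `n` splits as soon as it contains an element with `n` distinct
eigenvalues in the ground field. -/
theorem hasRep_of_eigenvalues {K D : Type*} [Field K] [DivisionRing D] [Algebra K D]
    [Algebra.IsCentral K D] [FiniteDimensional K D] {n : ℕ} (hn : Module.finrank K D = n * n) (d : D)
    {F : Type*} [Field F] (i : K →+* F) (α : Fin n → F) (hα : Function.Injective α)
    (hroot : ∀ k, (minpoly K d).eval₂ i (α k) = 0) : HasRep i D n := by
  let _ := i.toAlgebra
  let A := F ⊗[K] D
  let x : A := 1 ⊗ₜ d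
  let T : Module.End F A := LinearMap.mulRight F x
  let f := (minpoly K d).map i
  have hn0 : 0 < n := by
    have h0 : 0 < Module.finrank K D := Module.finrank_pos
    rw [hn] at h0
    exact Nat.pos_of_mul_pos_left h0
  have hint := Algebra.IsIntegral.isIntegral (R := K) d
  have hfx : aeval x f = 0 := by
    have : aeval x f = Algebra.TensorProduct.includeRight (aeval d (minpoly K d)) := by
      rw [← aeval_algHom_apply]
      exact aeval_map_algebraMap F _ (minpoly K d)
    rw [this, minpoly.aeval, map_zero]
  have hLI : LinearIndependent F fun j : Fin (minpoly K d).natDegree => x ^ (j : ℕ) := by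
    have := Module.Flat.linearIndependent_one_tmul (S := F) (linearIndependent_pow (K := K) d)
    convert this using 2 with j
    rw [Algebra.TensorProduct.tmul_pow, one_pow]
  have hf0 : f ≠ 0 := ((minpoly.monic hint).map i).ne_zero
  have hne : ∀ k, ∃ y : A, y ≠ 0 ∧ y * x = α k • y := by
    intro k
    obtain ⟨g, hg⟩ := dvd_iff_isRoot.2 (show IsRoot f (α k) by
      rw [IsRoot.def, eval_map, hroot])
    have hg0 : g ≠ 0 := by
      rintro rfl
      rw [mul_zero] at hg
      exact hf0 hg
    refine ⟨aeval x g, fun h0 => hg0 ?_, ?_⟩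
    · have hlt : g.natDegree < (minpoly K d).natDegree := by
        have := congrArg natDegree hg
        rw [natDegree_mul (X_sub_C_ne_zero _) hg0, natDegree_X_sub_C, natDegree_map] at this
        omega
      rw [aeval_eq_sum_range' hlt x, Finset.sum_range] at h0
      have h2 := Fintype.linearIndependent_iff.1 hLI _ h0
      ext j
      by_cases hj : j < (minpoly K d).natDegree
      · exact h2 ⟨j, hj⟩
      · exact coeff_eq_zero_of_natDegree_lt (by omega)
    · have := congrArg (aeval x) hg
      rw [hfx, mul_comm, map_mul, map_sub, aeval_X, aeval_C, mul_sub, eq_comm, sub_eq_zero] at this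
      rw [this, ← Algebra.commutes, Algebra.smul_def]
  let V : Fin n → Submodule F A := fun k => LinearMap.ker (T - algebraMap F _ (α k))
  have hV : ∀ k y, y ∈ V k ↔ y * x = α k • y := fun k y => by
    simp [V, T, sub_eq_zero]
  obtain ⟨k, hk⟩ : ∃ k, Module.finrank F (V k) ≤ n := by
    by_contra! hcon
    let g : (∀ k, V k) →ₗ[F] A := ∑ k, (V k).subtype.comp (LinearMap.proj k)
    have hg : ∀ c, g c = ∑ k, (c k : A) := fun c => by simp [g, LinearMap.sum_apply]
    have hgi : Function.Injective g := by
      rw [injective_iff_map_eq_zero]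
      intro c hc
      rw [hg] at hc
      ext k
      exact Module.End.eq_zero_of_sum_eigenvectors T hα (w := fun k => (c k : A)) (fun k => (hV k _).1 (c k).2) hc k
    have := LinearMap.finrank_le_finrank_of_injective hgi
    rw [Module.finrank_baseChange, hn, Module.finrank_pi_fintype] at this
    have h2 := Finset.sum_lt_sum_of_nonempty (s := (Finset.univ : Finset (Fin n))) ⟨⟨0, hn0⟩, by simp⟩ fun k _ => hcon k
    simp at h2
    omega
  have hrep : HasRep (RingHom.id F) A (Module.finrank F (V k)) := by
    refine HasRep.of_end (V := V k) rfl
      ({ toFun := fun b => (LinearMap.mulLeft F b).restrict (p := V k) (q := V k) (fun y hy => by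
          rw [hV] at hy ⊢
          rw [LinearMap.mulLeft_apply, mul_assoc, hy, mul_smul_comm])
         map_one' := by ext; simp
         map_mul' := fun a b => by ext; simp [mul_assoc]
         map_zero' := by ext; simp
         map_add' := fun a b => by ext; simp [add_mul] } : A →+* Module.End F (V k)) ?_
    intro a v
    ext
    simp [Algebra.smul_def]
  have hrep' := (hasRep_tensor_iff _).1 hrep
  have hdvd := dvd_of_hasRep hn hrep'
  obtain ⟨y, hy0, hy⟩ := hne k
  have : Nontrivial (V k) := ⟨⟨⟨y, (hV k y).2 hy⟩, 0, fun h => hy0 (congrArg Subtype.val h)⟩⟩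
  have := Nat.le_of_dvd (Module.finrank_pos (R := F) (M := V k)) hdvd
  rw [le_antisymm hk this] at hrep'
  exact hrep'

end EigenvalueSplit

/-- `[B : f A] = x * |ker f|` with both numbers finite. -/
def HasQ {A B : Type*} [CommGroup A] [CommGroup B] (f : A →* B) (x : ℚ) : Prop :=
  f.range.index ≠ 0 ∧ Finite f.ker ∧ (f.range.index : ℚ) = x * Nat.card f.ker

namespace HasQ

variable {A B C : Type*} [CommGroup A] [CommGroup B] [CommGroup C]

theorem card_ker_ne_zero {f : A →* B} {x : ℚ} (h : HasQ f x) : (Nat.card f.ker : ℚ) ≠ 0 := by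
  have := h.2.1
  exact_mod_cast Nat.card_pos.ne'

theorem eq_div {f : A →* B} {x : ℚ} (h : HasQ f x) :
    x = f.range.index / Nat.card f.ker := by
  rw [eq_div_iff h.card_ker_ne_zero, h.2.2]

theorem unique {f : A →* B} {x y : ℚ} (h : HasQ f x) (h' : HasQ f y) : x = y := by
  rw [h.eq_div, h'.eq_div]

theorem pos {f : A →* B} {x : ℚ} (h : HasQ f x) : 0 < x := by
  rw [h.eq_div]
  have := h.2.1
  have h1 := Nat.pos_of_ne_zero h.1
  have h2 : 0 < Nat.card f.ker := Nat.card_pos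
  positivity

theorem mk' {f : A →* B} (h1 : f.range.index ≠ 0) (h2 : Finite f.ker) :
    HasQ f (f.range.index / Nat.card f.ker) := by
  refine ⟨h1, h2, ?_⟩
  have : (Nat.card f.ker : ℚ) ≠ 0 := by exact_mod_cast Nat.card_pos.ne'
  field_simp

theorem card_comap (g : A →* B) (H : Subgroup B) :
    Nat.card (H.comap g) = Nat.card g.ker * Nat.card (g.range ⊓ H : Subgroup B) := by
  have h1 := Subgroup.relIndex_ker (K := H.comap g) g
  have h2 : g.ker ≤ H.comap g := fun x hx => by
    rw [Subgroup.mem_comap, (MonoidHom.mem_ker).1 hx]; exact H.one_mem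
  have h3 := Subgroup.relIndex_mul_relIndex ⊥ g.ker (H.comap g) bot_le h2
  rw [Subgroup.relIndex_bot_left, Subgroup.relIndex_bot_left, h1, Subgroup.map_comap_eq] at h3
  exact h3.symm

theorem comp {g : A →* B} {f : B →* C} {x y : ℚ} (hf : HasQ f x) (hg : HasQ g y) :
    HasQ (f.comp g) (x * y) := by
  have h1 : (f.comp g).range.index = (g.range ⊔ f.ker).index * f.range.index := by
    rw [MonoidHom.range_comp, Subgroup.index_map]
  have h2 : g.range.relIndex (g.range ⊔ f.ker) * (g.range ⊔ f.ker).index = g.range.index :=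
    Subgroup.relIndex_mul_index le_sup_left
  rw [Subgroup.relIndex_sup_left] at h2
  have h3 : Nat.card (f.comp g).ker = Nat.card g.ker * Nat.card (g.range ⊓ f.ker : Subgroup B) := by
    rw [← card_comap, MonoidHom.comap_ker]
  have h4 := Subgroup.relIndex_mul_relIndex ⊥ (g.range ⊓ f.ker) f.ker bot_le inf_le_right
  rw [Subgroup.relIndex_bot_left, Subgroup.relIndex_bot_left, Subgroup.inf_relIndex_right] at h4
  have hgi := hg.1
  have := hg.2.1
  have := hf.2.1
  have hne : Nat.card f.ker ≠ 0 := Nat.card_pos.ne'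
  have hne' : Nat.card g.ker ≠ 0 := Nat.card_pos.ne'
  rw [← h2] at hgi
  have h5 := left_ne_zero_of_mul hgi
  have h6 := right_ne_zero_of_mul hgi
  have h7 : Nat.card (g.range ⊓ f.ker : Subgroup B) ≠ 0 := by
    intro h; rw [h, zero_mul] at h4; exact hne h4.symm
  refine ⟨by rw [h1]; exact mul_ne_zero h6 hf.1, ?_, ?_⟩
  · apply Nat.finite_of_card_ne_zero
    rw [h3]; exact mul_ne_zero hne' h7
  · rw [hf.eq_div, hg.eq_div, h1, h3, ← h2, ← h4]
    have : (Nat.card g.ker : ℚ) ≠ 0 := by exact_mod_cast hne'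
    have : (Nat.card (g.range ⊓ f.ker : Subgroup B) : ℚ) ≠ 0 := by exact_mod_cast h7
    have : ((g.range.relIndex f.ker : ℕ) : ℚ) ≠ 0 := by exact_mod_cast h5
    push_cast
    field_simp

theorem of_bijective {f : A →* B} (hf : Function.Bijective f) : HasQ f 1 := by
  have h1 : f.range = ⊤ := MonoidHom.range_eq_top.2 hf.2
  have h2 : f.ker = ⊥ := (MonoidHom.ker_eq_bot_iff f).2 hf.1
  refine ⟨by simp [h1], by rw [h2]; infer_instance, by simp [h1, h2]⟩

/-- Restriction to the kernel and quotient: the power map on a short exact sequence. -/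
theorem pow_ses_identities (p : ℕ) (π : A →* C) (hπ : Function.Surjective π) :
    ∃ j k : ℕ, (powMonoidHom p : A →* A).range.index = (powMonoidHom p : C →* C).range.index * k ∧
      (powMonoidHom p : π.ker →* π.ker).range.index = k * j ∧
      Nat.card (powMonoidHom p : C →* C).ker * Nat.card (powMonoidHom p : π.ker →* π.ker).ker =
        Nat.card (powMonoidHom p : A →* A).ker * j := by
  set P : Subgroup A := (powMonoidHom p : A →* A).range with hP
  set P' : Subgroup A := π.ker.map (powMonoidHom p) with hP'
  have hP'P : P' ≤ P ⊓ π.ker := by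
    rintro _ ⟨x, hx, rfl⟩
    refine ⟨⟨x, rfl⟩, ?_⟩
    simp only [SetLike.mem_coe, MonoidHom.mem_ker] at hx
    simp [hx]
  have hPm : (powMonoidHom p : π.ker →* π.ker).range.map π.ker.subtype = P' := by
    ext x; constructor
    · rintro ⟨_, ⟨y, rfl⟩, rfl⟩; exact ⟨y, y.2, rfl⟩
    · rintro ⟨y, hy, rfl⟩; exact ⟨_, ⟨⟨y, hy⟩, rfl⟩, rfl⟩
  refine ⟨P'.relIndex (P ⊓ π.ker), P.relIndex π.ker, ?_, ?_, ?_⟩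
  · have h1 : (powMonoidHom p : C →* C).range = P.map π := by
      ext x; constructor
      · rintro ⟨y, rfl⟩
        obtain ⟨z, rfl⟩ := hπ y
        exact ⟨z ^ p, ⟨z, rfl⟩, by simp⟩
      · rintro ⟨_, ⟨z, rfl⟩, rfl⟩; exact ⟨π z, by simp⟩
    have h2 : P.relIndex (P ⊔ π.ker) * (P ⊔ π.ker).index = P.index :=
      Subgroup.relIndex_mul_index le_sup_left
    rw [Subgroup.relIndex_sup_left] at h2
    rw [h1, Subgroup.index_map, MonoidHom.range_eq_top.2 hπ, Subgroup.index_top, mul_one,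
      ← h2, mul_comm]
  · have h1 : (powMonoidHom p : π.ker →* π.ker).range.index = P'.relIndex π.ker := by
      rw [Subgroup.relIndex, ← hPm, Subgroup.subgroupOf,
        Subgroup.comap_map_eq_self_of_injective π.ker.subtype_injective]
    have h2 := Subgroup.relIndex_mul_relIndex P' (P ⊓ π.ker) π.ker hP'P inf_le_right
    rw [h1, ← h2, Subgroup.inf_relIndex_right, mul_comm]
  · -- X = {a : a ^ p ∈ ker}
    set X : Subgroup A := π.ker.comap (powMonoidHom p) with hX
    have hX1 : Nat.card X = Nat.card (powMonoidHom p : A →* A).ker * Nat.card (P ⊓ π.ker : Subgroup A) :=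
      card_comap _ _
    have hX2 : X = (powMonoidHom p : C →* C).ker.comap π := by
      ext x; simp [hX, MonoidHom.mem_ker]
    set T : Subgroup A := (powMonoidHom p : A →* A).ker with hT
    have hTX : T ≤ X := by
      intro x hx
      have : x ^ p = 1 := by simpa [hT, MonoidHom.mem_ker] using hx
      simp [hX, this]
    have hKX : π.ker ≤ X := by
      intro x hx
      have : π x = 1 := hx
      simp [hX, MonoidHom.mem_ker, this]
    -- C[p] has order [X : ker]
    have e1 : Nat.card (powMonoidHom p : C →* C).ker = π.ker.relIndex X := by
      rw [Subgroup.relIndex_ker, hX2, Subgroup.map_comap_eq_self_of_surjective hπ]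
    have e2 : π.ker.relIndex X = π.ker.relIndex (π.ker ⊔ T) * (π.ker ⊔ T).relIndex X :=
      (Subgroup.relIndex_mul_relIndex _ _ _ le_sup_left (sup_le hKX hTX)).symm
    have e3 : (π.ker ⊔ T).relIndex X = P'.relIndex (P ⊓ π.ker) := by
      have : (π.ker ⊔ T) = P'.comap (powMonoidHom p) := by
        rw [hP', Subgroup.comap_map_eq]
      rw [this, Subgroup.relIndex_comap, hX, Subgroup.map_comap_eq]
    have e4 : π.ker.relIndex (π.ker ⊔ T) = π.ker.relIndex T := Subgroup.relIndex_sup_left _ _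
    have e5 : Nat.card (powMonoidHom p : π.ker →* π.ker).ker = Nat.card (π.ker ⊓ T : Subgroup A) := by
      have : (powMonoidHom p : π.ker →* π.ker).ker = T.subgroupOf π.ker := by
        ext x
        simp only [MonoidHom.mem_ker, Subgroup.mem_subgroupOf, hT, powMonoidHom_apply]
        rw [← Subgroup.coe_pow, OneMemClass.coe_eq_one]
      rw [this, inf_comm, ← Subgroup.subgroupOf_map_subtype]
      exact (Nat.card_congr ((T.subgroupOf π.ker).equivMapOfInjective _
        π.ker.subtype_injective).toEquiv)
    have e6 := Subgroup.relIndex_mul_relIndex ⊥ (π.ker ⊓ T) T bot_le inf_le_right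
    rw [Subgroup.relIndex_bot_left, Subgroup.relIndex_bot_left, Subgroup.inf_relIndex_right] at e6
    rw [e1, e2, e3, e4, e5, ← e6]
    ring

abbrev pow (p : ℕ) (A : Type*) [CommGroup A] (x : ℚ) : Prop := HasQ (powMonoidHom p : A →* A) x

theorem pow_of_ses {p : ℕ} (π : A →* C) (hπ : Function.Surjective π) {x y : ℚ}
    (hk : HasQ.pow p π.ker x) (hC : HasQ.pow p C y) : HasQ.pow p A (x * y) := by
  obtain ⟨j, k, h1, h2, h3⟩ := pow_ses_identities p π hπ
  have hki := hk.1
  have := hk.2.1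
  have := hC.2.1
  have hne : Nat.card (powMonoidHom p : π.ker →* π.ker).ker ≠ 0 := Nat.card_pos.ne'
  have hne' : Nat.card (powMonoidHom p : C →* C).ker ≠ 0 := Nat.card_pos.ne'
  rw [h2] at hki
  have hj := right_ne_zero_of_mul hki
  have hk0 := left_ne_zero_of_mul hki
  have h4 : Nat.card (powMonoidHom p : A →* A).ker ≠ 0 := by
    intro h; rw [h, zero_mul] at h3; exact mul_ne_zero hne' hne h3
  refine ⟨by rw [h1]; exact mul_ne_zero hC.1 hk0, Nat.finite_of_card_ne_zero h4, ?_⟩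
  rw [hk.eq_div, hC.eq_div, h1, h2]
  have a1 : (Nat.card (powMonoidHom p : π.ker →* π.ker).ker : ℚ) ≠ 0 := by exact_mod_cast hne
  have a2 : (Nat.card (powMonoidHom p : C →* C).ker : ℚ) ≠ 0 := by exact_mod_cast hne'
  have h3' : (Nat.card (powMonoidHom p : C →* C).ker : ℚ) *
    Nat.card (powMonoidHom p : π.ker →* π.ker).ker = Nat.card (powMonoidHom p : A →* A).ker * j := by
    exact_mod_cast h3
  push_cast
  rw [div_mul_div_comm, div_mul_eq_mul_div, eq_div_iff (mul_ne_zero a1 a2)]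
  linear_combination (((powMonoidHom p : C →* C).range.index : ℚ) * k) * h3'

theorem pow_quotient {p : ℕ} (π : A →* C) (hπ : Function.Surjective π) {x y : ℚ}
    (hk : HasQ.pow p π.ker x) (hA : HasQ.pow p A y) : HasQ.pow p C (y / x) := by
  obtain ⟨j, k, h1, h2, h3⟩ := pow_ses_identities p π hπ
  have hki := hk.1
  have := hk.2.1
  have := hA.2.1
  have hne : Nat.card (powMonoidHom p : A →* A).ker ≠ 0 := Nat.card_pos.ne'
  rw [h2] at hki
  have hj := right_ne_zero_of_mul hki
  have h5 : Nat.card (powMonoidHom p : C →* C).ker ≠ 0 := by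
    intro h; rw [h, zero_mul] at h3; exact mul_ne_zero hne hj h3.symm
  have h6 : (powMonoidHom p : C →* C).range.index ≠ 0 := by
    intro h; apply hA.1; rw [h1, h, zero_mul]
  have hC := HasQ.mk' h6 (Nat.finite_of_card_ne_zero h5)
  have := (pow_of_ses π hπ hk hC).unique hA
  rw [← this, mul_comm, mul_div_assoc, div_self hk.pos.ne', mul_one]
  exact hC

theorem pow_finite (p : ℕ) [Finite A] : HasQ.pow p A 1 := by
  refine ⟨Subgroup.index_ne_zero_of_finite, inferInstance, ?_⟩
  have h1 := (powMonoidHom p : A →* A).range.card_mul_index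
  have h2 := (powMonoidHom p : A →* A).ker.card_mul_index
  rw [Subgroup.index_ker] at h2
  have h3 : Nat.card (powMonoidHom p : A →* A).range ≠ 0 := Nat.card_pos.ne'
  rw [one_mul]
  norm_cast
  apply Nat.eq_of_mul_eq_mul_left (Nat.pos_of_ne_zero h3)
  rw [h1, ← h2, mul_comm]

theorem pow_congr {p : ℕ} (e : A ≃* B) {x : ℚ} (h : HasQ.pow p A x) : HasQ.pow p B x := by
  have h1 := (HasQ.comp (g := e.symm.toMonoidHom) h (of_bijective e.symm.bijective))
  have h2 := HasQ.comp (f := e.toMonoidHom) (of_bijective e.bijective) h1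
  simp only [mul_one, one_mul] at h2
  convert h2
  ext b
  simp

theorem pow_of_finiteIndex {p : ℕ} (H : Subgroup A) (hH : H.index ≠ 0) {x : ℚ}
    (h : HasQ.pow p H x) : HasQ.pow p A x := by
  have hf : Finite (A ⧸ H) := Subgroup.index_ne_zero_iff_finite.1 hH
  have h' : HasQ.pow p (QuotientGroup.mk' H).ker x :=
    pow_congr (MulEquiv.subgroupCongr (QuotientGroup.ker_mk' H).symm) h
  simpa using pow_of_ses (QuotientGroup.mk' H) (QuotientGroup.mk'_surjective H) h' (pow_finite p)

theorem pow_finiteIndex_sub {p : ℕ} (H : Subgroup A) (hH : H.index ≠ 0) {x : ℚ}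
    (h : HasQ.pow p A x) : HasQ.pow p H x := by
  have hfin := h.2.1
  have h1 : Finite (powMonoidHom p : H →* H).ker := by
    refine Finite.of_injective (β := (powMonoidHom p : A →* A).ker)
      (fun y => ⟨y.1, ?_⟩) ?_
    · have := y.2
      rw [MonoidHom.mem_ker] at this ⊢
      simpa using congrArg Subtype.val this
    · intro y z hyz
      exact Subtype.ext (Subtype.ext (by simpa using congrArg Subtype.val hyz))
  have h2 : (powMonoidHom p : H →* H).range.index ≠ 0 := by
    set P' : Subgroup A := H.map (powMonoidHom p) with hP'
    have hP'i : P'.index ≠ 0 := by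
      rw [hP', Subgroup.index_map]
      refine mul_ne_zero ?_ h.1
      intro h0
      have := Subgroup.index_dvd_of_le (le_sup_left : H ≤ H ⊔ (powMonoidHom p : A →* A).ker)
      rw [h0, zero_dvd_iff] at this
      exact hH this
    have e : (powMonoidHom p : H →* H).range = P'.subgroupOf H := by
      ext ⟨x, hx⟩
      simp only [MonoidHom.mem_range, Subgroup.mem_subgroupOf, hP', Subgroup.mem_map]
      constructor
      · rintro ⟨y, hy⟩; exact ⟨y, y.2, by simpa using congrArg Subtype.val hy⟩
      · rintro ⟨y, hy, hyx⟩; exact ⟨⟨y, hy⟩, Subtype.ext hyx⟩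
    rw [e]
    intro h0
    exact hP'i (Subgroup.index_eq_zero_of_relIndex_eq_zero h0)
  have h3 := HasQ.mk' h2 h1
  rw [← (pow_of_finiteIndex H hH h3).unique h]
  exact h3

end HasQ

section GeomSumUnit

open Polynomial

theorem prod_one_sub_pow_of_geom_sum_eq_zero {E : Type*} [Ring E] (p : ℕ) (hp : p.Prime) (s : E)
    (hs : ∑ i ∈ Finset.range p, s ^ i = 0) :
    ∃ P : Polynomial ℤ, P = ∏ i ∈ Finset.range (p - 1), (1 - (X : ℤ[X]) ^ (i + 1)) ∧
      aeval s P = (p : E) := by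
  refine ⟨_, rfl, ?_⟩
  have : Fact p.Prime := ⟨hp⟩
  set P : ℤ[X] := ∏ i ∈ Finset.range (p - 1), (1 - (X : ℤ[X]) ^ (i + 1)) - C (p : ℤ) with hP
  have hζ := Complex.isPrimitiveRoot_exp p hp.ne_zero
  set ζ := Complex.exp (2 * Real.pi * Complex.I / p)
  have h1 : aeval ζ P = 0 := by
    obtain ⟨n, rfl⟩ : ∃ n, p = n + 1 := ⟨p - 1, by have := hp.pos; omega⟩
    rw [hP]
    simp only [map_sub, map_prod, map_one, map_pow, aeval_X, aeval_C, Nat.add_sub_cancel]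
    rw [hζ.prod_one_sub_pow_eq_order]
    simp
  have h2 : cyclotomic p ℤ ∣ P := by
    rw [cyclotomic_eq_minpoly hζ hp.pos]
    exact minpoly.isIntegrallyClosed_dvd (hζ.isIntegral hp.pos) h1
  have h3 : aeval s (cyclotomic p ℤ) = 0 := by
    rw [cyclotomic_prime]; simpa using hs
  obtain ⟨Q, hQ⟩ := h2
  have h4 : aeval s P = 0 := by rw [hQ, map_mul, h3, zero_mul]
  rw [hP, map_sub, sub_eq_zero] at h4
  rw [h4]; simp

theorem geom_sum_unit {E : Type*} [Ring E] (p : ℕ) (hp : p.Prime) (s : E)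
    (hs : ∑ i ∈ Finset.range p, s ^ i = 0) (i : ℕ) (hi : i.Coprime p) :
    IsUnit (∑ t ∈ Finset.range i, s ^ t) := by
  obtain ⟨j, -, hj⟩ := Nat.exists_mul_mod_eq_one_of_coprime hi hp.one_lt
  have hsp : s ^ p = 1 := by
    have := mul_geom_sum s p
    rw [hs, mul_zero] at this
    exact (sub_eq_zero.1 this.symm)
  have hk : ∀ k, ∑ t ∈ Finset.range (1 + p * k), s ^ t = 1 := by
    intro k
    induction k with
    | zero => simp
    | succ k ih =>
      rw [mul_add, ← add_assoc, mul_one, Finset.sum_range_add, ih]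
      simp [pow_add, pow_mul, hsp, ← Finset.mul_sum, hs]
  have hij : ∑ t ∈ Finset.range (i * j), s ^ t = 1 := by
    have : i * j = 1 + p * (i * j / p) := by
      have h := Nat.mod_add_div (i * j) p
      rw [hj] at h
      exact h.symm
    rw [this]; exact hk _
  have hmul : ∀ j, ∑ t ∈ Finset.range (i * j), s ^ t =
      (∑ t ∈ Finset.range i, s ^ t) * ∑ t ∈ Finset.range j, (s ^ i) ^ t := by
    intro j
    induction j with
    | zero => simp
    | succ k ih =>
      rw [mul_add, mul_one, Finset.sum_range_add, ih, Finset.sum_range_succ, mul_add]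
      congr 1
      rw [← pow_mul, Finset.sum_mul]
      exact Finset.sum_congr rfl fun t _ => by rw [← pow_add, add_comm]
  have hc : Commute (∑ t ∈ Finset.range i, s ^ t) (∑ t ∈ Finset.range j, (s ^ i) ^ t) := by
    apply Commute.sum_left; intro a _; apply Commute.sum_right; intro b _
    rw [← pow_mul]; exact Commute.pow_pow_self _ _ _
  rw [hmul] at hij
  exact ⟨⟨_, _, hij, hc.eq ▸ hij⟩, rfl⟩

theorem exists_unit_mul_sub_one_pow {E : Type*} [Ring E] (p : ℕ) (hp : p.Prime) (s : E)
    (hs : ∑ i ∈ Finset.range p, s ^ i = 0) : ∃ u : E, IsUnit u ∧ (p : E) = u * (s - 1) ^ (p - 1) := by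
  obtain ⟨P, hP, h⟩ := prod_one_sub_pow_of_geom_sum_eq_zero p hp s hs
  have key : ∀ n, n < p → ∃ u : E, IsUnit u ∧
      aeval s (∏ i ∈ Finset.range n, (1 - (X : ℤ[X]) ^ (i + 1))) = u * (s - 1) ^ n := by
    intro n
    induction n with
    | zero => intro _; exact ⟨1, isUnit_one, by simp⟩
    | succ n ih =>
      intro hn
      obtain ⟨u, hu, h⟩ := ih (by omega)
      refine ⟨u * -(∑ t ∈ Finset.range (n + 1), s ^ t), hu.mul (IsUnit.neg ?_), ?_⟩
      · apply geom_sum_unit p hp s hs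
        exact ((Nat.Prime.coprime_iff_not_dvd hp).2 fun h => by have := Nat.le_of_dvd (by omega) h; omega).symm
      · rw [Finset.prod_range_succ, map_mul, h]
        simp only [map_sub, map_one, map_pow, aeval_X]
        have h1 := mul_geom_sum s (n + 1)
        have h2 := geom_sum_mul s (n + 1)
        have h3 : Commute (s - 1) (∑ t ∈ Finset.range (n + 1), s ^ t) := h1.trans h2.symm
        rw [mul_assoc, mul_assoc, neg_mul, pow_succ (s - 1) n]
        congr 1
        rw [← mul_assoc, ← (h3.pow_left n).eq, mul_assoc, h2, ← mul_neg, neg_sub]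
  obtain ⟨u, hu, h'⟩ := key (p - 1) (by have := hp.pos; omega)
  exact ⟨u, hu, by rw [← h, hP, h']⟩

end GeomSumUnit

namespace HasQ

theorem pow_end {A : Type*} [CommGroup A] {f : Monoid.End A} {x : ℚ}
    (h : HasQ (B := A) f x) (n : ℕ) : HasQ (B := A) (f ^ n : Monoid.End A) (x ^ n) := by
  induction n with
  | zero => rw [pow_zero, pow_zero]; exact of_bijective (f := MonoidHom.id A) Function.bijective_id
  | succ n ih =>
    rw [pow_succ, pow_succ]
    exact HasQ.comp (f := (f ^ n : Monoid.End A)) (g := f) ih h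

end HasQ

/-- Herbrand quotient computation: if `Ĥ⁻¹` of a cyclic group of prime order `p` vanishes on `M`, then
the order of `Ĥ⁰` is determined by the `p`-power Euler characteristics of `M` and of its invariants. -/
theorem relIndex_norm_of_hasQ {M : Type*} [CommGroup M] {p : ℕ} (hp : p.Prime) (σ N : Monoid.End M)
    (hσ : σ ^ p = 1) (hN : ∀ m, N m = ∏ i ∈ Finset.range p, (σ ^ i) m)
    (MG : Subgroup M) (hMG : ∀ m, m ∈ MG ↔ σ m = m)
    (hY : ∀ y, N y = 1 → ∃ z, σ z / z = y) {x y : ℚ}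
    (hM : HasQ.pow p M x) (hM' : HasQ.pow p MG y) :
    ∃ d : ℚ, 0 < d ∧ d ^ (p - 1) = x / y ∧ ((MonoidHom.range N).relIndex MG : ℚ) * d = y := by
  set Y : Subgroup M := MonoidHom.ker N with hYdef
  have hNσ : ∀ m, N (σ m) = N m := by
    intro m
    rw [hN, hN]
    have h1 : ∀ i, (σ ^ i) (σ m) = (σ ^ (i + 1)) m := fun i => by rw [pow_succ]; rfl
    simp_rw [h1]
    have h2 := Finset.prod_range_succ (fun i => (σ ^ i) m) p
    rw [Finset.prod_range_succ' (fun i => (σ ^ i) m) p] at h2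
    rw [hσ, pow_zero] at h2
    exact mul_right_cancel h2
  have hσN : ∀ m, σ (N m) = N m := by
    intro m
    rw [hN, map_prod]
    have h1 : ∀ i, σ ((σ ^ i) m) = (σ ^ (i + 1)) m := fun i => by rw [pow_succ']; rfl
    simp_rw [h1]
    have h2 := Finset.prod_range_succ (fun i => (σ ^ i) m) p
    rw [Finset.prod_range_succ' (fun i => (σ ^ i) m) p] at h2
    rw [hσ, pow_zero] at h2
    exact mul_right_cancel h2
  have hNMG : ∀ m ∈ MG, N m = m ^ p := by
    intro m hm
    have h1 : ∀ i, (σ ^ i) m = m := by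
      intro i
      induction i with
      | zero => simp
      | succ i ih => rw [pow_succ]; show (σ ^ i) (σ m) = m; rw [(hMG m).1 hm, ih]
    rw [hN]; simp [h1]
  let σ' : M →* M := σ
  set Δ : M →* M := σ' / MonoidHom.id M with hΔ
  have hΔa : ∀ m, Δ m = σ m / m := fun m => rfl
  have hΔr : Δ.range = Y := by
    ext z; constructor
    · rintro ⟨m, rfl⟩
      show N (Δ m) = 1
      rw [hΔa, _root_.map_div, hNσ, div_self']
    · intro hz; obtain ⟨m, hm⟩ := hY z hz; exact ⟨m, hm⟩
  have hΔk : Δ.ker = MG := by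
    ext m; rw [MonoidHom.mem_ker, hΔa, div_eq_one, hMG]
  have hMGN : MonoidHom.range N ≤ MG := by
    rintro _ ⟨m, rfl⟩; exact (hMG _).2 (hσN m)
  -- the power Euler characteristic of `Y`
  have hqY : HasQ.pow p Y (x / y) := by
    have h1 := HasQ.pow_quotient (p := p) (Δ.rangeRestrict) Δ.rangeRestrict_surjective (x := y) (y := x)
      (HasQ.pow_congr (MulEquiv.subgroupCongr (by rw [MonoidHom.ker_rangeRestrict, hΔk])) hM') hM
    exact HasQ.pow_congr (MulEquiv.subgroupCongr hΔr) h1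
  have hσY : ∀ z : Y, σ z ∈ Y := fun z => by
    show N (σ z) = 1
    rw [hNσ]; exact z.2
  have hΔY : ∀ z : Y, Δ z ∈ Y := fun z => by
    have : Δ z ∈ Δ.range := ⟨z, rfl⟩
    rwa [hΔr] at this
  let σY : Monoid.End Y := ((σ : M →* M).comp Y.subtype).codRestrict Y hσY
  let ΔY : Monoid.End Y := (Δ.comp Y.subtype).codRestrict Y hΔY
  let s : AddMonoid.End (Additive Y) := MonoidHom.toAdditive σY
  have hs1 : ∀ (i : ℕ) (z : Y), ((Additive.toMul ((s ^ i) (Additive.ofMul z)) : Y) : M) = (σ ^ i) z := by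
    intro i
    induction i with
    | zero => intro z; rfl
    | succ i ih =>
      intro z
      rw [pow_succ, pow_succ]
      exact ih (σY z)
  have hs0 : ∑ i ∈ Finset.range p, s ^ i = 0 := by
    refine AddMonoidHom.ext fun z => ?_
    have hz : N z.toMul = 1 := (z.toMul).2
    rw [hN] at hz
    have hsum : (∑ i ∈ Finset.range p, s ^ i) z = ∑ i ∈ Finset.range p, (s ^ i) z :=
      map_sum ({ toFun := fun w => w z, map_zero' := rfl, map_add' := fun _ _ => rfl } :
        AddMonoid.End (Additive Y) →+ Additive Y) _ _
    refine hsum.trans ?_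
    apply Additive.toMul.injective
    rw [toMul_sum]
    refine Subtype.ext (?_ : ((∏ i ∈ Finset.range p, ((s ^ i) z).toMul : Y) : M) = 1)
    rw [Subgroup.val_finset_prod, ← hz]
    exact Finset.prod_congr rfl fun i _ => hs1 i z.toMul
  obtain ⟨u, hu, hpu⟩ := exists_unit_mul_sub_one_pow p hp s hs0
  have hs2 : ∀ (i : ℕ) (z : Y), (Additive.toMul (((s - 1) ^ i) (Additive.ofMul z)) : Y) = (ΔY ^ i) z := by
    intro i
    induction i with
    | zero => intro z; rfl
    | succ i ih =>
      intro z
      rw [pow_succ, pow_succ]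
      exact ih (ΔY z)
  let U : Monoid.End Y := AddMonoidHom.toMultiplicative u
  have hU : Function.Bijective U := by
    obtain ⟨v, rfl⟩ := hu
    refine Function.bijective_iff_has_inverse.2 ⟨(AddMonoidHom.toMultiplicative (v⁻¹).1 : Y →* Y), ?_, ?_⟩
    · intro z; exact congrArg (fun w : AddMonoid.End (Additive Y) => (w (Additive.ofMul z)).toMul) v.inv_mul
    · intro z; exact congrArg (fun w : AddMonoid.End (Additive Y) => (w (Additive.ofMul z)).toMul) v.mul_inv
  have hUp : ∀ z : Y, z ^ p = U ((ΔY ^ (p - 1)) z) := by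
    intro z
    have := congrArg (fun w : AddMonoid.End (Additive Y) => (w (Additive.ofMul z)).toMul) hpu
    rw [← hs2]
    refine Eq.trans ?_ this
    change z ^ p = ((p : AddMonoid.End (Additive Y)) (Additive.ofMul z)).toMul
    rw [AddMonoid.End.natCast_apply]; rfl
  have hUp' : ∀ z : Y, z ^ p = (ΔY ^ (p - 1)) (U z) := by
    have hc : Commute u ((s - 1) ^ (p - 1)) := by
      have h1 : Commute (p : AddMonoid.End (Additive Y)) u := Nat.cast_commute _ _
      obtain ⟨v, rfl⟩ := hu
      have h2 : (v : AddMonoid.End (Additive Y)) * (v * (s - 1) ^ (p - 1)) =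
          v * ((s - 1) ^ (p - 1) * v) := by
        rw [← hpu, ← h1.eq, hpu, mul_assoc]
      exact (Units.mul_right_inj v).1 h2
    intro z
    rw [hUp]
    have := congrArg (fun w : AddMonoid.End (Additive Y) => (w (Additive.ofMul z)).toMul) hc.eq
    rw [← hs2, ← hs2]
    exact this
  -- finiteness of kernel and cokernel of `ΔY`
  obtain ⟨m, hm⟩ : ∃ m, p - 1 = m + 1 := ⟨p - 2, by have := hp.two_le; omega⟩
  have hker : Finite (MonoidHom.ker ΔY) := by
    have := hqY.2.1
    refine Finite.of_injective (β := (powMonoidHom p : Y →* Y).ker) (fun z => ⟨z.1, ?_⟩)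
      fun a b hab => Subtype.ext (by simpa using hab)
    rw [MonoidHom.mem_ker, powMonoidHom_apply, hUp, hm, pow_succ]
    change U ((ΔY ^ m) (ΔY z.1)) = 1
    have hz : ΔY z.1 = 1 := z.2
    rw [hz, map_one, map_one]
  have hrange : (MonoidHom.range ΔY).index ≠ 0 := by
    intro h0
    apply hqY.1
    have : (powMonoidHom p : Y →* Y).range ≤ MonoidHom.range ΔY := by
      rintro _ ⟨z, rfl⟩
      rw [powMonoidHom_apply, hUp', hm, pow_succ']
      exact ⟨_, rfl⟩
    have := Subgroup.index_dvd_of_le this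
    rwa [h0, zero_dvd_iff] at this
  have hd := HasQ.mk' hrange hker
  set d : ℚ := ((MonoidHom.range ΔY).index / Nat.card (MonoidHom.ker ΔY) : ℚ)
  have hdp : d ^ (p - 1) = x / y := by
    have h1 := HasQ.comp (f := (U : Y →* Y)) (HasQ.of_bijective hU) (HasQ.pow_end hd (p - 1))
    rw [one_mul] at h1
    refine h1.unique ?_
    convert hqY using 1
    ext z
    exact congrArg Subtype.val (hUp z).symm
  refine ⟨d, hd.pos, hdp, ?_⟩
  -- index bookkeeping
  have i1 : (powMonoidHom p : MG →* MG).range.index = (MG.map N).relIndex MG := by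
    rw [Subgroup.relIndex]
    congr 1
    ext ⟨z, hz⟩
    simp only [MonoidHom.mem_range, Subgroup.mem_subgroupOf, Subgroup.mem_map]
    constructor
    · rintro ⟨w, hw⟩
      exact ⟨w, w.2, (hNMG _ w.2).trans (congrArg Subtype.val hw)⟩
    · rintro ⟨w, hw, hwz⟩
      exact ⟨⟨w, hw⟩, Subtype.ext ((hNMG _ hw).symm.trans hwz)⟩
  have i2 : (MG.map N).relIndex (MonoidHom.range N) * (MonoidHom.range N).relIndex MG =
      (MG.map N).relIndex MG :=
    Subgroup.relIndex_mul_relIndex _ _ _ (Subgroup.map_le_range _ _) hMGN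
  have i3 : (MG.map N).relIndex (MonoidHom.range N) = (MG ⊔ Y).index := by
    have h := Subgroup.relIndex_map_map (f := (N : M →* M)) MG ⊤
    rw [top_sup_eq, Subgroup.relIndex_top_right] at h
    rw [hYdef, ← h]
    exact congrArg (Subgroup.relIndex _) (MonoidHom.range_eq_map (N : M →* M))
  have i4 : (MonoidHom.range ΔY).index = (MG ⊔ Y).index := by
    have h1 : (MonoidHom.range ΔY).index = (Y.map Δ).relIndex Y := by
      rw [Subgroup.relIndex]
      congr 1
      ext ⟨z, hz⟩
      simp only [MonoidHom.mem_range, Subgroup.mem_subgroupOf, Subgroup.mem_map]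
      constructor
      · rintro ⟨w, hw⟩; exact ⟨w, w.2, congrArg Subtype.val hw⟩
      · rintro ⟨w, hw, hwz⟩; exact ⟨⟨w, hw⟩, Subtype.ext hwz⟩
    rw [h1]
    conv_lhs => rw [← hΔr, MonoidHom.range_eq_map, Subgroup.relIndex_map_map, top_sup_eq,
      Subgroup.relIndex_top_right, ← MonoidHom.range_eq_map, hΔr, hΔk, sup_comm]
  have i5 : Nat.card (powMonoidHom p : MG →* MG).ker = Nat.card (MonoidHom.ker ΔY) := by
    refine Nat.card_congr ⟨fun z => ⟨⟨z.1.1, ?_⟩, ?_⟩, fun z => ⟨⟨z.1.1, ?_⟩, ?_⟩, fun z => rfl, fun z => rfl⟩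
    · have := congrArg Subtype.val ((MonoidHom.mem_ker).1 z.2)
      show N _ = 1
      rw [hNMG _ z.1.2]; exact this
    · apply Subtype.ext; change σ z.1.1 / z.1.1 = 1
      rw [(hMG _).1 z.1.2, div_self']
    · have : σ z.1.1 / z.1.1 = 1 := congrArg Subtype.val ((MonoidHom.mem_ker).1 z.2)
      rw [hMG]; exact div_eq_one.1 this
    · have h1 : σ z.1.1 / z.1.1 = 1 := congrArg Subtype.val ((MonoidHom.mem_ker).1 z.2)
      have h2 : N z.1.1 = 1 := z.1.2
      apply Subtype.ext
      rw [hNMG _ ((hMG _).2 (div_eq_one.1 h1))] at h2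
      exact h2
  have e1 := hM'.2.2
  rw [i1, ← i2, i3, ← i4] at e1
  have e2 := hd.2.2
  have e3 := hd.card_ker_ne_zero
  rw [i5] at e1
  push_cast at e1
  rw [e2] at e1
  apply mul_right_cancel₀ e3
  rw [← e1]; ring

section Hensel

open Polynomial

/-- Hensel's lemma over an adically complete ring, for polynomials which need not be monic. -/
theorem exists_root_of_isAdicComplete {R : Type*} [CommRing R] (I : Ideal R) [IsAdicComplete I R]
    (f : R[X]) (a₀ : R) (h₁ : f.eval a₀ ∈ I) (h₂ : IsUnit (Ideal.Quotient.mk I (f.derivative.eval a₀))) :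
    ∃ a, f.IsRoot a ∧ a - a₀ ∈ I := by
  classical
  let f' := derivative f
  let c : ℕ → R := fun n => Nat.recOn n a₀ fun _ b => b - f.eval b * Ring.inverse (f'.eval b)
  have hc : ∀ n, c (n + 1) = c n - f.eval (c n) * Ring.inverse (f'.eval (c n)) := by
    intro n
    simp only [c]
  have hc_mod : ∀ n, c n ≡ a₀ [SMOD I] := by
    intro n
    induction n with
    | zero => rfl
    | succ n ih => ?_
    rw [hc, sub_eq_add_neg, ← add_zero a₀]
    refine ih.add ?_
    rw [SModEq.zero, Ideal.neg_mem_iff]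
    refine I.mul_mem_right _ ?_
    rw [← SModEq.zero] at h₁ ⊢
    exact (ih.eval f).trans h₁
  have hf'c : ∀ n, IsUnit (f'.eval (c n)) := by
    intro n
    have := isLocalHom_of_le_jacobson_bot I (IsAdicComplete.le_jacobson_bot I)
    apply IsUnit.of_map (Ideal.Quotient.mk I)
    convert! h₂ using 1
    exact SModEq.def.mp ((hc_mod n).eval _)
  have hfcI : ∀ n, f.eval (c n) ∈ I ^ (n + 1) := by
    intro n
    induction n with
    | zero => simpa only [Nat.rec_zero, zero_add, pow_one] using! h₁
    | succ n ih => ?_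
    rw [← taylor_eval_sub (c n), hc, sub_eq_add_neg, sub_eq_add_neg,
      add_neg_cancel_comm]
    rw [eval_eq_sum, sum_over_range' _ _ _ (lt_add_of_pos_right _ zero_lt_two), ←
      Finset.sum_range_add_sum_Ico _ (Nat.le_add_left _ _)]
    swap
    · intro i
      rw [zero_mul]
    refine Ideal.add_mem _ ?_ ?_
    · rw [← one_add_one_eq_two, Finset.sum_range_succ, Finset.range_one, Finset.sum_singleton,
        taylor_coeff_zero, taylor_coeff_one, pow_zero, pow_one, mul_one, mul_neg,
        mul_left_comm, Ring.mul_inverse_cancel _ (hf'c n), mul_one, add_neg_cancel]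
      exact Ideal.zero_mem _
    · refine Submodule.sum_mem _ ?_
      simp only [Finset.mem_Ico]
      rintro i ⟨h2i, _⟩
      have aux : n + 2 ≤ i * (n + 1) := by trans 2 * (n + 1) <;> nlinarith only [h2i]
      refine Ideal.mul_mem_left _ _ (Ideal.pow_le_pow_right aux ?_)
      rw [pow_mul']
      exact Ideal.pow_mem_pow ((Ideal.neg_mem_iff _).2 <| Ideal.mul_mem_right _ _ ih) _
  have aux : ∀ m n, m ≤ n → c m ≡ c n [SMOD (I ^ m • ⊤ : Ideal R)] := by
    intro m n hmn
    rw [← Ideal.one_eq_top, Ideal.smul_eq_mul, mul_one]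
    obtain ⟨k, rfl⟩ := Nat.exists_eq_add_of_le hmn
    clear hmn
    induction k with
    | zero => rw [add_zero]
    | succ k ih => ?_
    rw [← add_assoc, hc, ← add_zero (c m), sub_eq_add_neg]
    refine ih.add ?_
    symm
    rw [SModEq.zero, Ideal.neg_mem_iff]
    refine Ideal.mul_mem_right _ _ (Ideal.pow_le_pow_right ?_ (hfcI _))
    rw [add_assoc]
    exact le_self_add
  obtain ⟨a, ha⟩ := IsPrecomplete.prec' c (aux _ _)
  refine ⟨a, ?_, ?_⟩
  · show f.IsRoot a
    suffices ∀ n, f.eval a ≡ 0 [SMOD (I ^ n • ⊤ : Ideal R)] by exact IsHausdorff.haus' _ this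
    intro n
    specialize ha n
    rw [← Ideal.one_eq_top, Ideal.smul_eq_mul, mul_one] at ha ⊢
    refine (ha.symm.eval f).trans ?_
    rw [SModEq.zero]
    exact Ideal.pow_le_pow_right le_self_add (hfcI _)
  · show a - a₀ ∈ I
    specialize ha (0 + 1)
    rw [hc, pow_one, ← Ideal.one_eq_top, Ideal.smul_eq_mul, mul_one, sub_eq_add_neg] at ha
    rw [← SModEq.sub_mem, ← add_zero a₀]
    refine ha.symm.trans (SModEq.rfl.add ?_)
    rw [SModEq.zero, Ideal.neg_mem_iff]
    exact Ideal.mul_mem_right _ _ h₁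

end Hensel

section CongruenceUnits

open Polynomial

/-- The units of `A` congruent to `1` modulo `c`. -/
def congrUnits {A : Type*} [CommRing A] (c : A) : Subgroup Aˣ where
  carrier := {u | c ∣ (u : A) - 1}
  one_mem' := by simp
  mul_mem' := fun {a b} ha hb => by
    have : ((a * b : Aˣ) : A) - 1 = ((a : A) - 1) * b + (b - 1) := by push_cast; ring
    show c ∣ _
    rw [this]
    exact dvd_add (Dvd.dvd.mul_right ha _) hb
  inv_mem' := fun {a} ha => by
    have : ((a⁻¹ : Aˣ) : A) - 1 = ((a : A) - 1) * (-(a⁻¹ : Aˣ)) := by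
      rw [mul_neg, sub_mul, Units.mul_inv]; ring
    show c ∣ _
    rw [this]
    exact Dvd.dvd.mul_right ha _

theorem mem_congrUnits {A : Type*} [CommRing A] {c : A} {u : Aˣ} :
    u ∈ congrUnits c ↔ c ∣ (u : A) - 1 := Iff.rfl

theorem congrUnits_le {A : Type*} [CommRing A] {c d : A} (h : c ∣ d) : congrUnits d ≤ congrUnits c :=
  fun _ hu => h.trans hu

variable {A : Type*} [CommRing A] {ϖ : A} [IsAdicComplete (Ideal.span {ϖ}) A]

theorem isUnit_one_add_mul (a : A) : IsUnit (1 + ϖ * a) := by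
  have h := IsAdicComplete.le_jacobson_bot (Ideal.span {ϖ})
  have h2 := Ideal.mem_jacobson_bot.1 (h (Ideal.mem_span_singleton_self ϖ)) a
  rwa [add_comm]

theorem one_add_pow_eq (p : ℕ) : ∃ G : A[X], ∀ y : A, (1 + y) ^ p = 1 + p * y + y ^ 2 * G.eval y := by
  induction p with
  | zero => exact ⟨0, fun y => by simp⟩
  | succ p ih =>
    obtain ⟨G, hG⟩ := ih
    refine ⟨G * (1 + X) + C (p : A), fun y => ?_⟩
    rw [pow_succ, hG]
    simp
    ring

variable {p : ℕ} (hp : (p : A) ∈ nonZeroDivisors A) (hϖ : ϖ ∈ nonZeroDivisors A)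

include hp hϖ in
theorem eq_one_of_pow_eq_one_of_mem_congrUnits {u : Aˣ} (hu : u ∈ congrUnits (p * ϖ)) (h : u ^ p = 1) :
    u = 1 := by
  obtain ⟨a, ha⟩ := hu
  obtain ⟨G, hG⟩ := one_add_pow_eq (A := A) p
  have h1 := hG ((u : A) - 1)
  rw [add_sub_cancel, ← Units.val_pow_eq_pow_val, h, Units.val_one] at h1
  set g := G.eval ((u : A) - 1)
  have h2 : (p * (p * ϖ)) * (a * (1 + ϖ * (a * g))) = 0 := by
    rw [ha] at h1
    linear_combination -h1
  have h3 := (mem_nonZeroDivisors_iff.1 (mul_mem hp (mul_mem hp hϖ))).1 _ h2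
  rw [(isUnit_one_add_mul _).mul_left_eq_zero] at h3
  ext
  rw [h3, mul_zero, sub_eq_zero] at ha
  exact ha

theorem pow_mem_congrUnits {u : Aˣ} (hu : u ∈ congrUnits (p * ϖ)) : u ^ p ∈ congrUnits (p * (p * ϖ)) := by
  obtain ⟨a, ha⟩ := hu
  obtain ⟨G, hG⟩ := one_add_pow_eq (A := A) p
  have h1 := hG ((u : A) - 1)
  rw [add_sub_cancel, ha] at h1
  refine ⟨a + ϖ * a ^ 2 * G.eval (p * ϖ * a), ?_⟩
  rw [Units.val_pow_eq_pow_val, h1]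
  ring

theorem exists_pow_eq_of_mem_congrUnits {w : Aˣ} (hw : w ∈ congrUnits (p * (p * ϖ))) :
    ∃ u ∈ congrUnits (p * ϖ), u ^ p = w := by
  obtain ⟨b, hb⟩ := hw
  obtain ⟨G, hG⟩ := one_add_pow_eq (A := A) p
  let f : A[X] := X + C ϖ * (X ^ 2 * G.comp (C (p * ϖ) * X)) - C b
  obtain ⟨a, ha, -⟩ := exists_root_of_isAdicComplete (Ideal.span {ϖ}) f b
    (by simp [f]; exact Ideal.mul_mem_right _ _ (Ideal.mem_span_singleton_self ϖ))
    (by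
      have h0 : Ideal.Quotient.mk (Ideal.span {ϖ}) ϖ = 0 :=
        Ideal.Quotient.eq_zero_iff_mem.2 (Ideal.mem_span_singleton_self ϖ)
      simp only [f, derivative_sub, derivative_add, derivative_X, derivative_C_mul, derivative_C, eval_sub,
        eval_add, eval_one, eval_mul, eval_C, map_add, map_sub, map_mul, map_one, h0]
      simp)
  simp only [f, IsRoot.def, eval_sub, eval_add, eval_X, eval_mul, eval_C, eval_pow, eval_comp] at ha
  have hu : IsUnit (1 + p * ϖ * a) := by
    rw [mul_assoc, mul_left_comm]; exact isUnit_one_add_mul _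
  refine ⟨hu.unit, ⟨a, by rw [hu.unit_spec]; ring⟩, ?_⟩
  ext
  rw [Units.val_pow_eq_pow_val, hu.unit_spec, hG]
  linear_combination -hb + p * (p * ϖ) * ha

include hp hϖ in
theorem relIndex_congrUnits : (congrUnits (p * (p * ϖ))).relIndex (congrUnits (p * ϖ)) =
    Nat.card (A ⧸ Ideal.span {(p : A)}) := by
  have hnz := mul_mem hp hϖ
  choose q hq using fun u : congrUnits ((p : A) * ϖ) => u.2
  let φ : congrUnits ((p : A) * ϖ) →* Multiplicative (A ⧸ Ideal.span {(p : A)}) :=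
    MonoidHom.mk' (fun u => Multiplicative.ofAdd (Ideal.Quotient.mk _ (q u))) fun u v => by
      rw [← ofAdd_add, ← map_add]
      congr 1
      rw [Ideal.Quotient.eq, Ideal.mem_span_singleton]
      refine ⟨ϖ * q u * q v, ?_⟩
      have h1 : ((p : A) * ϖ) * (q (u * v) - (q u + q v) - p * (ϖ * q u * q v)) = 0 := by
        have h2 := hq (u * v)
        have h3 := hq u
        have h4 := hq v
        have h5 : (((u * v : congrUnits ((p : A) * ϖ)) : Aˣ) : A) = u.1 * v.1 := rfl
        rw [h5, sub_eq_iff_eq_add.1 h3, sub_eq_iff_eq_add.1 h4] at h2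
        linear_combination -h2
      exact sub_eq_zero.1 ((mem_nonZeroDivisors_iff.1 hnz).1 _ h1)
  have hker : φ.ker = (congrUnits (p * (p * ϖ))).subgroupOf (congrUnits (p * ϖ)) := by
    ext u
    rw [MonoidHom.mem_ker, Subgroup.mem_subgroupOf, mem_congrUnits, hq u]
    show Ideal.Quotient.mk _ (q u) = 0 ↔ _
    rw [Ideal.Quotient.eq_zero_iff_mem, Ideal.mem_span_singleton]
    refine ⟨fun ⟨c, hc⟩ => ⟨c, by rw [hc]; ring⟩, fun ⟨c, hc⟩ => ⟨c, ?_⟩⟩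
    have h1 : ((p : A) * ϖ) * (q u - p * c) = 0 := by linear_combination hc
    exact sub_eq_zero.1 ((mem_nonZeroDivisors_iff.1 hnz).1 _ h1)
  have hsurj : Function.Surjective φ := by
    intro z
    obtain ⟨a, ha⟩ := Ideal.Quotient.mk_surjective (Multiplicative.toAdd z)
    have hu : IsUnit (1 + p * ϖ * a) := by
      rw [mul_assoc, mul_left_comm]; exact isUnit_one_add_mul _
    obtain ⟨w, hw⟩ : ∃ w : congrUnits ((p : A) * ϖ), (w.1 : A) = 1 + p * ϖ * a :=
      ⟨⟨hu.unit, ⟨a, by rw [hu.unit_spec]; ring⟩⟩, hu.unit_spec⟩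
    refine ⟨w, (congrArg Multiplicative.ofAdd (?_ : _ = Ideal.Quotient.mk _ a)).trans (congrArg Multiplicative.ofAdd ha)⟩
    congr 1
    have h1 : ((p : A) * ϖ) * (q w - a) = 0 := by linear_combination -hq w + hw
    exact sub_eq_zero.1 ((mem_nonZeroDivisors_iff.1 hnz).1 _ h1)
  rw [Subgroup.relIndex, ← hker, Subgroup.index_ker, MonoidHom.range_eq_top.2 hsurj, Subgroup.card_top]
  rfl

include hp hϖ in
theorem hasQ_congrUnits (hfin : Finite (A ⧸ Ideal.span {(p : A)})) :
    HasQ.pow p (congrUnits ((p : A) * ϖ)) (Nat.card (A ⧸ Ideal.span {(p : A)})) := by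
  have hk : (powMonoidHom p : congrUnits ((p : A) * ϖ) →* _).ker = ⊥ := by
    rw [eq_bot_iff]
    intro u hu
    have := eq_one_of_pow_eq_one_of_mem_congrUnits hp hϖ u.2 (congrArg Subtype.val ((MonoidHom.mem_ker).1 hu))
    exact Subtype.ext this
  have hr : (powMonoidHom p : congrUnits ((p : A) * ϖ) →* _).range =
      (congrUnits (p * (p * ϖ))).subgroupOf (congrUnits (p * ϖ)) := by
    ext w
    rw [Subgroup.mem_subgroupOf]
    constructor
    · rintro ⟨u, rfl⟩
      exact pow_mem_congrUnits u.2
    · intro hw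
      obtain ⟨u, hu, h⟩ := exists_pow_eq_of_mem_congrUnits hw
      exact ⟨⟨u, hu⟩, Subtype.ext h⟩
  have hi := relIndex_congrUnits hp hϖ
  rw [Subgroup.relIndex] at hi
  refine ⟨?_, ?_, ?_⟩
  · rw [hr, hi]; exact Nat.card_pos.ne'
  · rw [hk]; infer_instance
  · rw [hr, hi, hk]; simp

end CongruenceUnits

section AdicCompleteSpanSingleton

theorem isAdicComplete_span_singleton_iff {R : Type*} [CommRing R] (a : R) :
    IsAdicComplete (Ideal.span {a}) R ↔
      (∀ x : R, (∀ n : ℕ, a ^ n ∣ x) → x = 0) ∧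
      ∀ f : ℕ → R, (∀ n, a ^ n ∣ f (n + 1) - f n) → ∃ L, ∀ n, a ^ n ∣ L - f n := by
  have key : ∀ (n : ℕ) (x y : R),
      x ≡ y [SMOD (Ideal.span {a} ^ n • ⊤ : Submodule R R)] ↔ a ^ n ∣ x - y := by
    intro n x y
    rw [SModEq.sub_mem, Ideal.span_singleton_pow, smul_eq_mul, Ideal.mul_top,
      Ideal.mem_span_singleton]
  constructor
  · intro h
    refine ⟨fun x hx => h.haus' x fun n => (key _ _ _).2 (by simpa using hx n), fun f hf => ?_⟩
    obtain ⟨L, hL⟩ := h.prec' f (fun {m n} hmn => by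
      rw [key]
      induction n, hmn using Nat.le_induction with
      | base => simp
      | succ n hmn ih =>
        have := dvd_sub ih ((pow_dvd_pow a hmn).trans (hf n))
        convert this using 1; ring)
    exact ⟨L, fun n => dvd_sub_comm.1 ((key _ _ _).1 (hL n))⟩
  · rintro ⟨h₁, h₂⟩
    refine { haus' := fun x hx => h₁ x fun n => by simpa using (key _ _ _).1 (hx n),
             prec' := fun f hf => ?_ }
    obtain ⟨L, hL⟩ := h₂ f fun n => dvd_sub_comm.1 ((key _ _ _).1 (hf n.le_succ))
    exact ⟨L, fun n => (key _ _ _).2 (dvd_sub_comm.1 (hL n))⟩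

variable {O A ι : Type*} [CommRing O] [CommRing A] [Algebra O A] [Finite ι]

theorem Module.Basis.algebraMap_dvd_iff (b : Module.Basis ι O A) (c : O) (x : A) :
    algebraMap O A c ∣ x ↔ ∀ i, c ∣ b.repr x i := by
  cases nonempty_fintype ι
  constructor
  · rintro ⟨y, rfl⟩ i
    rw [← Algebra.smul_def, map_smul, Finsupp.smul_apply, smul_eq_mul]
    exact dvd_mul_right _ _
  · intro h
    rw [← b.sum_repr x]
    refine Finset.dvd_sum fun i _ => ?_
    obtain ⟨y, hy⟩ := h i
    rw [hy, mul_smul, Algebra.smul_def]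
    exact dvd_mul_right _ _

theorem isAdicComplete_of_basis (b : Module.Basis ι O A) (a : O)
    [h : IsAdicComplete (Ideal.span {a}) O] : IsAdicComplete (Ideal.span {algebraMap O A a}) A := by
  cases nonempty_fintype ι
  rw [isAdicComplete_span_singleton_iff] at h ⊢
  simp only [← map_pow, b.algebraMap_dvd_iff]
  refine ⟨fun x hx => ?_, fun f hf => ?_⟩
  · refine b.repr.map_eq_zero_iff.1 (Finsupp.ext fun i => h.1 _ fun n => hx n i)
  · choose L hL using fun i => h.2 (fun n => b.repr (f n) i) (fun n => by simpa using hf n i)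
    refine ⟨∑ i, L i • b i, fun n i => ?_⟩
    rw [map_sub, Finsupp.sub_apply, b.repr_sum_self]
    exact hL i n

theorem card_quotient_span_algebraMap (b : Module.Basis ι O A) (c : O) :
    Nat.card (A ⧸ Ideal.span {algebraMap O A c}) = Nat.card (O ⧸ Ideal.span {c}) ^ Nat.card ι := by
  cases nonempty_fintype ι
  let φ : A →+ (ι → O ⧸ Ideal.span {c}) :=
    { toFun := fun x i => Ideal.Quotient.mk _ (b.repr x i)
      map_zero' := by ext; simp
      map_add' := fun x y => by ext; simp }
  have hker : φ.ker = (Submodule.toAddSubgroup (Ideal.span {algebraMap O A c})) := by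
    ext x
    rw [AddMonoidHom.mem_ker, Submodule.mem_toAddSubgroup, Ideal.mem_span_singleton,
      b.algebraMap_dvd_iff, funext_iff]
    refine forall_congr' fun i => ?_
    show Ideal.Quotient.mk _ _ = 0 ↔ _
    rw [Ideal.Quotient.eq_zero_iff_mem, Ideal.mem_span_singleton]
  have hsurj : Function.Surjective φ := by
    intro z
    choose y hy using fun i => Ideal.Quotient.mk_surjective (z i)
    refine ⟨∑ i, y i • b i, funext fun i => ?_⟩
    show Ideal.Quotient.mk _ (b.repr _ i) = _
    rw [b.repr_sum_self, hy]
  show (Submodule.toAddSubgroup (Ideal.span {algebraMap O A c})).index = _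
  rw [← hker, AddSubgroup.index_ker, AddMonoidHom.range_eq_top.2 hsurj]
  simp [Nat.card_eq_fintype_card, Nat.card_fun]

theorem exists_isIdempotentElem_pow {M : Type*} [Monoid M] [Finite M] (x : M) :
    ∃ N : ℕ, 0 < N ∧ IsIdempotentElem (x ^ N) := by
  obtain ⟨i, j, hij, h⟩ := Set.finite_univ.exists_lt_map_eq_of_forall_mem
    (f := fun n : ℕ => x ^ n) fun _ => Set.mem_univ _
  have key : ∀ k m, i ≤ m → x ^ (m + k * (j - i)) = x ^ m := by
    intro k
    induction k with
    | zero => simp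
    | succ k ih =>
      intro m hm
      rw [add_mul, one_mul, ← add_assoc, add_right_comm, ih (m + (j - i)) (by omega),
        show m + (j - i) = (m - i) + j by omega, pow_add, ← show x ^ i = x ^ j from h, ← pow_add,
        Nat.sub_add_cancel hm]
  have hN : i + 1 ≤ (i + 1) * (j - i) := Nat.le_mul_of_pos_right _ (by omega)
  refine ⟨(i + 1) * (j - i), by omega, ?_⟩
  rw [IsIdempotentElem, ← pow_add]
  exact key _ _ (by omega)

theorem isLocalRing_of_isAdicComplete_of_finite_quotient [IsDomain A] (a : A)
    (ha : ¬ IsUnit a) [IsAdicComplete (Ideal.span {a}) A] (hfin : Finite (A ⧸ Ideal.span {a})) :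
    IsLocalRing A := by
  have key : ∀ x : A, IsUnit x ∨ IsNilpotent (Ideal.Quotient.mk (Ideal.span {a}) x) := by
    intro x
    obtain ⟨N, hN, hid⟩ : ∃ N : ℕ, 0 < N ∧ IsIdempotentElem (Ideal.Quotient.mk (Ideal.span {a}) x ^ N) :=
      exists_isIdempotentElem_pow _
    have hd : a ∣ (x ^ N) ^ 2 - x ^ N := by
      rw [← Ideal.mem_span_singleton, ← Ideal.Quotient.eq, map_pow, map_pow, sq]
      exact hid
    obtain ⟨e, he, hex⟩ := exists_root_of_isAdicComplete (Ideal.span {a})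
      (Polynomial.X ^ 2 - Polynomial.X : Polynomial A) (x ^ N) (by simpa [Ideal.mem_span_singleton] using hd) (by
        refine IsUnit.of_mul_eq_one (Ideal.Quotient.mk _ (2 * x ^ N - 1)) ?_
        rw [← map_mul, ← map_one (Ideal.Quotient.mk _), Ideal.Quotient.eq, Ideal.mem_span_singleton]
        simp
        convert hd.mul_left 4 using 1
        ring)
    have h01 : e = 0 ∨ e = 1 := by
      have : e * (e - 1) = 0 := by
        have := he; simp [Polynomial.IsRoot] at this; linear_combination this
      rcases mul_eq_zero.1 this with h | h
      · exact Or.inl h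
      · exact Or.inr (sub_eq_zero.1 h)
    rw [Ideal.mem_span_singleton] at hex
    rcases h01 with rfl | rfl
    · refine Or.inr ⟨N, ?_⟩
      rw [← map_pow, Ideal.Quotient.eq_zero_iff_mem, Ideal.mem_span_singleton]
      simpa using hex
    · left
      obtain ⟨y, hy⟩ := hex
      have : IsUnit (x ^ N) := by
        rw [show x ^ N = 1 + a * (-y) by linear_combination -hy]
        exact isUnit_one_add_mul _
      exact (isUnit_pow_iff hN.ne').1 this
  refine IsLocalRing.of_nonunits_add fun x y hx hy hxy => ha ?_
  obtain ⟨n, hn⟩ := (Commute.all _ _).isNilpotent_add ((key x).resolve_left hx)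
    ((key y).resolve_left hy)
  rw [← map_add, ← map_pow, Ideal.Quotient.eq_zero_iff_mem, Ideal.mem_span_singleton] at hn
  exact isUnit_of_dvd_unit hn (hxy.pow _)

end AdicCompleteSpanSingleton

theorem hasQ_pow_multiplicative_int {p : ℕ} (hp : 0 < p) : HasQ.pow p (Multiplicative ℤ) p := by
  have hk : (powMonoidHom p : Multiplicative ℤ →* _).ker = ⊥ := by
    rw [eq_bot_iff]
    intro u hu
    have h : (p : ℤ) * Multiplicative.toAdd u = 0 := by
      simpa using congrArg Multiplicative.toAdd (MonoidHom.mem_ker.1 hu)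
    have := (mul_eq_zero.1 h).resolve_left (by exact_mod_cast hp.ne')
    exact this
  have hi : (powMonoidHom p : Multiplicative ℤ →* _).range.index = p := by
    have : (powMonoidHom p : Multiplicative ℤ →* _).range =
        (AddSubgroup.zmultiples (p : ℤ)).toSubgroup := by
      ext u
      constructor
      · rintro ⟨v, rfl⟩
        exact ⟨Multiplicative.toAdd v, by simp [mul_comm]⟩
      · rintro ⟨v, hv⟩
        refine ⟨Multiplicative.ofAdd v, ?_⟩
        have hv' : v • (p : ℤ) = Multiplicative.toAdd u := hv
        rw [← ofAdd_toAdd u, ← hv', powMonoidHom_apply, ← ofAdd_nsmul, nsmul_eq_mul, smul_eq_mul,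
          mul_comm]
    rw [this]
    exact (Int.index_zmultiples p).trans (by simp)
  refine ⟨?_, ?_, ?_⟩
  · rw [hi]; exact hp.ne'
  · rw [hk]; infer_instance
  · rw [hi, hk]; simp

theorem hasQ_units_fractionRing {A E : Type*} [CommRing A] [IsDomain A] [IsDiscreteValuationRing A]
    [Field E] [Algebra A E] [IsFractionRing A E] {p : ℕ} {ϖ : A} [IsAdicComplete (Ideal.span {ϖ}) A]
    (hp : (p : A) ≠ 0) (hϖ : ϖ ≠ 0) (hfin : Finite (A ⧸ Ideal.span {(p : A) * ϖ})) :
    HasQ.pow p Eˣ (p * Nat.card (A ⧸ Ideal.span {(p : A)})) := by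
  have hfin' : Finite (A ⧸ Ideal.span {(p : A)}) :=
    Finite.of_surjective (Ideal.Quotient.factor (Ideal.span_singleton_le_span_singleton.2 (dvd_mul_right (p : A) ϖ)))
      (Ideal.Quotient.factor_surjective _)
  have hU : HasQ.pow p Aˣ (Nat.card (A ⧸ Ideal.span {(p : A)})) := by
    refine HasQ.pow_of_finiteIndex (congrUnits ((p : A) * ϖ)) ?_
      (hasQ_congrUnits (mem_nonZeroDivisors_of_ne_zero hp) (mem_nonZeroDivisors_of_ne_zero hϖ) hfin')
    have : congrUnits ((p : A) * ϖ) = (Units.map (Ideal.Quotient.mk (Ideal.span {(p : A) * ϖ})).toMonoidHom).ker := by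
      ext u
      rw [mem_congrUnits, MonoidHom.mem_ker, Units.ext_iff, ← Ideal.mem_span_singleton, ← Ideal.Quotient.eq]
      simp
    rw [this]
    exact Subgroup.FiniteIndex.index_ne_zero
  let w := IsDiscreteValuationRing.maximalIdeal A
  let φ : Eˣ →* Multiplicative ℤ := w.valuationOfNeZero
  have hφ : Function.Surjective φ := by
    obtain ⟨π, hπ⟩ := w.valuation_exists_uniformizer E
    have hπ0 : π ≠ 0 := by rintro rfl; rw [map_zero] at hπ; exact WithZero.coe_ne_zero hπ.symm
    have h1 : φ (Units.mk0 π hπ0) = Multiplicative.ofAdd (-1) := by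
      rw [← WithZero.coe_inj]
      exact (w.valuationOfNeZero_eq _).trans hπ
    intro n
    refine ⟨(Units.mk0 π hπ0) ^ (-Multiplicative.toAdd n), ?_⟩
    rw [map_zpow, h1, ← ofAdd_zsmul]
    simp
  have hker : φ.ker = (Units.map (algebraMap A E : A →* E)).range := by
    ext u
    constructor
    · intro hu
      have hu1 : w.valuation E (u : E) = 1 := by
        rw [← w.valuationOfNeZero_eq]; rw [MonoidHom.mem_ker] at hu; exact congrArg _ hu
      have hu2 : w.valuation E ((u⁻¹ : Eˣ) : E) = 1 := by simp [hu1]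
      obtain ⟨a, ha⟩ := IsDiscreteValuationRing.exists_lift_of_le_one (A := A) (K := E) hu1.le
      obtain ⟨b, hb⟩ := IsDiscreteValuationRing.exists_lift_of_le_one (A := A) (K := E) hu2.le
      have hab : a * b = 1 := by
        apply IsFractionRing.injective A E
        rw [map_mul, ha, hb]; simp
      exact ⟨Units.mkOfMulEqOne a b hab, Units.ext ha⟩
    · rintro ⟨v, rfl⟩
      exact w.valuation_of_unit_eq v
  have e : Aˣ ≃* φ.ker :=
    (MonoidHom.ofInjective (Units.map_injective (IsFractionRing.injective A E))).trans
      (MulEquiv.subgroupCongr hker.symm)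
  rw [mul_comm]
  exact HasQ.pow_of_ses φ hφ (HasQ.pow_congr e hU)
    (hasQ_pow_multiplicative_int (Nat.pos_of_ne_zero (by rintro rfl; simp at hp)))

theorem hasQ_units_of_finiteDimensional {O F E : Type*} [CommRing O] [IsDomain O]
    [IsDiscreteValuationRing O] [Field F] [CharZero F] [Algebra O F] [IsFractionRing O F] [Field E]
    [Algebra F E] [FiniteDimensional F E] {p : ℕ} (hp : 0 < p) {ϖ : O}
    [IsAdicComplete (Ideal.span {ϖ}) O] (hϖ : ϖ ≠ 0) (hϖu : ¬ IsUnit ϖ)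
    (hfin : Finite (O ⧸ Ideal.span {(p : O) * ϖ})) :
    HasQ.pow p Eˣ (p * Nat.card (O ⧸ Ideal.span {(p : O)}) ^ Module.finrank F E) := by
  let _ : Algebra O E := ((algebraMap F E).comp (algebraMap O F)).toAlgebra
  have : IsScalarTower O F E := IsScalarTower.of_algebraMap_eq fun _ => rfl
  let A := integralClosure O E
  have hinj : Function.Injective (algebraMap O E) :=
    (algebraMap F E).injective.comp (IsFractionRing.injective O F)
  have : Module.IsTorsionFree O E := Module.isTorsionFree_iff_algebraMap_injective.2 hinj
  have : IsDedekindDomain A := IsIntegralClosure.isDedekindDomain O F E A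
  have : Module.Finite O A := IsIntegralClosure.finite O F E A
  have : Module.Free O A := IsIntegralClosure.module_free O F E A
  have : IsFractionRing A E := IsIntegralClosure.isFractionRing_of_finite_extension O F E A
  have hrank : Module.finrank O A = Module.finrank F E := IsIntegralClosure.rank O F E A
  have : CharZero O := (algebraMap O F).charZero
  have hinjA : Function.Injective (algebraMap O A) := fun x y h => hinj (congrArg (algebraMap A E) h)
  have : CharZero A := (algebraMap O A).charZero_iff hinjA |>.1 inferInstance
  let b := Module.Free.chooseBasis O A
  have hb : Nat.card (Module.Free.ChooseBasisIndex O A) = Module.finrank F E := by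
    rw [← hrank, Module.finrank_eq_nat_card_basis b]
  have hcomp : IsAdicComplete (Ideal.span {algebraMap O A ϖ}) A := isAdicComplete_of_basis b ϖ
  have hpϖ : Finite (A ⧸ Ideal.span {(p : A) * algebraMap O A ϖ}) := by
    apply Nat.finite_of_card_ne_zero
    rw [← map_natCast (algebraMap O A), ← map_mul, card_quotient_span_algebraMap b]
    exact pow_ne_zero _ Nat.card_pos.ne'
  have hϖfin : Finite (A ⧸ Ideal.span {algebraMap O A ϖ}) :=
    Finite.of_surjective (Ideal.Quotient.factor (Ideal.span_singleton_le_span_singleton.2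
      (dvd_mul_left (algebraMap O A ϖ) (p : A)))) (Ideal.Quotient.factor_surjective _)
  have hϖA : ¬ IsUnit (algebraMap O A ϖ) := fun h => hϖu (isUnit_of_map_unit _ _ h)
  have : IsLocalRing A := isLocalRing_of_isAdicComplete_of_finite_quotient _ hϖA hϖfin
  have hnf : ¬ IsField A := fun h => hϖA (h.mul_inv_cancel ((map_ne_zero_iff _ hinjA).2 hϖ) |>.elim
    fun y hy => IsUnit.of_mul_eq_one y hy)
  have : IsDiscreteValuationRing A := ((IsDiscreteValuationRing.TFAE A hnf).out 0 2).2 ‹IsDedekindDomain A›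
  have := hasQ_units_fractionRing (A := A) (E := E) (p := p) (ϖ := algebraMap O A ϖ)
    (by exact_mod_cast hp.ne') ((map_ne_zero_iff _ hinjA).2 hϖ) hpϖ
  have hc := card_quotient_span_algebraMap b (p : O)
  rw [map_natCast, hb] at hc
  rw [hc] at this
  exact_mod_cast this

section Kummer

open Polynomial

variable {F : Type} [Field F] {p : ℕ} {ζ b : F} [hirr : Fact (Irreducible (X ^ p - C b : F[X]))]

theorem exists_kummer_aut (hp : p.Prime) (hζ : IsPrimitiveRoot ζ p) :
    ∃ σ : AdjoinRoot (X ^ p - C b : F[X]) ≃ₐ[F] AdjoinRoot (X ^ p - C b : F[X]),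
      σ (AdjoinRoot.root _) = ζ • AdjoinRoot.root _ ∧ σ ^ p = 1 ∧
      (∀ y, σ y = y → ∃ c, algebraMap F _ c = y) ∧
      (∀ y, ∏ i ∈ Finset.range p, (σ ^ i) y = algebraMap F _ (Algebra.norm F y)) ∧
      ∀ y, ∏ i ∈ Finset.range p, (σ ^ i) y = 1 → ∃ z, z ≠ 0 ∧ σ z / z = y := by
  have : NeZero p := ⟨hp.ne_zero⟩
  have hprim : (primitiveRoots p F).Nonempty := ⟨ζ, (mem_primitiveRoots hp.pos).2 hζ⟩
  have hs := isSplittingField_AdjoinRoot_X_pow_sub_C hprim hirr.out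
  set L := AdjoinRoot (X ^ p - C b : F[X]) with hL
  have hgal : IsGalois F L := isGalois_of_isSplittingField_X_pow_sub_C hprim hirr.out L
  have hcyc : IsCyclic Gal(L/F) := isCyclic_of_isSplittingField_X_pow_sub_C hprim hirr.out L
  have hfd : FiniteDimensional F L := IsSplittingField.finiteDimensional L (X ^ p - C b)
  let σ : L ≃ₐ[F] L := autAdjoinRootXPowSubCEquiv hprim hirr.out hζ.toRootsOfUnity
  have hσ : σ (AdjoinRoot.root _) = ζ • AdjoinRoot.root _ :=
    autAdjoinRootXPowSubCEquiv_root hprim hirr.out _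
  have hord : orderOf σ = p := by
    rw [show orderOf σ = orderOf hζ.toRootsOfUnity from
      orderOf_injective (autAdjoinRootXPowSubCEquiv hprim hirr.out).toMonoidHom (MulEquiv.injective _) _,
      ← Subgroup.orderOf_coe, ← orderOf_units]
    exact hζ.eq_orderOf.symm
  have hcard : Nat.card Gal(L/F) = p := by
    rw [IsGalois.card_aut_eq_finrank, finrank_of_isSplittingField_X_pow_sub_C hprim hirr.out L]
  have hgen : ∀ x : Gal(L/F), x ∈ Subgroup.zpowers σ := by
    have : Subgroup.zpowers σ = ⊤ := by
      apply Subgroup.eq_top_of_card_eq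
      rw [Nat.card_zpowers, hord, hcard]
    intro x; rw [this]; trivial
  have hpow : σ ^ p = 1 := orderOf_dvd_iff_pow_eq_one.1 hord.dvd
  have hnorm : ∀ y, ∏ i ∈ Finset.range p, (σ ^ i) y = algebraMap F _ (Algebra.norm F y) := by
    classical
    intro y
    rw [Algebra.norm_eq_prod_automorphisms]
    refine Finset.prod_bij (fun i _ => σ ^ i) (fun _ _ => Finset.mem_univ _) ?_ ?_ fun _ _ => rfl
    · intro i hi j hj h
      exact pow_injOn_Iio_orderOf (by simpa [hord] using hi) (by simpa [hord] using hj) h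
    · intro τ _
      obtain ⟨k, hk, rfl⟩ := (mem_zpowers_iff_mem_range_orderOf.1 (hgen τ) |> Finset.mem_image.1)
      exact ⟨k, by rwa [hord] at hk, rfl⟩
  refine ⟨σ, hσ, hpow, ?_, hnorm, ?_⟩
  · intro y hy
    refine (IsGalois.mem_range_algebraMap_iff_fixed y).2 fun f => ?_
    obtain ⟨k, rfl⟩ := hgen f
    have : σ ∈ MulAction.stabilizer Gal(L/F) y := hy
    exact zpow_mem this k
  · intro y hy
    rw [hnorm] at hy
    obtain ⟨z, hz⟩ := groupCohomology.exists_div_of_norm_eq_one hgen (x := y)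
      ((algebraMap F L).injective (by rw [hy, map_one]))
    refine ⟨(z : L)⁻¹, by simp, ?_⟩
    rw [← hz, map_inv₀, div_eq_mul_inv, inv_inv, mul_comm, div_eq_mul_inv]

end Kummer

section NormGroup

open Polynomial

theorem NormP.mul {E : Type*} [Field E] {p : ℕ} {ζ b a a' : E} (h : NormP p ζ b a)
    (h' : NormP p ζ b a') : NormP p ζ b (a * a') := by
  obtain ⟨f, hf⟩ := h
  obtain ⟨g, hg⟩ := h'
  refine ⟨f * g, ?_⟩
  simp only [mul_comp, Finset.prod_mul_distrib, C_mul]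
  convert dvd_add (hf.mul_right (∏ i ∈ Finset.range p, g.comp (C (ζ ^ i) * X)))
    (hg.mul_left (C a)) using 1
  ring

theorem normP_pow {E : Type*} [Field E] (p : ℕ) (ζ b c : E) : NormP p ζ b (c ^ p) :=
  ⟨C c, by simp⟩

theorem NormP.inv {E : Type*} [Field E] {p : ℕ} {ζ b a : E} (hp : 0 < p) (h : NormP p ζ b a) :
    NormP p ζ b a⁻¹ := by
  rcases eq_or_ne a 0 with rfl | ha
  · simpa using h
  have hpow : ∀ k : ℕ, NormP p ζ b (a ^ k) := fun k => by
    induction k with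
    | zero => simpa using normP_pow p ζ b 1
    | succ k ih => rw [pow_succ]; exact ih.mul h
  have := (hpow (p - 1)).mul (normP_pow p ζ b a⁻¹)
  obtain ⟨k, rfl⟩ : ∃ k, p = k + 1 := ⟨p - 1, by omega⟩
  rwa [Nat.add_sub_cancel, pow_succ a⁻¹, ← mul_assoc, ← mul_pow, mul_inv_cancel₀ ha, one_pow,
    one_mul] at this

theorem NormP.map {E E' : Type*} [Field E] [Field E'] (j : E →+* E') {p : ℕ} {ζ b a : E}
    (h : NormP p ζ b a) : NormP p (j ζ) (j b) (j a) := by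
  obtain ⟨f, g, hg⟩ := h
  refine ⟨f.map j, g.map j, ?_⟩
  have := congrArg (Polynomial.map j) hg
  simpa [Polynomial.map_prod, Polynomial.map_comp] using this

/-- The group of nonzero `a` that are norms from `E[X]/(X ^ p - b)`. -/
def normGroup {E : Type*} [Field E] (p : ℕ) (ζ b : E) : Subgroup Eˣ where
  carrier := {a | NormP p ζ b a ∧ NormP p ζ b (a⁻¹ : Eˣ)}
  one_mem' := by simpa using normP_pow p ζ b 1
  mul_mem' := fun {x y} hx hy => ⟨hx.1.mul hy.1, by rw [mul_inv]; exact hx.2.mul hy.2⟩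
  inv_mem' := fun {x} hx => ⟨hx.2, by rw [inv_inv]; exact hx.1⟩

theorem mem_normGroup {E : Type*} [Field E] {p : ℕ} (hp : 0 < p) {ζ b : E} {a : Eˣ} :
    a ∈ normGroup p ζ b ↔ NormP p ζ b a :=
  ⟨fun h => h.1, fun h => ⟨h, by rw [Units.val_inv_eq_inv_val]; exact h.inv hp⟩⟩

theorem range_powMonoidHom_le_normGroup {E : Type*} [Field E] {p : ℕ} (hp : 0 < p) (ζ b : E) :
    (powMonoidHom p : Eˣ →* Eˣ).range ≤ normGroup p ζ b := by
  rintro _ ⟨u, rfl⟩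
  rw [mem_normGroup hp]
  simpa using normP_pow p ζ b u

theorem normGroup_pow {E : Type*} [Field E] {p : ℕ} (hp : 0 < p) {ζ c : E}
    (hζ : IsPrimitiveRoot ζ p) (hc : c ≠ 0) : normGroup p ζ (c ^ p) = ⊤ := by
  ext a
  simp [mem_normGroup hp, normP_of_pow hp hζ hc]

theorem normP_iff_exists_prod {F : Type*} [Field F] {p : ℕ} {ζ b : F}
    (σ : AdjoinRoot (X ^ p - C b : F[X]) ≃ₐ[F] AdjoinRoot (X ^ p - C b : F[X]))
    (hσ : σ (AdjoinRoot.root _) = ζ • AdjoinRoot.root _) (a : F) :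
    NormP p ζ b a ↔ ∃ y, ∏ i ∈ Finset.range p, (σ ^ i) y = algebraMap F _ a := by
  have hpow : ∀ i : ℕ, (σ ^ i) (AdjoinRoot.root _) = ζ ^ i • AdjoinRoot.root _ := fun i => by
    induction i with
    | zero => simp
    | succ i ih => rw [pow_succ', AlgEquiv.mul_apply, ih, map_smul, hσ, smul_smul, pow_succ]
  have key : ∀ f : F[X], AdjoinRoot.mk (X ^ p - C b)
      (∏ i ∈ Finset.range p, f.comp (C (ζ ^ i) * X)) =
      ∏ i ∈ Finset.range p, (σ ^ i) (AdjoinRoot.mk _ f) := fun f => by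
    rw [map_prod]
    refine Finset.prod_congr rfl fun i _ => ?_
    rw [← AdjoinRoot.aeval_eq, ← AdjoinRoot.aeval_eq, ← aeval_algHom_apply, aeval_comp]
    congr 2
    rw [← AlgEquiv.coe_algHom]
    exact (by simp [Algebra.smul_def] : _ = ζ ^ i • AdjoinRoot.root _).trans (hpow i).symm
  constructor
  · rintro ⟨f, hf⟩
    refine ⟨AdjoinRoot.mk _ f, ?_⟩
    rw [← AdjoinRoot.mk_eq_zero, map_sub, sub_eq_zero, key] at hf
    exact hf
  · rintro ⟨y, hy⟩
    obtain ⟨f, rfl⟩ := AdjoinRoot.mk_surjective y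
    refine ⟨f, ?_⟩
    rw [← AdjoinRoot.mk_eq_zero, map_sub, sub_eq_zero, key]
    exact hy

end NormGroup

section NormIndex

open Polynomial

/-- Hilbert 90 together with the Herbrand quotient of the multiplicative group of a Kummer
extension of prime degree. -/
theorem index_normGroup_of_hasQ {F : Type} [Field F] {p : ℕ} {ζ b : F}
    [hirr : Fact (Irreducible (X ^ p - C b : F[X]))] (hp : p.Prime) (hζ : IsPrimitiveRoot ζ p)
    {c : ℕ} (hc : 0 < c) (hF : HasQ.pow p Fˣ (p * c))
    (hE : HasQ.pow p (AdjoinRoot (X ^ p - C b : F[X]))ˣ (p * c ^ p)) :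
    (normGroup p ζ b).index = p := by
  obtain ⟨σ, hσ, hσp, hfix, hnorm, h90⟩ := exists_kummer_aut (b := b) hp hζ
  set L := AdjoinRoot (X ^ p - C b : F[X]) with hL
  let s : Monoid.End Lˣ := Units.map (σ : L →* L)
  have hs : ∀ (i : ℕ) (m : Lˣ), (((s ^ i) m : Lˣ) : L) = (σ ^ i) (m : L) := by
    intro i m
    induction i with
    | zero => rfl
    | succ i ih => rw [pow_succ', pow_succ', AlgEquiv.mul_apply, ← ih]; rfl
  let N : Monoid.End Lˣ :=
    { toFun := fun m => ∏ i ∈ Finset.range p, (s ^ i) m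
      map_one' := by simp
      map_mul' := fun x y => by simp [Finset.prod_mul_distrib] }
  have hN : ∀ m : Lˣ, ((N m : Lˣ) : L) = ∏ i ∈ Finset.range p, (σ ^ i) (m : L) := by
    intro m
    show ((∏ i ∈ Finset.range p, (s ^ i) m : Lˣ) : L) = _
    rw [Units.coe_prod]
    exact Finset.prod_congr rfl fun i _ => hs i m
  let ι : Fˣ →* Lˣ := Units.map (algebraMap F L : F →* L)
  have hι : Function.Injective ι := Units.map_injective (algebraMap F L).injective
  obtain ⟨d, hd, hd1, hd2⟩ := relIndex_norm_of_hasQ hp s N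
    (MonoidHom.ext fun m => Units.ext ((hs p m).trans (by rw [hσp]; rfl))) (fun _ => rfl) ι.range
    (fun m => by
      constructor
      · rintro ⟨u, rfl⟩
        exact Units.ext (σ.commutes _)
      · intro h
        obtain ⟨c, hc⟩ := hfix (m : L) (congrArg Units.val h)
        have hc0 : c ≠ 0 := by rintro rfl; rw [map_zero] at hc; exact m.ne_zero hc.symm
        exact ⟨Units.mk0 c hc0, Units.ext hc⟩)
    (fun y hy => by
      obtain ⟨z, hz, hzy⟩ := h90 (y : L) ((hN y).symm.trans (congrArg Units.val hy))
      exact ⟨Units.mk0 z hz, Units.ext (by rw [← hzy, Units.val_div_eq_div_val]; rfl)⟩)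
    hE (HasQ.pow_congr (MonoidHom.ofInjective hι) hF)
  have hp0 : (p : ℚ) ≠ 0 := by exact_mod_cast hp.ne_zero
  have hc0 : (0 : ℚ) < c := by exact_mod_cast hc
  have hdc : d = c := by
    have : d ^ (p - 1) = (c : ℚ) ^ (p - 1) := by
      rw [hd1]
      obtain ⟨k, hk⟩ : ∃ k, p = k + 1 := ⟨p - 1, (Nat.succ_pred_eq_of_pos hp.pos).symm⟩
      rw [show (c : ℚ) ^ p = c ^ (p - 1) * c by rw [← pow_succ, Nat.sub_add_cancel hp.one_le]]
      field_simp
    exact (pow_left_inj₀ hd.le hc0.le (Nat.sub_ne_zero_of_lt hp.one_lt)).1 this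
  rw [hdc] at hd2
  have hidx : (MonoidHom.range N).relIndex ι.range = p := by
    have := mul_right_cancel₀ hc0.ne' hd2
    exact_mod_cast this
  have hcomap : normGroup p ζ b = (MonoidHom.range N).comap ι := by
    ext a
    rw [mem_normGroup hp.pos, normP_iff_exists_prod σ hσ, Subgroup.mem_comap]
    constructor
    · rintro ⟨y, hy⟩
      have hy0 : y ≠ 0 := by
        rintro rfl
        rw [Finset.prod_eq_zero (Finset.mem_range.2 hp.pos) (by simp)] at hy
        exact a.ne_zero ((map_eq_zero _).1 hy.symm)
      exact ⟨Units.mk0 y hy0, Units.ext ((hN _).trans hy)⟩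
    · rintro ⟨y, hy⟩
      exact ⟨y, (hN y).symm.trans (congrArg Units.val hy)⟩
  rw [hcomap, Subgroup.index_comap, hidx]

theorem index_normGroup_eq {O F : Type} [CommRing O] [IsDomain O]
    [IsDiscreteValuationRing O] [Field F] [CharZero F] [Algebra O F] [IsFractionRing O F]
    {p : ℕ} (hp : p.Prime) {ϖ : O} [IsAdicComplete (Ideal.span {ϖ}) O] (hϖ : ϖ ≠ 0)
    (hϖu : ¬ IsUnit ϖ) (hfin : Finite (O ⧸ Ideal.span {(p : O) * ϖ})) {ζ b : F}
    (hζ : IsPrimitiveRoot ζ p) (hb : ∀ c, c ^ p ≠ b) : (normGroup p ζ b).index = p := by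
  have hirr : Fact (Irreducible (X ^ p - C b : F[X])) := ⟨X_pow_sub_C_irreducible_of_prime hp hb⟩
  have hmonic : (X ^ p - C b : F[X]).Monic := monic_X_pow_sub_C b hp.ne_zero
  have : FiniteDimensional F (AdjoinRoot (X ^ p - C b : F[X])) := hmonic.finite_adjoinRoot
  have hrank : Module.finrank F (AdjoinRoot (X ^ p - C b : F[X])) = p := by
    rw [(AdjoinRoot.powerBasis hmonic.ne_zero).finrank, AdjoinRoot.powerBasis_dim,
      natDegree_X_pow_sub_C]
  have hfin' : Finite (O ⧸ Ideal.span {(p : O)}) :=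
    Finite.of_surjective (Ideal.Quotient.factor (Ideal.span_singleton_le_span_singleton.2
      (dvd_mul_right (p : O) ϖ))) (Ideal.Quotient.factor_surjective _)
  refine index_normGroup_of_hasQ hp hζ (c := Nat.card (O ⧸ Ideal.span {(p : O)})) Nat.card_pos ?_ ?_
  · simpa using hasQ_units_of_finiteDimensional (F := F) (E := F) hp.pos hϖ hϖu hfin
  · have h := hasQ_units_of_finiteDimensional (F := F)
      (E := AdjoinRoot (X ^ p - C b : F[X])) hp.pos hϖ hϖu hfin
    rw [show Module.finrank F (AdjoinRoot (X ^ p - C b : F[X])) = p from hrank] at h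
    exact_mod_cast h

end NormIndex

section AdicCompletion

open IsDedekindDomain HeightOneSpectrum WithZero Filter Topology

variable {R : Type*} [CommRing R] [IsDedekindDomain R] {K : Type*} [Field K] [Algebra R K]
  [IsFractionRing R K] (v : HeightOneSpectrum R)

theorem exists_pow_lt_of_lt_one_of_ne_zero {x γ : ℤᵐ⁰} (hx : x < 1) (hγ : γ ≠ 0) :
    ∃ n : ℕ, x ^ n < γ :=
  exists_pow_lt₀ hx (Units.mk0 γ hγ)

theorem isOpen_setOf_valued_sub_lt (x c : v.adicCompletion K) :
    IsOpen {y : v.adicCompletion K | Valued.v (y - x) < Valued.v c} := by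
  have h := (Valued.isOpen_ball (v.adicCompletion K) (Valued.v.restrict c)).preimage
    (continuous_id.sub (continuous_const (y := x)))
  simpa [Valuation.restrict_lt_iff, Set.preimage] using h

theorem isClosed_setOf_valued_sub_le (x c : v.adicCompletion K) :
    IsClosed {y : v.adicCompletion K | Valued.v (y - x) ≤ Valued.v c} := by
  have h := (Valued.isClosed_closedBall (v.adicCompletion K) (Valued.v.restrict c)).preimage
    (continuous_id.sub (continuous_const (y := x)))
  simpa [Valuation.restrict_le_iff, Set.preimage] using h

theorem exists_valued_sub_lt (x : v.adicCompletion K) {γ : ℤᵐ⁰} (hγ : γ ≠ 0) :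
    ∃ k : K, Valued.v (algebraMap K (v.adicCompletion K) k - x) < γ := by
  obtain ⟨c, rfl⟩ := valuedAdicCompletion_surjective K v γ
  exact (denseRange_algebraMap K v).exists_mem_open (isOpen_setOf_valued_sub_lt v x c)
    ⟨x, by simpa using zero_lt_iff.2 hγ⟩

theorem adicCompletionIntegers_dvd_iff {a x : v.adicCompletionIntegers K} :
    a ∣ x ↔ Valued.v (x : v.adicCompletion K) ≤ Valued.v (a : v.adicCompletion K) :=
  (adicCompletionIntegers.integers K v).dvd_iff_le

theorem exists_adicCompletionIntegers_dvd_sub {a : v.adicCompletionIntegers K} (ha : a ≠ 0)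
    (x : v.adicCompletionIntegers K) : ∃ r : R, a ∣ algebraMap R _ r - x := by
  have ha' : Valued.v (a : v.adicCompletion K) ≠ 0 := by simpa using ha
  have hle : Valued.v (a : v.adicCompletion K) ≤ 1 := a.2
  obtain ⟨k, hk⟩ := exists_valued_sub_lt v (x : v.adicCompletion K) ha'
  have hk1 : v.valuation K k ≤ 1 := by
    rw [← valuedAdicCompletion_eq_valuation']
    have := Valued.v.map_add (algebraMap K (v.adicCompletion K) k - x) x
    rw [sub_add_cancel] at this
    exact this.trans (max_le (hk.le.trans hle) x.2)
  obtain ⟨r, hr⟩ := exists_valuation_sub_lt_of_integer v hk1 (Units.mk0 _ ha')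
  refine ⟨r, (adicCompletionIntegers_dvd_iff v).2 ?_⟩
  rw [← valuedAdicCompletion_eq_valuation'] at hr
  have := Valued.v.map_add (algebraMap K (v.adicCompletion K) (algebraMap R K r - k))
    (algebraMap K (v.adicCompletion K) k - x)
  refine le_trans (le_of_eq ?_) (this.trans (max_le hr.le hk.le))
  congr 1
  rw [map_sub, sub_add_sub_cancel]
  rfl

theorem isAdicComplete_adicCompletionIntegers {a : v.adicCompletionIntegers K}
    (ha : ¬ IsUnit a) : IsAdicComplete (Ideal.span {a}) (v.adicCompletionIntegers K) := by
  have hlt : Valued.v (a : v.adicCompletion K) < 1 :=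
    lt_of_le_of_ne a.2 fun h => ha ((adicCompletionIntegers.isUnit_iff_valued_eq_one).2 h)
  refine (isAdicComplete_span_singleton_iff a).2 ⟨fun x hx => ?_, fun f hf => ?_⟩
  · by_contra hx0
    have hx0' : Valued.v (x : v.adicCompletion K) ≠ 0 := by simpa using hx0
    obtain ⟨n, hn⟩ := exists_pow_lt_of_lt_one_of_ne_zero hlt hx0'
    have := (adicCompletionIntegers_dvd_iff v).1 (hx n)
    push_cast [map_pow] at this
    exact absurd hn (not_lt.2 this)
  · have hdiff : ∀ n, Valued.v ((f (n + 1) : v.adicCompletion K) - f n) ≤ Valued.v (a : v.adicCompletion K) ^ n := by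
      intro n
      simpa using (adicCompletionIntegers_dvd_iff v).1 (hf n)
    have hdiff' : ∀ n m, n ≤ m →
        Valued.v ((f m : v.adicCompletion K) - f n) ≤ Valued.v (a : v.adicCompletion K) ^ n := by
      intro n m hnm
      induction m, hnm using Nat.le_induction with
      | base => simp
      | succ m hm ih =>
        rw [← sub_add_sub_cancel _ (f m : v.adicCompletion K)]
        exact (Valued.v.map_add _ _).trans
          (max_le ((hdiff m).trans (pow_le_pow_right_of_le_one' hlt.le hm)) ih)
    have : NonarchimedeanAddGroup (v.adicCompletion K) :=
      ⟨fun U hU => by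
        obtain ⟨γ, hγ⟩ := Valued.mem_nhds_zero.1 hU
        exact ⟨⟨Valued.v.restrict.ltAddSubgroup γ, Valued.isOpen_ball _ _⟩, hγ⟩⟩
    have hcau : CauchySeq fun n => (f n : v.adicCompletion K) := by
      refine NonarchimedeanAddGroup.cauchySeq_of_tendsto_sub_nhds_zero ?_
      rw [tendsto_atTop']
      intro s hs
      obtain ⟨γ, hγ⟩ := Valued.mem_nhds.1 hs
      obtain ⟨n, hn⟩ := exists_pow_lt_of_lt_one_of_ne_zero hlt
        (γ := MonoidWithZeroHom.ValueGroup₀.embedding γ.val)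
        ((map_ne_zero _).2 γ.ne_zero)
      refine ⟨n, fun m hm => hγ ?_⟩
      rw [Set.mem_ofPred_eq, sub_zero, Valuation.restrict_lt_iff_lt_embedding]
      exact ((hdiff m).trans (pow_le_pow_right_of_le_one' hlt.le hm)).trans_lt hn
    obtain ⟨L, hL⟩ := cauchySeq_tendsto_of_complete hcau
    have hle : ∀ n, Valued.v (L - f n) ≤ Valued.v ((a : v.adicCompletion K) ^ n) := fun n =>
      (isClosed_setOf_valued_sub_le v (f n : v.adicCompletion K)
        ((a : v.adicCompletion K) ^ n)).mem_of_tendsto hL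
        (eventually_atTop.2 ⟨n, fun m hm => by simpa using hdiff' n m hm⟩)
    have hL1 : L ∈ v.adicCompletionIntegers K := by
      rw [mem_adicCompletionIntegers]
      have := Valued.v.map_add (L - f 0) (f 0 : v.adicCompletion K)
      rw [sub_add_cancel] at this
      exact this.trans (max_le ((hle 0).trans (by simp)) (f 0).2)
    exact ⟨⟨L, hL1⟩, fun n => (adicCompletionIntegers_dvd_iff v).2 (by simpa using hle n)⟩

theorem valued_algebraMap_adicCompletionIntegers (r : R) :
    Valued.v (algebraMap R (v.adicCompletionIntegers K) r : v.adicCompletion K) =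
      v.intValuation r := by
  rw [← valuation_of_algebraMap (K := K), ← valuedAdicCompletion_eq_valuation (K := K)]
  rfl

theorem finite_quotient_adicCompletionIntegers {r : R} (hr : r ≠ 0)
    (hfin : Finite (R ⧸ Ideal.span {r})) :
    Finite (v.adicCompletionIntegers K ⧸ Ideal.span {algebraMap R (v.adicCompletionIntegers K) r}) := by
  have hr' : algebraMap R (v.adicCompletionIntegers K) r ≠ 0 := by
    simpa using (FaithfulSMul.algebraMap_injective R (v.adicCompletionIntegers K)).ne hr
  let f : R →+* v.adicCompletionIntegers K ⧸ Ideal.span {algebraMap R (v.adicCompletionIntegers K) r} :=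
    (Ideal.Quotient.mk _).comp (algebraMap R _)
  refine Finite.of_surjective (Ideal.Quotient.lift (Ideal.span {r}) f fun a ha => ?_)
    (Ideal.Quotient.lift_surjective_of_surjective _ _ fun y => ?_)
  · obtain ⟨b, rfl⟩ := Ideal.mem_span_singleton.1 ha
    exact Ideal.Quotient.eq_zero_iff_dvd _ _ |>.2 (by rw [map_mul]; exact dvd_mul_right _ _)
  · obtain ⟨x, rfl⟩ := Ideal.Quotient.mk_surjective y
    obtain ⟨s, hs⟩ := exists_adicCompletionIntegers_dvd_sub v hr' x
    exact ⟨s, (Ideal.Quotient.eq.2 (Ideal.mem_span_singleton.2 hs))⟩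

theorem card_quotient_adicCompletionIntegers {r : R} (hr : r ≠ 0) {k : ℕ}
    (hk : v.intValuation r = exp (-(k : ℤ))) :
    Nat.card (v.adicCompletionIntegers K ⧸ Ideal.span {algebraMap R (v.adicCompletionIntegers K) r}) =
      Nat.card (R ⧸ v.asIdeal ^ k) := by
  have hr' : algebraMap R (v.adicCompletionIntegers K) r ≠ 0 := by
    simpa using (FaithfulSMul.algebraMap_injective R (v.adicCompletionIntegers K)).ne hr
  let f : R →+* v.adicCompletionIntegers K ⧸ Ideal.span {algebraMap R (v.adicCompletionIntegers K) r} :=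
    (Ideal.Quotient.mk _).comp (algebraMap R _)
  have hf : Function.Surjective f := fun y => by
    obtain ⟨x, rfl⟩ := Ideal.Quotient.mk_surjective y
    obtain ⟨s, hs⟩ := exists_adicCompletionIntegers_dvd_sub v hr' x
    exact ⟨s, (Ideal.Quotient.eq.2 (Ideal.mem_span_singleton.2 hs))⟩
  have hker : RingHom.ker f = v.asIdeal ^ k := by
    ext a
    rw [RingHom.mem_ker, RingHom.comp_apply, Ideal.Quotient.eq_zero_iff_dvd,
      adicCompletionIntegers_dvd_iff, ← intValuation_le_pow_iff_mem, ← hk,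
      valued_algebraMap_adicCompletionIntegers, valued_algebraMap_adicCompletionIntegers]
  rw [← hker]
  exact (Nat.card_congr (RingHom.quotientKerEquivOfSurjective hf).toEquiv).symm

end AdicCompletion

theorem IsPrimitiveRoot.card_ker_powMonoidHom {F : Type*} [Field F] {p : ℕ} (hp : 0 < p) {ζ : F}
    (hζ : IsPrimitiveRoot ζ p) : Nat.card (powMonoidHom p : Fˣ →* Fˣ).ker = p := by
  have : NeZero p := ⟨hp.ne'⟩
  have h : (powMonoidHom p : Fˣ →* Fˣ).ker = rootsOfUnity p F := by
    ext u
    rw [MonoidHom.mem_ker, mem_rootsOfUnity]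
    rfl
  rw [h]
  exact hζ.card_rootsOfUnity

section NumberFieldCompletion

open IsDedekindDomain HeightOneSpectrum WithZero NumberField

variable {K : Type} [Field K] [NumberField K] (v : HeightOneSpectrum (𝓞 K))

instance : CharZero (v.adicCompletion K) :=
  charZero_of_injective_algebraMap (algebraMap K (v.adicCompletion K)).injective

theorem finite_quotient_adicCompletionIntegers_natCast {m : ℕ} (hm : m ≠ 0) :
    Finite (v.adicCompletionIntegers K ⧸ Ideal.span {(m : v.adicCompletionIntegers K)}) := by
  have h := finite_quotient_adicCompletionIntegers (K := K) v (r := (m : 𝓞 K))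
    (by exact_mod_cast hm)
    (Ideal.finiteQuotientOfFreeOfNeBot _ (by simpa using hm))
  rwa [map_natCast] at h

theorem exists_natCast_not_isUnit :
    ∃ q : ℕ, q ≠ 0 ∧ ¬ IsUnit (q : v.adicCompletionIntegers K) := by
  refine ⟨Ideal.absNorm v.asIdeal, Ideal.absNorm_ne_zero_iff _ |>.2
    (Ideal.finiteQuotientOfFreeOfNeBot _ v.ne_bot), fun h => ?_⟩
  have h1 := (adicCompletionIntegers.isUnit_iff_valued_eq_one).1 h
  have h2 : v.intValuation (Ideal.absNorm v.asIdeal : 𝓞 K) < 1 :=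
    (intValuation_lt_one_iff_mem v _).2 (Ideal.absNorm_mem _)
  rw [← valued_algebraMap_adicCompletionIntegers (K := K), map_natCast] at h2
  exact h2.ne h1

theorem index_normGroup_adicCompletion {p : ℕ} (hp : p.Prime) {ζ b : v.adicCompletion K}
    (hζ : IsPrimitiveRoot ζ p) (hb : ∀ c, c ^ p ≠ b) : (normGroup p ζ b).index = p := by
  obtain ⟨q, hq0, hq⟩ := exists_natCast_not_isUnit v
  have := isAdicComplete_adicCompletionIntegers v hq
  refine index_normGroup_eq hp (ϖ := (q : v.adicCompletionIntegers K)) (by exact_mod_cast hq0) hq ?_ hζ hb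
  have := finite_quotient_adicCompletionIntegers_natCast v (mul_ne_zero hp.ne_zero hq0)
  exact_mod_cast this

theorem hasQ_units_adicCompletion {p : ℕ} (hp : p.Prime) :
    HasQ.pow p (v.adicCompletion K)ˣ
      (p * Nat.card (v.adicCompletionIntegers K ⧸ Ideal.span {(p : v.adicCompletionIntegers K)})) := by
  obtain ⟨q, hq0, hq⟩ := exists_natCast_not_isUnit v
  have := isAdicComplete_adicCompletionIntegers v hq
  have h := hasQ_units_of_finiteDimensional (F := v.adicCompletion K) (E := v.adicCompletion K)
    hp.pos (ϖ := (q : v.adicCompletionIntegers K)) (by exact_mod_cast hq0) hq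
    (by exact_mod_cast finite_quotient_adicCompletionIntegers_natCast v (mul_ne_zero hp.ne_zero hq0))
  simpa using h

theorem index_range_powMonoidHom_adicCompletion {p : ℕ} (hp : p.Prime) {ζ : v.adicCompletion K}
    (hζ : IsPrimitiveRoot ζ p) {k : ℕ} (hk : v.intValuation (p : 𝓞 K) = exp (-(k : ℤ))) :
    (powMonoidHom p : (v.adicCompletion K)ˣ →* _).range.index =
      p ^ 2 * Nat.card (𝓞 K ⧸ v.asIdeal ^ k) := by
  have h := (hasQ_units_adicCompletion v hp).2.2
  rw [hζ.card_ker_powMonoidHom hp.pos] at h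
  have h2 := card_quotient_adicCompletionIntegers (K := K) v (r := (p : 𝓞 K))
    (by exact_mod_cast hp.ne_zero) hk
  rw [map_natCast] at h2
  rw [h2] at h
  have : ((powMonoidHom p : (v.adicCompletion K)ˣ →* _).range.index : ℚ) =
      p ^ 2 * Nat.card (𝓞 K ⧸ v.asIdeal ^ k) := by rw [h]; ring
  exact_mod_cast this

end NumberFieldCompletion

section RealPlace

open Polynomial

theorem Real.eq_two_of_isPrimitiveRoot {p : ℕ} (hp : p.Prime) {ζ : ℝ} (hζ : IsPrimitiveRoot ζ p) :
    p = 2 ∧ ζ = -1 := by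
  have h2 : p = 2 := by
    refine hp.eq_two_or_odd'.resolve_right fun hodd => hζ.ne_one hp.one_lt ?_
    exact hodd.strictMono_pow.injective (by rw [hζ.pow_eq_one, one_pow])
  subst h2
  exact ⟨rfl, (sq_eq_one_iff.1 hζ.pow_eq_one).resolve_left (hζ.ne_one hp.one_lt)⟩

theorem Real.index_range_powMonoidHom {p : ℕ} (hp : p.Prime) {ζ : ℝ} (hζ : IsPrimitiveRoot ζ p) :
    (powMonoidHom p : ℝˣ →* ℝˣ).range.index = p := by
  obtain ⟨rfl, rfl⟩ := Real.eq_two_of_isPrimitiveRoot hp hζ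
  have hmem : ∀ u : ℝˣ, u ∈ (powMonoidHom 2 : ℝˣ →* ℝˣ).range ↔ 0 < (u : ℝ) := by
    intro u
    constructor
    · rintro ⟨w, rfl⟩
      exact sq_pos_of_ne_zero w.ne_zero
    · intro h
      refine ⟨Units.mk0 (√(u : ℝ)) (Real.sqrt_pos.2 h).ne', Units.ext ?_⟩
      simpa using Real.sq_sqrt h.le
  rw [Subgroup.index_eq_two_iff]
  refine ⟨-1, fun b => ?_⟩
  rw [hmem, hmem]
  rcases lt_or_gt_of_ne b.ne_zero with h | h
  · left; simp; exact ⟨h, h.le⟩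
  · right; simp; exact ⟨h, h.le⟩

theorem Real.index_normGroup {p : ℕ} (hp : p.Prime) {ζ b : ℝ} (hζ : IsPrimitiveRoot ζ p)
    (hb : ∀ c, c ^ p ≠ b) : (normGroup p ζ b).index = p := by
  have h1 := Real.index_range_powMonoidHom hp hζ
  obtain ⟨rfl, rfl⟩ := Real.eq_two_of_isPrimitiveRoot hp hζ
  have hdvd := Subgroup.index_dvd_of_le (range_powMonoidHom_le_normGroup two_pos (-1) b)
  rw [h1] at hdvd
  refine ((Nat.dvd_prime Nat.prime_two).1 hdvd).resolve_left fun h => ?_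
  have hneg : (-1 : ℝˣ) ∈ normGroup 2 (-1) b := by
    rw [Subgroup.index_eq_one.1 h]; trivial
  obtain ⟨f, hf⟩ := (mem_normGroup hp.pos).1 hneg
  have hb0 : b < 0 := by
    by_contra! h
    exact hb (√b) (Real.sq_sqrt h)
  set z : ℂ := Complex.I * (√(-b) : ℝ) with hz
  have hz2 : z ^ 2 = (b : ℂ) := by
    rw [hz, mul_pow, Complex.I_sq, ← Complex.ofReal_pow, Real.sq_sqrt (by linarith)]
    push_cast; ring
  have hconj : (starRingEnd ℂ) z = -z := by simp [hz]
  obtain ⟨g, hg⟩ := hf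
  have := congrArg (aeval z) hg
  simp only [Finset.prod_range_succ, Finset.prod_range_zero, map_sub, map_mul, aeval_comp] at this
  simp [hz2] at this
  rw [← hconj, aeval_conj, Complex.mul_conj] at this
  have h3 : (Complex.normSq (aeval z f) : ℝ) + 1 = 0 := by exact_mod_cast this
  linarith [Complex.normSq_nonneg (aeval z f)]

end RealPlace

section WeakApproximation

open IsDedekindDomain HeightOneSpectrum WithZero NumberField

variable {K : Type} [Field K] [NumberField K]

theorem exists_adicAbv_sub_lt (S : Finset (HeightOneSpectrum (𝓞 K)))
    (a : HeightOneSpectrum (𝓞 K) → K) (b : InfinitePlace K → K) {ε : ℝ} (hε : 0 < ε) :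
    ∃ k : K, (∀ v ∈ S, NumberField.HeightOneSpectrum.adicAbv K v (k - a v) < ε) ∧ ∀ w : InfinitePlace K, w (k - b w) < ε := by
  classical
  let V : S ⊕ InfinitePlace K → AbsoluteValue K ℝ :=
    Sum.elim (fun v => NumberField.HeightOneSpectrum.adicAbv K v.1) (fun w => w.1)
  have hval : ∀ (v : HeightOneSpectrum (𝓞 K)) (x : K),
      NumberField.HeightOneSpectrum.adicAbv K v x < 1 ↔ v.valuation K x < 1 := fun v x => by
    rw [NumberField.HeightOneSpectrum.adicAbv_def]
    exact_mod_cast WithZeroMulInt.toNNReal_lt_one_iff (NumberField.HeightOneSpectrum.one_lt_absNorm_nnreal v)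
  have hfi : ∀ (v : HeightOneSpectrum (𝓞 K)) (w : InfinitePlace K),
      ¬ (NumberField.HeightOneSpectrum.adicAbv K v).IsEquiv w.1 := fun v w h => by
    have h1 := h.le_one_iff.1 (NumberField.HeightOneSpectrum.adicAbv_natCast_le_one K v 2)
    have h2 : w.1 ((2 : ℕ) : K) = 2 := by
      rw [← InfinitePlace.coe_apply, InfinitePlace.map_natCast w 2]; norm_num
    rw [h2] at h1
    norm_num at h1
  have hnt : ∀ i, (V i).IsNontrivial := by
    rintro (v | w)
    · obtain ⟨π, hπ⟩ := v.1.valuation_exists_uniformizer K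
      have hlt : v.1.valuation K π < 1 := by rw [hπ]; decide
      exact ⟨π, fun h => exp_ne_zero (hπ.symm.trans (by rw [h, map_zero])), ((hval _ _).2 hlt).ne⟩
    · exact w.isNontrivial
  have hne : Pairwise fun i j => ¬ (V i).IsEquiv (V j) := by
    rintro (v | w) (v' | w') hij h
    · refine hij (congrArg Sum.inl (Subtype.ext ?_))
      refine eq_of_valuation_isEquiv_valuation (K := K) ?_
      rw [Valuation.isEquiv_iff_val_lt_one]
      intro x
      rw [← hval, ← hval]
      exact h.lt_one_iff
    · exact hfi _ _ h
    · exact hfi _ _ h.symm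
    · exact hij (congrArg Sum.inr (InfinitePlace.eq_iff_isEquiv.2 h))
  have hd := AbsoluteValue.denseRange_algebraMap_pi hnt hne
  obtain ⟨k, hk⟩ := Metric.denseRange_iff.1 hd
    (fun i => (WithAbs.equiv (V i)).symm (Sum.elim (fun v => a v.1) b i)) ε hε
  rw [dist_comm, dist_pi_lt_iff hε] at hk
  refine ⟨k, fun v hv => ?_, fun w => ?_⟩
  · have := hk (.inl ⟨v, hv⟩)
    rw [dist_eq_norm] at this
    exact this
  · have := hk (.inr w)
    rw [dist_eq_norm] at this
    exact this

theorem weak_approximation (S : Finset (HeightOneSpectrum (𝓞 K)))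
    (a : ∀ v : HeightOneSpectrum (𝓞 K), v.adicCompletion K) {γ : ℤᵐ⁰} (hγ : γ ≠ 0)
    (b : ∀ _ : {w : InfinitePlace K // w.IsReal}, ℝ) {ε : ℝ} (hε : 0 < ε) :
    ∃ k : K, (∀ v ∈ S, Valued.v (algebraMap K (v.adicCompletion K) k - a v) < γ) ∧
      ∀ w : {w : InfinitePlace K // w.IsReal}, |InfinitePlace.embedding_of_isReal w.2 k - b w| < ε := by
  classical
  choose a' ha' using fun v => exists_valued_sub_lt v (a v) hγ
  choose q hq using fun w => exists_rat_btwn (show b w - ε / 2 < b w by linarith)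
  obtain ⟨δ, hδ, hδS⟩ : ∃ δ : ℝ, 0 < δ ∧ ∀ v ∈ S,
      δ ≤ WithZeroMulInt.toNNReal (NumberField.HeightOneSpectrum.absNorm_ne_zero v) γ := by
    by_cases hS : S.Nonempty
    · obtain ⟨v, hv, hmin⟩ := S.exists_min_image
        (fun v => WithZeroMulInt.toNNReal (NumberField.HeightOneSpectrum.absNorm_ne_zero v) γ) hS
      exact ⟨_, NNReal.coe_pos.2 (WithZeroMulInt.toNNReal_pos _ hγ), fun v hv => by exact_mod_cast hmin v hv⟩
    · exact ⟨1, one_pos, fun v hv => absurd ⟨v, hv⟩ hS⟩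
  obtain ⟨k, hk, hk'⟩ := exists_adicAbv_sub_lt S a'
    (fun w => if h : w.IsReal then (q ⟨w, h⟩ : K) else 0) (lt_min hδ (half_pos hε))
  refine ⟨k, fun v hv => ?_, fun w => ?_⟩
  · have h1 := (hk v hv).trans_le ((min_le_left _ _).trans (hδS v hv))
    rw [NumberField.HeightOneSpectrum.adicAbv_def] at h1
    have h2 : v.valuation K (k - a' v) < γ :=
      (WithZeroMulInt.toNNReal_strictMono (NumberField.HeightOneSpectrum.one_lt_absNorm_nnreal v)).lt_iff_lt.1
        (by exact_mod_cast h1)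
    rw [← sub_add_sub_cancel _ (algebraMap K (v.adicCompletion K) (a' v)), ← map_sub]
    refine (Valued.v.map_add _ _).trans_lt (max_lt ?_ (ha' v))
    rw [← valuedAdicCompletion_eq_valuation'] at h2
    exact h2
  · have h1 := (hk' w.1).trans_le (min_le_right _ _)
    rw [dif_pos w.2, ← InfinitePlace.norm_embedding_of_isReal w.2, Real.norm_eq_abs, map_sub,
      map_ratCast] at h1
    have h2 := hq w
    rw [abs_lt] at h1 ⊢
    constructor <;> linarith [h2.1, h2.2]

end WeakApproximation

section LocalSubgroups

/-- The units of `K` which become `p`-th powers under `i : K →+* F`. -/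
def powSubgroup (p : ℕ) {K F : Type*} [Field K] [Field F] (i : K →+* F) : Subgroup Kˣ :=
  (powMonoidHom p : Fˣ →* Fˣ).range.comap (Units.map (i : K →* F))

/-- The units of `K` which become norms from `F(x^{1/p})` under `i : K →+* F`. -/
def normSubgroup (p : ℕ) {K F : Type*} [Field K] [Field F] (ζ x : K) (i : K →+* F) :
    Subgroup Kˣ :=
  (normGroup p (i ζ) (i x)).comap (Units.map (i : K →* F))

variable {p : ℕ} {K F : Type*} [Field K] [Field F] {i : K →+* F}

theorem mem_powSubgroup (hp : 0 < p) {a : Kˣ} : a ∈ powSubgroup p i ↔ ∃ c : F, c ^ p = i a := by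
  rw [powSubgroup, Subgroup.mem_comap, MonoidHom.mem_range]
  constructor
  · rintro ⟨c, hc⟩
    exact ⟨c, by simpa using congrArg Units.val hc⟩
  · rintro ⟨c, hc⟩
    have hc0 : c ≠ 0 := by
      rintro rfl
      rw [zero_pow hp.ne'] at hc
      exact (Units.map (i : K →* F) a).ne_zero hc.symm
    exact ⟨Units.mk0 c hc0, by ext; simpa using hc⟩

theorem mem_normSubgroup (hp : 0 < p) {ζ x : K} {a : Kˣ} :
    a ∈ normSubgroup p ζ x i ↔ NormP p (i ζ) (i x) (i a) := by
  rw [normSubgroup, Subgroup.mem_comap, mem_normGroup hp]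
  rfl

theorem pow_mem_powSubgroup (hp : 0 < p) (a : Kˣ) : a ^ p ∈ powSubgroup p i :=
  (mem_powSubgroup hp).2 ⟨i a, by simp⟩

theorem powSubgroup_le_normSubgroup (hp : 0 < p) (ζ x : K) (i : K →+* F) :
    powSubgroup p i ≤ normSubgroup p ζ x i :=
  Subgroup.comap_mono (range_powMonoidHom_le_normGroup hp _ _)

theorem normSubgroup_eq_top (hp : 0 < p) {ζ : K} (hζ : IsPrimitiveRoot ζ p) {x : Kˣ}
    (hx : x ∈ powSubgroup p i) : normSubgroup p ζ x i = ⊤ := by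
  obtain ⟨c, hc⟩ := (mem_powSubgroup hp).1 hx
  have hc0 : c ≠ 0 := by
    rintro rfl
    rw [zero_pow hp.ne'] at hc
    exact (Units.map (i : K →* F) x).ne_zero hc.symm
  rw [normSubgroup, ← hc, normGroup_pow hp (hζ.map_of_injective i.injective) hc0]
  rfl

theorem index_comap_unitsMap (H : Subgroup Fˣ)
    (h : ∀ u : Fˣ, ∃ a : Kˣ, (u⁻¹ * Units.map (i : K →* F) a) ∈ H) :
    (H.comap (Units.map (i : K →* F))).index = H.index := by
  rw [Subgroup.index_comap]
  rw [← Subgroup.relIndex_sup_left, ← Subgroup.relIndex_top_right]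
  congr 1
  rw [eq_top_iff]
  intro u _
  obtain ⟨a, ha⟩ := h u
  have : u = Units.map (i : K →* F) a * (u⁻¹ * Units.map (i : K →* F) a)⁻¹ := by
    rw [mul_inv, inv_inv, mul_left_comm, mul_inv_cancel, mul_one]
  rw [this]
  exact mul_mem (Subgroup.mem_sup_right ⟨a, rfl⟩) (Subgroup.mem_sup_left (inv_mem ha))

end LocalSubgroups

section NearOne

open IsDedekindDomain HeightOneSpectrum WithZero NumberField

variable {K : Type} [Field K] [NumberField K] (v : HeightOneSpectrum (𝓞 K)) {p : ℕ}

theorem exists_pow_eq_of_valued_sub_one_le (hp : 0 < p) {ϖ : v.adicCompletionIntegers K} (hϖ0 : ϖ ≠ 0)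
    (hϖ : ¬ IsUnit ϖ) {u : v.adicCompletion K}
    (hu : Valued.v (u - 1) ≤ Valued.v ((p : v.adicCompletion K) * (p * ϖ))) :
    ∃ c, c ^ p = u := by
  have := isAdicComplete_adicCompletionIntegers v hϖ
  have hp0 : (p : v.adicCompletionIntegers K) ≠ 0 := by exact_mod_cast hp.ne'
  have hlt : Valued.v (ϖ : v.adicCompletion K) < 1 :=
    lt_of_le_of_ne ϖ.2 fun h => hϖ ((adicCompletionIntegers.isUnit_iff_valued_eq_one).2 h)
  have hp1 : Valued.v (p : v.adicCompletion K) ≤ 1 := (p : v.adicCompletionIntegers K).2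
  have h1 : Valued.v (u - 1) < 1 := by
    refine hu.trans_lt ?_
    rw [map_mul, map_mul]
    exact mul_lt_one_of_nonneg_of_lt_one_right hp1 zero_le' (mul_lt_one_of_nonneg_of_lt_one_right hp1 zero_le' hlt)
  have hu1 : Valued.v u = 1 := by
    have := Valuation.map_one_add_of_lt (v := Valued.v) h1
    rwa [add_sub_cancel] at this
  let u' : v.adicCompletionIntegers K := ⟨u, hu1.le⟩
  have hu' : IsUnit u' := adicCompletionIntegers.isUnit_iff_valued_eq_one.2 hu1
  obtain ⟨c, -, hc⟩ := exists_pow_eq_of_mem_congrUnits (p := p) (ϖ := ϖ) (w := hu'.unit)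
    ((adicCompletionIntegers_dvd_iff v).2 hu)
  refine ⟨((c : v.adicCompletionIntegers K) : v.adicCompletion K), ?_⟩
  have := congrArg (fun x : (v.adicCompletionIntegers K)ˣ => ((x : v.adicCompletionIntegers K) : v.adicCompletion K)) hc
  simpa using this

theorem exists_forall_valued_sub_one_lt (hp : 0 < p) :
    ∃ γ : ℤᵐ⁰, γ ≠ 0 ∧ γ ≤ 1 ∧ ∀ u : v.adicCompletion K,
    Valued.v (u - 1) < γ → ∃ c, c ^ p = u := by
  obtain ⟨q, hq0, hq⟩ := exists_natCast_not_isUnit v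
  refine ⟨Valued.v ((p : v.adicCompletion K) * (p * q)), ?_,
    (p * (p * q) : v.adicCompletionIntegers K).2, fun u hu => ?_⟩
  · rw [Valuation.ne_zero_iff]
    have : (p : v.adicCompletion K) ≠ 0 := by exact_mod_cast hp.ne'
    have : (q : v.adicCompletion K) ≠ 0 := by exact_mod_cast hq0
    positivity
  · exact exists_pow_eq_of_valued_sub_one_le v hp (ϖ := (q : v.adicCompletionIntegers K))
      (by exact_mod_cast hq0) hq (by simpa using hu.le)

theorem exists_pow_eq_of_valued_sub_one_lt_one (hp : 0 < p)
    (hpv : v.valuation K (p : K) = 1) {u : v.adicCompletion K} (hu : Valued.v (u - 1) < 1) :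
    ∃ c, c ^ p = u := by
  by_cases h1 : u = 1
  · exact ⟨1, by rw [h1, one_pow]⟩
  obtain ⟨ϖ, hϖ⟩ : ∃ ϖ : v.adicCompletionIntegers K, (ϖ : v.adicCompletion K) = u - 1 :=
    ⟨⟨u - 1, hu.le⟩, rfl⟩
  have hpv' : Valued.v (p : v.adicCompletion K) = 1 := by
    have := valuedAdicCompletion_eq_valuation' v (p : K)
    rw [hpv] at this
    rw [← this]
    congr 1
    exact (map_natCast (algebraMap K (v.adicCompletion K)) p).symm
  refine exists_pow_eq_of_valued_sub_one_le v hp (ϖ := ϖ) ?_ ?_ ?_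
  · rintro rfl
    exact h1 (sub_eq_zero.1 hϖ.symm)
  · intro h
    rw [adicCompletionIntegers.isUnit_iff_valued_eq_one, hϖ] at h
    exact hu.ne h
  · rw [hϖ, Valuation.map_mul, Valuation.map_mul, hpv', one_mul, one_mul]

theorem mem_powSubgroup_of_valuation_sub_lt_one (hp : 0 < p)
    (hpv : v.valuation K (p : K) = 1) {x : Kˣ} (hx : v.valuation K (x : K) = 1) {z : K}
    (hz : v.valuation K (x - z ^ p) < 1) : x ∈ powSubgroup p (algebraMap K (v.adicCompletion K)) := by
  have hz1 : v.valuation K (z ^ p) = 1 := by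
    have := Valuation.map_sub_eq_of_lt_left (v.valuation K) (hz.trans_eq hx.symm)
    rw [sub_sub_cancel] at this
    exact this.trans hx
  have hz0 : z ^ p ≠ 0 := fun h => by rw [h, map_zero] at hz1; exact zero_ne_one hz1
  have h : Valued.v (algebraMap K (v.adicCompletion K) (x / z ^ p) - 1) < 1 := by
    rw [← map_one (algebraMap K (v.adicCompletion K)), ← map_sub, div_sub_one hz0]
    refine (valuedAdicCompletion_eq_valuation' v _).trans_lt ?_
    rw [Algebra.algebraMap_self_apply, map_div₀, hz1, div_one]
    exact hz
  obtain ⟨c, hc⟩ := exists_pow_eq_of_valued_sub_one_lt_one v hp hpv h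
  refine (mem_powSubgroup hp).2 ⟨c * algebraMap K _ z, ?_⟩
  rw [mul_pow, hc, ← map_pow, ← map_mul, div_mul_cancel₀ _ hz0]

end NearOne

section Places

open IsDedekindDomain HeightOneSpectrum WithZero NumberField

/-- The finite and real places of a number field. -/
abbrev Place (K : Type) [Field K] [NumberField K] : Type :=
  HeightOneSpectrum (𝓞 K) ⊕ {w : InfinitePlace K // w.IsReal}

variable {K : Type} [Field K] [NumberField K] {p : ℕ}

noncomputable instance : Fintype {w : InfinitePlace K // w.IsReal} := Fintype.ofFinite _

/-- A finite set of finite places, together with all the real places. -/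
noncomputable def withReal (S : Finset (HeightOneSpectrum (𝓞 K))) : Finset (Place K) :=
  S.disjSum Finset.univ

@[simp] theorem inl_mem_withReal {S : Finset (HeightOneSpectrum (𝓞 K))}
    {v : HeightOneSpectrum (𝓞 K)} : .inl v ∈ withReal S ↔ v ∈ S := by simp [withReal]

@[simp] theorem inr_mem_withReal (S : Finset (HeightOneSpectrum (𝓞 K)))
    (w : {w : InfinitePlace K // w.IsReal}) : .inr w ∈ withReal S := by simp [withReal]

/-- The elements of `Kˣ` which are `p`-th powers at a place. -/
noncomputable def placePow (p : ℕ) : Place K → Subgroup Kˣ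
  | .inl v => powSubgroup p (algebraMap K (v.adicCompletion K))
  | .inr w => powSubgroup p (InfinitePlace.embedding_of_isReal w.2)

/-- The elements of `Kˣ` which are norms from `K(x^{1/p})` at a place. -/
noncomputable def placeNorm (p : ℕ) (ζ x : K) : Place K → Subgroup Kˣ
  | .inl v => normSubgroup p ζ x (algebraMap K (v.adicCompletion K))
  | .inr w => normSubgroup p ζ x (InfinitePlace.embedding_of_isReal w.2)

theorem pow_mem_placePow (hp : 0 < p) (a : Kˣ) (P : Place K) : a ^ p ∈ placePow p P := by
  rcases P with v | w <;> exact pow_mem_powSubgroup hp a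

theorem placePow_le_placeNorm (hp : 0 < p) (ζ x : K) (P : Place K) :
    placePow p P ≤ placeNorm p ζ x P := by
  rcases P with v | w <;> exact powSubgroup_le_normSubgroup hp _ _ _

theorem placeNorm_eq_top (hp : 0 < p) {ζ : K} (hζ : IsPrimitiveRoot ζ p) {x : Kˣ} {P : Place K}
    (hx : x ∈ placePow p P) : placeNorm p ζ x P = ⊤ := by
  rcases P with v | w <;> exact normSubgroup_eq_top hp hζ hx

theorem exists_units_approx (hp : 0 < p) (S : Finset (HeightOneSpectrum (𝓞 K)))
    (a : ∀ v : HeightOneSpectrum (𝓞 K), (v.adicCompletion K)ˣ)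
    (b : {w : InfinitePlace K // w.IsReal} → ℝˣ) :
    ∃ k : Kˣ, (∀ v ∈ S, ∃ c, c ^ p = (a v : v.adicCompletion K)⁻¹ * algebraMap K _ (k : K)) ∧
      ∀ w, ∃ c, c ^ p = (b w : ℝ)⁻¹ * InfinitePlace.embedding_of_isReal w.2 (k : K) := by
  choose γ hγ hγ1 hγ' using fun v : HeightOneSpectrum (𝓞 K) => exists_forall_valued_sub_one_lt v hp
  obtain ⟨δ, hδ, hδS⟩ : ∃ δ : ℤᵐ⁰, δ ≠ 0 ∧ ∀ v ∈ S, δ ≤ γ v * Valued.v (a v : v.adicCompletion K) := by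
    by_cases hS : S.Nonempty
    · obtain ⟨v, hv, hmin⟩ := S.exists_min_image
        (fun v => γ v * Valued.v (a v : v.adicCompletion K)) hS
      exact ⟨_, mul_ne_zero (hγ v) ((Valuation.ne_zero_iff _).2 (a v).ne_zero), hmin⟩
    · exact ⟨1, one_ne_zero, fun v hv => absurd ⟨v, hv⟩ hS⟩
  obtain ⟨ε, hε, hεb⟩ : ∃ ε : ℝ, 0 < ε ∧ ∀ w, ε ≤ |(b w : ℝ)| := by
    by_cases hS : Nonempty {w : InfinitePlace K // w.IsReal}
    · obtain ⟨w, hmin⟩ := Finite.exists_min fun w => |(b w : ℝ)|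
      exact ⟨_, abs_pos.2 (b w).ne_zero, hmin⟩
    · exact ⟨1, one_pos, fun w => absurd ⟨w⟩ hS⟩
  obtain ⟨k, hk, hk'⟩ := weak_approximation S (fun v => (a v : v.adicCompletion K)) hδ
    (fun w => (b w : ℝ)) hε
  have h1 : ∀ v ∈ S, ∃ c, c ^ p = (a v : v.adicCompletion K)⁻¹ * algebraMap K _ (k : K) := fun v hv => by
    refine hγ' v _ ?_
    have h := (hk v hv).trans_le (hδS v hv)
    have ha : Valued.v (a v : v.adicCompletion K) ≠ 0 := (Valuation.ne_zero_iff _).2 (a v).ne_zero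
    have h2 : (a v : v.adicCompletion K)⁻¹ * algebraMap K _ (k : K) - 1 =
        (algebraMap K _ (k : K) - a v) * (a v : v.adicCompletion K)⁻¹ := by
      rw [sub_mul, mul_inv_cancel₀ (a v).ne_zero, mul_comm]
    rw [h2, Valuation.map_mul, map_inv₀]
    exact (mul_inv_lt_iff₀ (zero_lt_iff.2 ha)).2 h
  have h2 : ∀ w, 0 < (b w : ℝ)⁻¹ * InfinitePlace.embedding_of_isReal w.2 (k : K) := fun w => by
    have h := (hk' w).trans_le (hεb w)
    set t := InfinitePlace.embedding_of_isReal w.2 (k : K)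
    rcases lt_or_gt_of_ne (b w).ne_zero with hb | hb
    · rw [abs_of_neg hb, abs_lt] at h
      exact mul_pos_of_neg_of_neg (inv_lt_zero.2 hb) (by linarith [h.2])
    · rw [abs_of_pos hb, abs_lt] at h
      exact mul_pos (inv_pos.2 hb) (by linarith [h.1])
  have h3 : ∀ w, ∃ c, c ^ p = (b w : ℝ)⁻¹ * InfinitePlace.embedding_of_isReal w.2 (k : K) := fun w =>
    ⟨_, Real.rpow_inv_natCast_pow (h2 w).le hp.ne'⟩
  by_cases hk0 : k = 0
  · refine ⟨1, fun v hv => ?_, fun w => ?_⟩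
    · have h := (hk v hv).trans_le (hδS v hv)
      rw [hk0, map_zero, zero_sub, Valuation.map_neg] at h
      exact absurd h (not_lt.2 (mul_le_of_le_one_left' (hγ1 v)))
    · have := h2 w
      rw [hk0, map_zero, mul_zero] at this
      exact absurd this (lt_irrefl _)
  · exact ⟨Units.mk0 k hk0, h1, h3⟩

theorem exists_forall_inv_mul_mem_placePow (hp : 0 < p) (S : Finset (HeightOneSpectrum (𝓞 K)))
    (a : Place K → Kˣ) :
    ∃ k : Kˣ, ∀ P ∈ withReal S, (a P)⁻¹ * k ∈ placePow p P := by
  obtain ⟨k, hk, hk'⟩ := exists_units_approx hp S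
    (fun v => Units.map (algebraMap K (v.adicCompletion K) : K →* v.adicCompletion K) (a (.inl v)))
    (fun w => Units.map (InfinitePlace.embedding_of_isReal w.2 : K →* ℝ) (a (.inr w)))
  refine ⟨k, ?_⟩
  rintro (v | w) hP
  · obtain ⟨c, hc⟩ := hk v (by simpa using hP)
    exact (mem_powSubgroup hp).2 ⟨c, by simpa using hc⟩
  · obtain ⟨c, hc⟩ := hk' w
    exact (mem_powSubgroup hp).2 ⟨c, by simpa using hc⟩

theorem index_comap_adicCompletion (hp : 0 < p) (v : HeightOneSpectrum (𝓞 K))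
    (H : Subgroup (v.adicCompletion K)ˣ) (hH : (powMonoidHom p).range ≤ H) :
    (H.comap (Units.map (algebraMap K (v.adicCompletion K) : K →* v.adicCompletion K))).index =
      H.index := by
  refine index_comap_unitsMap H fun u => ?_
  obtain ⟨k, hk, -⟩ := exists_units_approx (K := K) hp {v}
    (fun w => open Classical in if h : v = w then h ▸ u else 1) 1
  obtain ⟨c, hc⟩ := hk v (Finset.mem_singleton_self v)
  rw [dif_pos rfl] at hc
  refine ⟨k, hH ?_⟩
  have hc0 : c ≠ 0 := by
    rintro rfl
    rw [zero_pow hp.ne'] at hc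
    exact mul_ne_zero (inv_ne_zero u.ne_zero) ((map_ne_zero _).2 k.ne_zero) hc.symm
  exact ⟨Units.mk0 c hc0, Units.ext (hc.trans (by rw [Units.val_mul, Units.val_inv_eq_inv_val]; rfl))⟩

theorem index_comap_embedding_of_isReal (hp : 0 < p) (w : {w : InfinitePlace K // w.IsReal})
    (H : Subgroup ℝˣ) (hH : (powMonoidHom p).range ≤ H) :
    (H.comap (Units.map (InfinitePlace.embedding_of_isReal w.2 : K →* ℝ))).index = H.index := by
  refine index_comap_unitsMap H fun u => ?_
  obtain ⟨k, -, hk⟩ := exists_units_approx (K := K) hp ∅ 1 (fun _ => u)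
  obtain ⟨c, hc⟩ := hk w
  refine ⟨k, hH ?_⟩
  have hc0 : c ≠ 0 := by
    rintro rfl
    rw [zero_pow hp.ne'] at hc
    exact mul_ne_zero (inv_ne_zero u.ne_zero) ((map_ne_zero _).2 k.ne_zero) hc.symm
  exact ⟨Units.mk0 c hc0, by ext; simpa using hc⟩

theorem index_placeNorm (hp : p.Prime) {ζ : K} (hζ : IsPrimitiveRoot ζ p) {x : Kˣ} {P : Place K}
    (hx : x ∉ placePow p P) : (placeNorm p ζ (x : K) P).index = p := by
  rcases P with v | w
  · refine (index_comap_adicCompletion hp.pos v _ (range_powMonoidHom_le_normGroup hp.pos _ _)).trans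
      (index_normGroup_adicCompletion v hp (hζ.map_of_injective (algebraMap K _).injective)
        fun c hc => hx ((mem_powSubgroup hp.pos).2 ⟨c, hc⟩))
  · refine (index_comap_embedding_of_isReal hp.pos w _ (range_powMonoidHom_le_normGroup hp.pos _ _)).trans
      (Real.index_normGroup hp (hζ.map_of_injective (RingHom.injective _))
        fun c hc => hx ((mem_powSubgroup hp.pos).2 ⟨c, hc⟩))

theorem index_placePow_inl (hp : p.Prime) {ζ : K} (hζ : IsPrimitiveRoot ζ p)
    (v : HeightOneSpectrum (𝓞 K)) {k : ℕ} (hk : v.intValuation (p : 𝓞 K) = exp (-(k : ℤ))) :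
    (placePow p (.inl v : Place K)).index = p ^ 2 * Nat.card (𝓞 K ⧸ v.asIdeal ^ k) :=
  (index_comap_adicCompletion hp.pos v _ le_rfl).trans
    (index_range_powMonoidHom_adicCompletion v hp
      (hζ.map_of_injective (algebraMap K _).injective) hk)

theorem index_placePow_inr (hp : p.Prime) {ζ : K} (hζ : IsPrimitiveRoot ζ p)
    (w : {w : InfinitePlace K // w.IsReal}) : (placePow p (.inr w : Place K)).index = p :=
  (index_comap_embedding_of_isReal hp.pos w _ le_rfl).trans
    (Real.index_range_powMonoidHom hp (hζ.map_of_injective (InfinitePlace.embedding_of_isReal w.2).injective))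

theorem exists_intValuation_natCast_eq (hp : 0 < p) (v : HeightOneSpectrum (𝓞 K)) :
    ∃ k : ℕ, v.intValuation (p : 𝓞 K) = exp (-(k : ℤ)) :=
  ⟨_, v.intValuation_if_neg (by exact_mod_cast hp.ne')⟩

theorem prod_card_quotient_le (hp : 0 < p) (S : Finset (HeightOneSpectrum (𝓞 K)))
    (k : HeightOneSpectrum (𝓞 K) → ℕ)
    (hk : ∀ v, v.intValuation (p : 𝓞 K) = exp (-(k v : ℤ))) :
    ∏ v ∈ S, Nat.card (𝓞 K ⧸ v.asIdeal ^ k v) ≤ p ^ Module.finrank ℚ K := by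
  have h1 : ∏ v ∈ S, v.asIdeal ^ k v ∣ Ideal.span {(p : 𝓞 K)} := by
    refine Finset.prod_dvd_of_coprime ?_ fun v _ => ?_
    · intro v _ w _ hvw
      refine IsCoprime.pow ?_
      rw [Ideal.isCoprime_iff_sup_eq]
      exact v.isMaximal.coprime_of_ne w.isMaximal fun h => hvw (HeightOneSpectrum.ext h)
    · rw [← intValuation_le_pow_iff_dvd]
      exact (hk v).le
  have h2 := Ideal.absNorm_dvd_absNorm_of_le (Ideal.le_of_dvd h1)
  rw [map_prod] at h2
  rw [Ideal.absNorm_span_singleton] at h2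
  have h3 : Algebra.norm ℤ (p : 𝓞 K) = p ^ Module.finrank ℚ K := by
    have := Algebra.norm_algebraMap (S := 𝓞 K) (p : ℤ)
    rw [RingOfIntegers.rank] at this
    simpa using this
  rw [h3, Int.natAbs_pow, Int.natAbs_natCast] at h2
  refine le_trans (le_of_eq ?_) (Nat.le_of_dvd (pow_pos hp _) h2)
  exact Finset.prod_congr rfl fun v _ => rfl

theorem prod_index_placePow_le (hp : p.Prime) {ζ : K} (hζ : IsPrimitiveRoot ζ p)
    (S : Finset (HeightOneSpectrum (𝓞 K))) :
    ∏ P ∈ withReal S, (placePow p P).index ≤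
      p ^ (2 * (S.card + Fintype.card (InfinitePlace K))) := by
  choose k hk using fun v => exists_intValuation_natCast_eq (K := K) hp.pos v
  rw [withReal, Finset.prod_disjSum, Finset.prod_congr rfl fun v _ => index_placePow_inl hp hζ v (hk v),
    Finset.prod_congr rfl fun w _ => index_placePow_inr hp hζ w, Finset.prod_mul_distrib,
    Finset.prod_const, Finset.prod_const, Finset.card_univ]
  refine (Nat.mul_le_mul_right _ (Nat.mul_le_mul_left _ (prod_card_quotient_le hp.pos S k hk))).trans
    (le_of_eq ?_)
  rw [← pow_mul, ← pow_add, ← pow_add]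
  congr 1
  have h1 := InfinitePlace.card_add_two_mul_card_eq_rank K
  have h2 := InfinitePlace.card_eq_nrRealPlaces_add_nrComplexPlaces K
  have h3 : Fintype.card {w : InfinitePlace K // w.IsReal} = InfinitePlace.nrRealPlaces K := by
     rw [InfinitePlace.nrRealPlaces]; congr!
  omega

end Places

section IndexInf

theorem Subgroup.index_iInf_of_forall_exists {G ι : Type*} [CommGroup G] (T : Finset ι) (H : ι → Subgroup G)
    (h : ∀ a : ι → G, ∃ k, ∀ i ∈ T, (a i)⁻¹ * k ∈ H i) :
    (⨅ i ∈ T, H i).index = ∏ i ∈ T, (H i).index := by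
  let φ : G →* ((i : T) → G ⧸ H i) := Pi.monoidHom fun i => QuotientGroup.mk' (H i)
  have hker : φ.ker = ⨅ i ∈ T, H i := by
    ext x
    simp only [MonoidHom.mem_ker, Subgroup.mem_iInf, funext_iff, Subtype.forall]
    exact forall₂_congr fun i _ => QuotientGroup.eq_one_iff x
  have hsurj : Function.Surjective φ := fun y => by
    classical
    choose a ha using fun i : T => QuotientGroup.mk'_surjective (H i) (y i)
    obtain ⟨k, hk⟩ := h fun i => if hi : i ∈ T then a ⟨i, hi⟩ else 1
    refine ⟨k, funext fun i => ?_⟩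
    have := hk i i.2
    rw [dif_pos i.2] at this
    rw [← ha i]
    exact (QuotientGroup.eq.2 this).symm
  rw [← hker, Subgroup.index_ker, MonoidHom.range_eq_top.2 hsurj, Subgroup.card_top, Nat.card_pi,
    ← Finset.prod_coe_sort T fun i => (H i).index]
  rfl

theorem hasQ_pow_pi {p : ℕ} {ι A : Type*} [Fintype ι] [CommGroup A] {x : ℚ} (h : HasQ.pow p A x) :
    HasQ.pow p (ι → A) (x ^ Fintype.card ι) := by
  have h1 : (powMonoidHom p : (ι → A) →* _).range = Subgroup.pi Set.univ fun _ => (powMonoidHom p : A →* A).range := by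
    ext f
    simp only [MonoidHom.mem_range, Subgroup.mem_pi, Set.mem_univ, true_imp_iff, powMonoidHom_apply]
    constructor
    · rintro ⟨g, rfl⟩ i
      exact ⟨g i, rfl⟩
    · intro hf
      choose g hg using hf
      exact ⟨g, funext hg⟩
  let e : (powMonoidHom p : (ι → A) →* _).ker ≃ (ι → (powMonoidHom p : A →* A).ker) :=
    { toFun := fun f i => ⟨f.1 i, congrFun f.2 i⟩
      invFun := fun f => ⟨fun i => f i, funext fun i => (f i).2⟩
      left_inv := fun f => rfl
      right_inv := fun f => rfl }
  obtain ⟨ha, hb, hc⟩ := h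
  have h2 : (powMonoidHom p : (ι → A) →* _).range.index =
      (powMonoidHom p : A →* A).range.index ^ Fintype.card ι := by
    rw [h1, Subgroup.index_pi, Finset.prod_const, Finset.card_univ]
  refine ⟨?_, Finite.of_equiv _ e.symm, ?_⟩
  · rw [h2]
    exact pow_ne_zero _ ha
  · rw [h2, Nat.card_congr e, Nat.card_fun, Nat.card_eq_fintype_card (α := ι)]
    push_cast
    rw [hc, mul_pow]

end IndexInf

section SUnits

open IsDedekindDomain HeightOneSpectrum WithZero NumberField
open scoped nonZeroDivisors

variable {K : Type} [Field K] [NumberField K]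

/-- The group of `S`-units of a number field. -/
def sUnits (S : Finset (HeightOneSpectrum (𝓞 K))) : Subgroup Kˣ where
  carrier := {x | ∀ v ∉ S, v.valuation K (x : K) = 1}
  one_mem' := fun v _ => by simp
  mul_mem' := fun ha hb v hv => by simp [ha v hv, hb v hv]
  inv_mem' := fun ha v hv => by simp [ha v hv]

theorem mem_sUnits {S : Finset (HeightOneSpectrum (𝓞 K))} {x : Kˣ} :
    x ∈ sUnits S ↔ ∀ v ∉ S, v.valuation K (x : K) = 1 := Iff.rfl

theorem sUnits_mono {S T : Finset (HeightOneSpectrum (𝓞 K))} (h : S ⊆ T) : sUnits S ≤ sUnits T :=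
  fun _ hx v hv => hx v fun h' => hv (h h')

theorem finite_setOf_valuation_ne_one (x : Kˣ) :
    {v : HeightOneSpectrum (𝓞 K) | v.valuation K (x : K) ≠ 1}.Finite := by
  obtain ⟨a, b, hb, hab⟩ := IsFractionRing.div_surjective (A := 𝓞 K) (x : K)
  have ha : a ≠ 0 := by
    rintro rfl
    rw [map_zero, zero_div] at hab
    exact x.ne_zero hab.symm
  refine ((Ideal.finite_factors (I := Ideal.span {a}) (by simpa using ha)).union
    (Ideal.finite_factors (I := Ideal.span {b}) (by simpa using nonZeroDivisors.ne_zero hb))).subset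
    fun v hv => ?_
  by_contra h
  simp only [Set.mem_union, Set.mem_ofPred_eq, not_or] at h hv
  rw [← valuation_lt_one_iff_dvd (K := K), ← valuation_lt_one_iff_dvd (K := K)] at h
  refine hv ?_
  rw [← hab, map_div₀, le_antisymm (valuation_le_one v a) (not_lt.1 h.1),
    le_antisymm (valuation_le_one v b) (not_lt.1 h.2), div_one]

theorem exists_mem_sUnits (x : Kˣ) : ∃ S : Finset (HeightOneSpectrum (𝓞 K)), x ∈ sUnits S :=
  ⟨(finite_setOf_valuation_ne_one x).toFinset, fun v hv => by simpa using hv⟩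

theorem exists_valuation_lt_one_eq_one (v : HeightOneSpectrum (𝓞 K)) :
    ∃ a : Kˣ, v.valuation K (a : K) < 1 ∧ ∀ w ≠ v, w.valuation K (a : K) = 1 := by
  have hv0 : v.asIdeal ∈ (Ideal (𝓞 K))⁰ := mem_nonZeroDivisors_of_ne_zero v.ne_bot
  have hcard : Fintype.card (ClassGroup (𝓞 K)) ≠ 0 := Fintype.card_ne_zero
  have h1 : ClassGroup.mk0 (⟨v.asIdeal, hv0⟩ ^ Fintype.card (ClassGroup (𝓞 K))) = 1 := by
    rw [map_pow, pow_card_eq_one]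
  have h2 := (ClassGroup.mk0_eq_one_iff (pow_mem hv0 _)).1 h1
  obtain ⟨a, ha⟩ := h2.principal
  change v.asIdeal ^ _ = Ideal.span {a} at ha
  have ha0 : a ≠ 0 := by
    rintro rfl
    rw [Ideal.span_singleton_eq_bot.2 rfl] at ha
    exact v.ne_bot (pow_eq_zero_iff hcard |>.1 ha)
  refine ⟨Units.mk0 (algebraMap (𝓞 K) K a) (by simpa using ha0), ?_, fun w hw => ?_⟩
  · refine (valuation_lt_one_iff_dvd (K := K) v a).2 ?_
    rw [← ha]
    exact dvd_pow_self _ hcard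
  · refine le_antisymm (valuation_le_one w a) (not_lt.1 fun h => hw ?_)
    have h3 := (valuation_lt_one_iff_dvd (K := K) w a).1 h
    rw [← ha] at h3
    have h4 := w.prime.dvd_of_dvd_pow h3
    exact HeightOneSpectrum.ext (v.isMaximal.eq_of_le w.isPrime.ne_top (Ideal.le_of_dvd h4)).symm

/-- Every prime outside `S` becomes principal in the ring of `S`-integers. -/
def IsGoodSet (S : Finset (HeightOneSpectrum (𝓞 K))) : Prop :=
  ∀ v ∉ S, ∃ π : Kˣ, v.valuation K (π : K) = exp (-1 : ℤ) ∧ ∀ w ∉ S, w ≠ v → w.valuation K (π : K) = 1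

theorem IsGoodSet.mono {S T : Finset (HeightOneSpectrum (𝓞 K))} (hS : IsGoodSet S) (h : S ⊆ T) :
    IsGoodSet T := fun v hv => by
  obtain ⟨π, h1, h2⟩ := hS v fun h' => hv (h h')
  exact ⟨π, h1, fun w hw => h2 w fun h' => hw (h h')⟩

theorem exists_isGoodSet : ∃ S : Finset (HeightOneSpectrum (𝓞 K)), IsGoodSet S := by
  choose I hI using ClassGroup.mk0_surjective (R := 𝓞 K)
  have hfin : (⋃ c, {v : HeightOneSpectrum (𝓞 K) | v.asIdeal ∣ (I c : Ideal (𝓞 K))}).Finite :=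
    Set.finite_iUnion fun c => Ideal.finite_factors (nonZeroDivisors.ne_zero (I c).2)
  refine ⟨hfin.toFinset, fun v hv => ?_⟩
  have hv0 : v.asIdeal ∈ (Ideal (𝓞 K))⁰ := mem_nonZeroDivisors_of_ne_zero v.ne_bot
  set J := I (ClassGroup.mk0 ⟨v.asIdeal, hv0⟩)⁻¹ with hJ
  have hJv : ∀ w ∉ hfin.toFinset, ¬ w.asIdeal ∣ (J : Ideal (𝓞 K)) := fun w hw h => by
    simp only [Set.Finite.mem_toFinset, Set.mem_iUnion, not_exists] at hw
    exact hw _ h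
  have h1 : ClassGroup.mk0 (⟨v.asIdeal, hv0⟩ * J) = 1 := by
    rw [map_mul, hJ, hI, mul_inv_cancel]
  have h2 := (ClassGroup.mk0_eq_one_iff (mul_mem hv0 J.2)).1 h1
  obtain ⟨a, ha⟩ := h2.principal
  change v.asIdeal * J = Ideal.span {a} at ha
  have ha0 : a ≠ 0 := by
    rintro rfl
    rw [Ideal.span_singleton_eq_bot.2 rfl] at ha
    exact mul_ne_zero v.ne_bot (nonZeroDivisors.ne_zero J.2) ha
  refine ⟨Units.mk0 (algebraMap (𝓞 K) K a) (by simpa using ha0), ?_, fun w hw hwv => ?_⟩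
  · rw [Units.val_mk0, valuation_of_algebraMap]
    have h3 : v.intValuation a ≤ exp (-(1 : ℕ) : ℤ) := by
      rw [intValuation_le_pow_iff_dvd, ← ha, pow_one]
      exact Dvd.intro _ rfl
    have h4 : ¬ v.intValuation a ≤ exp (-(2 : ℕ) : ℤ) := by
      rw [intValuation_le_pow_iff_dvd, ← ha, pow_two]
      exact fun h => hJv v hv ((mul_dvd_mul_iff_left v.ne_bot).1 h)
    rw [v.intValuation_if_neg ha0] at h3 h4 ⊢
    rw [exp_le_exp] at h3 h4
    congr 1
    push_cast at h3 h4
    omega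
  · refine le_antisymm (valuation_le_one w a) (not_lt.1 fun h => hwv ?_)
    have h3 := (valuation_lt_one_iff_dvd (K := K) w a).1 h
    rw [← ha] at h3
    have h4 := (w.prime.dvd_or_dvd h3).resolve_right (hJv w hw)
    exact HeightOneSpectrum.ext (v.isMaximal.eq_of_le w.isPrime.ne_top (Ideal.le_of_dvd h4)).symm

end SUnits

section HasQSUnits

open IsDedekindDomain HeightOneSpectrum WithZero NumberField

theorem index_ne_zero_of_mem_multiplicative_int {H : Subgroup (Multiplicative ℤ)} {u : Multiplicative ℤ}
    (hu : u ∈ H) (hu1 : u ≠ 1) : H.index ≠ 0 := by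
  have h : Subgroup.zpowers u ≤ H := Subgroup.zpowers_le.2 hu
  have h1 : (Subgroup.zpowers u).index = (Multiplicative.toAdd u).natAbs := by
    rw [← Int.index_zmultiples]
    rfl
  intro h0
  have h2 := Subgroup.index_dvd_of_le h
  rw [h0, h1, zero_dvd_iff, Int.natAbs_eq_zero] at h2
  exact hu1 h2

variable {K : Type} [Field K] [NumberField K] {p : ℕ}

theorem hasQ_pow_of_basis {A : Type*} [CommGroup A] (hp : 0 < p) {r : ℕ}
    (b : Module.Basis (Fin r) ℤ (Additive A)) : HasQ.pow p A (p ^ r) := by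
  let e : A ≃* (Fin r → Multiplicative ℤ) :=
    { toFun := fun x i => Multiplicative.ofAdd (b.equivFun (Additive.ofMul x) i)
      invFun := fun f => (b.equivFun.symm fun i => (f i).toAdd).toMul
      left_inv := fun x => congrArg Additive.toMul (b.equivFun.symm_apply_apply (Additive.ofMul x))
      right_inv := fun f => by
        funext i
        exact congrArg Multiplicative.ofAdd
          (congrFun (b.equivFun.apply_symm_apply fun i => (f i).toAdd) i)
      map_mul' := fun x y => by
        funext i
        rw [ofMul_mul, map_add]
        rfl }
  have h1 : HasQ.pow p (Fin r → Multiplicative ℤ) (p ^ Fintype.card (Fin r)) :=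
    hasQ_pow_pi (hasQ_pow_multiplicative_int hp)
  rw [Fintype.card_fin] at h1
  exact HasQ.pow_congr e.symm h1

theorem hasQ_pow_of_basis_quotient {A : Type*} [CommGroup A] (hp : 0 < p) (H : Subgroup A) [Finite H] {r : ℕ}
    (b : Module.Basis (Fin r) ℤ (Additive (A ⧸ H))) : HasQ.pow p A (p ^ r) := by
  have h3 : HasQ.pow p (QuotientGroup.mk' H).ker 1 :=
    HasQ.pow_congr (MulEquiv.subgroupCongr (QuotientGroup.ker_mk' H).symm) (HasQ.pow_finite p)
  have h4 := HasQ.pow_of_ses (QuotientGroup.mk' H) (QuotientGroup.mk'_surjective H) h3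
    (hasQ_pow_of_basis hp b)
  rwa [one_mul] at h4

theorem hasQ_units_ringOfIntegers (hp : 0 < p) : HasQ.pow p (𝓞 K)ˣ (p ^ Units.rank K) :=
  hasQ_pow_of_basis_quotient hp (Units.torsion K) (Units.basisModTorsion K)

theorem hasQ_sUnits_empty (hp : 0 < p) :
    HasQ.pow p (sUnits (∅ : Finset (HeightOneSpectrum (𝓞 K)))) (p ^ Units.rank K) := by
  let f : (𝓞 K)ˣ →* Kˣ := Units.map (algebraMap (𝓞 K) K : 𝓞 K →* K)
  have hinj : Function.Injective f := Units.map_injective (FaithfulSMul.algebraMap_injective (𝓞 K) K)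
  have hr : f.range = sUnits ∅ := by
    ext x
    constructor
    · rintro ⟨u, rfl⟩ v -
      have h := valuation_of_unit_eq v (K := K) u
      have h2 := valuationOfNeZero_eq v (K := K) (Units.map (algebraMap (𝓞 K) K : 𝓞 K →* K) u)
      rw [h] at h2
      exact h2.symm
    · intro hx
      have h1 : ∀ y : Kˣ, y ∈ sUnits (∅ : Finset (HeightOneSpectrum (𝓞 K))) →
          ∃ a : 𝓞 K, algebraMap _ K a = y := fun y hy =>
        mem_integers_of_valuation_le_one K _ fun v => (hy v (Finset.notMem_empty v)).le
      obtain ⟨a, ha⟩ := h1 x hx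
      obtain ⟨b, hb⟩ := h1 x⁻¹ (inv_mem hx)
      have hab : a * b = 1 := by
        apply FaithfulSMul.algebraMap_injective (𝓞 K) K
        rw [map_mul, ha, hb, map_one, Units.mul_inv]
      exact ⟨Units.mkOfMulEqOne a b hab, Units.ext ha⟩
  exact HasQ.pow_congr ((MonoidHom.ofInjective hinj).trans (MulEquiv.subgroupCongr hr))
    (hasQ_units_ringOfIntegers hp)

theorem hasQ_sUnits (hp : 0 < p) (S : Finset (HeightOneSpectrum (𝓞 K))) :
    HasQ.pow p (sUnits S) (p ^ (S.card + Units.rank K)) := by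
  classical
  induction S using Finset.induction_on with
  | empty => simpa using hasQ_sUnits_empty (K := K) hp
  | insert v S hv ih =>
    let φ : sUnits (insert v S) →* Multiplicative ℤ := v.valuationOfNeZero.comp (Subgroup.subtype _)
    have hφ : ∀ x, φ x = 1 ↔ v.valuation K ((x : Kˣ) : K) = 1 := fun x => by
      rw [← valuationOfNeZero_eq v (x : Kˣ)]
      exact_mod_cast Iff.rfl
    have hmem : ∀ x : Kˣ, x ∈ sUnits S ↔ x ∈ sUnits (insert v S) ∧ v.valuation K (x : K) = 1 := fun x => by
      refine ⟨fun h => ⟨sUnits_mono (Finset.subset_insert v S) h, h v hv⟩, fun h w hw => ?_⟩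
      by_cases hwv : w = v
      · exact hwv ▸ h.2
      · exact h.1 w (by simp [hw, hwv])
    let e : sUnits S ≃* φ.ker :=
      { toFun := fun x => ⟨⟨x, ((hmem x).1 x.2).1⟩, (hφ _).2 ((hmem x).1 x.2).2⟩
        invFun := fun x => ⟨x.1, (hmem _).2 ⟨x.1.2, (hφ _).1 x.2⟩⟩
        left_inv := fun x => rfl
        right_inv := fun x => rfl
        map_mul' := fun x y => rfl }
    have hind : φ.range.index ≠ 0 := by
      obtain ⟨a, ha, ha'⟩ := exists_valuation_lt_one_eq_one v
      have ha2 : a ∈ sUnits (insert v S) := fun w hw => ha' w fun h => hw (by simp [h])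
      exact index_ne_zero_of_mem_multiplicative_int ⟨⟨a, ha2⟩, rfl⟩
        fun h => ha.ne ((hφ ⟨a, ha2⟩).1 h)
    have h1 : HasQ.pow p φ.rangeRestrict.ker (p ^ (S.card + Units.rank K)) :=
      HasQ.pow_congr (e.trans (MulEquiv.subgroupCongr (MonoidHom.ker_rangeRestrict φ).symm)) ih
    have h2 := HasQ.pow_of_ses φ.rangeRestrict φ.rangeRestrict_surjective h1
      (HasQ.pow_finiteIndex_sub _ hind (hasQ_pow_multiplicative_int hp))
    rw [Finset.card_insert_of_notMem hv, add_right_comm, pow_succ]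
    exact h2

theorem card_infinitePlace_eq : Fintype.card (InfinitePlace K) = Units.rank K + 1 := by
  rw [Units.rank, Nat.sub_add_cancel Fintype.card_pos]

theorem index_pow_sUnits (hp : 0 < p) {ζ : K} (hζ : IsPrimitiveRoot ζ p)
    (S : Finset (HeightOneSpectrum (𝓞 K))) :
    (powMonoidHom p : sUnits S →* sUnits S).range.index = p ^ (S.card + Fintype.card (InfinitePlace K)) := by
  have h := (hasQ_sUnits hp S).2.2
  have hle : ∀ u : Kˣ, u ∈ (powMonoidHom p : Kˣ →* Kˣ).ker → u ∈ sUnits S := fun u hu v _ => by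
    have h1 : u ^ p = 1 := hu
    have h2 : v.valuation K (u : K) ^ p = 1 := by
      rw [← map_pow, ← Units.val_pow_eq_pow_val, h1, Units.val_one, map_one]
    exact (pow_eq_one_iff_of_nonneg zero_le' hp.ne').1 h2
  have hc : Nat.card (powMonoidHom p : sUnits S →* sUnits S).ker = p := by
    refine Eq.trans (Nat.card_congr ?_) (hζ.card_ker_powMonoidHom hp)
    exact
      { toFun := fun x => ⟨x.1, congrArg Subtype.val x.2⟩
        invFun := fun x => ⟨⟨x, hle x x.2⟩, Subtype.ext x.2⟩
        left_inv := fun x => rfl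
        right_inv := fun x => rfl }
  rw [hc] at h
  rw [card_infinitePlace_eq, ← add_assoc, pow_succ]
  exact_mod_cast h

end HasQSUnits

section Primes

open IsDedekindDomain HeightOneSpectrum WithZero NumberField

variable {K : Type} [Field K] [NumberField K]

theorem Valuation.map_le_one_of_isIntegral {L Γ : Type*} [Field L] [LinearOrderedCommGroupWithZero Γ]
    (w : Valuation L Γ) {y : L} (hy : IsIntegral ℤ y) : w y ≤ 1 := by
  have h : Valuation.Integers w w.integer := Valuation.integer.integers w
  exact h.mem_of_integral hy.tower_top

theorem exists_valuation_lt_one_iff {Γ : Type*} [LinearOrderedCommGroupWithZero Γ] (w : Valuation K Γ)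
    (hw : ∃ y, y ≠ 0 ∧ w y ≠ 1) :
    ∃ P : HeightOneSpectrum (𝓞 K), ∀ y, P.valuation K y < 1 ↔ w y < 1 := by
  have hint : ∀ r : 𝓞 K, w (algebraMap (𝓞 K) K r) ≤ 1 := fun r => w.map_le_one_of_isIntegral r.2
  let I : Ideal (𝓞 K) :=
    { carrier := {r | w (algebraMap (𝓞 K) K r) < 1}
      add_mem' := fun {a b} ha hb => by
        show w _ < 1
        rw [map_add]
        exact Valuation.map_add_lt w ha hb
      zero_mem' := by simp
      smul_mem' := fun c x hx => by
        show w _ < 1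
        rw [smul_eq_mul, map_mul, Valuation.map_mul]
        exact mul_lt_one_of_nonneg_of_lt_one_right (hint c) zero_le' hx }
  have hI : ∀ r, r ∈ I ↔ w (algebraMap (𝓞 K) K r) < 1 := fun r => Iff.rfl
  have hprime : I.IsPrime := by
    refine ⟨fun h => ?_, fun {a b} hab => ?_⟩
    · have := (hI 1).1 (h ▸ Submodule.mem_top)
      simp at this
    · by_contra! h
      rw [hI, hI, not_lt, not_lt] at h
      rw [hI, map_mul, Valuation.map_mul] at hab
      exact hab.not_ge (one_le_mul h.1 h.2)
  have hbot : I ≠ ⊥ := by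
    intro hbot
    have h1 : ∀ r : 𝓞 K, r ≠ 0 → w (algebraMap (𝓞 K) K r) = 1 := fun r hr =>
      (hint r).antisymm (not_lt.1 fun h => hr (by
        have : r ∈ I := h
        rwa [hbot] at this))
    obtain ⟨y, hy, hy1⟩ := hw
    obtain ⟨a, b, hb, rfl⟩ := IsFractionRing.div_surjective (A := 𝓞 K) y
    refine hy1 ?_
    have ha : a ≠ 0 := by rintro rfl; simp at hy
    rw [map_div₀, h1 a ha, h1 b (nonZeroDivisors.ne_zero hb), div_one]
  let P : HeightOneSpectrum (𝓞 K) := ⟨I, hprime, hbot⟩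
  have key : ∀ y, P.valuation K y ≤ 1 → w y ≤ 1 ∧ (P.valuation K y < 1 ↔ w y < 1) := by
    intro y hy
    obtain ⟨n, d, hnd⟩ := P.exists_primeCompl_mul_eq_of_integer y hy
    have hd : (d : 𝓞 K) ∉ I := d.2
    have hwd : w (algebraMap (𝓞 K) K d) = 1 := (hint d).antisymm (not_lt.1 hd)
    have hPd : P.valuation K (algebraMap (𝓞 K) K d) = 1 := P.valuation_eq_one_iff_notMem.2 hd
    have h1 : w y = w (algebraMap (𝓞 K) K n) := by rw [← hnd, Valuation.map_mul, hwd, mul_one]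
    have h2 : P.valuation K y = P.valuation K (algebraMap (𝓞 K) K n) := by
      rw [← hnd, Valuation.map_mul, hPd, mul_one]
    refine ⟨h1 ▸ hint n, ?_⟩
    rw [h1, h2, P.valuation_lt_one_iff_mem]
    exact hI n
  refine ⟨P, fun y => ?_⟩
  rcases le_total (P.valuation K y) 1 with h | h
  · exact (key y h).2
  · refine iff_of_false h.not_gt ?_
    have h0 : y ≠ 0 := by rintro rfl; simp at h
    have h1 := (key y⁻¹ (by rw [map_inv₀]; exact inv_le_one_of_one_le₀ h)).1
    rw [map_inv₀] at h1
    exact not_lt.2 ((inv_le_one₀ (zero_lt_iff.2 ((Valuation.ne_zero_iff _).2 h0))).1 h1)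

theorem valuation_le_one_iff_of_lt_one_iff {L M Γ Γ' : Type*} [Field L] [Field M]
    [LinearOrderedCommGroupWithZero Γ] [LinearOrderedCommGroupWithZero Γ'] {v : Valuation L Γ}
    {w : Valuation M Γ'} {f : L →+* M} (h : ∀ y, v y < 1 ↔ w (f y) < 1) (y : L) :
    v y ≤ 1 ↔ w (f y) ≤ 1 := by
  rcases eq_or_ne y 0 with rfl | hy
  · simp
  have h1 := h y⁻¹
  rw [map_inv₀, map_inv₀, map_inv₀, inv_lt_one₀ (zero_lt_iff.2 ((Valuation.ne_zero_iff _).2 hy)),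
    inv_lt_one₀ (zero_lt_iff.2 ((Valuation.ne_zero_iff _).2 (by simpa using hy)))] at h1
  rw [← not_lt, ← not_lt, h1]

theorem valuation_eq_one_iff_of_lt_one_iff {L M Γ Γ' : Type*} [Field L] [Field M]
    [LinearOrderedCommGroupWithZero Γ] [LinearOrderedCommGroupWithZero Γ'] {v : Valuation L Γ}
    {w : Valuation M Γ'} {f : L →+* M} (h : ∀ y, v y < 1 ↔ w (f y) < 1) (y : L) :
    v y = 1 ↔ w (f y) = 1 := by
  have := valuation_le_one_iff_of_lt_one_iff h y
  rw [eq_iff_le_not_lt, eq_iff_le_not_lt, h, this]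

theorem valuation_le_iff_of_lt_one_iff {L M Γ Γ' : Type*} [Field L] [Field M]
    [LinearOrderedCommGroupWithZero Γ] [LinearOrderedCommGroupWithZero Γ'] {v : Valuation L Γ}
    {w : Valuation M Γ'} {f : L →+* M} (h : ∀ y, v y < 1 ↔ w (f y) < 1) (y z : L) :
    v y ≤ v z ↔ w (f y) ≤ w (f z) := by
  rcases eq_or_ne z 0 with rfl | hz
  · simp
  have := valuation_le_one_iff_of_lt_one_iff h (y / z)
  rwa [map_div₀, map_div₀, map_div₀, div_le_one₀ (zero_lt_iff.2 ((Valuation.ne_zero_iff _).2 hz)),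
    div_le_one₀ (zero_lt_iff.2 ((Valuation.ne_zero_iff _).2 (by simpa using hz)))] at this

theorem HeightOneSpectrum.eq_of_valuation_lt_one_iff {P Q : HeightOneSpectrum (𝓞 K)}
    (h : ∀ y, P.valuation K y < 1 ↔ Q.valuation K y < 1) : P = Q := by
  ext r
  rw [← P.valuation_lt_one_iff_mem (K := K), h, Q.valuation_lt_one_iff_mem]

variable {L : Type} [Field L] [NumberField L] [Algebra K L]

variable (K) in
/-- The prime of `K` below a prime of `L`. -/
noncomputable def belowPrime (P : HeightOneSpectrum (𝓞 L)) : HeightOneSpectrum (𝓞 K) :=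
  ⟨P.asIdeal.under (𝓞 K), inferInstance, Ideal.under_ne_bot (𝓞 K) P.ne_bot⟩

theorem belowPrime_valuation_lt_one (P : HeightOneSpectrum (𝓞 L)) (a : K) :
    (belowPrime K P).valuation K a < 1 ↔ P.valuation L (algebraMap K L a) < 1 := by
  have : P.asIdeal.LiesOver (belowPrime K P).asIdeal := ⟨rfl⟩
  rw [← valuation_liesOver L (belowPrime K P) P a, pow_lt_one_iff_of_nonneg zero_le']
  exact Ideal.IsDedekindDomain.ramificationIdx'_ne_zero_of_liesOver P.asIdeal (belowPrime K P).ne_bot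

theorem belowPrime_eq_of_lt_one_iff {P : HeightOneSpectrum (𝓞 L)} {v : HeightOneSpectrum (𝓞 K)}
    (h : ∀ a : K, v.valuation K a < 1 ↔ P.valuation L (algebraMap K L a) < 1) : belowPrime K P = v :=
  HeightOneSpectrum.eq_of_valuation_lt_one_iff fun y => by rw [belowPrime_valuation_lt_one, h]

theorem exists_belowPrime_eq (v : HeightOneSpectrum (𝓞 K)) :
    ∃ P : HeightOneSpectrum (𝓞 L), belowPrime K P = v := by
  have := v.isMaximal
  obtain ⟨P, hP, hPv⟩ := Ideal.exists_maximal_ideal_liesOver_of_isIntegral (S := 𝓞 L) v.asIdeal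
  exact ⟨⟨P, hP.isPrime, Ideal.ne_bot_of_liesOver_of_ne_bot v.ne_bot P⟩, HeightOneSpectrum.ext hPv.over.symm⟩

theorem finite_setOf_belowPrime_eq (v : HeightOneSpectrum (𝓞 K)) :
    {P : HeightOneSpectrum (𝓞 L) | belowPrime K P = v}.Finite := by
  obtain ⟨a, ha, -⟩ := exists_valuation_lt_one_eq_one v
  refine (finite_setOf_valuation_ne_one (Units.map (algebraMap K L : K →* L) a)).subset ?_
  rintro P rfl
  exact ((belowPrime_valuation_lt_one P (a : K)).1 ha).ne

variable (L) in
/-- The primes of `L` above `S`. -/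
noncomputable def abovePrimes (S : Finset (HeightOneSpectrum (𝓞 K))) : Finset (HeightOneSpectrum (𝓞 L)) :=
  (S.finite_toSet.preimage' (f := belowPrime K) fun v _ => finite_setOf_belowPrime_eq v).toFinset

theorem mem_abovePrimes {S : Finset (HeightOneSpectrum (𝓞 K))} {P : HeightOneSpectrum (𝓞 L)} :
    P ∈ abovePrimes L S ↔ belowPrime K P ∈ S := by
  simp [abovePrimes]

end Primes

section KummerData

open IsDedekindDomain HeightOneSpectrum WithZero NumberField Polynomial

/-- `L = K(ξ)` with `ξ ^ p = x`, and `σ` is the generator of its Galois group with `σ ξ = ζ ξ`. -/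
structure IsKummer (p : ℕ) {K L : Type} [Field K] [Field L] [Algebra K L] (ζ x : K) (ξ : L) (σ : L ≃ₐ[K] L) :
    Prop where
  isGalois : IsGalois K L
  finrank_eq : Module.finrank K L = p
  root_pow : ξ ^ p = algebraMap K L x
  map_root : σ ξ = ζ • ξ
  aut_pow : σ ^ p = 1
  fixed : ∀ y, σ y = y → ∃ c, algebraMap K L c = y
  hilbert : ∀ y, ∏ i ∈ Finset.range p, (σ ^ i) y = 1 → ∃ z, z ≠ 0 ∧ σ z / z = y
  expand : ∀ y, ∃ c : ℕ → K, y = ∑ i ∈ Finset.range p, c i • ξ ^ i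
  normP_iff : ∀ a, NormP p ζ x a ↔ ∃ y, ∏ i ∈ Finset.range p, (σ ^ i) y = algebraMap K L a
  prod_eq : ∀ y, ∃ c, ∏ i ∈ Finset.range p, (σ ^ i) y = algebraMap K L c
  lift : ∀ (F : Type) [Field F] (j : K →+* F) (c : F), c ^ p = j x →
    ∃ τ : L →+* F, (∀ a, τ (algebraMap K L a) = j a) ∧ τ ξ = c

theorem exists_isKummer {K : Type} [Field K] [NumberField K] {p : ℕ} (hp : p.Prime) {ζ x : K}
    (hζ : IsPrimitiveRoot ζ p) (hx : ∀ c, c ^ p ≠ x) :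
    ∃ (L : Type) (_ : Field L) (_ : NumberField L) (_ : Algebra K L) (ξ : L) (σ : L ≃ₐ[K] L),
      IsKummer p ζ x ξ σ := by
  have hirr : Irreducible (X ^ p - C x) := X_pow_sub_C_irreducible_of_prime hp hx
  have : Fact (Irreducible (X ^ p - C x)) := ⟨hirr⟩
  have : NeZero p := ⟨hp.ne_zero⟩
  have hprim : (primitiveRoots p K).Nonempty := ⟨ζ, (mem_primitiveRoots hp.pos).2 hζ⟩
  have hs := isSplittingField_AdjoinRoot_X_pow_sub_C hprim hirr
  have hmon : (X ^ p - C x).Monic := monic_X_pow_sub_C x hp.ne_zero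
  have hdeg : (X ^ p - C x).natDegree = p := natDegree_X_pow_sub_C
  obtain ⟨σ, h1, h2, h3, h4, h5⟩ := exists_kummer_aut hp hζ (b := x)
  have hfd : FiniteDimensional K (AdjoinRoot (X ^ p - C x)) := hmon.finite_adjoinRoot
  have hnf : NumberField (AdjoinRoot (X ^ p - C x)) :=
    { to_charZero := charZero_of_injective_algebraMap (algebraMap K (AdjoinRoot (X ^ p - C x))).injective
      to_finiteDimensional := .trans ℚ K _ }
  refine ⟨AdjoinRoot (X ^ p - C x), inferInstance, hnf, inferInstance, AdjoinRoot.root _, σ, ?_⟩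
  constructor
  · exact isGalois_of_isSplittingField_X_pow_sub_C hprim hirr _
  · rw [(AdjoinRoot.powerBasis hirr.ne_zero).finrank, AdjoinRoot.powerBasis_dim, hdeg]
  · have := AdjoinRoot.eval₂_root (X ^ p - C x)
    rwa [eval₂_sub, eval₂_X_pow, eval₂_C, sub_eq_zero] at this
  · exact h1
  · exact h2
  · exact h3
  · exact h5
  · intro y
    refine ⟨fun i => ((AdjoinRoot.modByMonicHom hmon) y).coeff i, ?_⟩
    conv_lhs => rw [← AdjoinRoot.mk_leftInverse hmon y]
    rw [← AdjoinRoot.aeval_eq, aeval_eq_sum_range' (n := p)]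
    obtain ⟨g, rfl⟩ := AdjoinRoot.mk_surjective y
    rw [AdjoinRoot.modByMonicHom_mk]
    exact (natDegree_modByMonic_lt g hmon (by rintro h; rw [h] at hdeg; simp at hdeg; exact hp.ne_zero hdeg.symm)).trans_eq hdeg
  · exact fun a => normP_iff_exists_prod σ h1 a
  · exact fun y => ⟨_, h4 y⟩
  · intro F _ j c hc
    refine ⟨AdjoinRoot.lift j c (by simp [hc]), fun a => AdjoinRoot.lift_of _, AdjoinRoot.lift_root _⟩

variable {K L : Type} [Field K] [NumberField K] [Field L] [NumberField L] [Algebra K L]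

theorem IsGoodSet.exists_valuation_eq {S : Finset (HeightOneSpectrum (𝓞 K))} (hS : IsGoodSet S)
    (f : HeightOneSpectrum (𝓞 K) → Kˣ)
    (hf : {v | v ∉ S ∧ v.valuation K (f v : K) ≠ 1}.Finite) :
    ∃ k : Kˣ, ∀ v ∉ S, v.valuation K (k : K) = v.valuation K (f v : K) := by
  classical
  choose! π hπ hπ' using hS
  refine ⟨∏ v ∈ hf.toFinset, (π v) ^ (-(v.valuationOfNeZero (f v)).toAdd), fun v hv => ?_⟩
  have hprod : v.valuation K ((∏ w ∈ hf.toFinset, (π w) ^ (-(w.valuationOfNeZero (f w)).toAdd) : Kˣ) : K) =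
      ∏ w ∈ hf.toFinset, v.valuation K (π w : K) ^ (-(w.valuationOfNeZero (f w)).toAdd) := by
    rw [Units.coe_prod, map_prod]
    refine Finset.prod_congr rfl fun w _ => ?_
    rw [Units.val_zpow_eq_zpow_val, map_zpow₀]
  have h1 : ∀ w ∈ hf.toFinset, w ≠ v → v.valuation K (π w : K) ^ (-(w.valuationOfNeZero (f w)).toAdd) = 1 :=
    fun w hw hwv => by
      rw [hπ' w (by simpa using (hf.mem_toFinset.1 hw).1) v hv (Ne.symm hwv), one_zpow]
  rw [hprod]
  by_cases hvT : v ∈ hf.toFinset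
  · rw [Finset.prod_eq_single_of_mem v hvT h1, hπ v hv, ← valuationOfNeZero_eq v (f v), ← exp_zsmul]
    simp [exp]
  · rw [Finset.prod_eq_one fun w hw => h1 w hw (by rintro rfl; exact hvT hw)]
    by_contra h
    exact hvT (hf.mem_toFinset.2 ⟨hv, fun h' => h h'.symm⟩)

end KummerData

section KummerUnits

open IsDedekindDomain HeightOneSpectrum WithZero NumberField

variable {K L : Type} [Field K] [NumberField K] [Field L] [NumberField L] [Algebra K L]
  {p : ℕ} {ζ x : K} {ξ : L} {σ : L ≃ₐ[K] L}

theorem exists_heightOneSpectrum_comp (σ : L ≃ₐ[K] L) (P : HeightOneSpectrum (𝓞 L)) :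
    ∃ Q : HeightOneSpectrum (𝓞 L), (∀ y, Q.valuation L y < 1 ↔ P.valuation L (σ y) < 1) ∧
      belowPrime K Q = belowPrime K P := by
  obtain ⟨a, ha, -⟩ := exists_valuation_lt_one_eq_one P
  obtain ⟨Q, hQ⟩ := exists_valuation_lt_one_iff ((P.valuation L).comap (σ : L →+* L))
    ⟨σ.symm a, by simp, by simpa using ha.ne⟩
  refine ⟨Q, hQ, belowPrime_eq_of_lt_one_iff fun b => ?_⟩
  rw [belowPrime_valuation_lt_one, hQ]
  simp

variable {S : Finset (HeightOneSpectrum (𝓞 K))}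

theorem mem_sUnits_abovePrimes {y : Lˣ} : y ∈ sUnits (abovePrimes L S) ↔
    ∀ P : HeightOneSpectrum (𝓞 L), belowPrime K P ∉ S → P.valuation L (y : L) = 1 := by
  simp only [mem_sUnits, mem_abovePrimes]

theorem map_mem_sUnits_abovePrimes (σ : L ≃ₐ[K] L) {y : Lˣ} (hy : y ∈ sUnits (abovePrimes L S)) :
    Units.map (σ : L →* L) y ∈ sUnits (abovePrimes L S) := by
  rw [mem_sUnits_abovePrimes] at hy ⊢
  intro P hP
  obtain ⟨Q, hQ, hQP⟩ := exists_heightOneSpectrum_comp σ P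
  exact (valuation_eq_one_iff_of_lt_one_iff (f := (σ : L →+* L)) hQ y).1 (hy Q (by rwa [hQP]))

theorem algebraMap_mem_sUnits_abovePrimes {a : Kˣ} :
    Units.map (algebraMap K L : K →* L) a ∈ sUnits (abovePrimes L S) ↔ a ∈ sUnits S := by
  rw [mem_sUnits_abovePrimes, mem_sUnits]
  constructor
  · intro h v hv
    obtain ⟨P, rfl⟩ := exists_belowPrime_eq (L := L) v
    exact (valuation_eq_one_iff_of_lt_one_iff (f := algebraMap K L) (belowPrime_valuation_lt_one P) _).2 (h P hv)
  · intro h P hP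
    exact (valuation_eq_one_iff_of_lt_one_iff (f := algebraMap K L) (belowPrime_valuation_lt_one P) _).1 (h _ hP)

theorem map_smul_of_algEquiv (σ : L ≃ₐ[K] L) (a : K) (y : L) : σ (a • y) = a • σ y := by
  rw [Algebra.smul_def, map_mul, AlgEquiv.commutes, ← Algebra.smul_def]

namespace IsKummer

theorem pow_map_root (hK : IsKummer p ζ x ξ σ) (j : ℕ) : (σ ^ j) ξ = ζ ^ j • ξ := by
  induction j with
  | zero => simp
  | succ j ih => rw [pow_succ', AlgEquiv.mul_apply, ih, map_smul_of_algEquiv, hK.map_root, smul_smul, pow_succ]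

theorem root_ne_zero (hK : IsKummer p ζ x ξ σ) (hx : x ≠ 0) (hp : 0 < p) : ξ ≠ 0 := by
  rintro rfl
  have := hK.root_pow
  rw [zero_pow hp.ne', eq_comm, map_eq_zero] at this
  exact hx this

theorem sum_smul_pow (hK : IsKummer p ζ x ξ σ) (hp : 0 < p) (hζ : IsPrimitiveRoot ζ p) {z : L} {c : ℕ → K}
    (hc : z = ∑ i ∈ Finset.range p, c i • ξ ^ i) {i : ℕ} (hi : i < p) :
    ∑ j ∈ Finset.range p, (ζ⁻¹) ^ (i * j) • (σ ^ j) z = (p : L) * (c i • ξ ^ i) := by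
  have hζ0 : ζ ≠ 0 := hζ.ne_zero hp.ne'
  have h1 : ∀ j, (ζ⁻¹) ^ (i * j) • (σ ^ j) z =
      ∑ k ∈ Finset.range p, ((ζ ^ k * (ζ ^ i)⁻¹) ^ j) • (c k • ξ ^ k) := fun j => by
    rw [hc, map_sum, Finset.smul_sum]
    refine Finset.sum_congr rfl fun k _ => ?_
    rw [map_smul_of_algEquiv, map_pow, hK.pow_map_root, smul_pow, smul_smul, smul_smul, smul_smul]
    congr 1
    rw [mul_pow, inv_pow, inv_pow, ← pow_mul, ← pow_mul, ← pow_mul]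
    ring
  simp_rw [h1]
  rw [Finset.sum_comm]
  simp_rw [← Finset.sum_smul]
  rw [Finset.sum_eq_single_of_mem i (Finset.mem_range.2 hi)]
  · rw [mul_inv_cancel₀ (pow_ne_zero _ hζ0)]
    simp [Algebra.smul_def]
  · intro k hk hki
    have hne : ζ ^ k * (ζ ^ i)⁻¹ ≠ 1 := fun h => by
      rw [mul_inv_eq_one₀ (pow_ne_zero _ hζ0)] at h
      exact hki (hζ.pow_inj (Finset.mem_range.1 hk) hi h)
    have h2 : (∑ j ∈ Finset.range p, (ζ ^ k * (ζ ^ i)⁻¹) ^ j) = 0 := by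
      have h3 := geom_sum_mul (ζ ^ k * (ζ ^ i)⁻¹) p
      rw [mul_pow, inv_pow, ← pow_mul, ← pow_mul, mul_comm k, mul_comm i, pow_mul, pow_mul, hζ.pow_eq_one,
        one_pow, one_pow, inv_one, mul_one, sub_self] at h3
      exact (mul_eq_zero.1 h3).resolve_right (sub_ne_zero.2 hne)
    rw [h2, zero_smul]

theorem exists_sUnits_div_eq (hK : IsKummer p ζ x ξ σ) (hp : 0 < p) (hζ : IsPrimitiveRoot ζ p)
    (hS : IsGoodSet S) (hpS : ∀ v ∉ S, v.valuation K (p : K) = 1)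
    (hx0 : x ≠ 0) (hxS : ∀ v ∉ S, v.valuation K x = 1) (y : Lˣ) (hy : y ∈ sUnits (abovePrimes L S))
    (hN : ∏ i ∈ Finset.range p, (σ ^ i) (y : L) = 1) :
    ∃ z : Lˣ, z ∈ sUnits (abovePrimes L S) ∧ σ z / z = (y : L) := by
  obtain ⟨z, hz0, hz⟩ := hK.hilbert _ hN
  obtain ⟨c, hc⟩ := hK.expand z
  rw [mem_sUnits_abovePrimes] at hy
  have hlt := fun P : HeightOneSpectrum (𝓞 L) => belowPrime_valuation_lt_one (K := K) P
  have h1 : ∀ P : HeightOneSpectrum (𝓞 L), belowPrime K P ∉ S → ∀ a : K,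
      (belowPrime K P).valuation K a = 1 → P.valuation L (algebraMap K L a) = 1 := fun P _ a ha =>
    (valuation_eq_one_iff_of_lt_one_iff (hlt P) a).1 ha
  have hξ : ∀ P : HeightOneSpectrum (𝓞 L), belowPrime K P ∉ S → P.valuation L ξ = 1 := fun P hP => by
    have := h1 P hP x (hxS _ hP)
    rw [← hK.root_pow, map_pow] at this
    exact (pow_eq_one_iff_of_nonneg zero_le' hp.ne').1 this
  have hζP : ∀ P : HeightOneSpectrum (𝓞 L), P.valuation L (algebraMap K L ζ) = 1 := fun P => by
    refine (pow_eq_one_iff_of_nonneg zero_le' hp.ne').1 ?_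
    rw [← map_pow, ← map_pow, hζ.pow_eq_one, map_one, map_one]
  have hσz : ∀ P : HeightOneSpectrum (𝓞 L), belowPrime K P ∉ S → ∀ j : ℕ,
      P.valuation L ((σ ^ j) z) = P.valuation L z := fun P hP j => by
    induction j with
    | zero => simp
    | succ j ih =>
      have h2 : σ z = z * y := by rw [← hz, mul_div_cancel₀ _ hz0]
      have h3 : Units.map ((σ ^ j : L ≃ₐ[K] L) : L →* L) y ∈ sUnits (abovePrimes L S) :=
        map_mem_sUnits_abovePrimes (σ ^ j) (mem_sUnits_abovePrimes.2 hy)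
      have h4 : P.valuation L ((σ ^ j) y) = 1 := mem_sUnits_abovePrimes.1 h3 P hP
      rw [pow_succ, AlgEquiv.mul_apply, h2, map_mul, Valuation.map_mul, ih, h4, mul_one]
  have hle : ∀ P : HeightOneSpectrum (𝓞 L), belowPrime K P ∉ S → ∀ i < p,
      P.valuation L (algebraMap K L (c i)) ≤ P.valuation L z := fun P hP i hi => by
    have h2 : P.valuation L ((p : L) * (c i • ξ ^ i)) ≤ P.valuation L z := by
      rw [← hK.sum_smul_pow hp hζ hc hi]
      refine Valuation.map_sum_le _ fun j _ => ?_
      rw [Algebra.smul_def, Valuation.map_mul, map_pow, map_inv₀, map_pow, map_inv₀, hζP, inv_one, one_pow,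
        one_mul, hσz P hP]
    have h3 := h1 P hP (p : K) (hpS _ hP)
    rw [map_natCast] at h3
    rwa [Valuation.map_mul, h3, one_mul, Algebra.smul_def, Valuation.map_mul, map_pow, hξ P hP, one_pow, mul_one] at h2
  have hmax : ∀ v : HeightOneSpectrum (𝓞 K), ∃ i < p, ∀ k < p, v.valuation K (c k) ≤ v.valuation K (c i) := fun v => by
    obtain ⟨i, hi, h⟩ := Finset.exists_max_image (Finset.range p) (fun k => v.valuation K (c k))
      ⟨0, Finset.mem_range.2 hp⟩
    exact ⟨i, Finset.mem_range.1 hi, fun k hk => h k (Finset.mem_range.2 hk)⟩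
  choose i hi himax using hmax
  have heq : ∀ P : HeightOneSpectrum (𝓞 L), belowPrime K P ∉ S →
      P.valuation L z = P.valuation L (algebraMap K L (c (i (belowPrime K P)))) := fun P hP => by
    refine le_antisymm ?_ (hle P hP _ (hi _))
    conv_lhs => rw [hc]
    refine Valuation.map_sum_le _ fun k hk => ?_
    rw [Algebra.smul_def, Valuation.map_mul, map_pow, hξ P hP, one_pow, mul_one]
    exact (valuation_le_iff_of_lt_one_iff (hlt P) _ _).1 (himax _ k (Finset.mem_range.1 hk))
  have hne : ∀ v ∉ S, c (i v) ≠ 0 := fun v hv h0 => by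
    obtain ⟨P, rfl⟩ := exists_belowPrime_eq (L := L) v
    have := heq P hv
    rw [h0, map_zero, map_zero, Valuation.zero_iff] at this
    exact hz0 this
  classical
  obtain ⟨k, hk⟩ := hS.exists_valuation_eq (fun v => if h : c (i v) = 0 then 1 else Units.mk0 _ h) (by
    refine ((finite_setOf_valuation_ne_one (Units.mk0 z hz0)).image (belowPrime K)).subset ?_
    rintro v ⟨hv, h⟩
    obtain ⟨P, rfl⟩ := exists_belowPrime_eq (L := L) v
    refine ⟨P, fun h' => h ?_, rfl⟩
    rw [dif_neg (hne _ hv), Units.val_mk0]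
    rw [Units.val_mk0, heq P hv] at h'
    exact (valuation_eq_one_iff_of_lt_one_iff (hlt P) _).2 h')
  have hk0 : algebraMap K L (k : K) ≠ 0 := by simp
  refine ⟨Units.mk0 (z / algebraMap K L (k : K)) (div_ne_zero hz0 hk0), ?_, ?_⟩
  · rw [mem_sUnits_abovePrimes]
    intro P hP
    have h2 := hk _ hP
    rw [dif_neg (hne _ hP), Units.val_mk0] at h2
    have h3 : P.valuation L (algebraMap K L (k : K)) = P.valuation L z := by
      rw [heq P hP]
      exact le_antisymm ((valuation_le_iff_of_lt_one_iff (hlt P) _ _).1 h2.le)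
        ((valuation_le_iff_of_lt_one_iff (hlt P) _ _).1 h2.ge)
    rw [Units.val_mk0, map_div₀, h3, div_self ((Valuation.ne_zero_iff _).2 hz0)]
  · rw [Units.val_mk0, map_div₀, AlgEquiv.commutes, div_div_div_cancel_right₀ hk0, hz]

end IsKummer

end KummerUnits

section KummerRank

open IsDedekindDomain HeightOneSpectrum WithZero NumberField

variable {K L : Type} [Field K] [NumberField K] [Field L] [NumberField L] [Algebra K L]
  {p : ℕ} {ζ : K} {x : Kˣ} {ξ : L} {σ : L ≃ₐ[K] L}

namespace IsKummer

theorem exists_injOn_primes (hK : IsKummer p ζ (x : K) ξ σ) (hp : 0 < p) (hζ : IsPrimitiveRoot ζ p)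
    {v : HeightOneSpectrum (𝓞 K)} (hx : x ∈ placePow p (.inl v)) :
    ∃ P : ℕ → HeightOneSpectrum (𝓞 L), (∀ i, belowPrime K (P i) = v) ∧ Set.InjOn P (Finset.range p) := by
  obtain ⟨c, hc⟩ := (mem_powSubgroup hp).1 hx
  obtain ⟨τ, hτ, hτξ⟩ := hK.lift _ _ c hc
  have hc0 : c ≠ 0 := by
    rintro rfl
    rw [zero_pow hp.ne', eq_comm, map_eq_zero] at hc
    exact x.ne_zero hc
  obtain ⟨a, ha, -⟩ := exists_valuation_lt_one_eq_one v
  have hval : ∀ (i : ℕ) (b : K), Valued.v (τ ((σ ^ i) (algebraMap K L b))) = v.valuation K b := fun i b => by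
    rw [AlgEquiv.commutes, hτ]
    exact valuedAdicCompletion_eq_valuation' v b
  have hP : ∀ i : ℕ, ∃ P : HeightOneSpectrum (𝓞 L), ∀ y, P.valuation L y < 1 ↔ Valued.v (τ ((σ ^ i) y)) < 1 := fun i =>
    exists_valuation_lt_one_iff ((Valued.v : Valuation (v.adicCompletion K) ℤᵐ⁰).comap
      (τ.comp ((σ ^ i : L ≃ₐ[K] L) : L →+* L)))
      ⟨algebraMap K L a, by simp, by
        rw [Valuation.comap_apply]
        exact ((hval i a).trans_lt ha).ne⟩
  choose P hP using hP
  refine ⟨P, fun i => belowPrime_eq_of_lt_one_iff fun b => by rw [hP, hval], ?_⟩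
  intro i hi j hj hij
  by_contra hne
  have hξ : ∀ i : ℕ, τ ((σ ^ i) ξ) = algebraMap K _ (ζ ^ i) * c := fun i => by
    rw [hK.pow_map_root, Algebra.smul_def, map_mul, hτ, hτξ]
  have hsub : algebraMap K (v.adicCompletion K) (ζ ^ j) * c - algebraMap K _ (ζ ^ i) * c ≠ 0 := by
    rw [← sub_mul, ← map_sub]
    refine mul_ne_zero ?_ hc0
    rw [map_ne_zero, sub_ne_zero]
    exact fun h => hne (hζ.pow_inj (Finset.mem_coe.1 hj |> Finset.mem_range.1) (Finset.mem_coe.1 hi |> Finset.mem_range.1) h).symm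
  set δ := algebraMap K (v.adicCompletion K) (ζ ^ j) * c - algebraMap K _ (ζ ^ i) * c with hδ
  have hδ0 : Valued.v δ ≠ 0 := (Valuation.ne_zero_iff _).2 hsub
  obtain ⟨k, hk⟩ := exists_valued_sub_lt v (algebraMap K _ (ζ ^ i) * c) hδ0
  obtain ⟨k', hk'⟩ := exists_valued_sub_lt v δ hδ0
  have hk'2 : v.valuation K k' = Valued.v δ := by
    rw [← valuedAdicCompletion_eq_valuation' v k']
    exact Valuation.map_eq_of_sub_lt _ hk'
  have hk'0 : Valued.v (algebraMap K (v.adicCompletion K) k') = Valued.v δ :=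
    (valuedAdicCompletion_eq_valuation' v k').trans hk'2
  have hw : ∀ i : ℕ, Valued.v (τ ((σ ^ i) ((ξ - algebraMap K L k) / algebraMap K L k'))) =
      Valued.v (algebraMap K (v.adicCompletion K) (ζ ^ i) * c - algebraMap K _ k) / Valued.v δ := fun i => by
    rw [map_div₀, map_div₀, map_sub, map_sub, hξ, AlgEquiv.commutes, AlgEquiv.commutes, hτ, hτ, map_div₀, hk'0]
  have hlt : Valued.v (algebraMap K (v.adicCompletion K) (ζ ^ i) * c - algebraMap K _ k) < Valued.v δ := by
    rwa [Valuation.map_sub_swap]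
  have h1 := (hP i ((ξ - algebraMap K L k) / algebraMap K L k')).2 (by
    rw [hw]
    exact (div_lt_one₀ (zero_lt_iff.2 hδ0)).2 hlt)
  rw [hij, hP, hw, div_lt_one₀ (zero_lt_iff.2 hδ0)] at h1
  have h2 : algebraMap K (v.adicCompletion K) (ζ ^ j) * c - algebraMap K _ k =
      δ + (algebraMap K (v.adicCompletion K) (ζ ^ i) * c - algebraMap K _ k) := by
    rw [hδ]; ring
  rw [h2, Valuation.map_add_eq_of_lt_left _ hlt] at h1
  exact lt_irrefl _ h1

open Classical in
theorem card_abovePrimes_ge (hK : IsKummer p ζ (x : K) ξ σ) (hp : 0 < p) (hζ : IsPrimitiveRoot ζ p)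
    (S : Finset (HeightOneSpectrum (𝓞 K))) :
    p * S.card ≤ (abovePrimes L S).card + (p - 1) * (S.filter fun v => x ∉ placePow p (.inl v)).card := by
  rw [Finset.card_eq_sum_card_fiberwise (f := belowPrime K) (t := S) fun P hP => mem_abovePrimes.1 hP,
    Finset.card_filter, Finset.mul_sum, ← Finset.sum_add_distrib, mul_comm, ← smul_eq_mul]
  refine Finset.card_nsmul_le_sum _ _ _ fun v hv => ?_
  by_cases h : x ∈ placePow p (.inl v)
  · obtain ⟨P, hP, hinj⟩ := hK.exists_injOn_primes hp hζ h
    have := Finset.card_le_card_of_injOn P (s := Finset.range p)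
      (t := (abovePrimes L S).filter fun P => belowPrime K P = v)
      (fun i _ => by simp [mem_abovePrimes, hP, hv]) hinj
    rw [Finset.card_range] at this
    omega
  · rw [if_pos h]
    obtain ⟨P, hP⟩ := exists_belowPrime_eq (L := L) v
    have : 0 < ((abovePrimes L S).filter fun P => belowPrime K P = v).card :=
      Finset.card_pos.2 ⟨P, by simp [mem_abovePrimes, hP, hv]⟩
    omega

theorem isReal_of_mem_placePow (hK : IsKummer p ζ (x : K) ξ σ) (hp : p.Prime) (hζ : IsPrimitiveRoot ζ p)
    (W : InfinitePlace L) (hW : (W.comap (algebraMap K L)).IsReal) (hx : x ∈ placePow p (.inr ⟨_, hW⟩)) :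
    W.IsReal := by
  obtain ⟨rfl, -⟩ := Real.eq_two_of_isPrimitiveRoot hp
    (hζ.map_of_injective (InfinitePlace.embedding_of_isReal hW).injective)
  obtain ⟨c, hc⟩ := (mem_powSubgroup hp.pos).1 hx
  set φ := W.embedding with hφ
  have h1 : W.comap (algebraMap K L) = InfinitePlace.mk (φ.comp (algebraMap K L)) := by
    rw [← InfinitePlace.comap_mk, InfinitePlace.mk_embedding]
  have hψ : ComplexEmbedding.IsReal (φ.comp (algebraMap K L)) := by
    rwa [h1, InfinitePlace.isReal_mk_iff] at hW
  have h2 : (W.comap (algebraMap K L)).embedding = φ.comp (algebraMap K L) := by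
    rw [h1, InfinitePlace.embedding_mk_eq_of_isReal hψ]
  have h3 : ((c : ℂ)) ^ 2 = φ ξ ^ 2 := by
    rw [← map_pow, hK.root_pow, ← Complex.ofReal_pow, hc, InfinitePlace.embedding_of_isReal_apply, h2]
    rfl
  have h4 : (starRingEnd ℂ) (φ ξ) = φ ξ := by
    rcases sq_eq_sq_iff_eq_or_eq_neg.1 h3.symm with h | h <;> simp [h]
  rw [InfinitePlace.isReal_iff, ComplexEmbedding.isReal_iff]
  ext y
  obtain ⟨c, rfl⟩ := hK.expand y
  rw [ComplexEmbedding.conjugate_coe_eq, ← hφ, map_sum, map_sum]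
  refine Finset.sum_congr rfl fun i _ => ?_
  rw [Algebra.smul_def, map_mul, map_mul, map_pow, map_pow, h4]
  congr 1
  exact RingHom.congr_fun hψ (c i)

open Classical in
theorem card_infinitePlace_ge (hK : IsKummer p ζ (x : K) ξ σ) (hp : p.Prime) (hζ : IsPrimitiveRoot ζ p) :
    p * Fintype.card (InfinitePlace K) ≤ Fintype.card (InfinitePlace L) +
      (p - 1) * (Finset.univ.filter fun w : {w : InfinitePlace K // w.IsReal} => x ∉ placePow p (.inr w)).card := by
  have := hK.isGalois
  set U : Finset (InfinitePlace K) := Finset.univ.filter fun w => w.IsUnramifiedIn L with hU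
  have hcard : Fintype.card (InfinitePlace L) = U.card * p + Uᶜ.card * (p / 2) := by
    have := InfinitePlace.card_eq_card_isUnramifiedIn (k := K) (K := L)
    rw [hK.finrank_eq] at this
    convert this
  have hram : ∀ w ∈ Uᶜ, ∃ h : w.IsReal, x ∉ placePow p (.inr ⟨w, h⟩) := by
    intro w hw
    rw [Finset.mem_compl, hU, Finset.mem_filter] at hw
    have : ¬ w.IsUnramifiedIn L := fun h => hw ⟨Finset.mem_univ _, h⟩
    rw [InfinitePlace.IsUnramifiedIn] at this
    push Not at this
    obtain ⟨W, rfl, hW⟩ := this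
    rw [InfinitePlace.isUnramified_iff, not_or, InfinitePlace.not_isComplex_iff_isReal] at hW
    exact ⟨hW.2, fun h => hW.1 (hK.isReal_of_mem_placePow hp hζ W hW.2 h)⟩
  have hle : Uᶜ.card ≤ (Finset.univ.filter fun w : {w : InfinitePlace K // w.IsReal} => x ∉ placePow p (.inr w)).card := by
    refine Finset.card_le_card_of_surjOn (fun w => w.1) fun w hw => ?_
    obtain ⟨h, h'⟩ := hram w hw
    exact ⟨⟨w, h⟩, by simpa using h', rfl⟩
  have hUc : U.card + Uᶜ.card = Fintype.card (InfinitePlace K) := Finset.card_add_card_compl U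
  rw [hcard, ← hUc]
  rcases Nat.eq_zero_or_pos Uᶜ.card with h0 | h0
  · rw [h0]
    nlinarith [Nat.zero_le ((p - 1) * (Finset.univ.filter fun w : {w : InfinitePlace K // w.IsReal} => x ∉ placePow p (.inr w)).card)]
  · obtain ⟨w, hw⟩ := Finset.card_pos.1 h0
    obtain ⟨h, -⟩ := hram w hw
    obtain ⟨rfl, -⟩ := Real.eq_two_of_isPrimitiveRoot hp
      (hζ.map_of_injective (InfinitePlace.embedding_of_isReal h).injective)
    omega

open Classical in
theorem mul_card_le (hK : IsKummer p ζ (x : K) ξ σ) (hp : p.Prime) (hζ : IsPrimitiveRoot ζ p)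
    (S : Finset (HeightOneSpectrum (𝓞 K))) :
    p * (S.card + Fintype.card (InfinitePlace K)) ≤ (abovePrimes L S).card + Fintype.card (InfinitePlace L) +
      (p - 1) * ((withReal S).filter fun P => x ∉ placePow p P).card := by
  have h1 := hK.card_abovePrimes_ge hp.pos hζ S
  have h2 := hK.card_infinitePlace_ge hp hζ
  have h3 : ((withReal S).filter fun P => x ∉ placePow p P).card =
      (S.filter fun v => x ∉ placePow p (.inl v)).card +
      (Finset.univ.filter fun w : {w : InfinitePlace K // w.IsReal} => x ∉ placePow p (.inr w)).card := by
    simp only [Finset.card_filter, withReal, Finset.sum_disjSum]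
  rw [h3, mul_add, mul_add]
  omega

end IsKummer

end KummerRank

section GlobalNorms

open IsDedekindDomain HeightOneSpectrum WithZero NumberField

variable {K : Type} [Field K] [NumberField K] {p : ℕ} {ζ : K} {S : Finset (HeightOneSpectrum (𝓞 K))}

open Classical in
/-- The number of places in `withReal S` where `x` is not a `p`-th power. -/
noncomputable def nonsplitCard (p : ℕ) (x : Kˣ) (S : Finset (HeightOneSpectrum (𝓞 K))) : ℕ :=
  ((withReal S).filter fun P => x ∉ placePow p P).card

theorem exists_subgroup_norms (hp : p.Prime) (hζ : IsPrimitiveRoot ζ p) (hS : IsGoodSet S)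
    (hpS : ∀ v ∉ S, v.valuation K (p : K) = 1) {x : Kˣ} (hx : x ∈ sUnits S) (hxp : ∀ c, c ^ p ≠ (x : K)) :
    ∃ N : Subgroup Kˣ, N ≤ sUnits S ∧ (∀ a ∈ N, NormP p ζ (x : K) (a : K)) ∧
      N.relIndex (sUnits S) ≠ 0 ∧ N.relIndex (sUnits S) * p ≤ p ^ nonsplitCard p x S := by
  obtain ⟨L, _, _, _, ξ, σ, hK⟩ := exists_isKummer hp hζ hxp
  let τ : Monoid.End (sUnits (abovePrimes L S)) :=
    (((Units.map (σ : L →* L)).comp (sUnits (abovePrimes L S)).subtype).codRestrict _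
      fun y => map_mem_sUnits_abovePrimes σ y.2)
  have hτ : ∀ y, (((τ y : sUnits (abovePrimes L S)) : Lˣ) : L) = σ (y : Lˣ) := fun y => rfl
  have hτi : ∀ (i : ℕ) y, ((((τ ^ i) y : sUnits (abovePrimes L S)) : Lˣ) : L) = (σ ^ i) (y : Lˣ) := fun i => by
    induction i with
    | zero => intro y; rfl
    | succ i ih =>
      intro y
      rw [pow_succ, pow_succ]
      exact (ih (τ y)).trans rfl
  let N : Monoid.End (sUnits (abovePrimes L S)) :=
    (∏ i ∈ Finset.range p, ((τ ^ i : Monoid.End _) : sUnits (abovePrimes L S) →* sUnits (abovePrimes L S)) :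
      sUnits (abovePrimes L S) →* sUnits (abovePrimes L S))
  have hN : ∀ m, N m = ∏ i ∈ Finset.range p, (τ ^ i) m := fun m => MonoidHom.finset_prod_apply _ _ _
  have hNval : ∀ m, ((N m : Lˣ) : L) = ∏ i ∈ Finset.range p, (σ ^ i) (m : Lˣ) := fun m => by
    rw [hN]
    push_cast
    exact Finset.prod_congr rfl fun i _ => hτi i m
  let ψ : sUnits S →* sUnits (abovePrimes L S) :=
    ((Units.map (algebraMap K L : K →* L)).comp (sUnits S).subtype).codRestrict _
      fun a => algebraMap_mem_sUnits_abovePrimes.2 a.2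
  have hψ : ∀ a, ((ψ a : Lˣ) : L) = algebraMap K L (a : Kˣ) := fun a => rfl
  have hψinj : Function.Injective ψ := fun a b hab => by
    have : algebraMap K L (a : Kˣ) = algebraMap K L (b : Kˣ) := by rw [← hψ, hab, hψ]
    exact Subtype.ext (Units.ext ((algebraMap K L).injective this))
  obtain ⟨d, hd, hdp, hrel⟩ := relIndex_norm_of_hasQ hp τ N
    (by
      refine MonoidHom.ext fun y => Subtype.ext (Units.ext ?_)
      exact (hτi p y).trans (by rw [hK.aut_pow]; rfl))
    hN ψ.range
    (by
      intro m
      constructor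
      · rintro ⟨a, rfl⟩
        refine Subtype.ext (Units.ext ?_)
        rw [hτ, hψ, AlgEquiv.commutes]
      · intro h
        obtain ⟨c, hc⟩ := hK.fixed (m : Lˣ) (by rw [← hτ, h])
        have hc0 : c ≠ 0 := by
          rintro rfl
          exact (m : Lˣ).ne_zero (by rw [← hc, map_zero])
        have hm : Units.map (algebraMap K L : K →* L) (Units.mk0 c hc0) = (m : Lˣ) := Units.ext hc
        exact ⟨⟨Units.mk0 c hc0, algebraMap_mem_sUnits_abovePrimes.1 (by rw [hm]; exact m.2)⟩,
          Subtype.ext hm⟩)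
    (by
      intro y hy
      obtain ⟨z, hz, hzy⟩ := hK.exists_sUnits_div_eq hp.pos hζ hS hpS x.ne_zero (fun v hv => mem_sUnits.1 hx v hv)
        (y : Lˣ) y.2 (by rw [← hNval, hy]; rfl)
      refine ⟨⟨z, hz⟩, Subtype.ext (Units.ext ?_)⟩
      rw [← hzy]
      exact Units.val_div_eq_div_val _ _)
    (hasQ_sUnits hp.pos (abovePrimes L S))
    (HasQ.pow_congr (MonoidHom.ofInjective hψinj) (hasQ_sUnits hp.pos S))
  have hidx : (((MonoidHom.range N).comap ψ).map (sUnits S).subtype).relIndex (sUnits S) =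
      (MonoidHom.range N).relIndex ψ.range := by
    rw [← Subgroup.index_comap, Subgroup.relIndex, Subgroup.subgroupOf,
      Subgroup.comap_map_eq_self_of_injective (sUnits S).subtype_injective]
  refine ⟨((MonoidHom.range N).comap ψ).map (sUnits S).subtype, ?_, ?_, ?_, ?_⟩
  · rintro - ⟨a, -, rfl⟩
    exact a.2
  · rintro - ⟨a, ⟨m, hm⟩, rfl⟩
    exact (hK.normP_iff _).2 ⟨(m : Lˣ), (hNval m).symm.trans (congrArg (fun z : sUnits (abovePrimes L S) => ((z : Lˣ) : L)) hm)⟩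
  · rw [hidx]
    intro h
    rw [h, Nat.cast_zero, zero_mul] at hrel
    have : (0 : ℚ) < p := by exact_mod_cast hp.pos
    exact (pow_pos this _).ne hrel
  · rw [hidx]
    set R := (MonoidHom.range N).relIndex ψ.range
    have hle := hK.mul_card_le hp hζ S
    change _ ≤ _ + (p - 1) * nonsplitCard p x S at hle
    rw [card_infinitePlace_eq, card_infinitePlace_eq] at hle
    have hp1 : p - 1 ≠ 0 := Nat.sub_ne_zero_of_lt hp.one_lt
    have hp0 : (0 : ℚ) < p := by exact_mod_cast hp.pos
    refine (Nat.pow_le_pow_iff_left hp1).1 ?_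
    have h1 : ((R : ℚ) * p) ^ (p - 1) * p ^ ((abovePrimes L S).card + Units.rank L) =
        p ^ ((S.card + Units.rank K + 1) * (p - 1) + (S.card + Units.rank K)) := by
      rw [eq_div_iff (pow_pos hp0 _).ne'] at hdp
      have h3 : (p : ℚ) ^ ((S.card + Units.rank K + 1) * (p - 1) + (S.card + Units.rank K)) =
          (p ^ (S.card + Units.rank K) * p) ^ (p - 1) * p ^ (S.card + Units.rank K) := by
        rw [pow_add _ (_ * _), pow_mul, pow_succ]
      rw [← hdp, h3, ← hrel, ← mul_assoc, ← mul_pow]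
      ring
    have h2 : (R * p) ^ (p - 1) * p ^ ((abovePrimes L S).card + Units.rank L) =
        p ^ ((S.card + Units.rank K + 1) * (p - 1) + (S.card + Units.rank K)) := by exact_mod_cast h1
    refine Nat.le_of_mul_le_mul_right (h2.le.trans ?_) (pow_pos hp.pos ((abovePrimes L S).card + Units.rank L))
    rw [← pow_mul, ← pow_add]
    refine Nat.pow_le_pow_right hp.pos ?_
    obtain ⟨q, rfl⟩ : ∃ q, p = q + 1 := ⟨p - 1, by omega⟩
    simp only [Nat.add_sub_cancel] at hle ⊢
    nlinarith

end GlobalNorms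

section NormResidue

open IsDedekindDomain HeightOneSpectrum WithZero NumberField

variable {K : Type} [Field K] [NumberField K] {p : ℕ} {ζ : K} {S : Finset (HeightOneSpectrum (𝓞 K))}

theorem mem_placeNorm_of_normP (hp : 0 < p) {x : K} {a : Kˣ} (h : NormP p ζ x (a : K)) (P : Place K) :
    a ∈ placeNorm p ζ x P := by
  rcases P with v | w <;> exact (mem_normSubgroup hp).2 (h.map _)

/-- The elements of `Kˣ` which are norms at all places of `withReal S`. -/
noncomputable def localNorms (p : ℕ) (ζ x : K) (S : Finset (HeightOneSpectrum (𝓞 K))) : Subgroup Kˣ :=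
  ⨅ P ∈ withReal S, placeNorm p ζ x P

/-- The elements of `Kˣ` which are `p`-th powers at all places of `withReal S`. -/
noncomputable def localPows (p : ℕ) (S : Finset (HeightOneSpectrum (𝓞 K))) : Subgroup Kˣ :=
  ⨅ P ∈ withReal S, placePow p P

theorem mem_localNorms {x : K} {a : Kˣ} : a ∈ localNorms p ζ x S ↔ ∀ P ∈ withReal S, a ∈ placeNorm p ζ x P := by
  simp [localNorms, Subgroup.mem_iInf]

theorem mem_localPows {a : Kˣ} : a ∈ localPows p S ↔ ∀ P ∈ withReal S, a ∈ placePow p P := by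
  simp [localPows, Subgroup.mem_iInf]

theorem localPows_le_localNorms (hp : 0 < p) (x : K) : localPows p S ≤ localNorms p ζ x S := fun a ha =>
  mem_localNorms.2 fun P hP => placePow_le_placeNorm hp ζ x P (mem_localPows.1 ha P hP)

theorem index_localNorms (hp : p.Prime) (hζ : IsPrimitiveRoot ζ p) (x : Kˣ) :
    (localNorms p ζ (x : K) S).index = p ^ nonsplitCard p x S := by
  classical
  rw [localNorms, Subgroup.index_iInf_of_forall_exists, nonsplitCard, ← Finset.prod_const, Finset.prod_filter]
  · refine Finset.prod_congr rfl fun P _ => ?_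
    by_cases h : x ∈ placePow p P
    · rw [if_neg (not_not.2 h), placeNorm_eq_top hp.pos hζ h, Subgroup.index_top]
    · rw [if_pos h, index_placeNorm hp hζ h]
  · intro a
    obtain ⟨k, hk⟩ := exists_forall_inv_mul_mem_placePow hp.pos S a
    exact ⟨k, fun P hP => placePow_le_placeNorm hp.pos ζ x P (hk P hP)⟩

theorem index_localPows_le (hp : p.Prime) (hζ : IsPrimitiveRoot ζ p) :
    (localPows p S : Subgroup Kˣ).index ≤ p ^ (2 * (S.card + Fintype.card (InfinitePlace K))) := by
  rw [localPows, Subgroup.index_iInf_of_forall_exists]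
  · exact prod_index_placePow_le hp hζ S
  · exact exists_forall_inv_mul_mem_placePow hp.pos S

theorem sUnits_sup_localNorms_ne_top (hp : p.Prime) (hζ : IsPrimitiveRoot ζ p) (hS : IsGoodSet S)
    (hpS : ∀ v ∉ S, v.valuation K (p : K) = 1) {x : Kˣ} (hx : x ∈ sUnits S) (hxp : ∀ c, c ^ p ≠ (x : K)) :
    sUnits S ⊔ localNorms p ζ (x : K) S ≠ ⊤ := by
  intro h
  obtain ⟨N, -, hN, h0, hle⟩ := exists_subgroup_norms hp hζ hS hpS hx hxp
  have h1 := Subgroup.relIndex_le_of_le_left (K := localNorms p ζ (x : K) S)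
    (fun a ha => mem_localNorms.2 fun P _ => mem_placeNorm_of_normP hp.pos (hN a ha) P) h0
  rw [← Subgroup.relIndex_sup_right, h, Subgroup.relIndex_top_right, index_localNorms hp hζ] at h1
  have h2 : 0 < p ^ nonsplitCard p x S := pow_pos hp.pos _
  have := hp.two_le
  nlinarith

theorem localNorms_eq_of_subset (hp : 0 < p) (hζ : IsPrimitiveRoot ζ p) {x : Kˣ}
    {T : Finset (HeightOneSpectrum (𝓞 K))} (h : S ⊆ T) (hT : ∀ v ∈ T, v ∉ S → x ∈ placePow p (.inl v)) :
    localNorms p ζ (x : K) T = localNorms p ζ (x : K) S := by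
  ext a
  simp only [mem_localNorms]
  refine ⟨fun H P hP => H P ?_, fun H P hP => ?_⟩
  · rcases P with v | w
    · simp only [inl_mem_withReal] at hP ⊢
      exact h hP
    · simp
  · by_cases hPS : P ∈ withReal S
    · exact H P hPS
    · rcases P with v | w
      · rw [inl_mem_withReal] at hP hPS
        rw [placeNorm_eq_top hp hζ (hT v hP hPS)]
        trivial
      · exact absurd (inr_mem_withReal _ _) hPS

theorem exists_sup_sUnits_eq_top {W : Subgroup Kˣ} (hW : W.index ≠ 0) (S : Finset (HeightOneSpectrum (𝓞 K))) :
    ∃ T, S ⊆ T ∧ sUnits T ⊔ W = ⊤ := by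
  classical
  have : W.FiniteIndex := ⟨hW⟩
  choose f hf using fun x : Kˣ => exists_mem_sUnits x
  have := Fintype.ofFinite (Kˣ ⧸ W)
  refine ⟨S ∪ Finset.univ.biUnion fun q : Kˣ ⧸ W => f q.out, Finset.subset_union_left, eq_top_iff.2 fun a _ => ?_⟩
  have h1 : ((a : Kˣ ⧸ W).out)⁻¹ * a ∈ W := QuotientGroup.eq.1 (QuotientGroup.out_eq' _)
  have h2 := sUnits_mono (Finset.subset_biUnion_of_mem (fun q : Kˣ ⧸ W => f q.out)
    (Finset.mem_univ (a : Kˣ ⧸ W)) |>.trans (Finset.subset_union_right (s₁ := S))) (hf (a : Kˣ ⧸ W).out)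
  rw [← mul_inv_cancel_left ((a : Kˣ ⧸ W).out) a]
  exact Subgroup.mul_mem_sup h2 h1

theorem exists_notMem_placePow (hp : p.Prime) (hζ : IsPrimitiveRoot ζ p) {x : Kˣ} (hxp : ∀ c, c ^ p ≠ (x : K))
    (S : Finset (HeightOneSpectrum (𝓞 K))) : ∃ v ∉ S, x ∉ placePow p (.inl v) := by
  classical
  by_contra! h
  obtain ⟨S₁, hS₁⟩ := exists_isGoodSet (K := K)
  obtain ⟨S₂, hS₂⟩ := exists_mem_sUnits x
  have hp0 : (p : K) ≠ 0 := by exact_mod_cast hp.ne_zero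
  obtain ⟨S₃, hS₃⟩ := exists_mem_sUnits (Units.mk0 (p : K) hp0)
  set U := S ∪ S₁ ∪ S₂ ∪ S₃
  have hU : ∀ v ∉ U, v ∉ S ∧ v ∉ S₁ ∧ v ∉ S₂ ∧ v ∉ S₃ := fun v hv => by
    simpa [U, not_or, and_assoc] using hv
  obtain ⟨T, hUT, hT⟩ := exists_sup_sUnits_eq_top (W := localNorms p ζ (x : K) U) (by
    rw [index_localNorms hp hζ]
    exact (pow_pos hp.pos _).ne') U
  have hT' : ∀ v ∉ T, v ∉ U := fun v hv h => hv (hUT h)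
  rw [← localNorms_eq_of_subset hp.pos hζ hUT fun v _ hv => h v (hU v hv).1] at hT
  exact sUnits_sup_localNorms_ne_top hp hζ (hS₁.mono fun v hv => hUT (by simp [U, hv]))
    (fun v hv => mem_sUnits.1 hS₃ v (hU v (hT' v hv)).2.2.2)
    (mem_sUnits.2 fun v hv => mem_sUnits.1 hS₂ v (hU v (hT' v hv)).2.2.1) hxp hT

end NormResidue

section HasseNorm

open IsDedekindDomain HeightOneSpectrum WithZero NumberField

variable {K : Type} [Field K] [NumberField K] {p : ℕ} {ζ : K} {S : Finset (HeightOneSpectrum (𝓞 K))}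

/-- The elements of `Kˣ` which are units at `v`. -/
noncomputable def unitsAt (v : HeightOneSpectrum (𝓞 K)) : Subgroup Kˣ :=
  (v.valuationOfNeZero (K := K)).ker

theorem mem_unitsAt {v : HeightOneSpectrum (𝓞 K)} {a : Kˣ} : a ∈ unitsAt v ↔ v.valuation K (a : K) = 1 := by
  rw [unitsAt, MonoidHom.mem_ker, ← valuationOfNeZero_eq v a, ← WithZero.coe_one, WithZero.coe_inj]

theorem relIndex_placePow_unitsAt (hp : p.Prime) (hζ : IsPrimitiveRoot ζ p) {v : HeightOneSpectrum (𝓞 K)}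
    (hpv : v.valuation K (p : K) = 1) : (placePow p (.inl v) : Subgroup Kˣ).relIndex (unitsAt v) = p := by
  have h1 : (placePow p (.inl v) : Subgroup Kˣ).index = p ^ 2 := by
    rw [index_placePow_inl hp hζ v (k := 0)]
    · simp
    · refine (v.valuation_of_algebraMap (K := K) (p : 𝓞 K)).symm.trans ?_
      refine (congrArg (v.valuation K) (map_natCast (algebraMap (𝓞 K) K) p)).trans (hpv.trans ?_)
      simp
  have hsurj : Function.Surjective (v.valuationOfNeZero (K := K)) := by
    obtain ⟨π, hπ⟩ := v.valuation_exists_uniformizer K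
    have hπ0 : π ≠ 0 := by rintro rfl; exact exp_ne_zero (hπ.symm.trans (map_zero _))
    intro n
    refine ⟨(Units.mk0 π hπ0) ^ (-(Multiplicative.toAdd n)), ?_⟩
    rw [← WithZero.coe_inj, valuationOfNeZero_eq]
    rw [Units.val_zpow_eq_zpow_val, map_zpow₀, Units.val_mk0, hπ, ← exp_zsmul]
    simp [exp]
  have h2 : (unitsAt v ⊔ placePow p (.inl v)).index = p := by
    rw [unitsAt, sup_comm, ← Nat.mul_one (Subgroup.index _), ← Subgroup.index_top (G := Multiplicative ℤ),
      ← MonoidHom.range_eq_top.2 hsurj, ← Subgroup.index_map]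
    have h3 : (placePow p (.inl v) : Subgroup Kˣ).map (v.valuationOfNeZero (K := K)) =
        (powMonoidHom p : Multiplicative ℤ →* Multiplicative ℤ).range := by
      ext n
      constructor
      · rintro ⟨a, ha, rfl⟩
        obtain ⟨c, hc⟩ := (mem_powSubgroup hp.pos).1 ha
        have hc0 : Valued.v c ≠ 0 := (Valuation.ne_zero_iff _).2 fun h => by
          rw [h, zero_pow hp.ne_zero, eq_comm, map_eq_zero] at hc
          exact a.ne_zero hc
        obtain ⟨k, hk⟩ := exists_valued_sub_lt v c hc0
        have hkc : v.valuation K k = Valued.v c :=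
          (valuedAdicCompletion_eq_valuation' v k).symm.trans (Valuation.map_eq_of_sub_lt _ hk)
        have hk0 : k ≠ 0 := by
          rintro rfl
          exact hc0 (hkc.symm.trans (map_zero _))
        refine ⟨v.valuationOfNeZero (Units.mk0 k hk0), ?_⟩
        rw [powMonoidHom_apply, ← map_pow, ← WithZero.coe_inj, valuationOfNeZero_eq, valuationOfNeZero_eq,
          Units.val_pow_eq_pow_val, Units.val_mk0, map_pow, hkc, ← Valuation.map_pow, hc]
        exact valuedAdicCompletion_eq_valuation' v (a : K)
      · rintro ⟨m, rfl⟩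
        obtain ⟨a, rfl⟩ := hsurj m
        exact ⟨a ^ p, pow_mem_placePow hp.pos a _, map_pow _ _ _⟩
    rw [h3]
    have h4 := (hasQ_pow_multiplicative_int hp.pos).2.2
    have h5 : (powMonoidHom p : Multiplicative ℤ →* Multiplicative ℤ).ker = ⊥ :=
      (MonoidHom.ker_eq_bot_iff _).2 (pow_left_injective hp.ne_zero)
    rw [h5, Subgroup.card_bot, Nat.cast_one, mul_one] at h4
    exact_mod_cast h4
  have h3 := Subgroup.relIndex_mul_index (H := placePow p (.inl v)) (K := unitsAt v ⊔ placePow p (.inl v)) le_sup_right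
  rw [h1, h2, Subgroup.relIndex_sup_right, sq] at h3
  exact Nat.eq_of_mul_eq_mul_right hp.pos h3

theorem _root_.Valuation.map_pow_sub_pow_lt_one {R Γ : Type*} [CommRing R] [LinearOrderedCommGroupWithZero Γ]
    (v : Valuation R Γ) {x y : R} (hx : v x ≤ 1) (hy : v y ≤ 1) (h : v (x - y) < 1) (n : ℕ) :
    v (x ^ n - y ^ n) < 1 := by
  induction n with
  | zero => simp
  | succ n ih =>
    have : x ^ (n + 1) - y ^ (n + 1) = x ^ n * (x - y) + (x ^ n - y ^ n) * y := by ring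
    rw [this]
    refine Valuation.map_add_lt _ ?_ ?_
    · rw [map_mul, map_pow]
      exact mul_lt_one_of_nonneg_of_lt_one_right (pow_le_one' hx _) zero_le' h
    · rw [map_mul]
      exact mul_lt_one_of_nonneg_of_lt_one_left zero_le' ih hy

theorem mem_placePow_above {L : Type} [Field L] [NumberField L] [Algebra K L] (hp : 0 < p)
    (w : HeightOneSpectrum (𝓞 L)) {c : Kˣ} (hpv : (belowPrime K w).valuation K (p : K) = 1)
    (hc : c ∈ unitsAt (belowPrime K w)) (hcp : c ∈ placePow p (.inl (belowPrime K w))) :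
    Units.map (algebraMap K L : K →* L) c ∈ placePow p (.inl w) := by
  obtain ⟨d, hd⟩ := (mem_powSubgroup hp).1 hcp
  have hlt := belowPrime_valuation_lt_one (K := K) w
  have hone := fun a => valuation_eq_one_iff_of_lt_one_iff (f := algebraMap K L) hlt a
  rw [mem_unitsAt] at hc
  have hd1 : Valued.v d = 1 := by
    have h1 : Valued.v d ^ p = 1 := by
      rw [← Valuation.map_pow, hd]
      exact (valuedAdicCompletion_eq_valuation' _ (c : K)).trans hc
    exact (pow_eq_one_iff_of_nonneg zero_le' hp.ne').1 h1
  obtain ⟨z, hz⟩ := exists_valued_sub_lt (belowPrime K w) d (γ := 1) one_ne_zero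
  have hz1 : (belowPrime K w).valuation K ((c : K) - z ^ p) < 1 := by
    rw [← valuedAdicCompletion_eq_valuation' (belowPrime K w)]
    have h1 : Valued.v (algebraMap K ((belowPrime K w).adicCompletion K) z) ≤ 1 := by
      have := Valuation.map_add_le _ hz.le hd1.le
      rwa [sub_add_cancel] at this
    refine Eq.trans_lt ?_ (Valuation.map_pow_sub_pow_lt_one _ hd1.le h1 (by rwa [Valuation.map_sub_swap]) p)
    rw [hd, ← map_pow, ← map_sub]
    rfl
  refine mem_powSubgroup_of_valuation_sub_lt_one w hp ?_ ?_ (z := algebraMap K L z) ?_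
  · rw [← map_natCast (algebraMap K L)]
    exact (hone _).1 hpv
  · exact (hone _).1 hc
  · rw [hlt, map_sub, map_pow] at hz1
    exact hz1

end HasseNorm

theorem Subgroup.relIndex_eq_of_prime {G : Type*} [CommGroup G] {A B P : Subgroup G} {p : ℕ} (hp : p.Prime)
    (hAB : A ≤ B) (hP : P.relIndex B = p) (hA : ¬ A ≤ P) : P.relIndex A = p ∧ B ≤ A ⊔ P := by
  have h := Subgroup.relIndex_mul_relIndex P (A ⊔ P) (B ⊔ P) le_sup_right (sup_le_sup_right hAB P)
  rw [Subgroup.relIndex_sup_right, Subgroup.relIndex_sup_right, hP] at h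
  have h1 : P.relIndex A ≠ 1 := fun h => hA (Subgroup.relIndex_eq_one.1 h)
  have h2 : P.relIndex A = p := ((Nat.dvd_prime hp).1 ⟨_, h.symm⟩).resolve_left h1
  rw [h2] at h
  refine ⟨h2, le_sup_left.trans (Subgroup.relIndex_eq_one.1 (Nat.eq_of_mul_eq_mul_left hp.pos (h.trans (mul_one p).symm)))⟩

section HasseNorm2

open IsDedekindDomain HeightOneSpectrum WithZero NumberField

variable {K : Type} [Field K] [NumberField K] {p : ℕ} {ζ : K} {S : Finset (HeightOneSpectrum (𝓞 K))}

theorem sUnits_le_unitsAt {v : HeightOneSpectrum (𝓞 K)} (hv : v ∉ S) : sUnits S ≤ unitsAt v := fun _ ha =>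
  mem_unitsAt.2 (mem_sUnits.1 ha v hv)

theorem IsKummer.exists_mul_pow_eq {L : Type} [Field L] [NumberField L] [Algebra K L] {b : K} {ξ : L} {σ : L ≃ₐ[K] L}
    (hK : IsKummer p ζ b ξ σ) (hp : 0 < p) (hζ : IsPrimitiveRoot ζ p) (hb : b ≠ 0) {u : K} (hu : u ≠ 0) {y : L}
    (hy : y ^ p = algebraMap K L u) : ∃ (i : ℕ) (c : K), c ^ p * b ^ i = u := by
  have hζL : IsPrimitiveRoot (algebraMap K L ζ) p := hζ.map_of_injective (algebraMap K L).injective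
  have hy0 : y ≠ 0 := by
    rintro rfl
    rw [zero_pow hp.ne', eq_comm, map_eq_zero] at hy
    exact hu hy
  have : NeZero p := ⟨hp.ne'⟩
  obtain ⟨j, -, hj⟩ := hζL.eq_pow_of_pow_eq_one (ξ := σ y / y) (by
    rw [div_pow, ← map_pow, hy, AlgEquiv.commutes, div_self]
    rwa [map_ne_zero])
  have hξ0 := hK.root_ne_zero hb hp
  obtain ⟨c, hc⟩ := hK.fixed (y / ξ ^ j) (by
    rw [map_div₀, map_pow, hK.map_root, (div_eq_iff hy0).1 hj.symm, Algebra.smul_def, mul_pow]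
    exact mul_div_mul_left _ _ (pow_ne_zero _ (hζL.ne_zero hp.ne')))
  refine ⟨j, c, (algebraMap K L).injective ?_⟩
  rw [map_mul, map_pow, hc, div_pow, hy, map_pow, ← hK.root_pow, ← pow_mul, ← pow_mul, mul_comm p j,
    div_mul_cancel₀ _ (pow_ne_zero _ hξ0)]

theorem exists_mem_notMem_placePow (hp : p.Prime) (hζ : IsPrimitiveRoot ζ p)
    (hpS : ∀ v ∉ S, v.valuation K (p : K) = 1) {b u : Kˣ} (hb : b ∈ sUnits S) (hu : u ∈ sUnits S)
    (hbp : ∀ c, c ^ p ≠ (b : K)) (hub : ∀ (i : ℕ) (c : K), c ^ p * (b : K) ^ i ≠ u) :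
    ∃ v ∉ S, b ∈ placePow p (.inl v) ∧ u ∉ placePow p (.inl v) := by
  obtain ⟨L, _, _, _, ξ, σ, hK⟩ := exists_isKummer hp hζ hbp
  obtain ⟨w, hw, huw⟩ := exists_notMem_placePow (K := L) hp
    (hζ.map_of_injective (algebraMap K L).injective) (x := Units.map (algebraMap K L : K →* L) u)
    (fun y hy => by
      obtain ⟨i, c, h⟩ := hK.exists_mul_pow_eq hp.pos hζ b.ne_zero u.ne_zero hy
      exact hub i c h) (abovePrimes L S)
  rw [mem_abovePrimes] at hw
  have hpw := hpS _ hw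
  refine ⟨belowPrime K w, hw, ?_, fun h => huw (mem_placePow_above hp.pos w hpw (sUnits_le_unitsAt hw hu) h)⟩
  by_contra hbw
  have h1 := (Subgroup.relIndex_eq_of_prime hp (A := Subgroup.zpowers b)
    (Subgroup.zpowers_le.2 (sUnits_le_unitsAt hw hb)) (relIndex_placePow_unitsAt hp hζ hpw)
    (fun h => hbw (Subgroup.zpowers_le.1 h))).2 (sUnits_le_unitsAt hw hu)
  obtain ⟨-, ⟨i, rfl⟩, c, hc, hbc⟩ := Subgroup.mem_sup.1 h1
  have hcU : c ∈ unitsAt (belowPrime K w) := by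
    rw [← eq_inv_mul_iff_mul_eq] at hbc
    rw [hbc]
    exact mul_mem (inv_mem (zpow_mem (sUnits_le_unitsAt hw hb) _)) (sUnits_le_unitsAt hw hu)
  refine huw ?_
  rw [← hbc, map_mul, map_zpow]
  refine mul_mem (zpow_mem ?_ _) (mem_placePow_above hp.pos w hpw hcU hc)
  have hξ0 := hK.root_ne_zero b.ne_zero hp.pos
  have : Units.map (algebraMap K L : K →* L) b = Units.mk0 ξ hξ0 ^ p := by
    ext
    simp [hK.root_pow]
  rw [this]
  exact pow_mem_placePow hp.pos _ _

theorem relIndex_pow_sUnits (hp : 0 < p) (hζ : IsPrimitiveRoot ζ p) (S : Finset (HeightOneSpectrum (𝓞 K))) :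
    ((sUnits S).map (powMonoidHom p)).relIndex (sUnits S) = p ^ (S.card + Fintype.card (InfinitePlace K)) := by
  rw [← index_pow_sUnits hp hζ S, Subgroup.relIndex]
  congr 1
  ext a
  constructor
  · rintro ⟨c, hc, hca⟩
    exact ⟨⟨c, hc⟩, Subtype.ext hca⟩
  · rintro ⟨c, rfl⟩
    exact ⟨c, c.2, rfl⟩

theorem mem_sUnits_of_pow_mem (hp : 0 < p) {c : Kˣ} (hc : c ^ p ∈ sUnits S) : c ∈ sUnits S := by
  refine mem_sUnits.2 fun v hv => ?_
  have := mem_sUnits.1 hc v hv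
  rw [Units.val_pow_eq_pow_val, map_pow] at this
  exact (pow_eq_one_iff_of_nonneg zero_le' hp.ne').1 this

theorem exists_finset_relIndex (hp : p.Prime) (hζ : IsPrimitiveRoot ζ p)
    (hpS : ∀ v ∉ S, v.valuation K (p : K) = 1) {b : Kˣ} (hb : b ∈ sUnits S) (hbp : ∀ c, c ^ p ≠ (b : K))
    (k : ℕ) (hk : k < S.card + Fintype.card (InfinitePlace K)) :
    ∃ T : Finset (HeightOneSpectrum (𝓞 K)), T.card = k ∧ Disjoint S T ∧ (∀ v ∈ T, b ∈ placePow p (.inl v)) ∧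
      (⨅ v ∈ T, placePow p (.inl v) : Subgroup Kˣ).relIndex (sUnits S) = p ^ k := by
  classical
  induction k with
  | zero => exact ⟨∅, by simp⟩
  | succ k ih =>
    obtain ⟨T, hT, hST, hbT, hrel⟩ := ih (by omega)
    set Q : Subgroup Kˣ := ⨅ v ∈ T, placePow p (.inl v) with hQ
    set V : Subgroup Kˣ := (sUnits S).map (powMonoidHom p) with hV
    obtain ⟨u, hu, huV⟩ : ∃ u ∈ Q ⊓ sUnits S, u ∉ Subgroup.zpowers b ⊔ V := by
      by_contra! h
      have hVU : V ≤ sUnits S := by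
        rintro - ⟨a, ha, rfl⟩
        exact pow_mem ha p
      have h1 := Subgroup.relIndex_le_of_le_left (H := Q ⊓ sUnits S) (K := Subgroup.zpowers b ⊔ V) (L := sUnits S) h (by
        rw [Subgroup.inf_relIndex_right, hrel]
        exact (pow_pos hp.pos _).ne')
      rw [Subgroup.inf_relIndex_right, hrel] at h1
      have h2 := Subgroup.relIndex_mul_relIndex V (Subgroup.zpowers b ⊔ V) (sUnits S) le_sup_right
        (sup_le (Subgroup.zpowers_le.2 hb) hVU)
      rw [relIndex_pow_sUnits hp.pos hζ, Subgroup.relIndex_sup_right] at h2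
      have h3 : V.relIndex (Subgroup.zpowers b) ∣ p := by
        have h4 : (powMonoidHom p : Multiplicative ℤ →* _).range ≤ V.comap (zpowersHom Kˣ b) := by
          rintro - ⟨m, rfl⟩
          exact ⟨zpowersHom Kˣ b m, by
            rw [zpowersHom_apply]
            exact zpow_mem hb _, (map_pow _ _ _).symm⟩
        have h5 := Subgroup.index_dvd_of_le h4
        have h6 := (hasQ_pow_multiplicative_int hp.pos).2.2
        have h7 : (powMonoidHom p : Multiplicative ℤ →* Multiplicative ℤ).ker = ⊥ :=
          (MonoidHom.ker_eq_bot_iff _).2 (pow_left_injective hp.ne_zero)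
        rw [h7, Subgroup.card_bot, Nat.cast_one, mul_one] at h6
        rw [Subgroup.index_comap, Nat.cast_injective h6] at h5
        exact h5
      have h4 : p ^ (S.card + Fintype.card (InfinitePlace K)) ≤ p ^ (k + 1) := by
        rw [← h2, pow_succ, mul_comm]
        exact Nat.mul_le_mul h1 (Nat.le_of_dvd hp.pos h3)
      exact absurd ((Nat.pow_le_pow_iff_right hp.one_lt).1 h4) (by omega)
    obtain ⟨v, hv, hbv, huv⟩ := exists_mem_notMem_placePow (S := S ∪ T) hp hζ
      (fun v hv => hpS v fun h => hv (Finset.mem_union_left _ h)) (sUnits_mono Finset.subset_union_left hb)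
      (sUnits_mono Finset.subset_union_left hu.2) hbp (fun i c h => huV (by
        have hc0 : c ≠ 0 := by
          rintro rfl
          rw [zero_pow hp.ne_zero, zero_mul] at h
          exact u.ne_zero h.symm
        have h1 : Units.mk0 c hc0 ^ p * b ^ i = u := by
          ext
          simpa using h
        have h2 : Units.mk0 c hc0 ^ p ∈ sUnits S := by
          rw [← eq_mul_inv_iff_mul_eq] at h1
          rw [h1]
          exact mul_mem hu.2 (inv_mem (pow_mem hb _))
        rw [← h1, mul_comm]
        exact Subgroup.mul_mem_sup (pow_mem (Subgroup.mem_zpowers b) i) ⟨_, mem_sUnits_of_pow_mem hp.pos h2, rfl⟩))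
    rw [Finset.mem_union, not_or] at hv
    refine ⟨insert v T, by rw [Finset.card_insert_of_notMem hv.2, hT], ?_, ?_, ?_⟩
    · rw [Finset.disjoint_insert_right]
      exact ⟨hv.1, hST⟩
    · intro w hw
      rcases Finset.mem_insert.1 hw with rfl | hw
      · exact hbv
      · exact hbT w hw
    · rw [Finset.iInf_insert, ← hQ, ← Subgroup.relIndex_inf_mul_relIndex, hrel, pow_succ, mul_comm]
      congr 1
      exact (Subgroup.relIndex_eq_of_prime hp (inf_le_right.trans (sUnits_le_unitsAt hv.1))
        (relIndex_placePow_unitsAt hp hζ (hpS v hv.1)) (fun h => huv (h hu))).1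

end HasseNorm2

section HasseNorm3

open IsDedekindDomain HeightOneSpectrum WithZero NumberField

variable {K : Type} [Field K] [NumberField K] {p : ℕ} {ζ : K} {S T : Finset (HeightOneSpectrum (𝓞 K))}

theorem exists_pow_eq_of_mem_localPows [DecidableEq (HeightOneSpectrum (𝓞 K))] (hp : p.Prime)
    (hζ : IsPrimitiveRoot ζ p) (hS : IsGoodSet S)
    (hpS : ∀ v ∉ S, v.valuation K (p : K) = 1) (hST : Disjoint S T)
    (hT : (⨅ v ∈ T, placePow p (.inl v) : Subgroup Kˣ).relIndex (sUnits S) = p ^ T.card)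
    {x : Kˣ} (hx : x ∈ sUnits (S ∪ T)) (hxS : x ∈ localPows p S) : ∃ c, c ^ p = (x : K) := by
  by_contra! hxp
  refine sUnits_sup_localNorms_ne_top hp hζ (hS.mono Finset.subset_union_left)
    (fun v hv => hpS v fun h => hv (Finset.mem_union_left _ h)) hx hxp (eq_top_iff.2 fun a _ => ?_)
  set Q : Subgroup Kˣ := ⨅ v ∈ T, placePow p (.inl v) with hQ
  set Y : Subgroup Kˣ := ⨅ v ∈ T, unitsAt v with hY
  have hTS : ∀ v ∈ T, v ∉ S := fun v hv hv' => Finset.disjoint_left.1 hST hv' hv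
  obtain ⟨k, hk⟩ := hS.exists_valuation_eq (fun v => if v ∈ T then a else 1)
    (T.finite_toSet.subset fun v hv => by
      by_contra h
      refine hv.2 ?_
      rw [if_neg (fun h' => h (Finset.mem_coe.2 h')), Units.val_one, map_one])
  have hkU : k ∈ sUnits (S ∪ T) := mem_sUnits.2 fun v hv => by
    rw [Finset.mem_union, not_or] at hv
    rw [hk v hv.1, if_neg hv.2, Units.val_one, map_one]
  have hakY : k⁻¹ * a ∈ Y := by
    simp only [hY, Subgroup.mem_iInf]
    intro v hv
    rw [mem_unitsAt, Units.val_mul, map_mul, Units.val_inv_eq_inv_val, map_inv₀, hk v (hTS v hv), if_pos hv]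
    exact inv_mul_cancel₀ ((Valuation.ne_zero_iff _).2 a.ne_zero)
  have hUY : sUnits S ≤ Y := le_iInf₂ fun v hv => sUnits_le_unitsAt (hTS v hv)
  have hle : ∀ i : T, (placePow p (.inl i.1) : Subgroup Kˣ).relIndex Y ≤ p ∧
      (placePow p (.inl i.1) : Subgroup Kˣ).relIndex Y ≠ 0 := fun i => by
    have h1 := relIndex_placePow_unitsAt hp hζ (hpS i.1 (hTS i.1 i.2))
    have hYi : Y ≤ unitsAt i.1 := iInf₂_le i.1 i.2
    refine ⟨(Subgroup.relIndex_le_of_le_right hYi (by rw [h1]; exact hp.ne_zero)).trans h1.le, fun h => ?_⟩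
    exact hp.ne_zero (h1.symm.trans (Subgroup.relIndex_eq_zero_of_le_right hYi h))
  have hQi : Q = ⨅ i : T, placePow p (.inl i.1) := iInf_subtype'
  have hQY : Q.relIndex Y ≤ p ^ T.card := by
    rw [hQi]
    refine (Subgroup.relIndex_iInf_le _).trans ((Finset.prod_le_prod' fun i _ => (hle i).1).trans ?_)
    rw [Finset.prod_const, Finset.card_univ, Fintype.card_coe]
  have hYU : Y ≤ sUnits S ⊔ Q := by
    have h1 := Subgroup.relIndex_mul_relIndex Q (sUnits S ⊔ Q) (Y ⊔ Q) le_sup_right (sup_le_sup_right hUY Q)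
    rw [Subgroup.relIndex_sup_right, Subgroup.relIndex_sup_right, hT] at h1
    have h2 : 0 < p ^ T.card := pow_pos hp.pos _
    have h0 : Q.relIndex Y ≠ 0 := by
      rw [hQi]
      exact Subgroup.relIndex_iInf_ne_zero fun i => (hle i).2
    refine (le_sup_left : Y ≤ Y ⊔ Q).trans (Subgroup.relIndex_eq_one.1 ?_)
    have h3 : (sUnits S ⊔ Q).relIndex (Y ⊔ Q) ≠ 0 := fun h => h0 (by rw [← h1, h, mul_zero])
    have h4 : (sUnits S ⊔ Q).relIndex (Y ⊔ Q) ≤ 1 := by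
      refine Nat.le_of_mul_le_mul_left ?_ h2
      rw [h1, mul_one]
      exact hQY
    omega
  obtain ⟨u, hu, q, hq, huq⟩ := Subgroup.mem_sup.1 (hYU hakY)
  have hqN : q ∈ localNorms p ζ (x : K) (S ∪ T) := by
    rw [mem_localNorms]
    intro P hP
    by_cases hxP : x ∈ placePow p P
    · rw [placeNorm_eq_top hp.pos hζ hxP]
      trivial
    · rcases P with v | w
      · rw [inl_mem_withReal, Finset.mem_union] at hP
        have hvT : v ∈ T := hP.resolve_left fun h => hxP (mem_localPows.1 hxS _ (inl_mem_withReal.2 h))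
        simp only [hQ, Subgroup.mem_iInf] at hq
        exact placePow_le_placeNorm hp.pos ζ x _ (hq v hvT)
      · exact absurd (mem_localPows.1 hxS _ (inr_mem_withReal _ _)) hxP
  have ha : a = (k * u) * q := by
    rw [mul_assoc, huq, mul_inv_cancel_left]
  rw [ha]
  exact Subgroup.mul_mem_sup (mul_mem hkU (sUnits_mono Finset.subset_union_left hu)) hqN

theorem index_localPows_ne_zero (hp : p.Prime) (hζ : IsPrimitiveRoot ζ p) :
    (localPows p S : Subgroup Kˣ).index ≠ 0 := by
  rw [localPows, Subgroup.index_iInf_of_forall_exists _ _ (exists_forall_inv_mul_mem_placePow hp.pos S),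
    Finset.prod_ne_zero_iff]
  rintro (v | w) -
  · obtain ⟨k, hk⟩ := exists_intValuation_natCast_eq (K := K) hp.pos v
    rw [index_placePow_inl hp hζ v hk]
    have : Finite (𝓞 K ⧸ v.asIdeal ^ k) := Ring.HasFiniteQuotients.finiteQuotient (pow_ne_zero k v.ne_bot)
    exact mul_ne_zero (pow_ne_zero 2 hp.ne_zero) Nat.card_pos.ne'
  · rw [index_placePow_inr hp hζ]
    exact hp.ne_zero

/-- **Hasse's norm theorem** for Kummer extensions of prime degree. -/
theorem normP_of_forall_mem_placeNorm (hp : p.Prime) (hζ : IsPrimitiveRoot ζ p) {a b : Kˣ}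
    (h : ∀ P, a ∈ placeNorm p ζ (b : K) P) : NormP p ζ (b : K) (a : K) := by
  classical
  by_cases hbp : ∃ c, c ^ p = (b : K)
  · obtain ⟨c, hc⟩ := hbp
    rw [← hc]
    exact normP_of_pow hp.pos hζ (by rintro rfl; rw [zero_pow hp.ne_zero] at hc; exact b.ne_zero hc.symm)
  push Not at hbp
  obtain ⟨S₁, hS₁⟩ := exists_isGoodSet (K := K)
  obtain ⟨S₂, hS₂⟩ := exists_mem_sUnits b
  obtain ⟨S₄, hS₄⟩ := exists_mem_sUnits a
  have hp0 : (p : K) ≠ 0 := by exact_mod_cast hp.ne_zero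
  obtain ⟨S₃, hS₃⟩ := exists_mem_sUnits (Units.mk0 (p : K) hp0)
  obtain ⟨S, hS, hb, ha, hpS⟩ : ∃ S : Finset (HeightOneSpectrum (𝓞 K)), IsGoodSet S ∧ b ∈ sUnits S ∧ a ∈ sUnits S ∧
      ∀ v ∉ S, v.valuation K (p : K) = 1 := by
    refine ⟨S₁ ∪ S₂ ∪ S₃ ∪ S₄, hS₁.mono fun v hv => by simp [hv], sUnits_mono (fun v hv => by simp [hv]) hS₂,
      sUnits_mono (fun v hv => by simp [hv]) hS₄, fun v hv => mem_sUnits.1 hS₃ v fun h => hv (by simp [h])⟩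
  set s := S.card + Fintype.card (InfinitePlace K) with hs
  have hspos : 0 < s := by
    have := card_infinitePlace_eq (K := K)
    omega
  obtain ⟨T, hTc, hST, hbT, hrel⟩ := exists_finset_relIndex hp hζ hpS hb hbp (s - 1) (by omega)
  rw [← hTc] at hrel
  have hS'c : (S ∪ T).card = S.card + T.card := Finset.card_union_of_disjoint hST
  have hmono : sUnits S ≤ sUnits (S ∪ T) := sUnits_mono Finset.subset_union_left
  obtain ⟨N, hNU, hN, hN0, hNle⟩ := exists_subgroup_norms hp hζ (hS.mono Finset.subset_union_left)
    (fun v hv => hpS v fun h => hv (Finset.mem_union_left _ h)) (hmono hb) hbp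
  have hWN := localNorms_eq_of_subset hp.pos hζ (x := b) (Finset.subset_union_left (s₁ := S) (s₂ := T))
    (fun v hv hv' => hbT v ((Finset.mem_union.1 hv).resolve_left hv'))
  rw [← index_localNorms hp hζ, hWN] at hNle
  set U := (sUnits (S ∪ T) : Subgroup Kˣ) with hU
  set WN := localNorms p ζ (b : K) S with hWNdef
  set WP := (localPows p S : Subgroup Kˣ) with hWPdef
  have h1 : WP.relIndex U = p ^ (2 * s - 1) := by
    rw [← Subgroup.inf_relIndex_right]
    have : WP ⊓ U = U.map (powMonoidHom p) := by
      ext x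
      constructor
      · rintro ⟨hx, hxU⟩
        obtain ⟨c, hc⟩ := exists_pow_eq_of_mem_localPows hp hζ hS hpS hST hrel hxU hx
        have hc0 : c ≠ 0 := by
          rintro rfl
          rw [zero_pow hp.ne_zero] at hc
          exact x.ne_zero hc.symm
        have hcx : Units.mk0 c hc0 ^ p = x := Units.ext (by simpa using hc)
        exact ⟨Units.mk0 c hc0, mem_sUnits_of_pow_mem hp.pos (by rwa [hcx]), hcx⟩
      · rintro ⟨c, hc, rfl⟩
        exact ⟨mem_localPows.2 fun P _ => pow_mem_placePow hp.pos c P, pow_mem hc p⟩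
    rw [this, relIndex_pow_sUnits hp.pos hζ, hS'c, hTc]
    congr 1
    omega
  have hWP0 : WP.index ≠ 0 := index_localPows_ne_zero hp hζ
  have h2 : (U ⊔ WP).index ≤ p := by
    have h3 := Subgroup.relIndex_mul_index (H := WP) (K := U ⊔ WP) le_sup_right
    rw [Subgroup.relIndex_sup_right, h1] at h3
    have h4 := index_localPows_le hp hζ (S := S)
    rw [← hWPdef, ← h3, ← hs] at h4
    refine Nat.le_of_mul_le_mul_left (h4.trans (le_of_eq ?_)) (pow_pos hp.pos (2 * s - 1))
    rw [← pow_succ]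
    congr 1
    omega
  have h20 : (U ⊔ WP).index ≠ 0 := fun h =>
    hWP0 (Nat.eq_zero_of_zero_dvd (h ▸ Subgroup.index_dvd_of_le le_sup_right))
  have h3 : (U ⊔ WN).index ≤ p := (Nat.le_of_dvd (Nat.pos_of_ne_zero h20)
    (Subgroup.index_dvd_of_le (sup_le_sup_left (localPows_le_localNorms hp.pos _) U))).trans h2
  have h4 := Subgroup.relIndex_mul_index (H := WN) (K := U ⊔ WN) le_sup_right
  rw [Subgroup.relIndex_sup_right] at h4
  have h5 : N.relIndex U ≤ WN.relIndex U := by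
    refine Nat.le_of_mul_le_mul_right (hNle.trans ?_) hp.pos
    rw [← h4]
    exact Nat.mul_le_mul_left _ h3
  have h6 := Subgroup.relIndex_mul_relIndex N (WN ⊓ U) U (le_inf (fun c hc => mem_localNorms.2 fun P _ =>
    mem_placeNorm_of_normP hp.pos (hN c hc) P) hNU) inf_le_right
  rw [Subgroup.inf_relIndex_right] at h6
  have h7 : N.relIndex (WN ⊓ U) = 1 := by
    have h8 : WN.relIndex U ≠ 0 := fun h => hN0 (by rw [← h6, h, mul_zero])
    have h9 : N.relIndex (WN ⊓ U) ≠ 0 := fun h => hN0 (by rw [← h6, h, zero_mul])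
    have h10 : N.relIndex (WN ⊓ U) ≤ 1 := by
      refine Nat.le_of_mul_le_mul_right ?_ (Nat.pos_of_ne_zero h8)
      rw [h6, one_mul]
      exact h5
    omega
  exact hN a (Subgroup.relIndex_eq_one.1 h7 ⟨mem_localNorms.2 fun P _ => h P, hmono ha⟩)

end HasseNorm3

section AdicMap

open IsDedekindDomain HeightOneSpectrum WithZero NumberField

variable {K L : Type} [Field K] [NumberField K] [Field L] [NumberField L] [Algebra K L]

theorem continuous_algebraMap_belowPrime (P : HeightOneSpectrum (𝓞 L)) :
    Continuous (algebraMap (WithVal ((belowPrime K P).valuation K)) (WithVal (P.valuation L))) := by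
  have : P.asIdeal.LiesOver (belowPrime K P).asIdeal := ⟨rfl⟩
  exact (uniformContinuous_algebraMap_liesOver K L (belowPrime K P) P).continuous

variable (K) in
/-- The homomorphism of completions at a prime and at the prime below it. -/
noncomputable def adicMap (P : HeightOneSpectrum (𝓞 L)) :
    (belowPrime K P).adicCompletion K →+* P.adicCompletion L :=
  ((adicCompletion.equiv L P).symm : _ →+* P.adicCompletion L).comp
    ((UniformSpace.Completion.mapRingHom _ (continuous_algebraMap_belowPrime (K := K) P)).comp
      (adicCompletion.equiv K (belowPrime K P) : (belowPrime K P).adicCompletion K →+* _))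

theorem adicMap_algebraMap (P : HeightOneSpectrum (𝓞 L)) (x : K) :
    adicMap K P (algebraMap K _ x) = algebraMap L _ (algebraMap K L x) := by
  apply adicCompletion.ext
  exact UniformSpace.Completion.mapRingHom_coe (continuous_algebraMap_belowPrime (K := K) P) _

theorem continuous_adicMap (P : HeightOneSpectrum (𝓞 L)) : Continuous (adicMap K P) :=
  (adicCompletion.uniformEquiv L P).symm.continuous.comp
    (UniformSpace.Completion.continuous_map.comp (adicCompletion.uniformEquiv K (belowPrime K P)).continuous)

theorem valued_adicMap_le_one (P : HeightOneSpectrum (𝓞 L)) {y : (belowPrime K P).adicCompletion K}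
    (hy : Valued.v y ≤ 1) : Valued.v (adicMap K P y) ≤ 1 := by
  refine (denseRange_algebraMap K (belowPrime K P)).induction_on
    (p := fun y => Valued.v y ≤ 1 → Valued.v (adicMap K P y) ≤ 1) y ?_ (fun k hk => ?_) hy
  · exact isClosed_imp (Valued.isOpen_integer ((belowPrime K P).adicCompletion K))
      ((Valued.isClosed_integer (P.adicCompletion L)).preimage (continuous_adicMap P))
  · rw [adicMap_algebraMap]
    refine (valuedAdicCompletion_eq_valuation' P _).trans_le ?_
    exact (valuation_le_one_iff_of_lt_one_iff (f := algebraMap K L) (belowPrime_valuation_lt_one P) k).1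
      ((valuedAdicCompletion_eq_valuation' (belowPrime K P) k).symm.trans_le hk)

end AdicMap

section LocallySplit

open IsDedekindDomain HeightOneSpectrum NumberField IntermediateField

/-- All completions of `F` at finite and real places have `n`-dimensional representations of `D`. -/
structure LocallySplit {K F : Type} [Field K] [Field F] [NumberField F] (i : K →+* F) (D : Type) [Ring D]
    [Algebra K D] (n : ℕ) : Prop where
  finite : ∀ v : HeightOneSpectrum (𝓞 F), HasRep ((algebraMap F (v.adicCompletion F)).comp i) D n
  real : ∀ φ : F →+* ℝ, HasRep (φ.comp i) D n

variable {K : Type} [Field K] {D : Type} [DivisionRing D] [Algebra K D] {n : ℕ}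

theorem LocallySplit.extend {F L : Type} [Field F] [NumberField F] [Field L] [NumberField L] [Algebra F L]
    {i : K →+* F} (h : LocallySplit i D n) : LocallySplit ((algebraMap F L).comp i) D n where
  finite P := (h.finite (belowPrime F P)).map_eq (adicMap F P) (by
    ext a
    simp [adicMap_algebraMap])
  real φ := by
    rw [← RingHom.comp_assoc]
    exact h.real (φ.comp (algebraMap F L))

variable [Algebra.IsCentral K D] [FiniteDimensional K D]

theorem LocallySplit.hasRep_of_isKummer (hn : Module.finrank K D = n * n) {F L : Type} [Field F] [NumberField F]
    [Field L] [Algebra F L] {i : K →+* F} (h : LocallySplit i D n) {p : ℕ} (hp : p.Prime) {ζ : F}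
    (hζ : IsPrimitiveRoot ζ p) [IsGalois F L] (hL : Module.finrank F L = p)
    (hr : HasRep ((algebraMap F L).comp i) D n) : HasRep i D n := by
  have : FiniteDimensional F L := Module.finite_of_finrank_pos (hL ▸ hp.pos)
  have : Fact p.Prime := ⟨hp⟩
  have : IsCyclic Gal(L/F) := isCyclic_of_prime_card (p := p) (by rw [IsGalois.card_aut_eq_finrank, hL])
  obtain ⟨ξ, ⟨b, hb⟩, hξ⟩ := exists_root_adjoin_eq_top_of_isCyclic F L
    ⟨ζ, (mem_primitiveRoots Module.finrank_pos).2 (hL ▸ hζ)⟩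
  rw [hL] at hb
  have hξ' : ∀ c, ξ ≠ algebraMap F L c := by
    rintro c rfl
    have h1 : F⟮algebraMap F L c⟯ = ⊥ := adjoin_simple_eq_bot_iff.2 (IntermediateField.algebraMap_mem _ c)
    have h2 := finrank_eq_one_iff.2 (h1.symm.trans hξ).symm
    rw [finrank_top', hL] at h2
    exact hp.one_lt.ne' h2
  have hb0 : b ≠ 0 := by
    rintro rfl
    rw [map_zero] at hb
    exact hξ' 0 (by rw [map_zero]; exact eq_zero_of_pow_eq_zero hb.symm)
  obtain h1 | ⟨ζ', a, hζ', ha, hna, hE⟩ := hasRep_or_not_normP.{0} i hn hp hζ hL hb.symm hξ' hr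
  · exact h1
  · refine absurd (normP_of_forall_mem_placeNorm hp hζ' (a := Units.mk0 a ha) (b := Units.mk0 b hb0) ?_) hna
    rintro (v | w)
    · exact (mem_normSubgroup hp.pos).2 (hE _ _ (h.finite v))
    · exact (mem_normSubgroup hp.pos).2 (hE _ _ (h.real _))

theorem LocallySplit.hasRep_of_finrank_eq_pow (hn : Module.finrank K D = n * n) {p : ℕ} (hp : p.Prime) (k : ℕ) :
    ∀ {F L : Type} [Field F] [NumberField F] [Field L] [Algebra F L] [IsGalois F L] {i : K →+* F} {ζ : F},
      LocallySplit i D n → IsPrimitiveRoot ζ p → Module.finrank F L = p ^ k →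
        HasRep ((algebraMap F L).comp i) D n → HasRep i D n := by
  induction k with
  | zero =>
    intro F L _ _ _ _ _ i ζ h hζ hL hr
    have : FiniteDimensional F L := Module.finite_of_finrank_pos (hL ▸ pow_pos hp.pos _)
    have h1 := hr.restrict (i₀ := i) rfl
    rwa [hL, pow_zero, one_mul] at h1
  | succ k ih =>
    intro F L _ _ _ _ _ i ζ h hζ hL hr
    have : FiniteDimensional F L := Module.finite_of_finrank_pos (hL ▸ pow_pos hp.pos _)
    have : Fact p.Prime := ⟨hp⟩
    have hcard : Nat.card Gal(L/F) = p ^ (k + 1) := by rw [IsGalois.card_aut_eq_finrank, hL]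
    obtain ⟨H, hH⟩ := Sylow.exists_subgroup_card_pow_prime (G := Gal(L/F)) p (n := k)
      (by rw [hcard]; exact pow_dvd_pow p k.le_succ)
    have hindex : H.index = p := by
      have h1 := H.card_mul_index
      rw [hH, hcard, pow_succ] at h1
      exact Nat.eq_of_mul_eq_mul_left (pow_pos hp.pos k) h1
    have : H.Normal := Subgroup.normal_of_index_eq_minFac_card (by
      rw [hindex, hcard, hp.pow_minFac k.succ_ne_zero])
    let M := fixedField H
    have hML : Module.finrank M L = p ^ k := (finrank_fixedField_eq_card H).trans hH
    have hFM : Module.finrank F M = p := by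
      have h1 := Module.finrank_mul_finrank F M L
      rw [hML, hL, pow_succ, mul_comm] at h1
      exact Nat.eq_of_mul_eq_mul_left (pow_pos hp.pos k) h1
    have : NumberField M := NumberField.of_module_finite F M
    refine h.hasRep_of_isKummer hn hp hζ hFM ?_
    exact ih (F := M) (L := L) h.extend (hζ.map_of_injective (algebraMap F M).injective) hML
      (by rwa [← RingHom.comp_assoc, ← IsScalarTower.algebraMap_eq])

theorem IsPrimitiveRoot.exists_eq_of_finrank_eq_pow {F L : Type*} [Field F] [Field L] [Algebra F L] {p k : ℕ}
    (hp : p.Prime) (hL : Module.finrank F L = p ^ k) {z : L} (hz : IsPrimitiveRoot z p) :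
    ∃ ζ : F, algebraMap F L ζ = z := by
  have : FiniteDimensional F L := Module.finite_of_finrank_pos (hL ▸ pow_pos hp.pos _)
  have h1 : Module.finrank F F⟮z⟯ ∣ p ^ k := hL ▸ ⟨_, (Module.finrank_mul_finrank F F⟮z⟯ L).symm⟩
  have h2 : Module.finrank F F⟮z⟯ < p := by
    rw [adjoin.finrank (IsIntegral.of_finite F z)]
    have h3 : Polynomial.aeval z (Polynomial.cyclotomic p F) = 0 := by
      rw [Polynomial.aeval_def, Polynomial.eval₂_eq_eval_map, Polynomial.map_cyclotomic]
      exact hz.isRoot_cyclotomic hp.pos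
    have h4 := Polynomial.natDegree_le_of_dvd (minpoly.dvd F z h3) (Polynomial.cyclotomic_ne_zero p F)
    rw [Polynomial.natDegree_cyclotomic, Nat.totient_prime hp] at h4
    have := hp.pos
    omega
  obtain ⟨j, -, hj⟩ := (Nat.dvd_prime_pow hp).1 h1
  have h5 : Module.finrank F F⟮z⟯ = 1 := by
    rcases j with _ | j
    · rw [hj, pow_zero]
    · rw [hj, pow_succ] at h2
      exact absurd h2 (not_lt.2 (Nat.le_mul_of_pos_left p (pow_pos hp.pos j)))
  exact mem_bot.1 (finrank_adjoin_simple_eq_one_iff.1 h5)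

/-- The **Albert–Brauer–Hasse–Noether theorem**: a central simple algebra over a number field which
splits at all finite and real places splits. -/
theorem LocallySplit.hasRep (hn : Module.finrank K D = n * n) {F : Type} [Field F] [NumberField F]
    {i : K →+* F} (h : LocallySplit i D n) : HasRep i D n := by
  have hn0 : 0 < n := Nat.pos_of_ne_zero (by
    rintro rfl
    exact Module.finrank_pos.ne' hn)
  let _ := i.toAlgebra
  have key : ∀ k, schurIndex F (F ⊗[K] D) ∣ k ↔ HasRep i D (n * k) := schurIndex_tensor_dvd_iff hn0 hn
  have h1 : schurIndex F (F ⊗[K] D) = 1 := by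
    by_contra hne
    obtain ⟨p, hp, hpd⟩ := Nat.exists_prime_and_dvd hne
    have : Fact p.Prime := ⟨hp⟩
    obtain ⟨z, hz⟩ : ∃ z : AlgebraicClosure F, IsPrimitiveRoot z p :=
      (HasEnoughRootsOfUnity.exists_primitiveRoot _ p)
    obtain ⟨Ω, _, _, hzΩ, hΩ⟩ := exists_galois_hasRep i hn z
    let P : Sylow p Gal(Ω/F) := default
    let M := fixedField (P : Subgroup Gal(Ω/F))
    have : NumberField M := NumberField.of_module_finite F M
    obtain ⟨k, hk⟩ := IsPGroup.iff_card.1 P.isPGroup'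
    have hMΩ : Module.finrank M Ω = p ^ k := (finrank_fixedField_eq_card (P : Subgroup Gal(Ω/F))).trans hk
    have hFM : ¬ p ∣ Module.finrank F M := by
      have h2 : Module.finrank F M = (P : Subgroup Gal(Ω/F)).index := by
        rw [finrank_eq_fixingSubgroup_index, fixingSubgroup_fixedField]
      rw [h2]
      exact P.not_dvd_index
    obtain ⟨ζ, hζ⟩ := IsPrimitiveRoot.exists_eq_of_finrank_eq_pow (F := M) (z := (⟨z, hzΩ⟩ : Ω)) hp hMΩ
      (IsPrimitiveRoot.of_map_of_injective (f := Ω.val) hz Ω.val.injective)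
    have hζ' : IsPrimitiveRoot ζ p := IsPrimitiveRoot.of_map_of_injective (f := algebraMap M Ω)
      (by rw [hζ]; exact IsPrimitiveRoot.of_map_of_injective (f := Ω.val) hz Ω.val.injective)
      (algebraMap M Ω).injective
    have h3 : HasRep ((algebraMap F M).comp i) D n :=
      h.extend.hasRep_of_finrank_eq_pow hn hp k hζ' hMΩ
        (by rwa [← RingHom.comp_assoc, ← IsScalarTower.algebraMap_eq])
    have h4 := h3.restrict (i₀ := i) rfl
    rw [mul_comm, ← key] at h4
    exact hFM (hpd.trans h4)
  have h2 := (key 1).1 h1.dvd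
  rwa [mul_one] at h2

end LocallySplit

section Reduction

open Polynomial

theorem exists_eq_sum_mul_mul {K D : Type*} [Field K] [DivisionRing D] [Algebra K D] [Algebra.IsCentral K D]
    {ι : Type*} [Fintype ι] (b : Module.Basis ι K D) (f : D →ₗ[K] D) :
    ∃ a : ι → ι → K, ∀ x, f x = ∑ k, ∑ l, a k l • (b k * x * b l) := by
  classical
  let R := D ⊗[K] Dᵐᵒᵖ
  let _ : Module R D := Module.compHom D (AlgHom.mulLeftRight K D).toRingHom
  have hsm : ∀ (r : R) (x : D), r • x = AlgHom.mulLeftRight K D r x := fun _ _ => rfl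
  have hsimple : IsSimpleModule R D := by
    rw [isSimpleModule_iff_toSpanSingleton_surjective]
    refine ⟨inferInstance, fun m hm y => ⟨(y * m⁻¹) ⊗ₜ 1, ?_⟩⟩
    rw [LinearMap.toSpanSingleton_apply, hsm, AlgHom.mulLeftRight_apply]
    simp [mul_assoc, hm]
  have hEnd : ∀ φ : Module.End R D, ∃ c : K, ∀ x, φ x = c • x := by
    intro φ
    have h1 : ∀ x y : D, φ (x * y) = x * φ y := fun x y => by
      have := φ.map_smul ((x ⊗ₜ 1 : R)) y
      simpa [hsm] using this
    have h2 : ∀ x y : D, φ (x * y) = φ x * y := fun x y => by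
      have := φ.map_smul (((1 : D) ⊗ₜ MulOpposite.op y : R)) x
      simpa [hsm] using this
    have h3 : φ 1 ∈ Subalgebra.center K D := by
      rw [Subalgebra.mem_center_iff]
      intro d
      rw [← h1, ← h2, mul_one, one_mul]
    obtain ⟨c, hc⟩ := Algebra.IsCentral.out h3
    refine ⟨c, fun x => ?_⟩
    conv_lhs => rw [← one_mul x]
    rw [h2, ← hc, Algebra.smul_def]
    rfl
  let F : Module.End (Module.End R D) D :=
    { toFun := f
      map_add' := f.map_add
      map_smul' := fun φ x => by
        obtain ⟨c, hc⟩ := hEnd φ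
        change f (φ x) = φ (f x)
        rw [hc, hc, map_smul] }
  obtain ⟨r, hr⟩ := jacobson_density F (Finset.univ.image b)
  have hfr : f = AlgHom.mulLeftRight K D r := b.ext fun i => hr _ (by simp)
  let b' : Module.Basis ι K Dᵐᵒᵖ := b.map (MulOpposite.opLinearEquiv K)
  refine ⟨fun k l => (b.tensorProduct b').repr r (k, l), fun x => ?_⟩
  rw [hfr]
  conv_lhs => rw [← (b.tensorProduct b').sum_repr r]
  rw [map_sum, LinearMap.sum_apply, Fintype.sum_prod_type]
  refine Finset.sum_congr rfl fun k _ => Finset.sum_congr rfl fun l _ => ?_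
  rw [map_smul, LinearMap.smul_apply, Module.Basis.tensorProduct_apply, AlgHom.mulLeftRight_apply]
  simp [b']

theorem IsSimpleRing.exists_algEquiv_matrix_of_finite {k : Type*} [Field k] [Finite k] {B : Type*} [Ring B]
    [Algebra k B] [IsSimpleRing B] [Algebra.IsCentral k B] [FiniteDimensional k B] {n : ℕ}
    (hn : Module.finrank k B = n * n) : Nonempty (B ≃ₐ[k] Matrix (Fin n) (Fin n) k) := by
  have : IsArtinianRing B := IsArtinianRing.of_finite k B
  obtain ⟨m, hm, Δ, _, _, _, ⟨e⟩⟩ := IsSimpleRing.exists_algEquiv_matrix_divisionRing_finite k B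
  have : Finite Δ := Module.finite_of_finite k
  let _ : Field Δ := littleWedderburn Δ
  have hc : Algebra.IsCentral k (Matrix (Fin m) (Fin m) Δ) := Algebra.IsCentral.of_algEquiv k _ _ e
  have hbij : Function.Bijective (algebraMap k Δ) := by
    refine ⟨(algebraMap k Δ).injective, fun d => ?_⟩
    have hd : Matrix.scalar (Fin m) d ∈ Subalgebra.center k (Matrix (Fin m) (Fin m) Δ) := by
      rw [Subalgebra.mem_center_iff]
      intro M
      exact (Matrix.scalar_commute d (fun r => mul_comm _ _) M).eq.symm
    obtain ⟨c, hc⟩ := hc.out hd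
    refine ⟨c, ?_⟩
    have h0 := congrFun (congrFun hc 0) 0
    simpa [Matrix.algebraMap_matrix_apply] using h0
  let e₁ : k ≃ₐ[k] Δ := AlgEquiv.ofBijective (Algebra.ofId k Δ) hbij
  have e₂ := e.trans e₁.symm.mapMatrix
  have h1 := e₂.toLinearEquiv.finrank_eq
  rw [hn, Module.finrank_matrix, Fintype.card_fin, Module.finrank_self, mul_one] at h1
  obtain rfl : n = m := Nat.mul_self_inj.1 h1
  exact ⟨e₂⟩

theorem isSimpleRing_and_isCentral_of_basis {k B ι : Type*} [Field k] [Ring B] [Algebra k B] [Fintype ι] [Nonempty ι]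
    (β : Module.Basis ι k B)
    (h : ∀ i j, ∃ a : ι → ι → k, ∀ x, β.repr x j • β i = ∑ k, ∑ l, a k l • (β k * x * β l)) :
    IsSimpleRing B ∧ Algebra.IsCentral k B := by
  have : Nontrivial B := β.repr.toEquiv.nontrivial
  refine ⟨⟨⟨fun I => ?_⟩⟩, ⟨fun z hz => ?_⟩⟩
  · by_cases hI : I = ⊥
    · exact Or.inl hI
    right
    obtain ⟨x, hx, hx0⟩ : ∃ x ∈ I, x ≠ 0 := by
      by_contra! h
      exact hI (le_bot_iff.1 fun x hx => (TwoSidedIdeal.mem_bot _).2 (h x hx))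
    obtain ⟨j, hj⟩ : ∃ j, β.repr x j ≠ 0 := by
      by_contra! h
      exact hx0 (β.repr.injective (by rw [map_zero]; exact Finsupp.ext h))
    have hsmul : ∀ (c : k) (y : B), y ∈ I → c • y ∈ I := fun c y hy => by
      rw [Algebra.smul_def]
      exact I.mul_mem_left _ _ hy
    have hi : ∀ i, β i ∈ I := fun i => by
      obtain ⟨a, ha⟩ := h i j
      have h1 : β.repr x j • β i ∈ I := by
        rw [ha]
        exact sum_mem fun k _ => sum_mem fun l _ =>
          hsmul _ _ (I.mul_mem_right _ _ (I.mul_mem_left _ _ hx))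
      simpa [smul_smul, hj] using hsmul (β.repr x j)⁻¹ _ h1
    rw [← TwoSidedIdeal.one_mem_iff, ← β.sum_repr 1]
    exact sum_mem fun i _ => hsmul _ _ (hi i)
  · obtain ⟨j⟩ := ‹Nonempty ι›
    rw [Subalgebra.mem_center_iff] at hz
    have h1 : ∀ i, β.repr (z * β j) j • β i = z * β i := fun i => by
      obtain ⟨a, ha⟩ := h i j
      have h2 := ha (β j)
      rw [β.repr_self, Finsupp.single_eq_same, one_smul] at h2
      rw [ha, h2, Finset.mul_sum]
      refine Finset.sum_congr rfl fun k _ => ?_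
      rw [Finset.mul_sum]
      refine Finset.sum_congr rfl fun l _ => ?_
      rw [mul_smul_comm, ← mul_assoc, ← mul_assoc, hz, ← mul_assoc]
    refine ⟨β.repr (z * β j) j, ?_⟩
    change algebraMap k B _ = z
    have h2 : LinearMap.lsmul k B (β.repr (z * β j) j) = LinearMap.mulLeft k z := β.ext h1
    have h3 := LinearMap.congr_fun h2 1
    simpa [Algebra.algebraMap_eq_smul_one] using h3

open IsLocalRing in
theorem exists_residue_eigenvalues {V Λ ι : Type*} [CommRing V] [IsLocalRing V] [Finite (ResidueField V)]
    [Ring Λ] [Algebra V Λ] [Fintype ι] [DecidableEq ι] [Nonempty ι] (b : Module.Basis ι V Λ) {n : ℕ}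
    (hn : Fintype.card ι = n * n)
    (h : ∀ i j, ∃ a : ι → ι → V, ∀ m, (if m = j then b i else 0) = ∑ k, ∑ l, a k l • (b k * b m * b l)) :
    ∃ x : Λ, ∀ q : V[X], aeval x q = 0 → ∀ i : Fin n, (q.map (residue V)).eval ((i : ℕ) : ResidueField V) = 0 := by
  let k := ResidueField V
  let B := k ⊗[V] Λ
  let β : Module.Basis ι k B := Algebra.TensorProduct.basis k b
  have hβ : ∀ i, β i = 1 ⊗ₜ b i := fun i => Algebra.TensorProduct.basis_apply b i
  obtain ⟨_, _⟩ := isSimpleRing_and_isCentral_of_basis β (fun i j => by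
    obtain ⟨a, ha⟩ := h i j
    refine ⟨fun k l => residue V (a k l), fun x => ?_⟩
    let T₁ : B →ₗ[k] B := (β.coord j).smulRight (β i)
    let T₂ : B →ₗ[k] B := ∑ p, ∑ q, residue V (a p q) • (LinearMap.mulRight k (β q) ∘ₗ LinearMap.mulLeft k (β p))
    have hT : T₁ = T₂ := β.ext fun m => by
      have h1 := congrArg (fun y => (1 : k) ⊗ₜ[V] y) (ha m)
      simp only [T₁, T₂, LinearMap.smulRight_apply, Module.Basis.coord_apply, β.repr_self, LinearMap.sum_apply,
        LinearMap.smul_apply, LinearMap.comp_apply, LinearMap.mulRight_apply, LinearMap.mulLeft_apply]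
      simp only [TensorProduct.tmul_sum] at h1
      rw [Finsupp.single_apply, ite_smul, one_smul, zero_smul, hβ i]
      rw [apply_ite (fun y => (1 : k) ⊗ₜ[V] y), TensorProduct.tmul_zero] at h1
      rw [h1]
      refine Finset.sum_congr rfl fun p _ => Finset.sum_congr rfl fun q _ => ?_
      rw [hβ, hβ, hβ, Algebra.TensorProduct.tmul_mul_tmul, Algebra.TensorProduct.tmul_mul_tmul, one_mul, one_mul,
        TensorProduct.tmul_smul]
      rw [← IsLocalRing.ResidueField.algebraMap_eq, algebraMap_smul]
    have := LinearMap.congr_fun hT x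
    simpa [T₁, T₂, LinearMap.sum_apply] using this)
  have : FiniteDimensional k B := β.finiteDimensional_of_finite
  obtain ⟨e⟩ := IsSimpleRing.exists_algEquiv_matrix_of_finite (k := k) (B := B) (n := n)
    (by rw [Module.finrank_eq_card_basis β, hn])
  let π : Λ →ₐ[V] B := Algebra.TensorProduct.includeRight
  have hπ : Function.Surjective π := Algebra.TensorProduct.includeRight_surjective Λ residue_surjective
  obtain ⟨x, hx⟩ := hπ (e.symm (Matrix.diagonal fun i : Fin n => ((i : ℕ) : k)))
  refine ⟨x, fun q hq i => ?_⟩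
  have h1 : aeval (π x) q = 0 := by rw [aeval_algHom_apply, hq, map_zero]
  have h2 : aeval (Matrix.diagonal fun i : Fin n => ((i : ℕ) : k)) (q.map (residue V)) = 0 := by
    rw [← IsLocalRing.ResidueField.algebraMap_eq, aeval_map_algebraMap]
    have h3 := aeval_algHom_apply (e.toAlgHom.restrictScalars V) (π x) q
    rw [h1, map_zero, hx] at h3
    simpa using h3
  have h4 : Matrix.diagonal (fun i : Fin n => (q.map (residue V)).eval ((i : ℕ) : k)) = 0 := by
    rw [← h2]
    have h5 := aeval_algHom_apply (Matrix.diagonalAlgHom k (n := Fin n) (α := k)) (fun i : Fin n => ((i : ℕ) : k)) (q.map (residue V))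
    rw [Matrix.diagonalAlgHom_apply, Matrix.diagonalAlgHom_apply] at h5
    rw [h5]
    congr 1
    ext i
    rw [Polynomial.aeval_pi_apply₂, Polynomial.coe_aeval_eq_eval]
  have h6 := congrFun (congrFun h4 i) i
  rwa [Matrix.diagonal_apply_eq] at h6

end Reduction

section Reduction

open Polynomial

open IsLocalRing in
theorem exists_minpoly_residue_eigenvalues {V K D ι : Type*} [CommRing V] [IsDomain V] [IsLocalRing V]
    [IsIntegrallyClosed V] [Finite (ResidueField V)] [Field K] [Algebra V K] [IsFractionRing V K]
    [DivisionRing D] [Algebra K D] [Algebra V D] [IsScalarTower V K D] [Fintype ι] [DecidableEq ι] [Nonempty ι]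
    (b : Module.Basis ι K D) {n : ℕ} (hn : Fintype.card ι = n * n)
    (h1 : ∃ c : ι → V, 1 = ∑ l, c l • b l) (hmul : ∀ i j, ∃ c : ι → V, b i * b j = ∑ l, c l • b l)
    (h : ∀ i j, ∃ a : ι → ι → V, ∀ m, (if m = j then b i else 0) = ∑ k, ∑ l, a k l • (b k * b m * b l)) :
    ∃ (d : D) (f : V[X]), f.Monic ∧ f.map (algebraMap V K) = minpoly K d ∧
      ∀ i : Fin n, (f.map (residue V)).eval ((i : ℕ) : ResidueField V) = 0 := by
  have hsum : ∀ c : ι → V, ∑ l, c l • b l ∈ Submodule.span V (Set.range b) := fun c =>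
    sum_mem fun l _ => Submodule.smul_mem _ _ (Submodule.subset_span ⟨l, rfl⟩)
  let Λ : Subalgebra V D := (Submodule.span V (Set.range b)).toSubalgebra
    (by
      obtain ⟨c, hc⟩ := h1
      exact hc ▸ hsum c)
    (fun x y hx hy => by
      have hle : Submodule.span V (Set.range b) * Submodule.span V (Set.range b) ≤ Submodule.span V (Set.range b) := by
        rw [Submodule.span_mul_span, Submodule.span_le]
        rintro _ ⟨_, ⟨i, rfl⟩, _, ⟨j, rfl⟩, rfl⟩
        obtain ⟨c, hc⟩ := hmul i j
        change b i * b j ∈ Submodule.span V (Set.range b)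
        exact hc ▸ hsum c
      exact hle (Submodule.mul_mem_mul hx hy))
  have : FaithfulSMul V K := (faithfulSMul_iff_algebraMap_injective V K).2 (IsFractionRing.injective V K)
  let b' : Module.Basis ι V Λ := b.restrictScalars V
  have hb' : ∀ i, (b' i : D) = b i := fun i => b.restrictScalars_apply V i
  have hinj : Function.Injective Λ.val := Subtype.val_injective
  obtain ⟨x, hx⟩ := exists_residue_eigenvalues b' hn (fun i j => by
    obtain ⟨a, ha⟩ := h i j
    refine ⟨a, fun m => hinj ?_⟩
    have := ha m
    simp only [map_sum, map_smul, map_mul, Subalgebra.coe_val, hb', apply_ite Λ.val, map_zero]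
    exact this)
  have : Module.Finite V Λ := Module.Finite.of_basis b'
  obtain ⟨q, hqm, hq⟩ := Algebra.IsIntegral.isIntegral (R := V) x
  have hq : aeval x q = 0 := hq
  have haev : ∀ p : V[X], aeval (x : D) (p.map (algebraMap V K)) = (aeval x p : Λ) := fun p => by
    rw [aeval_map_algebraMap]
    exact aeval_algHom_apply Λ.val x p
  have hdvd : minpoly K (x : D) ∣ q.map (algebraMap V K) :=
    minpoly.dvd K _ (by rw [haev, hq, ZeroMemClass.coe_zero])
  have hxi : IsIntegral K (x : D) := ⟨q.map (algebraMap V K), hqm.map _, by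
    rw [← aeval_def, haev, hq, ZeroMemClass.coe_zero]⟩
  obtain ⟨f, hf⟩ := IsIntegrallyClosed.eq_map_mul_C_of_dvd K hqm hdvd
  rw [(minpoly.monic hxi).leadingCoeff, C_1, mul_one] at hf
  refine ⟨x, f, monic_of_injective (IsFractionRing.injective V K) (hf ▸ minpoly.monic hxi), hf, hx f ?_⟩
  apply hinj
  change ((aeval x f : Λ) : D) = Λ.val 0
  rw [← haev, hf, minpoly.aeval, map_zero]

open IsLocalRing in
theorem exists_roots_of_residue_roots {V R : Type*} [CommRing V] [IsLocalRing V] [CommRing R]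
    (I : Ideal R) [IsAdicComplete I R] (hI : I ≠ ⊤) (g : V →+* R) (hg : ∀ x ∈ maximalIdeal V, g x ∈ I)
    {f : V[X]} (hf : f.Monic) {n : ℕ} (hfn : f.natDegree ≤ n) (hn : IsUnit ((n.factorial : ℕ) : V))
    (h : ∀ i : Fin n, (f.map (residue V)).eval ((i : ℕ) : ResidueField V) = 0) :
    ∃ α : Fin n → R, Function.Injective α ∧ ∀ i, (f.map g).eval (α i) = 0 := by
  have hlt : ∀ i j : ℕ, i < j → j ≤ n → IsUnit ((j : V) - (i : V)) := by
    intro i j hij hj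
    rw [← Nat.cast_sub hij.le]
    exact isUnit_of_dvd_unit (Nat.cast_dvd_cast (Nat.dvd_factorial (by omega) (by omega))) hn
  have hne : ∀ i j : Fin n, i ≠ j → IsUnit (((i : ℕ) : V) - ((j : ℕ) : V)) := by
    intro i j hij
    rcases lt_or_gt_of_ne (fun h => hij (Fin.ext h) : (i : ℕ) ≠ j) with h | h
    · rw [← neg_sub]
      exact (hlt _ _ h j.2.le).neg
    · exact hlt _ _ h i.2.le
  have hinj : Function.Injective fun i : Fin n => ((i : ℕ) : ResidueField V) := by
    intro i j hij
    by_contra hc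
    apply (residue_ne_zero_iff_isUnit _).2 (hne i j hc)
    rw [map_sub, map_natCast, map_natCast, sub_eq_zero]
    exact hij
  have hprod : f.map (residue V) = ∏ i : Fin n, (X - C ((i : ℕ) : ResidueField V)) := by
    apply eq_of_monic_of_dvd_of_natDegree_le (monic_prod_of_monic _ _ fun i _ => monic_X_sub_C _) (hf.map (residue V))
    · refine Finset.prod_dvd_of_coprime (fun i _ j _ hij => ?_) fun i _ => dvd_iff_isRoot.2 (h i)
      exact pairwise_coprime_X_sub_C hinj hij
    · rw [natDegree_prod_of_monic _ _ fun (i : Fin n) _ => monic_X_sub_C ((i : ℕ) : ResidueField V), hf.natDegree_map]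
      simpa only [natDegree_X_sub_C, Finset.sum_const, Finset.card_univ, Fintype.card_fin, smul_eq_mul, mul_one] using hfn
  have hsep : (f.map (residue V)).Separable := by
    rw [hprod]
    exact separable_prod_X_sub_C_iff.2 hinj
  have hroot : ∀ i : Fin n, ∃ a, (f.map g).IsRoot a ∧ a - ((i : ℕ) : R) ∈ I := by
    intro i
    apply exists_root_of_isAdicComplete
    · have h1 := h i
      rw [← map_natCast (residue V), eval_map_apply, residue_eq_zero_iff] at h1
      rw [← map_natCast g, eval_map_apply]
      exact hg _ h1
    · have h1 := hsep.eval₂_derivative_ne_zero (RingHom.id _) (x := ((i : ℕ) : ResidueField V)) (h i)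
      rw [derivative_map, eval₂_id, ← map_natCast (residue V), eval_map_apply, residue_ne_zero_iff_isUnit] at h1
      rw [derivative_map, ← map_natCast g, eval_map_apply]
      exact (h1.map g).map (Ideal.Quotient.mk I)
  choose α hα hα' using hroot
  refine ⟨α, fun i j hij => ?_, hα⟩
  by_contra hc
  apply hI
  have h1 : g (((i : ℕ) : V) - ((j : ℕ) : V)) ∈ I := by
    have := I.sub_mem (hα' j) (hα' i)
    rw [hij, sub_sub_sub_cancel_left] at this
    simpa using this
  exact I.eq_top_of_isUnit_mem h1 ((hne i j hc).map g)

end Reduction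

section GoodPrimes

open Polynomial IsDedekindDomain HeightOneSpectrum NumberField

variable {K : Type} [Field K] [NumberField K]

theorem finite_residueField_valuationSubring (v : HeightOneSpectrum (𝓞 K)) :
    Finite (IsLocalRing.ResidueField (v.valuation K).valuationSubring) := by
  have : Finite (𝓞 K ⧸ v.asIdeal) := Ring.HasFiniteQuotients.finiteQuotient v.ne_bot
  let g : 𝓞 K →+* (v.valuation K).valuationSubring :=
    (algebraMap (𝓞 K) K).codRestrict _ fun r => v.valuation_le_one r
  let h : 𝓞 K →+* IsLocalRing.ResidueField (v.valuation K).valuationSubring :=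
    (IsLocalRing.residue _).comp g
  have hker : ∀ a ∈ v.asIdeal, h a = 0 := fun a ha => by
    rw [RingHom.comp_apply, IsLocalRing.residue_eq_zero_iff, Valuation.mem_maximalIdeal_iff]
    exact (v.valuation_lt_one_iff_mem a).2 ha
  refine Finite.of_surjective (Ideal.Quotient.lift v.asIdeal h hker) fun y => ?_
  obtain ⟨x, rfl⟩ := IsLocalRing.residue_surjective y
  obtain ⟨r, hr⟩ := exists_valuation_sub_lt_of_integer v x.2 1
  refine ⟨Ideal.Quotient.mk _ r, ?_⟩
  rw [Ideal.Quotient.lift_mk, RingHom.comp_apply, ← sub_eq_zero, ← map_sub, IsLocalRing.residue_eq_zero_iff,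
    Valuation.mem_maximalIdeal_iff]
  exact hr

theorem exists_finset_valuation_le_one (T : Finset K) : ∃ S : Finset (HeightOneSpectrum (𝓞 K)),
    ∀ v ∉ S, ∀ x ∈ T, v.valuation K x ≤ 1 := by
  classical
  have : ∀ x : K, ∃ S : Finset (HeightOneSpectrum (𝓞 K)), ∀ v ∉ S, v.valuation K x ≤ 1 := fun x => by
    by_cases hx : x = 0
    · exact ⟨∅, fun v _ => by simp [hx]⟩
    · exact ⟨(finite_setOf_valuation_ne_one (Units.mk0 x hx)).toFinset, fun v hv => by
        have h : v.valuation K x = 1 := by simpa using hv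
        exact h.le⟩
  choose S hS using this
  refine ⟨T.biUnion S, fun v hv x hx => hS x v fun h => hv (Finset.mem_biUnion.2 ⟨x, hx, h⟩)⟩

theorem hasRep_of_valuation_le_one {D : Type*} [DivisionRing D] [Algebra K D] [Algebra.IsCentral K D]
    [FiniteDimensional K D] {n : ℕ} (hn : Module.finrank K D = n * n) {ι : Type*} [Fintype ι] [DecidableEq ι]
    (b : Module.Basis ι K D) (v : HeightOneSpectrum (𝓞 K)) {c₁ : ι → K} (hc₁ : 1 = ∑ l, c₁ l • b l)
    (hv₁ : ∀ l, v.valuation K (c₁ l) ≤ 1)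
    {c : ι → ι → ι → K} (hc : ∀ i j, b i * b j = ∑ l, c i j l • b l) (hv : ∀ i j l, v.valuation K (c i j l) ≤ 1)
    {a : ι → ι → ι → ι → K}
    (ha : ∀ i j m, (if m = j then b i else 0) = ∑ k, ∑ l, a i j k l • (b k * b m * b l))
    (hva : ∀ i j k l, v.valuation K (a i j k l) ≤ 1)
    (hvn : v.valuation K (n.factorial : K) = 1) :
    HasRep (algebraMap K (v.adicCompletion K)) D n := by
  let V := (v.valuation K).valuationSubring
  have : Finite (IsLocalRing.ResidueField V) := finite_residueField_valuationSubring v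
  let _ : Algebra V D := Algebra.compHom D (algebraMap V K)
  have hsm : ∀ (x : V) (d : D), x • d = (x : K) • d := fun _ _ => rfl
  have : IsScalarTower V K D := ⟨fun x y z => by
    rw [hsm, smul_smul]
    rfl⟩
  have : Nonempty ι := b.index_nonempty
  obtain ⟨d, f, hfm, hf, hroot⟩ := exists_minpoly_residue_eigenvalues (V := V) b
    (n := n) (by rw [← hn, Module.finrank_eq_card_basis b])
    ⟨fun l => ⟨c₁ l, hv₁ l⟩, hc₁⟩ (fun i j => ⟨fun l => ⟨c i j l, hv i j l⟩, hc i j⟩)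
    (fun i j => ⟨fun k l => ⟨a i j k l, hva i j k l⟩, ha i j⟩)
  have hg : ∀ x : V, algebraMap K (v.adicCompletion K) x ∈ v.adicCompletionIntegers K := fun x => by
    exact (valuedAdicCompletion_eq_valuation' v (x : K)).trans_le x.2
  let g : V →+* v.adicCompletionIntegers K :=
    ((algebraMap K (v.adicCompletion K)).comp V.subtype).codRestrict _ hg
  obtain ⟨ϖ, hϖ⟩ := IsDiscreteValuationRing.exists_irreducible (v.adicCompletionIntegers K)
  have : IsAdicComplete (Ideal.span {ϖ}) (v.adicCompletionIntegers K) :=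
    isAdicComplete_adicCompletionIntegers v hϖ.not_isUnit
  have hdeg : f.natDegree ≤ n := by
    rw [← hfm.natDegree_map (algebraMap V K), hf]
    exact natDegree_minpoly_le hn d
  obtain ⟨α, hα, hαr⟩ := exists_roots_of_residue_roots (Ideal.span {ϖ})
    (by rw [Ne, Ideal.span_singleton_eq_top]; exact hϖ.not_isUnit) g
    (fun x hx => by
      rw [← hϖ.maximalIdeal_eq, IsLocalRing.mem_maximalIdeal, mem_nonunits_iff,
        adicCompletionIntegers.isUnit_iff_valued_eq_one]
      rw [Valuation.mem_maximalIdeal_iff] at hx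
      have : Valued.v (algebraMap K (v.adicCompletion K) x) < 1 :=
        (valuedAdicCompletion_eq_valuation' v (x : K)).trans_lt hx
      exact this.ne)
    hfm hdeg
    (by
      by_contra h
      have h1 := (Valuation.mem_maximalIdeal_iff (v := v.valuation K)).1 ((IsLocalRing.mem_maximalIdeal _).2 h)
      exact h1.ne hvn)
    hroot
  refine hasRep_of_eigenvalues hn d _ (fun i => (α i : v.adicCompletion K)) (fun i j h => hα (Subtype.ext h)) fun k => ?_
  have h1 := congrArg (algebraMap (v.adicCompletionIntegers K) (v.adicCompletion K)) (hαr k)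
  rw [← hf, eval₂_map]
  rw [map_zero, eval_map, hom_eval₂] at h1
  exact h1

/-- A central division algebra over a number field is split at almost all primes. -/
theorem exists_finset_hasRep {D : Type*} [DivisionRing D] [Algebra K D] [Algebra.IsCentral K D]
    [FiniteDimensional K D] {n : ℕ} (hn : Module.finrank K D = n * n) :
    ∃ S : Finset (HeightOneSpectrum (𝓞 K)), ∀ v ∉ S, HasRep (algebraMap K (v.adicCompletion K)) D n := by
  classical
  let b := Module.finBasis K D
  have h : ∀ i j, ∃ a : _ → _ → K, ∀ m, (if m = j then b i else 0) = ∑ k, ∑ l, a k l • (b k * b m * b l) := by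
    intro i j
    obtain ⟨a, ha⟩ := exists_eq_sum_mul_mul b ((b.coord j).smulRight (b i))
    refine ⟨a, fun m => ?_⟩
    rw [← ha]
    simp [Finsupp.single_apply]
  choose a ha using h
  obtain ⟨S, hS⟩ := exists_finset_valuation_le_one
    (insert ((n.factorial : K)⁻¹) (insert (n.factorial : K) (Finset.univ.image (fun l => b.repr 1 l) ∪
      Finset.univ.image (fun p : _ × _ × _ => b.repr (b p.1 * b p.2.1) p.2.2) ∪
      Finset.univ.image (fun p : _ × _ × _ × _ => a p.1 p.2.1 p.2.2.1 p.2.2.2))))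
  refine ⟨S, fun v hv => ?_⟩
  have hS := hS v hv
  refine hasRep_of_valuation_le_one hn b v (b.sum_repr 1).symm (fun l => hS _ ?_)
    (fun i j => (b.sum_repr (b i * b j)).symm) (fun i j l => hS _ ?_) ha (fun i j k l => hS _ ?_) ?_
  · refine Finset.mem_insert_of_mem (Finset.mem_insert_of_mem (Finset.mem_union_left _ (Finset.mem_union_left _ ?_)))
    exact Finset.mem_image_of_mem _ (Finset.mem_univ l)
  · refine Finset.mem_insert_of_mem (Finset.mem_insert_of_mem (Finset.mem_union_left _ (Finset.mem_union_right _ ?_)))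
    exact Finset.mem_image.2 ⟨(i, j, l), Finset.mem_univ _, rfl⟩
  · refine Finset.mem_insert_of_mem (Finset.mem_insert_of_mem (Finset.mem_union_right _ ?_))
    exact Finset.mem_image.2 ⟨(i, j, k, l), Finset.mem_univ _, rfl⟩
  · have h1 := hS _ (Finset.mem_insert_self _ _)
    have h2 := hS _ (Finset.mem_insert_of_mem (Finset.mem_insert_self _ _))
    have h0 : v.valuation K (n.factorial : K) ≠ 0 :=
      (Valuation.ne_zero_iff _).2 (Nat.cast_ne_zero.2 n.factorial_ne_zero)
    rw [map_inv₀, inv_le_one₀ (zero_lt_iff.2 h0)] at h1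
    exact le_antisymm h2 h1

end GoodPrimes

section Approximation

open Polynomial IsDedekindDomain HeightOneSpectrum NumberField

theorem exists_root_of_eval_eq_derivative_sq {R : Type*} [CommRing R] (I : Ideal R) [IsAdicComplete I R]
    (f : R[X]) {a c : R} (h : f.eval a = f.derivative.eval a ^ 2 * c) (hc : c ∈ I) : ∃ x, f.IsRoot x := by
  obtain ⟨k, hk⟩ := (f.map C).binomExpansion (C a) (C (f.derivative.eval a) * X)
  obtain ⟨x, hx, -⟩ := exists_root_of_isAdicComplete I (C c + X + k * X ^ 2) 0 (by simpa using hc) (by simp)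
  refine ⟨a + f.derivative.eval a * x, ?_⟩
  have h1 := congrArg (Polynomial.eval x) hk
  rw [derivative_map, eval_map_apply, eval_map_apply, h] at h1
  have h2 : ((f.map C).eval (C a + C (f.derivative.eval a) * X)).eval x = f.eval (a + f.derivative.eval a * x) := by
    have h3 : (evalRingHom x).comp C = RingHom.id R := by ext; simp
    rw [← coe_evalRingHom, eval_map, hom_eval₂, h3, eval₂_id]
    simp
  rw [h2] at h1
  rw [IsRoot, h1]
  rw [IsRoot] at hx
  simp only [eval_add, eval_mul, eval_C, eval_X, eval_pow] at hx ⊢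
  linear_combination f.derivative.eval a ^ 2 * hx

theorem exists_root_of_near_pow {R : Type*} [CommRing R] [IsDomain R] [IsLocalRing R] [IsIntegrallyClosed R]
    {t : R} (ht : ¬ IsUnit t) [IsAdicComplete (Ideal.span {t}) R] {F u h g : R[X]} {η : R} {e : ℕ} (he : e ≠ 0)
    (huh : u * F + h * derivative F = C η) (hg : ∀ k, (η ^ 2 * t) ^ e ∣ (F ^ e - g).coeff k) {θ : R}
    (hθ : g.eval θ = 0) : ∃ x, F.IsRoot x := by
  have h1 : η ^ 2 * t ∣ F.eval θ := by
    rw [← IsIntegrallyClosed.pow_dvd_pow_iff he]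
    have h2 : F.eval θ ^ e = (F ^ e - g).eval θ := by rw [eval_sub, hθ, sub_zero, eval_pow]
    rw [h2, eval_eq_sum_range]
    exact Finset.dvd_sum fun k _ => Dvd.dvd.mul_right (hg k) _
  obtain ⟨y, hy⟩ := h1
  have h2 := congrArg (Polynomial.eval θ) huh
  simp only [eval_add, eval_mul, eval_C, hy] at h2
  have h3 : IsUnit (1 - t * (u.eval θ * η * y)) := by
    have := (IsLocalRing.mem_maximalIdeal t).2 ht
    exact IsLocalRing.isUnit_one_sub_self_of_mem_nonunits _ ((IsLocalRing.maximalIdeal R).mul_mem_right _ this)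
  obtain ⟨z, hz⟩ := h3.exists_left_inv
  have h4 : η = F.derivative.eval θ * (h.eval θ * z) := by
    linear_combination (-z) * h2 - η * hz
  refine exists_root_of_eval_eq_derivative_sq (Ideal.span {t}) F (a := θ) (c := (h.eval θ * z) ^ 2 * y * t) ?_
    (Ideal.mul_mem_left _ _ (Ideal.mem_span_singleton_self t))
  rw [hy]
  conv_lhs => rw [h4]
  ring

theorem dvd_natDegree_of_irreducible {K : Type*} [Field K] {n : ℕ} {g : K[X]} (hg : g ≠ 0)
    (h : ∀ p, Irreducible p → p ∣ g → n ∣ p.natDegree) : n ∣ g.natDegree := by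
  induction g using WfDvdMonoid.induction_on_irreducible with
  | zero => exact absurd rfl hg
  | unit u hu => rw [natDegree_eq_zero_of_isUnit hu]; exact dvd_zero n
  | mul a i ha hi ih =>
    rw [natDegree_mul hi.ne_zero ha]
    exact dvd_add (h i hi (dvd_mul_right _ _)) (ih ha fun p hp hd => h p hp (hd.mul_left _))

theorem eval_pos_of_near {s : ℕ} {ε : ℝ} (hε : (2 * s : ℕ) * ε < 1) {g : ℝ[X]} (hg : g.Monic)
    (hdeg : g.natDegree = 2 * s) (h : ∀ k < 2 * s, |g.coeff k - ((X ^ 2 + 1 : ℝ[X]) ^ s).coeff k| < ε) (x : ℝ) :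
    0 < g.eval x := by
  have hm : (X ^ 2 + 1 : ℝ[X]).Monic := by monicity!
  have hd : (X ^ 2 + 1 : ℝ[X]).natDegree = 2 := by compute_degree!
  have hd' : ((X ^ 2 + 1 : ℝ[X]) ^ s).natDegree = 2 * s := by rw [hm.natDegree_pow, hd, mul_comm]
  have h1 : g.eval x - (x ^ 2 + 1) ^ s =
      ∑ k ∈ Finset.range (2 * s), (g.coeff k - ((X ^ 2 + 1 : ℝ[X]) ^ s).coeff k) * x ^ k := by
    have h2 : (x ^ 2 + 1) ^ s = ((X ^ 2 + 1 : ℝ[X]) ^ s).eval x := by simp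
    rw [h2, eval_eq_sum_range, eval_eq_sum_range, hd', hdeg, Finset.sum_range_succ, Finset.sum_range_succ]
    have h3 := hg.coeff_natDegree
    have h4 := (hm.pow s).coeff_natDegree
    rw [hdeg] at h3
    rw [hd'] at h4
    rw [h3, h4, add_sub_add_right_eq_sub, ← Finset.sum_sub_distrib]
    exact Finset.sum_congr rfl fun k _ => by ring
  have hpos : 0 < (x ^ 2 + 1) ^ s := by positivity
  have hle : ∀ k < 2 * s, |x| ^ k ≤ (x ^ 2 + 1) ^ s := by
    intro k hk
    calc |x| ^ k ≤ (max 1 |x|) ^ k := by gcongr; exact le_max_right _ _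
      _ ≤ (max 1 |x|) ^ (2 * s) := pow_le_pow_right₀ (le_max_left _ _) hk.le
      _ = ((max 1 |x|) ^ 2) ^ s := pow_mul _ _ _
      _ ≤ (x ^ 2 + 1) ^ s := by
        gcongr
        rcases max_cases 1 |x| with h | h
        · rw [h.1]; nlinarith
        · rw [h.1, sq_abs]; linarith
  have h5 : |g.eval x - (x ^ 2 + 1) ^ s| ≤ (2 * s : ℕ) * (ε * (x ^ 2 + 1) ^ s) := by
    rw [h1]
    refine (Finset.abs_sum_le_sum_abs _ _).trans ?_
    refine (Finset.sum_le_card_nsmul _ _ (ε * (x ^ 2 + 1) ^ s) fun k hk => ?_).trans ?_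
    · rw [abs_mul, abs_pow]
      have hk := Finset.mem_range.1 hk
      exact mul_le_mul (h k hk).le (hle k hk) (by positivity) ((abs_nonneg _).trans (h k hk).le)
    · rw [Finset.card_range, nsmul_eq_mul]
  have h6 := (abs_le.1 h5).1
  nlinarith

end Approximation

section IntegralModel

open Polynomial

theorem exists_bezout_of_separable_map {O E : Type*} [CommRing O] [IsDomain O] [Field E] [Algebra O E] [IsFractionRing O E]
    {F : O[X]} (hF : (F.map (algebraMap O E)).Separable) :
    ∃ (u h : O[X]) (η : O), η ≠ 0 ∧ u * F + h * derivative F = C η := by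
  obtain ⟨a, b, hab⟩ := hF
  obtain ⟨c, hc, hca⟩ := IsLocalization.integerNormalization_spec (nonZeroDivisors O) a
  obtain ⟨d, hd, hdb⟩ := IsLocalization.integerNormalization_spec (nonZeroDivisors O) b
  refine ⟨C d * IsLocalization.integerNormalization (nonZeroDivisors O) a,
    C c * IsLocalization.integerNormalization (nonZeroDivisors O) b, c * d,
    mul_ne_zero (nonZeroDivisors.ne_zero hc) (nonZeroDivisors.ne_zero hd), ?_⟩
  apply map_injective _ (IsFractionRing.injective O E)
  rw [derivative_map] at hab
  simp only [Polynomial.map_add, Polynomial.map_mul, map_C, hca, hdb, algebraMap_smul, map_mul]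
  rw [← algebraMap_smul E c a, ← algebraMap_smul E d b, smul_eq_C_mul, smul_eq_C_mul]
  linear_combination (C (algebraMap O E c) * C (algebraMap O E d)) * hab

theorem exists_integral_model {O E : Type*} [CommRing O] [IsDomain O] [IsIntegrallyClosed O] [Field E] [CharZero E]
    [Algebra O E] [IsFractionRing O E] {f : E[X]} (hf : Irreducible f) :
    ∃ F : O[X], F.Monic ∧ F.natDegree ∣ f.natDegree ∧ 0 < F.natDegree ∧
      (∃ (u h : O[X]) (η : O), η ≠ 0 ∧ u * F + h * derivative F = C η) ∧
      ∃ c : E, ∀ {M : Type} [Field M] (j : E →+* M) (x : M), (F.map (algebraMap O E)).eval₂ j x = 0 →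
        f.eval₂ j (j c * x) = 0 := by
  have : Fact (Irreducible f) := ⟨hf⟩
  have hfin : FiniteDimensional E (AdjoinRoot f) := (AdjoinRoot.powerBasis hf.ne_zero).finite
  have halg : IsAlgebraic O (AdjoinRoot.root f) :=
    (IsFractionRing.isAlgebraic_iff O E (AdjoinRoot f)).2 (Algebra.IsAlgebraic.isAlgebraic _)
  obtain ⟨c, hc, hint⟩ := halg.exists_integral_multiple
  have hm := minpoly.isIntegrallyClosed_eq_field_fractions E (AdjoinRoot f) hint
  rw [Algebra.algebraMap_self_apply] at hm
  have hirr := minpoly.irreducible (IsIntegral.of_finite E (c • AdjoinRoot.root f))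
  have hdeg : (minpoly E (c • AdjoinRoot.root f)).natDegree = (minpoly O (c • AdjoinRoot.root f)).natDegree := by
    rw [hm]; exact (minpoly.monic hint).natDegree_map _
  refine ⟨minpoly O (c • AdjoinRoot.root f), minpoly.monic hint, ?_, ?_, ?_, (algebraMap O E c)⁻¹, ?_⟩
  · rw [← hdeg]
    have := minpoly.degree_dvd (IsIntegral.of_finite E (c • AdjoinRoot.root f))
    rwa [(AdjoinRoot.powerBasis hf.ne_zero).finrank, AdjoinRoot.powerBasis_dim] at this
  · rw [← hdeg]
    exact hirr.natDegree_pos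
  · exact exists_bezout_of_separable_map (E := E) (by rw [← hm]; exact hirr.separable)
  · intro M _ j x hx
    rw [← hm] at hx
    have h0 : algebraMap O E c ≠ 0 := by simpa using hc
    have hd : minpoly E (c • AdjoinRoot.root f) ∣ f.comp (C (algebraMap O E c)⁻¹ * X) := by
      apply minpoly.dvd
      rw [aeval_comp]
      have : (aeval (c • AdjoinRoot.root f)) (C (algebraMap O E c)⁻¹ * X) = AdjoinRoot.root f := by
        rw [map_mul, aeval_C, aeval_X, ← algebraMap_smul E c (AdjoinRoot.root f), ← Algebra.smul_def,
          smul_smul, inv_mul_cancel₀ h0, one_smul]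
      rw [this, AdjoinRoot.aeval_eq, AdjoinRoot.mk_self]
    obtain ⟨q, hq⟩ := hd
    have := congrArg (eval₂ j x) hq
    rw [eval₂_mul, hx, zero_mul, eval₂_comp] at this
    simpa using this

end IntegralModel

section LocalApproximation

open Polynomial IsDedekindDomain HeightOneSpectrum NumberField WithZero

variable {K : Type} [Field K] [NumberField K]

theorem exists_adicMap {L : Type} [Field L] [NumberField L] [Algebra K L] {P : HeightOneSpectrum (𝓞 L)}
    {v : HeightOneSpectrum (𝓞 K)} (hP : belowPrime K P = v) :
    ∃ j : v.adicCompletion K →+* P.adicCompletion L,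
      j.comp (algebraMap K _) = (algebraMap L _).comp (algebraMap K L) ∧
        ∀ y, Valued.v y ≤ 1 → Valued.v (j y) ≤ 1 := by
  subst hP
  exact ⟨adicMap K P, RingHom.ext fun x => adicMap_algebraMap P x, fun y => valued_adicMap_le_one P⟩

theorem exists_near_lift {v : HeightOneSpectrum (𝓞 K)} {G : (v.adicCompletionIntegers K)[X]} (hG : G.Monic)
    {b : v.adicCompletionIntegers K} {g : (v.adicCompletion K)[X]} (hg : g.Monic) (hdeg : g.natDegree = G.natDegree)
    (h : ∀ k < G.natDegree, Valued.v (g.coeff k - (G.coeff k : v.adicCompletion K)) < Valued.v (b : v.adicCompletion K)) :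
    ∃ g' : (v.adicCompletionIntegers K)[X], g'.Monic ∧ g'.map (algebraMap _ (v.adicCompletion K)) = g ∧
      ∀ k, b ∣ (G - g').coeff k := by
  have h' : ∀ k, Valued.v (g.coeff k - (G.coeff k : v.adicCompletion K)) ≤ Valued.v (b : v.adicCompletion K) := by
    intro k
    rcases lt_trichotomy k G.natDegree with hk | hk | hk
    · exact (h k hk).le
    · have h1 := hg.coeff_natDegree
      have h2 := hG.coeff_natDegree
      rw [hdeg, ← hk] at h1
      rw [← hk] at h2
      rw [h1, h2]
      simp
    · rw [coeff_eq_zero_of_natDegree_lt hk, coeff_eq_zero_of_natDegree_lt (hdeg.trans_lt hk)]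
      simp
  have hmem : ∀ k, g.coeff k ∈ v.adicCompletionIntegers K := fun k => by
    have := add_mem (show g.coeff k - (G.coeff k : v.adicCompletion K) ∈ v.adicCompletionIntegers K from
      (h' k).trans b.2) (G.coeff k).2
    rwa [sub_add_cancel] at this
  have hlift : g ∈ lifts (algebraMap (v.adicCompletionIntegers K) (v.adicCompletion K)) :=
    (lifts_iff_coeff_lifts _).2 fun k => ⟨⟨g.coeff k, hmem k⟩, rfl⟩
  obtain ⟨g', hg', -, hm⟩ := lifts_and_natDegree_eq_and_monic hlift hg
  refine ⟨g', hm, hg', fun k => (adicCompletionIntegers_dvd_iff v).2 ?_⟩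
  have h1 : g.coeff k = (g'.coeff k : v.adicCompletion K) := by
    rw [← hg', coeff_map]; rfl
  refine le_trans (le_of_eq ?_) (h' k)
  rw [h1, coeff_sub, Valuation.map_sub_swap]
  rfl

theorem exists_valued_algebraMap_lt_one (v : HeightOneSpectrum (𝓞 K)) :
    ∃ x : K, x ≠ 0 ∧ v.valuation K x < 1 := by
  obtain ⟨x, hx⟩ := valuation_exists_uniformizer K v
  refine ⟨x, fun h => ?_, ?_⟩
  · rw [h, map_zero] at hx
    exact exp_ne_zero hx.symm
  · rw [hx]
    simpa using exp_lt_exp.2 (neg_one_lt_zero (R := ℤ))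

/-- By Krasner's lemma, roots of polynomials sufficiently close to a power of the minimal polynomial of a
generator of a splitting field generate splitting fields. -/
theorem exists_forall_near_hasRep {D : Type} [DivisionRing D] [Algebra K D] [Algebra.IsCentral K D]
    [FiniteDimensional K D] {n m : ℕ} (hn : Module.finrank K D = n * n) (hm : 0 < m) (v : HeightOneSpectrum (𝓞 K))
    (hv : HasRep (algebraMap K (v.adicCompletion K)) D (n * m)) :
    ∃ (a : ℕ → v.adicCompletion K) (δ : ℤᵐ⁰), δ ≠ 0 ∧ ∀ g : K[X], g.Monic → g.natDegree = m →
      (∀ k < m, Valued.v (algebraMap K _ (g.coeff k) - a k) < δ) →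
      ∀ {L : Type} [Field L] [NumberField L] [Algebra K L] (θ : L), aeval θ g = 0 →
      ∀ P : HeightOneSpectrum (𝓞 L), belowPrime K P = v →
        HasRep ((algebraMap L (P.adicCompletion L)).comp (algebraMap K L)) D n := by
  have : CharZero (v.adicCompletion K) := charZero_of_injective_algebraMap (algebraMap K _).injective
  obtain ⟨f, hfm, hf, hdeg, hfact, hrep⟩ := exists_splitting_polynomial _ hn hv
  obtain ⟨F, hFm, hFdeg, hFpos, ⟨u, h, η, hη, huh⟩, c, hc⟩ := exists_integral_model (O := v.adicCompletionIntegers K) hf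
  obtain ⟨e, he⟩ := hFdeg.trans hdeg
  obtain ⟨π, hπ0, hπ⟩ := exists_valued_algebraMap_lt_one v
  have hπv : Valued.v (algebraMap K (v.adicCompletion K) π) < 1 :=
    (valuedAdicCompletion_eq_valuation' v π).trans_lt hπ
  let t : v.adicCompletionIntegers K := ⟨algebraMap K _ π, hπv.le⟩
  have ht0 : t ≠ 0 := fun h => by
    have := congrArg Subtype.val h
    exact hπ0 ((map_eq_zero (algebraMap K (v.adicCompletion K))).1 this)
  have he0 : e ≠ 0 := by rintro rfl; omega
  have hGdeg : (F ^ e).natDegree = m := by rw [hFm.natDegree_pow, he, mul_comm]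
  refine ⟨fun k => ((F ^ e).coeff k : v.adicCompletion K),
    Valued.v (((η ^ 2 * t) ^ e : v.adicCompletionIntegers K) : v.adicCompletion K), ?_, ?_⟩
  · rw [Valuation.ne_zero_iff, Ne, ZeroMemClass.coe_eq_zero]
    exact pow_ne_zero _ (mul_ne_zero (pow_ne_zero _ hη) ht0)
  intro g hg hgm hnear L _ _ _ θ hθ P hP
  obtain ⟨g', hg'm, hg', hdvd⟩ := exists_near_lift (hFm.pow e) (hg.map (algebraMap K (v.adicCompletion K)))
    (by rw [hg.natDegree_map, hgm, hGdeg]) (b := (η ^ 2 * t) ^ e) (fun k hk => by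
      rw [coeff_map]; exact hnear k (hGdeg ▸ hk))
  obtain ⟨j, hj, hj1⟩ := exists_adicMap hP
  let jO : v.adicCompletionIntegers K →+* P.adicCompletionIntegers L :=
    (j.comp (algebraMap _ (v.adicCompletion K))).codRestrict (P.adicCompletionIntegers L).toSubring
      fun y => hj1 _ y.2
  have hjO : (algebraMap _ (P.adicCompletion L)).comp jO = j.comp (algebraMap _ (v.adicCompletion K)) := rfl
  have hroot : ((g'.map jO).map (algebraMap _ (P.adicCompletion L))).eval (algebraMap L _ θ) = 0 := by
    rw [map_map, hjO, ← map_map, hg', map_map, hj, ← map_map, eval_map_apply, eval_map_algebraMap, hθ, map_zero]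
  obtain ⟨θ', hθ'⟩ := IsIntegrallyClosed.isIntegral_iff.1
    (show IsIntegral (P.adicCompletionIntegers L) (algebraMap L (P.adicCompletion L) θ) from
      ⟨g'.map jO, hg'm.map _, by rw [← eval_map]; exact hroot⟩)
  have ht : ¬ IsUnit (jO t) := by
    intro hu
    have h1 := (adicCompletionIntegers.isUnit_iff_valued_eq_one).1 hu
    have h2 : ((jO t : P.adicCompletionIntegers L) : P.adicCompletion L) = algebraMap L _ (algebraMap K L π) :=
      RingHom.congr_fun hj π
    rw [h2] at h1
    have h3 := (belowPrime_valuation_lt_one P π).1 (hP ▸ hπ)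
    exact (((valuedAdicCompletion_eq_valuation' P _).symm.trans h1).symm.trans_lt h3).false
  have := isAdicComplete_adicCompletionIntegers P ht
  obtain ⟨x, hx⟩ := exists_root_of_near_pow ht (F := F.map jO) (u := u.map jO) (h := h.map jO) (g := g'.map jO)
    (η := jO η) he0 (by rw [derivative_map, ← Polynomial.map_mul, ← Polynomial.map_mul, ← Polynomial.map_add, huh, map_C])
    (fun k => by
      rw [← Polynomial.map_pow, ← Polynomial.map_sub, coeff_map, ← map_pow, ← map_mul, ← map_pow]
      exact map_dvd jO (hdvd k)) (θ := θ') (by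
      apply FaithfulSMul.algebraMap_injective (P.adicCompletionIntegers L) (P.adicCompletion L)
      rw [← eval_map_apply, hθ', hroot, map_zero])
  rw [← hj]
  refine hrep.of_root j (hc j (algebraMap _ (P.adicCompletion L) x) ?_)
  rw [eval₂_map, ← hjO, ← eval₂_map, ← eval_map, eval_map_apply, hx.eq_zero, map_zero]

end LocalApproximation

section Global

open Polynomial IsDedekindDomain HeightOneSpectrum NumberField WithZero

theorem HasRep.real_dichotomy {K : Type} [Field K] {D : Type} [DivisionRing D] [Algebra K D] [Algebra.IsCentral K D]
    [FiniteDimensional K D] {n m : ℕ} (hn : Module.finrank K D = n * n) {φ : K →+* ℝ} (h : HasRep φ D (n * m)) :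
    HasRep φ D n ∨ 2 ∣ m := by
  obtain ⟨f, hfm, hf, hdeg, hfact, hrep⟩ := exists_splitting_polynomial _ hn h
  have h1 := hf.natDegree_le_two
  have h2 := hf.natDegree_pos
  rcases (by omega : f.natDegree = 1 ∨ f.natDegree = 2) with h | h
  · obtain ⟨x, hx⟩ := exists_root_of_degree_eq_one (degree_eq_iff_natDegree_eq_of_pos one_pos |>.2 h)
    exact Or.inl (hrep.of_root (RingHom.id ℝ) (x := x) (by rwa [eval₂_id]))
  · exact Or.inr (h ▸ hdeg)

theorem exists_polynomial_near {K : Type} [Field K] [NumberField K] (S : Finset (HeightOneSpectrum (𝓞 K)))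
    (a : ∀ v : HeightOneSpectrum (𝓞 K), ℕ → v.adicCompletion K) (δ : HeightOneSpectrum (𝓞 K) → ℤᵐ⁰)
    (hδ : ∀ v, δ v ≠ 0) (b : ℕ → ℝ) {ε : ℝ} (hε : 0 < ε) {m : ℕ} :
    ∃ g : K[X], g.Monic ∧ g.natDegree = m ∧
      (∀ v ∈ S, ∀ k < m, Valued.v (algebraMap K _ (g.coeff k) - a v k) < δ v) ∧
      ∀ φ : K →+* ℝ, ∀ k < m, |φ (g.coeff k) - b k| < ε := by
  obtain ⟨γ, hγ, hγS⟩ : ∃ γ : ℤᵐ⁰, γ ≠ 0 ∧ ∀ v ∈ S, γ ≤ δ v := by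
    by_cases hS : S.Nonempty
    · obtain ⟨v, hv, hmin⟩ := S.exists_min_image δ hS
      exact ⟨_, hδ v, hmin⟩
    · exact ⟨1, one_ne_zero, fun v hv => absurd ⟨v, hv⟩ hS⟩
  choose c hc hc' using fun k => weak_approximation S (fun v => a v k) hγ (fun _ => b k) hε
  have hlt : degree (∑ k ∈ Finset.range m, C (c k) * X ^ k) < (m : WithBot ℕ) := by
    rw [← mem_degreeLT]
    refine Submodule.sum_mem _ fun k hk => mem_degreeLT.2 ?_
    exact (degree_C_mul_X_pow_le _ _).trans_lt (by exact_mod_cast Finset.mem_range.1 hk)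
  have hcoeff : ∀ k < m, (X ^ m + ∑ k ∈ Finset.range m, C (c k) * X ^ k).coeff k = c k := by
    intro k hk
    rw [coeff_add, coeff_X_pow, if_neg hk.ne, zero_add, finset_sum_coeff,
      Finset.sum_eq_single k (fun i _ hi => by rw [coeff_C_mul_X_pow, if_neg hi.symm])
        (fun h => absurd (Finset.mem_range.2 hk) h)]
    simp
  refine ⟨X ^ m + ∑ k ∈ Finset.range m, C (c k) * X ^ k, monic_X_pow_add hlt, ?_, fun v hv k hk => ?_,
    fun φ k hk => ?_⟩
  · rw [natDegree_add_eq_left_of_degree_lt (by rwa [degree_X_pow]), natDegree_X_pow]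
  · rw [hcoeff k hk]
    exact (hc k v hv).trans_le (hγS v hv)
  · rw [hcoeff k hk]
    have hφ : ComplexEmbedding.IsReal (Complex.ofRealHom.comp φ) := by
      ext x; simp [ComplexEmbedding.conjugate]
    have hw : (InfinitePlace.mk (Complex.ofRealHom.comp φ)).IsReal := ⟨_, hφ, rfl⟩
    have h1 : InfinitePlace.embedding_of_isReal hw (c k) = φ (c k) := by
      apply Complex.ofReal_injective
      rw [InfinitePlace.embedding_of_isReal_apply, InfinitePlace.embedding_mk_eq_of_isReal hφ]
      rfl
    have := hc' k ⟨_, hw⟩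
    rwa [h1] at this

/-- A central division algebra over a number field has an index dividing `m` as soon as its local indices do. -/
theorem dvd_of_forall_hasRep {K : Type} [Field K] [NumberField K] {D : Type} [DivisionRing D] [Algebra K D]
    [Algebra.IsCentral K D] [FiniteDimensional K D] {n m : ℕ} (hn0 : 0 < n) (hn : Module.finrank K D = n * n) (hm : 0 < m)
    (hfin : ∀ v : HeightOneSpectrum (𝓞 K), HasRep (algebraMap K (v.adicCompletion K)) D (n * m))
    (hreal : ∀ φ : K →+* ℝ, HasRep φ D (n * m)) : n ∣ m := by
  obtain ⟨S, hS⟩ := exists_finset_hasRep hn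
  choose a δ hδ hnear using fun v => exists_forall_near_hasRep hn hm v (hfin v)
  obtain ⟨g, hg, hgm, hgS, hgr⟩ := exists_polynomial_near S a δ hδ (fun k => ((X ^ 2 + 1 : ℝ[X]) ^ (m / 2)).coeff k)
    (ε := ((m : ℝ) + 1)⁻¹) (by positivity) (m := m)
  rw [← hgm]
  refine dvd_natDegree_of_irreducible hg.ne_zero fun p hp hpg => ?_
  have : Fact (Irreducible p) := ⟨hp⟩
  have hfd : FiniteDimensional K (AdjoinRoot p) := (AdjoinRoot.powerBasis hp.ne_zero).finite
  have : NumberField (AdjoinRoot p) := NumberField.of_module_finite K (AdjoinRoot p)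
  have hθ : aeval (AdjoinRoot.root p) g = 0 := by
    rw [AdjoinRoot.aeval_eq, AdjoinRoot.mk_eq_zero]
    exact hpg
  have hsplit : LocallySplit (algebraMap K (AdjoinRoot p)) D n := by
    refine ⟨fun P => ?_, fun φ => ?_⟩
    · by_cases hP : belowPrime K P ∈ S
      · exact hnear _ g hg hgm (hgS _ hP) (AdjoinRoot.root p) hθ P rfl
      · obtain ⟨j, hj, -⟩ := exists_adicMap (rfl : belowPrime K P = _)
        exact (hS _ hP).map_eq j hj
    · rcases (hreal (φ.comp (algebraMap K (AdjoinRoot p)))).real_dichotomy hn with h | ⟨s, rfl⟩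
      · exact h
      · exfalso
        have h1 := eval_pos_of_near (s := s) (ε := (((2 * s : ℕ) : ℝ) + 1)⁻¹) (by
          rw [← div_eq_mul_inv, div_lt_one (by positivity)]
          exact lt_add_one _) (hg.map (φ.comp (algebraMap K (AdjoinRoot p)))) (by rw [hg.natDegree_map, hgm])
          (fun k hk => by
            have := hgr (φ.comp (algebraMap K (AdjoinRoot p))) k hk
            rwa [Nat.mul_div_cancel_left _ two_pos, ← coeff_map] at this) (φ (AdjoinRoot.root p))
        rw [← map_map, eval_map_apply, eval_map_algebraMap, hθ, map_zero] at h1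
        exact h1.false
  have h := (hsplit.hasRep hn).finrank_dvd
  rw [hn, (AdjoinRoot.powerBasis hp.ne_zero).finrank, AdjoinRoot.powerBasis_dim, mul_comm p.natDegree n] at h
  exact Nat.dvd_of_mul_dvd_mul_left hn0 h

end Global

theorem hasRep_of_mul_self {K : Type} [Field K] {D : Type} [DivisionRing D] [Algebra K D]
    [FiniteDimensional K D] {n : ℕ} (hn : Module.finrank K D = n * n) {E : Type} [Field E] (φ : K →+* E) : HasRep φ D (n * n) := by
  rw [← hn]
  exact (hasRep_regular K D).map_eq φ rfl

theorem schur_stmt17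
    (K : Type) [Field K] [NumberField K]
    (D : Type) [DivisionRing D] [Algebra K D] [FiniteDimensional K D]
    (hZ : Set.range (algebraMap K D) = (Subring.center D : Set D)) :
    (∀ v : IsDedekindDomain.HeightOneSpectrum (NumberField.RingOfIntegers K),
      schurIndex (v.adicCompletion K) ((v.adicCompletion K) ⊗[K] D) ∣ schurIndex K D) ∧
    (∀ φ : K →+* ℝ, realLocalIndex K D φ ∣ schurIndex K D) ∧
    (∀ φ : K →+* ℂ, complexLocalIndex K D φ ∣ schurIndex K D) ∧
    ∀ m : ℕ, 0 < m →
      (∀ v : IsDedekindDomain.HeightOneSpectrum (NumberField.RingOfIntegers K),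
        schurIndex (v.adicCompletion K) ((v.adicCompletion K) ⊗[K] D) ∣ m) →
      (∀ φ : K →+* ℝ, realLocalIndex K D φ ∣ m) →
      (∀ φ : K →+* ℂ, complexLocalIndex K D φ ∣ m) →
      schurIndex K D ∣ m := by
  have hcen : Algebra.IsCentral K D := ⟨fun x hx => by
    have h : x ∈ (Subring.center D : Set D) := Subring.mem_center_iff.2 (Subalgebra.mem_center_iff.1 hx)
    rw [← hZ] at h
    exact h⟩
  obtain ⟨n, hn0, hn, -⟩ := exists_matrix_over_algebraicClosure (K := K) (D := D)
  have hreal : ∀ (φ : K →+* ℝ) (k : ℕ), realLocalIndex K D φ ∣ k ↔ HasRep φ D (n * k) := by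
    intro φ k
    let _ := φ.toAlgebra
    exact schurIndex_tensor_dvd_iff hn0 hn k
  have hcomplex : ∀ (φ : K →+* ℂ) (k : ℕ), complexLocalIndex K D φ ∣ k ↔ HasRep φ D (n * k) := by
    intro φ k
    let _ := φ.toAlgebra
    exact schurIndex_tensor_dvd_iff hn0 hn k
  rw [schurIndex_division hn0 hn]
  refine ⟨fun v => (schurIndex_tensor_dvd_iff hn0 hn n).2 (hasRep_of_mul_self hn _),
    fun φ => (hreal φ n).2 (hasRep_of_mul_self hn _), fun φ => (hcomplex φ n).2 (hasRep_of_mul_self hn _),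
    fun m hm hfin hr _ => ?_⟩
  exact dvd_of_forall_hasRep hn0 hn hm (fun v => (schurIndex_tensor_dvd_iff hn0 hn m).1 (hfin v))
    fun φ => (hreal φ m).1 (hr φ)
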